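/- Let $n\ge 1$. For $a\in(0,\infty)^n$ put $D(a)=\mathrm{diag}(a_1J,\dots,a_nJ)\in M_{2n}(\mathbb R)$ with $J=\begin{pmatrix}0&1\\-1&0\end{pmatrix}$, $D(1)=D(1,\dots,1)$, and $\Delta_n(a^2)=\prod_{1\le j<k\le n}(a_k^2-a_j^2)$. A function $P:M_{2n}(\mathbb R)\to[0,\infty)$ is called a *factorizing density* with weight $\sigma:M_2(\mathbb R)\to[0,\infty)$ if $P$ is an integrable probability density with respect to Lebesgue measure, $P(k_1gk_2)=P(g)$ for all $g$ and all $k_1,k_2\in O(2n)$, and for almost every block-diagonal $z=\mathrm{diag}(z_1,\dots,z_n)$ with $z_j\in M_2(\mathbb R)$ $$\Big(\prod_{j=1}^n\det(z_jz_j^T)^{n-j}\Big)\int_T P(tz)\,dt=\prod_{j=1}^n\sigma(z_j),$$ where $T$ is the set of $2n\times 2n$ real matrices that are block-lower-triangular in $2\times2$ blocks with all diagonal blocks equal to $I_2$, and $dt$ is Lebesgue measure on the strictly lower blocks. A function $h:(0,\infty)\to[0,\infty)$ is the *determinant density* of $\sigma$ if $\int_{M_2(\mathbb R)}\sigma(z)\,\psi(|\det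 z|)\,dz=\int_0^\infty h(t)\psi(t)\,dt$ for every bounded measurable $\psi$; write $Mh(u)=\int_0^\infty h(t)\,t^{u-1}\,dt$. Let $g$ be a random $2n\times2n$ real matrix whose law has a factorizing density $P_G$ with weight $\sigma$, let $h$ be the determinant density of $\sigma$ with $0<Mh(2j-1)<\infty$ for $j=1,\dots,n$, and assume that $h$ is $(n-1)$-times differentiable on $(0,\infty)$. Then, for every bounded measurable function $\varphi$ from the $2n\times 2n$ real antisymmetric matrices to $\mathbb R$ with $\varphi(kXk^T)=\varphi(X)$ for all $k\in O(2n)$, $$\mathbb E\big[\varphi(g\,D(1)\,g^T)\big]=\int_{(0,\infty)^n}\varphi(D(a))\,p(a)\,da,$$ where $$p(a)=\frac{1}{2^{n(n-1)/2}\,\prod_{j=1}^n j!\,Mh(2j-1)}\;\Delta_n(a^2)\;\det\Big[\Big(\big(-a_b\tfrac{d}{da_b}\big)^{c-1}h\Big)(a_b)\Big]_{b,c=1,\dots,n},$$ with $(-a\,\frac{d}{da})^{c-1}$ denoting the $(c-1)$-fold iterate of the differential operator $f\mapsto -a f'(a)$. -/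

import Mathlib

open MeasureTheory

noncomputable section

/-- Real matrices carry the product σ-algebra and the Lebesgue measure of their entries. -/
instance matrixMeasureSpace {l m : Type*} [Fintype l] [Fintype m] :
    MeasureSpace (Matrix l m ℝ) :=
  inferInstanceAs (MeasureSpace (l → m → ℝ))

/-- The `2n × 2n` real antisymmetric matrix `D(a) = diag(a₁ J, …, aₙ J)`,
`J = [[0,1],[-1,0]]`. -/
def Dmat {n : ℕ} (a : Fin n → ℝ) : Matrix (Fin (2 * n)) (Fin (2 * n)) ℝ :=
  Matrix.of fun i j =>
    if i.val / 2 = j.val / 2 then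
      a ⟨i.val / 2, by have := i.isLt; omega⟩ *
        (if i.val % 2 = 0 ∧ j.val % 2 = 1 then 1
          else if i.val % 2 = 1 ∧ j.val % 2 = 0 then -1 else 0)
    else 0

/-- The matrix that is block-lower-triangular in `2×2` blocks, has identity diagonal blocks,
and has the strictly-lower `2×2` blocks `c`. -/
def Tmat {n : ℕ} (c : {ij : Fin n × Fin n // ij.2 < ij.1} → Matrix (Fin 2) (Fin 2) ℝ) :
    Matrix (Fin (2 * n)) (Fin (2 * n)) ℝ :=
  Matrix.of fun i j =>
    if h : j.val / 2 < i.val / 2 then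
      c ⟨(⟨i.val / 2, by have := i.isLt; omega⟩, ⟨j.val / 2, by have := j.isLt; omega⟩),
          Fin.mk_lt_mk.mpr h⟩ ⟨i.val % 2, by omega⟩ ⟨j.val % 2, by omega⟩
    else if i.val / 2 = j.val / 2 then (if i.val % 2 = j.val % 2 then 1 else 0) else 0

/-- The block-diagonal matrix `diag(z₁,…,zₙ)` with `2×2` blocks. -/
def Zmat {n : ℕ} (z : Fin n → Matrix (Fin 2) (Fin 2) ℝ) :
    Matrix (Fin (2 * n)) (Fin (2 * n)) ℝ :=
  Matrix.of fun i j =>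
    if i.val / 2 = j.val / 2 then
      z ⟨i.val / 2, by have := i.isLt; omega⟩ ⟨i.val % 2, by omega⟩ ⟨j.val % 2, by omega⟩
    else 0

/-- `P` is a factorizing density with weight `σw`: an `O(2n)`-bi-invariant probability density
on `M_{2n}(ℝ)` whose block-triangular transform factorizes. The index `j` runs from `0`, so
`n - 1 - j` is the exponent `n - j` of the usual one-based numbering. -/
structure IsFactorizing (n : ℕ) (P : Matrix (Fin (2 * n)) (Fin (2 * n)) ℝ → ℝ)
    (σw : Matrix (Fin 2) (Fin 2) ℝ → ℝ) : Prop where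
  nonneg : ∀ g, 0 ≤ P g
  integrable : Integrable P
  prob : (∫ g, P g) = 1
  invariant : ∀ g, ∀ k₁ ∈ Matrix.orthogonalGroup (Fin (2 * n)) ℝ,
      ∀ k₂ ∈ Matrix.orthogonalGroup (Fin (2 * n)) ℝ, P (k₁ * g * k₂) = P g
  wnonneg : ∀ z, 0 ≤ σw z
  factor : ∀ᵐ z : Fin n → Matrix (Fin 2) (Fin 2) ℝ,
    (∏ j : Fin n, (z j * (z j).transpose).det ^ (n - 1 - j.val)) *
        (∫ c : {ij : Fin n × Fin n // ij.2 < ij.1} → Matrix (Fin 2) (Fin 2) ℝ,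
          P (Tmat c * Zmat z)) =
      ∏ j : Fin n, σw (z j)

/-- Vandermonde product `Δ_m(x) = ∏_{j<k} (x_k - x_j)`. -/
def vdm {m : ℕ} (x : Fin m → ℝ) : ℝ :=
  ∏ p ∈ Finset.univ.filter (fun p : Fin m × Fin m => p.1 < p.2), (x p.2 - x p.1)

/-- A bounded measurable function that is `O(m)`-invariant on antisymmetric matrices. It is
defined on all matrices, but only its values on antisymmetric ones are ever used. -/
def IsInvTest (m : ℕ) (φ : Matrix (Fin m) (Fin m) ℝ → ℝ) : Prop :=
  Measurable φ ∧ (∃ C, ∀ X, |φ X| ≤ C) ∧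
    ∀ X : Matrix (Fin m) (Fin m) ℝ, X.transpose = -X →
      ∀ k ∈ Matrix.orthogonalGroup (Fin m) ℝ, φ (k * X * k.transpose) = φ X

/-- `h` is the density of `|det z|` under the weight `σw` on `M₂(ℝ)`. -/
def IsDetDensity (σw : Matrix (Fin 2) (Fin 2) ℝ → ℝ) (h : ℝ → ℝ) : Prop :=
  (∀ t : ℝ, 0 < t → 0 ≤ h t) ∧
    ∀ ψ : ℝ → ℝ, Measurable ψ → (∃ C, ∀ t, |ψ t| ≤ C) →
      (∫ z : Matrix (Fin 2) (Fin 2) ℝ, σw z * ψ |z.det|) =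
        ∫ t in Set.Ioi (0 : ℝ), h t * ψ t

/-- Mellin transform `Mh(u) = ∫₀^∞ h(t) t^{u-1} dt`. -/
def mellH (h : ℝ → ℝ) (u : ℝ) : ℝ := ∫ t in Set.Ioi (0 : ℝ), h t * t ^ (u - 1)

/-- The `m`-fold iterate of the differential operator `f ↦ (a ↦ -a * f'(a))`. -/
def negADeriv : ℕ → (ℝ → ℝ) → (ℝ → ℝ)
  | 0, f => f
  | m + 1, f => fun a => -a * deriv (negADeriv m f) a

/-- The density `p(a)`; the index `j` runs from `0`, so the product over `j` is
`∏_{j=1}^n j! · Mh(2j-1)` in one-based numbering. -/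
def svDensity (n : ℕ) (h : ℝ → ℝ) (a : Fin n → ℝ) : ℝ :=
  1 / ((2 : ℝ) ^ (n * (n - 1) / 2) *
      ∏ j : Fin n, (Nat.factorial (j.val + 1) : ℝ) * mellH h (2 * ((j.val : ℝ) + 1) - 1)) *
    vdm (fun j => a j ^ 2) *
    (Matrix.of fun b c : Fin n => negADeriv c.val h (a b)).det

end

open scoped Matrix

noncomputable section

/-! ### Lebesgue measure on matrices and Haar measure on the orthogonal group -/

section MatrixMeasure

variable {l m : Type*} [Fintype l] [Fintype m]

instance matrixBorelSpace : BorelSpace (Matrix l m ℝ) :=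
  inferInstanceAs (BorelSpace (l → m → ℝ))

instance matrixSecondCountable : SecondCountableTopology (Matrix l m ℝ) :=
  inferInstanceAs (SecondCountableTopology (l → m → ℝ))

instance matrixSigmaFinite : SigmaFinite (volume : Measure (Matrix l m ℝ)) :=
  inferInstanceAs (SigmaFinite (volume : Measure (l → m → ℝ)))

/-- A linear endomorphism of a matrix space scales Lebesgue measure by its determinant. -/
theorem matrix_map_linearMap (f : Matrix l m ℝ →ₗ[ℝ] Matrix l m ℝ) (hf : LinearMap.det f ≠ 0) :
    Measure.map f volume = ENNReal.ofReal |(LinearMap.det f)⁻¹| • volume :=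
  Measure.map_linearMap_addHaar_eq_smul_addHaar (E := l → m → ℝ) volume hf

theorem det_mulRightMatrix [DecidableEq m] (A : Matrix m m ℝ) :
    LinearMap.det (mulRightLinearMap l ℝ A) = A.det ^ Fintype.card l := by
  have h : (mulRightLinearMap l ℝ A) =
      LinearMap.pi (fun i : l => (Matrix.toLin' A.transpose) ∘ₗ LinearMap.proj i) := by
    refine LinearMap.ext fun g => ?_
    ext j k
    change (g * A) j k = (A.transpose *ᵥ (g j)) k
    simp [Matrix.mul_apply, Matrix.mulVec, dotProduct, mul_comm]
  rw [h]
  refine (LinearMap.det_pi (R := ℝ) (M := m → ℝ) (ι := l) _).trans ?_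
  simp

/-- Right multiplication by an invertible matrix scales Lebesgue measure. -/
theorem map_mul_right_volume [DecidableEq m] (A : Matrix m m ℝ) (hA : A.det ≠ 0) :
    Measure.map (fun g : Matrix l m ℝ => g * A) volume =
      ENNReal.ofReal (|A.det| ^ Fintype.card l)⁻¹ • volume := by
  have := matrix_map_linearMap (l := l) (m := m) (mulRightLinearMap l ℝ A)
    (by rw [det_mulRightMatrix]; exact pow_ne_zero _ hA)
  rw [det_mulRightMatrix, abs_inv, abs_pow] at this
  exact this

theorem abs_det_of_mem_orthogonalGroup [DecidableEq m] {k : Matrix m m ℝ}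
    (hk : k ∈ Matrix.orthogonalGroup m ℝ) : |k.det| = 1 := by
  have h := congrArg Matrix.det ((Matrix.mem_orthogonalGroup_iff _ _).1 hk)
  rw [Matrix.det_mul, Matrix.det_transpose, Matrix.det_one] at h
  exact (abs_eq zero_le_one).2 (mul_self_eq_one_iff.1 h)

theorem measurePreserving_mul_right [DecidableEq m] {k : Matrix m m ℝ}
    (hk : k ∈ Matrix.orthogonalGroup m ℝ) :
    MeasurePreserving (fun g : Matrix l m ℝ => g * k) volume volume := by
  refine ⟨(by fun_prop : Continuous fun g : Matrix l m ℝ => g * k).measurable, ?_⟩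
  have h1 := abs_det_of_mem_orthogonalGroup hk
  rw [map_mul_right_volume k (fun h => by simp [h] at h1), h1]
  simp

theorem measurePreserving_transpose :
    MeasurePreserving (fun g : Matrix m m ℝ => g.transpose) volume volume := by
  refine ⟨(by fun_prop : Continuous fun g : Matrix m m ℝ => g.transpose).measurable, ?_⟩
  let T : Matrix m m ℝ →ₗ[ℝ] Matrix m m ℝ := (Matrix.transposeLinearEquiv m m ℝ ℝ).toLinearMap
  have hT : LinearMap.det T * LinearMap.det T = 1 := by
    rw [← LinearMap.det_comp]
    have : T ∘ₗ T = LinearMap.id := by ext; simp [T]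
    rw [this, LinearMap.det_id]
  have h2 := matrix_map_linearMap T (fun h => by simp [h] at hT)
  have h1 : |(LinearMap.det T)⁻¹| = 1 := by
    rw [abs_inv, (abs_eq zero_le_one).2 (mul_self_eq_one_iff.1 hT), inv_one]
  rw [h1, ENNReal.ofReal_one, one_smul] at h2
  exact h2

theorem transpose_mem_orthogonalGroup [DecidableEq m] {k : Matrix m m ℝ}
    (hk : k ∈ Matrix.orthogonalGroup m ℝ) : k.transpose ∈ Matrix.orthogonalGroup m ℝ := by
  rw [Matrix.mem_orthogonalGroup_iff] at *
  rw [Matrix.transpose_transpose]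
  exact mul_eq_one_comm.1 hk

theorem orthogonal_mul_transpose [DecidableEq m] {k : Matrix m m ℝ}
    (hk : k ∈ Matrix.orthogonalGroup m ℝ) : k * k.transpose = 1 := by
  exact (Matrix.mem_orthogonalGroup_iff _ _).1 hk

theorem orthogonal_transpose_mul [DecidableEq m] {k : Matrix m m ℝ}
    (hk : k ∈ Matrix.orthogonalGroup m ℝ) : k.transpose * k = 1 :=
  mul_eq_one_comm.1 (orthogonal_mul_transpose hk)

theorem mem_orthogonalGroup_of_mul_transpose [DecidableEq m] {k : Matrix m m ℝ}
    (hk : k * k.transpose = 1) : k ∈ Matrix.orthogonalGroup m ℝ := by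
  exact (Matrix.mem_orthogonalGroup_iff _ _).2 hk

theorem measurePreserving_mul_left [DecidableEq m] {k : Matrix m m ℝ}
    (hk : k ∈ Matrix.orthogonalGroup m ℝ) :
    MeasurePreserving (fun g : Matrix m m ℝ => k * g) volume volume := by
  have := (measurePreserving_transpose (m := m)).comp
    ((measurePreserving_mul_right (transpose_mem_orthogonalGroup hk)).comp
      (measurePreserving_transpose (m := m)))
  convert this using 1
  ext g : 1
  simp [Matrix.transpose_mul]

end MatrixMeasure

section HaarO

variable {m : Type*} [Fintype m] [DecidableEq m]

instance orthogonalCompact : CompactSpace (Matrix.orthogonalGroup m ℝ) := by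
  refine isCompact_iff_compactSpace (s := (Matrix.orthogonalGroup m ℝ : Set (Matrix m m ℝ))).1 ?_
  have hcl : IsClosed (Matrix.orthogonalGroup m ℝ : Set (Matrix m m ℝ)) := by
    have : (Matrix.orthogonalGroup m ℝ : Set (Matrix m m ℝ)) = {k | k * k.transpose = 1} := by
      ext k
      exact ⟨orthogonal_mul_transpose, mem_orthogonalGroup_of_mul_transpose⟩
    rw [this]
    exact isClosed_eq (by fun_prop) continuous_const
  have hc : IsCompact (Set.pi Set.univ (fun _ : m => Set.pi Set.univ
      (fun _ : m => Set.Icc (-1 : ℝ) 1))) :=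
    isCompact_univ_pi fun _ => isCompact_univ_pi fun _ => isCompact_Icc
  refine IsCompact.of_isClosed_subset (X := m → m → ℝ) hc hcl ?_
  intro k hk i _ j _
  have h : (Matrix.of k * (Matrix.of k).transpose) i i = (1 : Matrix m m ℝ) i i :=
    congrFun (congrFun (orthogonal_mul_transpose hk) i) i
  rw [Matrix.mul_apply] at h
  simp only [Matrix.transpose_apply, Matrix.one_apply_eq, Matrix.of_apply] at h
  have h2 : k i j * k i j ≤ 1 := by
    rw [← h]
    exact Finset.single_le_sum (f := fun j => k i j * k i j)
      (fun j _ => mul_self_nonneg _) (Finset.mem_univ j)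
  exact abs_le.1 (abs_le_one_iff_mul_self_le_one.2 h2)

instance orthogonalBorel : BorelSpace (Matrix.orthogonalGroup m ℝ) :=
  inferInstanceAs (BorelSpace (Subtype _))

instance orthogonalSecondCountable : SecondCountableTopology (Matrix.orthogonalGroup m ℝ) :=
  TopologicalSpace.Subtype.secondCountableTopology _

/-- The Haar probability measure on the orthogonal group. -/
def haarO (m : Type*) [Fintype m] [DecidableEq m] : Measure (Matrix.orthogonalGroup m ℝ) :=
  Measure.haarMeasure ⊤

instance : (haarO m).IsHaarMeasure := by unfold haarO; infer_instance

instance : IsProbabilityMeasure (haarO m) := ⟨by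
  have := Measure.haarMeasure_self (K₀ := (⊤ : TopologicalSpace.PositiveCompacts
    (Matrix.orthogonalGroup m ℝ)))
  simpa [haarO] using this⟩

instance : (haarO m).IsMulRightInvariant := ⟨fun g => by
  have : IsProbabilityMeasure ((haarO m).map (fun x => x * g)) :=
    Measure.isProbabilityMeasure_map (by fun_prop)
  exact Measure.isHaarMeasure_eq_of_isProbabilityMeasure _ _⟩

end HaarO

end

noncomputable section

/-! ### Canonical form of real antisymmetric matrices -/

section Canonical

/-- The antisymmetric `N × N` matrix with `2 × 2` diagonal blocks `b l * J`; for odd `N` the last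
row and column vanish. -/
def Dcan (N : ℕ) (b : ℕ → ℝ) : Matrix (Fin N) (Fin N) ℝ :=
  Matrix.of fun i j =>
    if i.val / 2 = j.val / 2 then
      b (i.val / 2) * (if i.val % 2 = 0 ∧ j.val % 2 = 1 then 1
          else if i.val % 2 = 1 ∧ j.val % 2 = 0 then -1 else 0)
    else 0

theorem Dcan_apply (N : ℕ) (b : ℕ → ℝ) (i j : Fin N) : Dcan N b i j =
    if i.val / 2 = j.val / 2 then
      b (i.val / 2) * (if i.val % 2 = 0 ∧ j.val % 2 = 1 then 1
          else if i.val % 2 = 1 ∧ j.val % 2 = 0 then -1 else 0)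
    else 0 := rfl

theorem Dcan_congr {N : ℕ} {b b' : ℕ → ℝ} (h : ∀ l, 2 * l + 1 < N → b l = b' l) :
    Dcan N b = Dcan N b' := by
  ext i j
  simp only [Dcan_apply]
  have := i.isLt
  have := j.isLt
  split_ifs with h1 h2 h3
  · rw [h _ (by omega)]
  · rw [h _ (by omega)]
  · simp
  · rfl

theorem Dcan_transpose (N : ℕ) (b : ℕ → ℝ) : (Dcan N b)ᵀ = -Dcan N b := by
  ext i j
  simp only [Matrix.transpose_apply, Matrix.neg_apply, Dcan_apply]
  by_cases h : i.val / 2 = j.val / 2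
  · rw [if_pos h, if_pos h.symm, h]
    have := Nat.mod_two_eq_zero_or_one i.val
    have := Nat.mod_two_eq_zero_or_one j.val
    split_ifs <;> first | omega | simp
  · rw [if_neg h, if_neg (Ne.symm h)]; simp

theorem Dcan_mul_transpose (N : ℕ) (b c : ℕ → ℝ) (hb : N % 2 = 1 → b (N / 2) = 0) :
    Dcan N b * (Dcan N c)ᵀ = Matrix.diagonal fun i : Fin N => b (i.val / 2) * c (i.val / 2) := by
  ext i j
  rw [Matrix.mul_apply]
  simp only [Matrix.transpose_apply, Matrix.diagonal_apply, Dcan_apply]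
  have hi := i.isLt
  have hj := j.isLt
  by_cases hp : (if i.val % 2 = 0 then i.val + 1 else i.val - 1) < N
  · rw [Finset.sum_eq_single (⟨_, hp⟩ : Fin N)]
    · by_cases hij : i = j
      · subst hij
        simp only [if_true]
        rcases Nat.mod_two_eq_zero_or_one i.val with h0 | h0
        · have e1 : i.val / 2 = (i.val + 1) / 2 := by omega
          have e2 : (i.val + 1) % 2 = 1 := by omega
          simp [h0, ← e1, e2]
        · have e1 : i.val / 2 = (i.val - 1) / 2 := by omega
          have e2 : (i.val - 1) % 2 = 0 := by omega
          simp [h0, ← e1, e2]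
      · rw [if_neg hij]
        have hij' : i.val ≠ j.val := fun h => hij (Fin.ext h)
        rcases Nat.mod_two_eq_zero_or_one i.val with h0 | h0
        · simp only [h0, if_true]
          by_cases h2 : j.val / 2 = (i.val + 1) / 2
          · rw [if_pos h2, if_neg (c := j.val % 2 = 0 ∧ _) (by omega),
              if_neg (c := j.val % 2 = 1 ∧ _) (by omega)]; simp
          · rw [if_neg h2]; simp
        · simp only [h0, one_ne_zero, if_false, false_and, true_and]
          by_cases h2 : j.val / 2 = (i.val - 1) / 2
          · rw [if_pos h2, if_neg (c := j.val % 2 = 0 ∧ _) (by omega),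
              if_neg (c := j.val % 2 = 1 ∧ _) (by omega)]; simp
          · rw [if_neg h2]; simp
    · intro k _ hk
      have hk' : k.val ≠ if i.val % 2 = 0 then i.val + 1 else i.val - 1 := fun h => hk (Fin.ext h)
      by_cases h2 : i.val / 2 = k.val / 2
      · rw [if_pos h2, if_neg (c := i.val % 2 = 0 ∧ _), if_neg (c := i.val % 2 = 1 ∧ _)]
        · simp
        · rintro ⟨h3, h4⟩; rw [if_neg (by omega)] at hk'; omega
        · rintro ⟨h3, h4⟩; rw [if_pos h3] at hk'; omega
      · rw [if_neg h2]; simp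
    · intro h; exact absurd (Finset.mem_univ _) h
  · have h0 : i.val % 2 = 0 := by
      by_contra h; rw [if_neg h] at hp; omega
    rw [if_pos h0] at hp
    have hN : N % 2 = 1 := by omega
    have hiN : i.val / 2 = N / 2 := by omega
    rw [hiN, hb hN]
    simp

/-- Simultaneous permutation of rows and columns is conjugation by an orthogonal matrix. -/
theorem exists_orthogonal_submatrix {ι : Type*} [Fintype ι] [DecidableEq ι] (e : Equiv.Perm ι) :
    ∃ k ∈ Matrix.orthogonalGroup ι ℝ, ∀ Y : Matrix ι ι ℝ, k * Y * kᵀ = Y.submatrix e e := by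
  refine ⟨(1 : Matrix ι ι ℝ).submatrix e id, ?_, fun Y => ?_⟩
  · apply mem_orthogonalGroup_of_mul_transpose
    rw [Matrix.transpose_submatrix, Matrix.transpose_one]
    have := Matrix.submatrix_mul_equiv (1 : Matrix ι ι ℝ) (1 : Matrix ι ι ℝ) e (Equiv.refl ι) e
    simpa using this
  · rw [Matrix.transpose_submatrix, Matrix.transpose_one]
    have h1 := Matrix.submatrix_mul_equiv (1 : Matrix ι ι ℝ) Y e (Equiv.refl ι) id
    have h2 := Matrix.submatrix_mul_equiv (Y.submatrix e id) (1 : Matrix ι ι ℝ) id (Equiv.refl ι) e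
    simp only [Equiv.coe_refl, one_mul, mul_one, Matrix.submatrix_id_id,
      Matrix.submatrix_submatrix, Function.id_comp, Function.comp_id] at h1 h2
    rw [h1, h2]

section
attribute [local instance] Matrix.linftyOpNormedRing Matrix.linftyOpNormedAlgebra

/-- At a maximum of `k ↦ tr (k Y kᵀ Dᵀ)` over the orthogonal group, attained at the identity, the
antisymmetric matrices `Y` and `D` commute. -/
theorem commute_of_isMax_trace {ι : Type*} [Fintype ι] [DecidableEq ι] {Y D : Matrix ι ι ℝ}
    (hY : Yᵀ = -Y) (hD : Dᵀ = -D)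
    (hmax : ∀ k ∈ Matrix.orthogonalGroup ι ℝ, (k * Y * kᵀ * Dᵀ).trace ≤ (Y * Dᵀ).trace) :
    Y * D = D * Y := by
  set C := Y * D - D * Y with hC
  have hCt : Cᵀ = -C := by
    rw [hC, Matrix.transpose_sub, Matrix.transpose_mul, Matrix.transpose_mul, hY, hD]
    noncomm_ring
  have hder : HasDerivAt (fun s : ℝ => NormedSpace.exp (s • C)) C 0 := by
    have h := hasDerivAt_exp_smul_const (𝕂 := ℝ) C (0 : ℝ)
    rw [zero_smul, NormedSpace.exp_zero, one_mul] at h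
    exact h
  have hder2 : HasDerivAt (fun s : ℝ => NormedSpace.exp (s • (-C))) (-C) 0 := by
    have h := hasDerivAt_exp_smul_const (𝕂 := ℝ) (-C) (0 : ℝ)
    rw [zero_smul, NormedSpace.exp_zero, one_mul] at h
    exact h
  have hd := (hder.mul_const Y).mul hder2 |>.mul_const Dᵀ
  have htr := (Matrix.traceLinearMap ι ℝ ℝ).toContinuousLinearMap.hasFDerivAt.comp_hasDerivAt
    (0 : ℝ) hd
  have hloc : IsLocalMax (fun s : ℝ => (NormedSpace.exp (s • C) * Y * NormedSpace.exp (s • (-C)) *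
      Dᵀ).trace) 0 := by
    refine Filter.Eventually.of_forall fun s => ?_
    have hk : NormedSpace.exp (s • C) ∈ Matrix.orthogonalGroup ι ℝ := by
      apply mem_orthogonalGroup_of_mul_transpose
      rw [← Matrix.exp_transpose, Matrix.transpose_smul, hCt, smul_neg]
      rw [← Matrix.exp_add_of_commute (s • C) (-(s • C)) ((Commute.refl (s • C)).neg_right)]
      simp
    have h := hmax _ hk
    rw [← Matrix.exp_transpose, Matrix.transpose_smul, hCt] at h
    simpa using h
  have h0 := hloc.hasDerivAt_eq_zero htr
  simp only [zero_smul, NormedSpace.exp_zero, one_mul, mul_one] at h0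
  have h1 : ((C * Y + Y * -C) * Dᵀ).trace = 0 := h0
  have h2 : ((C * Y + Y * -C) * Dᵀ).trace = (C * Cᵀ).trace := by
    rw [hD, hCt]
    have e1 : (C * Y + Y * -C) * -D = Y * C * D - C * (Y * D) := by noncomm_ring
    have e2 : C * -C = C * (D * Y) - C * (Y * D) := by rw [hC]; noncomm_ring
    rw [e1, e2, Matrix.trace_sub, Matrix.trace_sub]
    congr 1
    rw [Matrix.mul_assoc, Matrix.trace_mul_comm, Matrix.mul_assoc]
  rw [h2, ← Matrix.conjTranspose_eq_transpose_of_trivial,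
    Matrix.trace_mul_conjTranspose_self_eq_zero_iff] at h1
  exact sub_eq_zero.1 h1

end

/-- The permutation of `Fin N` induced by a permutation of the `2 × 2` blocks. -/
def blockSwap {N : ℕ} (l l' : ℕ) (hl : 2 * l + 1 < N) (hl' : 2 * l' + 1 < N) :
    Equiv.Perm (Fin N) :=
  Function.Involutive.toPerm
    (fun i => ⟨2 * (Equiv.swap l l' (i.val / 2)) + i.val % 2, by
      have := i.isLt
      rw [Equiv.swap_apply_def]; split_ifs <;> omega⟩)
    (by
      intro i
      apply Fin.ext
      simp only
      have h1 : (2 * (Equiv.swap l l' (i.val / 2)) + i.val % 2) / 2 =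
        Equiv.swap l l' (i.val / 2) := by omega
      have h2 : (2 * (Equiv.swap l l' (i.val / 2)) + i.val % 2) % 2 = i.val % 2 := by omega
      rw [h1, h2, Equiv.swap_apply_self]
      omega)

theorem blockSwap_val {N : ℕ} (l l' : ℕ) (hl : 2 * l + 1 < N) (hl' : 2 * l' + 1 < N) (i : Fin N) :
    (blockSwap l l' hl hl' i).val = 2 * (Equiv.swap l l' (i.val / 2)) + i.val % 2 := rfl

theorem Dcan_submatrix_blockSwap {N : ℕ} (b : ℕ → ℝ) (l l' : ℕ) (hl : 2 * l + 1 < N)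
    (hl' : 2 * l' + 1 < N) : (Dcan N b).submatrix (blockSwap l l' hl hl') (blockSwap l l' hl hl') =
      Dcan N (b ∘ Equiv.swap l l') := by
  ext i j
  simp only [Matrix.submatrix_apply, Dcan_apply, blockSwap_val]
  have h1 : ∀ i : ℕ, (2 * (Equiv.swap l l' (i / 2)) + i % 2) / 2 =
    Equiv.swap l l' (i / 2) := fun i => by omega
  have h2 : ∀ i : ℕ, (2 * (Equiv.swap l l' (i / 2)) + i % 2) % 2 = i % 2 := fun i => by omega
  simp only [h1, h2, Function.comp, EmbeddingLike.apply_eq_iff_eq]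

/-- The transposition of the two indices of a `2 × 2` block. -/
def blockFlip {N : ℕ} (l : ℕ) (hl : 2 * l + 1 < N) : Equiv.Perm (Fin N) :=
  Function.Involutive.toPerm
    (fun i => if i.val / 2 = l then ⟨2 * l + (1 - i.val % 2), by omega⟩ else i)
    (by
      intro i
      apply Fin.ext
      by_cases h : i.val / 2 = l
      · simp only [h, if_true]
        rw [if_pos (by omega)]
        simp only; omega
      · simp only [h, if_false])

theorem blockFlip_val {N : ℕ} (l : ℕ) (hl : 2 * l + 1 < N) (i : Fin N) :
    (blockFlip l hl i).val = if i.val / 2 = l then 2 * l + (1 - i.val % 2) else i.val :=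
  apply_ite Fin.val _ _ _

theorem Dcan_submatrix_blockFlip {N : ℕ} (b : ℕ → ℝ) (l : ℕ) (hl : 2 * l + 1 < N) :
    (Dcan N b).submatrix (blockFlip l hl) (blockFlip l hl) =
      Dcan N (Function.update b l (-b l)) := by
  ext i j
  simp only [Matrix.submatrix_apply, Dcan_apply, blockFlip_val]
  have hi2 := Nat.mod_two_eq_zero_or_one i.val
  have hj2 := Nat.mod_two_eq_zero_or_one j.val
  by_cases hi : i.val / 2 = l
  · by_cases hj : j.val / 2 = l
    · simp only [hi, hj, if_true, Function.update_self]
      rw [if_pos (by omega), show (2 * l + (1 - i.val % 2)) / 2 = l by omega]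
      rcases hi2 with h1 | h1 <;> rcases hj2 with h2 | h2 <;> simp [h1, h2]
    · simp only [hi, hj, if_true, if_false]
      rw [if_neg (by omega), if_neg (by omega)]
  · simp only [hi, if_false]
    by_cases hj : j.val / 2 = l
    · simp only [hj, if_true]
      rw [if_neg (by omega), if_neg (by omega)]
    · simp only [hj, if_false, Function.update_of_ne hi]

theorem eq_Dcan_of_blockDiagonal {N : ℕ} {Y : Matrix (Fin N) (Fin N) ℝ} (hY : Yᵀ = -Y)
    (h : ∀ i j : Fin N, i.val / 2 ≠ j.val / 2 → Y i j = 0) :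
    Y = Dcan N fun l => if hl : 2 * l + 1 < N then Y ⟨2 * l, by omega⟩ ⟨2 * l + 1, hl⟩ else 0 := by
  have hanti : ∀ i j, Y j i = -Y i j := fun i j => congrFun (congrFun hY i) j
  ext i j
  rw [Dcan_apply]
  have hi := i.isLt
  have hj := j.isLt
  by_cases hij : i.val / 2 = j.val / 2
  · rw [if_pos hij]
    rcases Nat.mod_two_eq_zero_or_one i.val with h1 | h1 <;>
    rcases Nat.mod_two_eq_zero_or_one j.val with h2 | h2
    · have : i = j := Fin.ext (by omega)
      subst this
      simp only [h1]; simp; linarith [hanti i i]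
    · rw [dif_pos (by omega)]
      simp only [h1, h2, and_self, if_true, mul_one]
      congr 1 <;> apply Fin.ext <;> simp only <;> omega
    · rw [dif_pos (by omega)]
      simp only [h1, h2]; simp
      rw [hanti]
      congr 2 <;> apply Fin.ext <;> simp only <;> omega
    · have : i = j := Fin.ext (by omega)
      subst this
      simp only [h1]; simp; linarith [hanti i i]
  · rw [if_neg hij, h _ _ hij]

theorem transpose_conj_antisymm {ι κ : Type*} [Fintype ι] [Fintype κ] {X : Matrix ι ι ℝ}
    (hX : Xᵀ = -X) (k : Matrix κ ι ℝ) : (k * X * kᵀ)ᵀ = -(k * X * kᵀ) := by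
  rw [Matrix.transpose_mul, Matrix.transpose_mul, hX, Matrix.transpose_transpose]
  simp [Matrix.mul_assoc]

/-- Sorted canonical parameters of an antisymmetric matrix of size `N`. -/
def IsCanon (N : ℕ) (b : ℕ → ℝ) : Prop :=
  (∀ l, 0 ≤ b l) ∧ (∀ l l', l ≤ l' → 2 * l' + 1 < N → b l ≤ b l') ∧
    ∀ l, ¬ 2 * l + 1 < N → b l = 0

/-- Every real antisymmetric matrix is orthogonally conjugate to its canonical form. -/
theorem exists_canonical_form {N : ℕ} {X : Matrix (Fin N) (Fin N) ℝ} (hX : Xᵀ = -X) :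
    ∃ k ∈ Matrix.orthogonalGroup (Fin N) ℝ, ∃ b, IsCanon N b ∧ X = k * Dcan N b * kᵀ := by
  set w : ℕ → ℝ := fun l => if 2 * l + 1 < N then (l : ℝ) + 1 else 0 with hw
  set D := Dcan N w with hDdef
  have hwN : N % 2 = 1 → w (N / 2) = 0 := fun h => by
    simp only [hw]; rw [if_neg (by omega)]
  obtain ⟨k, -, hk⟩ := isCompact_univ.exists_isMaxOn (Set.univ_nonempty
    (α := Matrix.orthogonalGroup (Fin N) ℝ))
    (f := fun k => ((k : Matrix (Fin N) (Fin N) ℝ) * X * (k : Matrix (Fin N) (Fin N) ℝ)ᵀ *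
      Dᵀ).trace) (by fun_prop : Continuous _).continuousOn
  set Y := (k : Matrix (Fin N) (Fin N) ℝ) * X * (k : Matrix (Fin N) (Fin N) ℝ)ᵀ with hYdef
  have hY : Yᵀ = -Y := transpose_conj_antisymm hX _
  have hmax : ∀ k' ∈ Matrix.orthogonalGroup (Fin N) ℝ,
      (k' * Y * k'ᵀ * Dᵀ).trace ≤ (Y * Dᵀ).trace := by
    intro k' hk'
    have := isMaxOn_univ_iff.1 hk (⟨k', hk'⟩ * k)
    simp only [Submonoid.coe_mul, Matrix.transpose_mul] at this
    simpa only [hYdef, Matrix.mul_assoc] using this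
  have hcomm : Y * D = D * Y := commute_of_isMax_trace hY (Dcan_transpose N w) hmax
  have hdiag : ∀ i j : Fin N, i.val / 2 ≠ j.val / 2 → Y i j = 0 := by
    intro i j hij
    have h1 : Y * (D * Dᵀ) = (D * Dᵀ) * Y := by
      rw [hDdef, Dcan_transpose, ← hDdef]
      calc Y * (D * -D) = -((Y * D) * D) := by noncomm_ring
        _ = -(D * (Y * D)) := by rw [hcomm, Matrix.mul_assoc, hcomm]
        _ = -(D * (D * Y)) := by rw [hcomm]
        _ = D * -D * Y := by noncomm_ring
    rw [hDdef, Dcan_mul_transpose N w w hwN] at h1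
    have h2 := congrFun (congrFun h1 i) j
    rw [Matrix.mul_diagonal, Matrix.diagonal_mul] at h2
    have h3 : w (i.val / 2) * w (i.val / 2) ≠ w (j.val / 2) * w (j.val / 2) := by
      have hi := i.isLt
      have hj := j.isLt
      have hcast : ((i.val / 2 : ℕ) : ℝ) ≠ ((j.val / 2 : ℕ) : ℝ) := by exact_mod_cast hij
      have p1 : (0 : ℝ) ≤ ((i.val / 2 : ℕ) : ℝ) := Nat.cast_nonneg _
      have p2 : (0 : ℝ) ≤ ((j.val / 2 : ℕ) : ℝ) := Nat.cast_nonneg _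
      intro h
      have hnn : ∀ l, 0 ≤ w l := fun l => by simp only [hw]; split_ifs <;> positivity
      rw [mul_self_inj (hnn _) (hnn _)] at h
      simp only [hw] at h
      split_ifs at h with q1 q2 q2
      · exact hcast (by linarith)
      · linarith
      · linarith
      · omega
    have h4 : Y i j * (w (j.val / 2) * w (j.val / 2) - w (i.val / 2) * w (i.val / 2)) = 0 := by
      linarith
    rcases mul_eq_zero.1 h4 with h5 | h5
    · exact h5
    · exact absurd (sub_eq_zero.1 h5).symm h3
  obtain ⟨b, hb0, hYb⟩ : ∃ b : ℕ → ℝ, (∀ l, ¬ 2 * l + 1 < N → b l = 0) ∧ Y = Dcan N b :=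
    ⟨_, fun l hl => dif_neg hl, eq_Dcan_of_blockDiagonal hY hdiag⟩
  have hbN : ∀ b : ℕ → ℝ, (∀ l, ¬ 2 * l + 1 < N → b l = 0) → N % 2 = 1 → b (N / 2) = 0 :=
    fun b hb h => hb _ (by omega)
  have hval : ∀ b : ℕ → ℝ, (∀ l, ¬ 2 * l + 1 < N → b l = 0) →
      (Dcan N b * Dᵀ).trace = ∑ i : Fin N, b (i.val / 2) * w (i.val / 2) := fun b hb => by
    rw [Dcan_mul_transpose N b w (hbN b hb), Matrix.trace_diagonal]
  have hle : ∀ e : Equiv.Perm (Fin N), ∀ b' : ℕ → ℝ, (∀ l, ¬ 2 * l + 1 < N → b' l = 0) →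
      (Dcan N b).submatrix e e = Dcan N b' →
      ∑ i : Fin N, (b' (i.val / 2) - b (i.val / 2)) * w (i.val / 2) ≤ 0 := by
    intro e b' hb' he
    obtain ⟨k', hk', hk'2⟩ := exists_orthogonal_submatrix e
    have := hmax k' hk'
    rw [hk'2, hYb, he, hval _ hb', hval _ hb0] at this
    simp only [sub_mul, Finset.sum_sub_distrib]
    linarith
  have hpos : ∀ l, 0 ≤ b l := by
    intro l
    by_cases hl : 2 * l + 1 < N
    · by_contra hneg
      push Not at hneg
      have h := hle _ _ (fun l' hl' => by
        rw [Function.update_of_ne (by rintro rfl; exact hl' hl)]; exact hb0 _ hl')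
        (Dcan_submatrix_blockFlip b l hl)
      refine absurd h (not_le.2 ?_)
      apply Finset.sum_pos'
      · intro i _
        by_cases hil : i.val / 2 = l
        · rw [hil, Function.update_self]; simp only [hw]; rw [if_pos hl]
          apply mul_nonneg (by linarith) (by positivity)
        · rw [Function.update_of_ne hil]; simp
      · refine ⟨⟨2 * l, by omega⟩, Finset.mem_univ _, ?_⟩
        simp only [show 2 * l / 2 = l by omega, Function.update_self, hw]
        rw [if_pos hl]
        apply mul_pos (by linarith) (by positivity)
    · rw [hb0 l hl]
  have hmono : ∀ l l', l ≤ l' → 2 * l' + 1 < N → b l ≤ b l' := by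
    intro l l' hll' hl'
    have hl : 2 * l + 1 < N := by omega
    by_contra hneg
    push Not at hneg
    have hne : l ≠ l' := by rintro rfl; exact lt_irrefl _ hneg
    have h := hle _ _ (fun q hq => by
      simp only [Function.comp]
      rw [Equiv.swap_apply_of_ne_of_ne (by rintro rfl; exact hq hl) (by rintro rfl; exact hq hl')]
      exact hb0 _ hq) (Dcan_submatrix_blockSwap b l l' hl hl')
    have hsum : ∑ i : Fin N, ((b ∘ Equiv.swap l l') (i.val / 2) - b (i.val / 2)) * w (i.val / 2) =
        ∑ i : Fin N, ((if i.val / 2 = l then (b l' - b l) * w l else 0) +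
          (if i.val / 2 = l' then (b l - b l') * w l' else 0)) := by
      refine Finset.sum_congr rfl fun i _ => ?_
      simp only [Function.comp]
      by_cases h1 : i.val / 2 = l
      · rw [h1, Equiv.swap_apply_left, if_pos rfl, if_neg hne]; ring
      · by_cases h2 : i.val / 2 = l'
        · rw [h2, Equiv.swap_apply_right, if_neg (Ne.symm hne), if_pos rfl]; ring
        · rw [Equiv.swap_apply_of_ne_of_ne h1 h2, if_neg h1, if_neg h2]; ring
    have hcard : ∀ q, 2 * q + 1 < N → ∀ c : ℝ,
        ∑ i : Fin N, (if i.val / 2 = q then c else 0) = 2 * c := by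
      intro q hq c
      rw [← Finset.sum_filter, Finset.sum_const]
      have : (Finset.univ.filter fun i : Fin N => i.val / 2 = q) =
          {(⟨2 * q, by omega⟩ : Fin N), ⟨2 * q + 1, hq⟩} := by
        ext i
        simp only [Finset.mem_filter, Finset.mem_univ, true_and, Finset.mem_insert,
          Finset.mem_singleton, Fin.ext_iff]
        omega
      rw [this, Finset.card_pair (by simp [Fin.ext_iff])]
      simp
    rw [hsum, Finset.sum_add_distrib, hcard l hl, hcard l' hl'] at h
    simp only [hw, if_pos hl, if_pos hl'] at h
    have : (l : ℝ) < l' := by exact_mod_cast lt_of_le_of_ne hll' hne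
    nlinarith
  refine ⟨(k : Matrix (Fin N) (Fin N) ℝ)ᵀ, transpose_mem_orthogonalGroup k.2, b,
    ⟨hpos, hmono, hb0⟩, ?_⟩
  rw [← hYb, hYdef, Matrix.transpose_transpose]
  have := orthogonal_transpose_mul k.2
  calc X = ((k : Matrix (Fin N) (Fin N) ℝ)ᵀ * k) * X * ((k : Matrix (Fin N) (Fin N) ℝ)ᵀ * k) := by
        rw [this]; simp
    _ = _ := by simp only [Matrix.mul_assoc]

end Canonical

end

noncomputable section

/-! ### Vandermonde products and determinants of integrals -/

section Vandermonde

theorem vdm_eq_det {m : ℕ} (x : Fin m → ℝ) : vdm x = (Matrix.vandermonde x).det := by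
  rw [Matrix.det_vandermonde, vdm, Finset.prod_filter, ← Finset.univ_product_univ,
    Finset.prod_product]
  refine Finset.prod_congr rfl fun i _ => ?_
  rw [← Finset.prod_filter]
  refine Finset.prod_congr ?_ fun _ _ => rfl
  ext j; simp

theorem vdm_pos {m : ℕ} {x : Fin m → ℝ} (hx : StrictMono x) : 0 < vdm x := by
  refine Finset.prod_pos fun p hp => ?_
  exact sub_pos.2 (hx (Finset.mem_filter.1 hp).2)

theorem prod_succAbove_abs {m : ℕ} (x : Fin (m + 1) → ℝ) :
    ∏ i, ∏ k : Fin m, |x i - x (i.succAbove k)| = vdm x ^ 2 := by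
  have h1 : ∀ i, ∏ k : Fin m, |x i - x (i.succAbove k)| =
      ∏ j ∈ Finset.univ.filter (fun j => i ≠ j), |x i - x j| := by
    intro i
    rw [Finset.prod_filter, Fin.prod_univ_succAbove _ i]
    simp [(Fin.succAbove_ne i _).symm]
  simp only [h1]
  rw [← sq_abs, vdm, Finset.abs_prod, sq]
  have h2 : ∏ i, ∏ j ∈ Finset.univ.filter (fun j => i ≠ j), |x i - x j| =
      ∏ q ∈ Finset.univ.filter (fun q : Fin (m + 1) × Fin (m + 1) => q.1 ≠ q.2),
        |x q.1 - x q.2| := by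
    rw [Finset.prod_filter, ← Finset.univ_product_univ, Finset.prod_product]
    simp only [Finset.prod_filter]
  have h3 : (Finset.univ.filter (fun q : Fin (m + 1) × Fin (m + 1) => q.1 ≠ q.2)) =
      (Finset.univ.filter (fun q : Fin (m + 1) × Fin (m + 1) => q.1 < q.2)) ∪
        (Finset.univ.filter (fun q : Fin (m + 1) × Fin (m + 1) => q.2 < q.1)) := by
    ext q; simp
  have h4 : Disjoint (Finset.univ.filter (fun q : Fin (m + 1) × Fin (m + 1) => q.1 < q.2))
        (Finset.univ.filter (fun q : Fin (m + 1) × Fin (m + 1) => q.2 < q.1)) := by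
    rw [Finset.disjoint_filter]; intro q _ h; exact not_lt.2 h.le
  rw [h2, h3, Finset.prod_union h4]
  congr 1
  · exact Finset.prod_congr rfl fun q _ => abs_sub_comm _ _
  · refine Finset.prod_nbij' Prod.swap Prod.swap ?_ ?_ ?_ ?_ ?_ <;> simp

/-- The determinant of increments of a family of functions along a sequence of points. -/
theorem det_increments {R : Type*} [CommRing R] {m : ℕ} (A : Fin (m + 1) → Fin m → R) :
    (Matrix.of fun i j : Fin m => A i.succ j - A i.castSucc j).det =
      (Matrix.of fun i : Fin (m + 1) => Fin.cons (1 : R) (A i)).det := by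
  have h := Matrix.det_eq_of_forall_row_eq_smul_add_pred
    (A := Matrix.of fun i : Fin (m + 1) => (Fin.cons (1 : R) (A i) : Fin (m + 1) → R))
    (B := Matrix.of (Fin.cons (Fin.cons (1 : R) (A 0))
      (fun i : Fin m => Fin.cons (0 : R) (fun j => A i.succ j - A i.castSucc j)) :
        Fin (m + 1) → Fin (m + 1) → R)) (fun _ => 1)
    (fun j => by simp) (fun i j => by
      refine Fin.cases ?_ (fun j => ?_) j <;> simp)
  rw [h, Matrix.det_succ_column_zero, Fin.sum_univ_succ]
  simp only [Matrix.of_apply, Fin.cons_zero, Fin.cons_succ, mul_zero, zero_mul,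
    Finset.sum_const_zero, add_zero, Fin.val_zero, pow_zero, one_mul]
  congr 1

/-- Integrating a determinant whose rows depend on separate variables. -/
theorem integral_det_pi {𝕜 : Type*} [RCLike 𝕜] {m : ℕ} (ν : Fin m → Measure ℝ)
    [∀ k, SigmaFinite (ν k)] (G : Fin m → Fin m → ℝ → 𝕜)
    (hG : ∀ k j, Integrable (G k j) (ν k)) :
    Integrable (fun y : Fin m → ℝ => (Matrix.of fun k j => G k j (y k)).det) (Measure.pi ν) ∧
    ∫ y, (Matrix.of fun k j => G k j (y k)).det ∂(Measure.pi ν) =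
      (Matrix.of fun k j => ∫ t, G k j t ∂(ν k)).det := by
  have hint : ∀ σ : Equiv.Perm (Fin m), Integrable (fun y : Fin m → ℝ => ∏ k, G k (σ k) (y k))
      (Measure.pi ν) := fun σ => Integrable.fintype_prod (fun k => hG _ _)
  have hint2 : ∀ σ : Equiv.Perm (Fin m), Integrable (fun y : Fin m → ℝ =>
      Equiv.Perm.sign σ • ∏ k, G k (σ k) (y k)) (Measure.pi ν) := fun σ => (hint σ).smul _
  have hdet : ∀ M : Matrix (Fin m) (Fin m) 𝕜, M.det =
      ∑ σ : Equiv.Perm (Fin m), Equiv.Perm.sign σ • ∏ k, M k (σ k) := fun M => by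
    rw [← Matrix.det_transpose, Matrix.det_apply]; rfl
  simp only [hdet, Matrix.of_apply]
  constructor
  · exact integrable_finsetSum _ fun σ _ => hint2 σ
  · rw [integral_finsetSum _ fun σ _ => hint2 σ]
    refine Finset.sum_congr rfl fun σ _ => ?_
    have hs : ∀ (z : ℤˣ) (f : (Fin m → ℝ) → 𝕜) (μ : Measure (Fin m → ℝ)),
        ∫ y, z • f y ∂μ = z • ∫ y, f y ∂μ := by
      intro z f μ
      rcases Int.units_eq_one_or z with h | h <;> simp [h, integral_neg]
    rw [hs, integral_fintype_prod_eq_prod (fun k t => G k (σ k) t)]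

/-- Integrating a determinant of functions of separate variables over a box. -/
theorem integral_det_box {𝕜 : Type*} [RCLike 𝕜] {m : ℕ} (G : Fin m → ℝ → 𝕜) (I : Fin m → Set ℝ)
    (hG : ∀ j k, IntegrableOn (G j) (I k)) :
    IntegrableOn (fun y : Fin m → ℝ => (Matrix.of fun k j => G j (y k)).det) (Set.pi Set.univ I) ∧
    ∫ y in Set.pi Set.univ I, (Matrix.of fun k j => G j (y k)).det =
      (Matrix.of fun k j => ∫ t in I k, G j t).det := by
  have hr : (volume : Measure (Fin m → ℝ)).restrict (Set.pi Set.univ I) =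
      Measure.pi fun k => volume.restrict (I k) := by
    rw [volume_pi, Measure.restrict_pi_pi]
  unfold IntegrableOn
  rw [hr]
  exact integral_det_pi _ (fun _ j => G j) (fun k j => hG j k)

end Vandermonde

/-! ### The Dixon–Anderson change of variables -/

section DixonAnderson

open Polynomial in
/-- Evaluation matrix of the polynomials `∏ (X - y)` and `∏_{l ≠ k} (X - y l)`. -/
theorem abs_det_eval_prod {m : ℕ} (p : Fin (m + 1) → ℝ) (y : Fin m → ℝ)
    (hy : Function.Injective y) :
    |(Matrix.of fun i : Fin (m + 1) => (Fin.cons (∏ k, (p i - y k))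
      (fun k => ∏ l ∈ Finset.univ.erase k, (p i - y l)) : Fin (m + 1) → ℝ)).det| =
      |vdm p| * |vdm y| := by
  set L : Fin (m + 1) → ℝ[X] := Fin.cons (∏ k, (X - C (y k)))
    (fun k => ∏ l ∈ Finset.univ.erase k, (X - C (y l))) with hL
  have hL0 : L 0 = ∏ k, (X - C (y k)) := rfl
  have hLs : ∀ k, L (Fin.succ k) = ∏ l ∈ Finset.univ.erase k, (X - C (y l)) := fun k => rfl
  have hdeg0 : (L 0).natDegree = m := by
    rw [hL0, natDegree_prod_of_monic _ _ fun k _ => monic_X_sub_C _]; simp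
  have hm0 : (L 0).Monic := by
    rw [hL0]; exact monic_prod_of_monic _ _ fun k _ => monic_X_sub_C _
  have hdegs : ∀ k, (L (Fin.succ k)).natDegree < m := fun k => by
    rw [hLs, natDegree_prod_of_monic _ _ fun k _ => monic_X_sub_C _]
    have := k.isLt
    simp; omega
  have hdeg : ∀ c, (L c).natDegree < m + 1 := fun c => by
    refine Fin.cases ?_ (fun k => ?_) c
    · omega
    · have := hdegs k; omega
  set Cm : Matrix (Fin (m + 1)) (Fin (m + 1)) ℝ := Matrix.of fun d c => (L c).coeff d with hCm
  have h1 : (Matrix.of fun i : Fin (m + 1) => (Fin.cons (∏ k, (p i - y k))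
      (fun k => ∏ l ∈ Finset.univ.erase k, (p i - y l)) : Fin (m + 1) → ℝ)) =
      Matrix.vandermonde p * Cm := by
    ext i c
    have : (Matrix.vandermonde p * Cm) i c = (L c).eval (p i) := by
      rw [Matrix.mul_apply, eval_eq_sum_range' (hdeg c), Finset.sum_range]
      refine Finset.sum_congr rfl fun d _ => ?_
      simp [Cm, Matrix.vandermonde_apply, mul_comm]
    rw [this]
    refine Fin.cases ?_ (fun k => ?_) c
    · simp [hL0, eval_prod]
    · simp [hLs, eval_prod]
  have h2 : |Cm.det| = |(Matrix.of fun d k : Fin m => (L k.succ).coeff d).det| := by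
    rw [Matrix.det_succ_row Cm (Fin.last m), Fin.sum_univ_succ]
    have e0 : Cm (Fin.last m) 0 = 1 := by
      simp only [hCm, Matrix.of_apply, Fin.val_last]
      have := hm0.coeff_natDegree
      rwa [hdeg0] at this
    have es : ∀ k : Fin m, Cm (Fin.last m) k.succ = 0 := fun k => by
      simp only [hCm, Matrix.of_apply, Fin.val_last]
      exact coeff_eq_zero_of_natDegree_lt (hdegs k)
    simp only [e0, es, mul_zero, zero_mul, Finset.sum_const_zero, add_zero, mul_one, abs_mul,
      abs_pow, abs_neg, abs_one, one_pow, one_mul]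
    congr 2
    ext d k
    simp [hCm]
  have h3 : Matrix.vandermonde y * (Matrix.of fun d k : Fin m => (L k.succ).coeff d) =
      Matrix.diagonal fun k => ∏ l ∈ Finset.univ.erase k, (y k - y l) := by
    ext i k
    rw [Matrix.mul_apply]
    have : ∑ j, Matrix.vandermonde y i j * (Matrix.of fun d k : Fin m => (L k.succ).coeff d) j k =
        (L k.succ).eval (y i) := by
      rw [eval_eq_sum_range' (hdegs k), Finset.sum_range]
      refine Finset.sum_congr rfl fun d _ => ?_
      simp [Matrix.vandermonde_apply, mul_comm]
    rw [this, hLs, eval_prod, Matrix.diagonal_apply]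
    by_cases hik : i = k
    · subst hik; simp
    · rw [if_neg hik]
      exact Finset.prod_eq_zero (Finset.mem_erase.2 ⟨hik, Finset.mem_univ _⟩) (by simp)
  have h4 : |vdm y| * |(Matrix.of fun d k : Fin m => (L k.succ).coeff d).det| = |vdm y| ^ 2 := by
    have := congrArg (fun M => |Matrix.det M|) h3
    simp only [Matrix.det_mul, abs_mul, ← vdm_eq_det, Matrix.det_diagonal] at this
    rw [this, sq_abs]
    cases m with
    | zero => simp [vdm]
    | succ m =>
      rw [← prod_succAbove_abs, Finset.abs_prod]
      refine Finset.prod_congr rfl fun i _ => ?_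
      rw [Finset.abs_prod, ← Finset.filter_ne, Finset.prod_filter, Fin.prod_univ_succAbove _ i]
      simp [(Fin.succAbove_ne i _).symm]
  have h5 : |vdm y| ≠ 0 := by
    rw [vdm_eq_det, abs_ne_zero]
    exact Matrix.det_vandermonde_ne_zero_iff.2 hy
  rw [h1, Matrix.det_mul, abs_mul, ← vdm_eq_det, h2]
  congr 1
  apply mul_left_cancel₀ h5
  rw [h4, sq]

/-- The map from interlacing points `y` (and a total mass `r`) to the residues of
`r ∏ (z - y k) / ∏ (z - p i)` at the points `p i`. Coordinate `0` is `r`. -/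
def daMap {m : ℕ} (p : Fin (m + 1) → ℝ) (q : Fin (m + 1) → ℝ) : Fin (m + 1) → ℝ :=
  fun i => q 0 * ∏ k : Fin m, (p i - q k.succ) / (p i - p (i.succAbove k))

/-- The set of points interlacing with `p`. -/
def interlaceBox {m : ℕ} (p : Fin (m + 1) → ℝ) : Set (Fin m → ℝ) :=
  Set.pi Set.univ fun k => Set.Ioo (p k.castSucc) (p k.succ)

/-- Pairs of a positive mass and a point of the interlacing box. -/
def daDomain {m : ℕ} (p : Fin (m + 1) → ℝ) : Set (Fin (m + 1) → ℝ) :=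
  {q | 0 < q 0 ∧ Fin.tail q ∈ interlaceBox p}

theorem mem_interlaceBox {m : ℕ} {p : Fin (m + 1) → ℝ} {y : Fin m → ℝ} :
    y ∈ interlaceBox p ↔ ∀ k, p k.castSucc < y k ∧ y k < p k.succ := by
  simp [interlaceBox, Set.mem_pi]

theorem strictMono_of_mem_interlaceBox {m : ℕ} {p : Fin (m + 1) → ℝ} (hp : StrictMono p)
    {y : Fin m → ℝ} (hy : y ∈ interlaceBox p) : StrictMono y := by
  rw [mem_interlaceBox] at hy
  intro i j hij
  calc y i < p i.succ := (hy i).2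
    _ ≤ p j.castSucc := hp.monotone (by
        rw [Fin.le_def]; simpa using Nat.succ_le_of_lt hij)
    _ < y j := (hy j).1

theorem measurableSet_daDomain {m : ℕ} (p : Fin (m + 1) → ℝ) : MeasurableSet (daDomain p) := by
  apply IsOpen.measurableSet
  have h1 : IsOpen {q : Fin (m + 1) → ℝ | 0 < q 0} :=
    isOpen_lt continuous_const (continuous_apply 0)
  have h2 : IsOpen (interlaceBox p) := isOpen_set_pi Set.finite_univ fun _ _ => isOpen_Ioo
  have h3 : Continuous fun q : Fin (m + 1) → ℝ => Fin.tail q := by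
    unfold Fin.tail; fun_prop
  exact h1.inter (h2.preimage h3)

theorem sub_succAbove_ne {m : ℕ} {p : Fin (m + 1) → ℝ} (hp : StrictMono p) (i : Fin (m + 1))
    (k : Fin m) : p i - p (i.succAbove k) ≠ 0 :=
  sub_ne_zero.2 fun h => Fin.succAbove_ne i k (hp.injective h).symm

theorem daMap_pos {m : ℕ} {p : Fin (m + 1) → ℝ} (hp : StrictMono p) {q : Fin (m + 1) → ℝ}
    (hq : q ∈ daDomain p) (i : Fin (m + 1)) : 0 < daMap p q i := by
  refine mul_pos hq.1 (Finset.prod_pos fun k _ => ?_)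
  have hk := mem_interlaceBox.1 hq.2 k
  simp only [Fin.tail] at hk
  rcases lt_or_ge k.castSucc i with h | h
  · rw [Fin.succAbove_of_castSucc_lt _ _ h]
    have h2 : p k.succ ≤ p i := hp.monotone (by rw [Fin.le_def]; simpa using Nat.succ_le_of_lt h)
    exact div_pos (by linarith) (sub_pos.2 (hp h))
  · rw [Fin.succAbove_of_le_castSucc _ _ h]
    have h2 : p i ≤ p k.castSucc := hp.monotone h
    exact div_pos_of_neg_of_neg (by linarith) (by linarith)

open Polynomial in
/-- Lagrange interpolation for `r ∏ (X - y k)` at the nodes `p i`. -/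
theorem daMap_interpolation {m : ℕ} {p : Fin (m + 1) → ℝ} (hp : StrictMono p)
    (q : Fin (m + 1) → ℝ) :
    ∑ i, C (daMap p q i) * ∏ k : Fin m, (X - C (p (i.succAbove k))) =
      C (q 0) * ∏ k : Fin m, (X - C (q k.succ)) := by
  have hd : ∀ f : Fin m → ℝ, (∏ k : Fin m, (X - C (f k))).degree < ((m + 1 : ℕ) : WithBot ℕ) := by
    intro f
    rw [degree_eq_natDegree (monic_prod_of_monic _ _ fun k _ => monic_X_sub_C _).ne_zero,
      natDegree_prod_of_monic _ _ fun k _ => monic_X_sub_C _]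
    simp only [natDegree_X_sub_C, Finset.sum_const, Finset.card_univ, Fintype.card_fin, smul_eq_mul,
      mul_one]
    exact_mod_cast Nat.lt_succ_self m
  have hC : ∀ (c : ℝ) (f : ℝ[X]), f.degree < ((m + 1 : ℕ) : WithBot ℕ) →
      (C c * f).degree < ((m + 1 : ℕ) : WithBot ℕ) := by
    intro c f hf
    exact lt_of_le_of_lt (by rw [← smul_eq_C_mul]; exact degree_smul_le c f) hf
  refine eq_of_degrees_lt_of_eval_index_eq (s := Finset.univ) (v := p) (hp.injective.injOn) ?_ ?_ ?_
  · rw [Finset.card_univ, Fintype.card_fin]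
    refine lt_of_le_of_lt (degree_sum_le _ _) ?_
    rw [Finset.sup_lt_iff (WithBot.bot_lt_coe _)]
    exact fun i _ => hC _ _ (hd _)
  · rw [Finset.card_univ, Fintype.card_fin]
    exact hC _ _ (hd _)
  · intro i _
    rw [eval_finsetSum, Finset.sum_eq_single i]
    · simp only [eval_mul, eval_C, eval_prod, eval_sub, eval_X, daMap]
      rw [Finset.prod_div_distrib, mul_assoc, div_mul_cancel₀]
      exact Finset.prod_ne_zero_iff.2 fun k _ => sub_succAbove_ne hp i k
    · intro j _ hj
      obtain ⟨k, hk⟩ := Fin.exists_succAbove_eq hj.symm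
      simp only [eval_mul, eval_C, eval_prod, eval_sub, eval_X]
      rw [Finset.prod_eq_zero (Finset.mem_univ k) (by rw [hk]; simp), mul_zero]
    · intro h; exact absurd (Finset.mem_univ _) h

theorem daMap_eval {m : ℕ} {p : Fin (m + 1) → ℝ} (hp : StrictMono p) (q : Fin (m + 1) → ℝ)
    (t : ℝ) : ∑ i, daMap p q i * ∏ k : Fin m, (t - p (i.succAbove k)) =
      q 0 * ∏ k : Fin m, (t - q k.succ) := by
  have := congrArg (Polynomial.eval t) (daMap_interpolation hp q)
  simpa [Polynomial.eval_finsetSum, Polynomial.eval_prod] using this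

theorem daMap_sum {m : ℕ} {p : Fin (m + 1) → ℝ} (hp : StrictMono p) (q : Fin (m + 1) → ℝ) :
    ∑ i, daMap p q i = q 0 := by
  have h := congrArg (fun f => Polynomial.coeff f m) (daMap_interpolation hp q)
  simp only [Polynomial.finsetSum_coeff, Polynomial.coeff_C_mul] at h
  have hc : ∀ f : Fin m → ℝ, (∏ k : Fin m, (Polynomial.X - Polynomial.C (f k))).coeff m = 1 := by
    intro f
    have hm := Polynomial.monic_prod_of_monic Finset.univ (fun k => Polynomial.X - Polynomial.C (f k))
      fun k _ => Polynomial.monic_X_sub_C _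
    have hd : (∏ k : Fin m, (Polynomial.X - Polynomial.C (f k))).natDegree = m := by
      rw [Polynomial.natDegree_prod_of_monic _ _ fun k _ => Polynomial.monic_X_sub_C _]; simp
    have := hm.coeff_natDegree
    rwa [hd] at this
  simpa [hc] using h

theorem injOn_daMap {m : ℕ} {p : Fin (m + 1) → ℝ} (hp : StrictMono p) :
    Set.InjOn (daMap p) (daDomain p) := by
  intro q hq q' hq' h
  have h0 : q 0 = q' 0 := by rw [← daMap_sum hp q, ← daMap_sum hp q', h]
  ext c
  refine Fin.cases h0 (fun k => ?_) c
  have h1 := daMap_eval hp q (q k.succ)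
  rw [h, daMap_eval hp q', Finset.prod_eq_zero (i := k) (f := fun l => q k.succ - q (Fin.succ l))
    (Finset.mem_univ k) (by simp), mul_zero, mul_eq_zero, Finset.prod_eq_zero_iff] at h1
  rcases h1 with h1 | ⟨l, -, hl⟩
  · exact absurd h1 hq'.1.ne'
  · have hk1 := mem_interlaceBox.1 hq.2 k
    have hl1 := mem_interlaceBox.1 hq'.2 l
    simp only [Fin.tail] at hk1 hl1
    have : k = l := by
      by_contra hne
      rcases lt_or_gt_of_ne hne with hlt | hlt
      · have : p k.succ ≤ p l.castSucc := hp.monotone (by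
          rw [Fin.le_def]; simpa using Nat.succ_le_of_lt hlt)
        linarith
      · have : p l.succ ≤ p k.castSucc := hp.monotone (by
          rw [Fin.le_def]; simpa using Nat.succ_le_of_lt hlt)
        linarith
    subst this
    linarith

/-- The Jacobian matrix of `daMap`. -/
def daJac {m : ℕ} (p : Fin (m + 1) → ℝ) (q : Fin (m + 1) → ℝ) :
    Matrix (Fin (m + 1)) (Fin (m + 1)) ℝ :=
  Matrix.diagonal (fun i => ∏ k : Fin m, (p i - p (i.succAbove k))⁻¹) *
    (Matrix.of fun i : Fin (m + 1) => (Fin.cons (∏ k, (p i - q (Fin.succ k)))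
      (fun k => ∏ l ∈ Finset.univ.erase k, (p i - q (Fin.succ l))) : Fin (m + 1) → ℝ)) *
    Matrix.diagonal (Fin.cons 1 fun _ => -q 0)

theorem hasFDerivAt_daMap {m : ℕ} (p : Fin (m + 1) → ℝ) (q : Fin (m + 1) → ℝ) :
    HasFDerivAt (daMap p) (Matrix.toLin' (daJac p q)).toContinuousLinearMap q := by
  rw [hasFDerivAt_pi']
  intro i
  have h1 : ∀ k : Fin m, HasFDerivAt
      (fun q : Fin (m + 1) → ℝ => (p i - q (Fin.succ k)) / (p i - p (i.succAbove k)))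
      ((p i - p (i.succAbove k))⁻¹ • -ContinuousLinearMap.proj (R := ℝ) (φ := fun _ => ℝ)
        (Fin.succ k)) q := by
    intro k
    have := (((hasFDerivAt_apply (𝕜 := ℝ) (F' := fun _ => ℝ) (Fin.succ k) q).const_sub
      (p i)).mul_const (p i - p (i.succAbove k))⁻¹)
    simpa only [div_eq_mul_inv] using this
  have h2 := (hasFDerivAt_apply (𝕜 := ℝ) (F' := fun _ => ℝ) (0 : Fin (m + 1)) q).mul
    (HasFDerivAt.finsetProd (u := Finset.univ) (fun k _ => h1 k))
  refine h2.congr_fderiv ?_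
  ext v
  simp only [_root_.add_apply, _root_.smul_apply,
    _root_.sum_apply, _root_.neg_apply,
    ContinuousLinearMap.proj_apply,
    ContinuousLinearMap.comp_apply, LinearMap.coe_toContinuousLinearMap', Matrix.toLin'_apply,
    Matrix.mulVec, dotProduct, smul_eq_mul, daJac, Matrix.mul_diagonal, Matrix.diagonal_mul,
    Matrix.of_apply, Fin.sum_univ_succ, Fin.cons_zero, Fin.cons_succ]
  rw [add_comm, Finset.mul_sum]
  congr 1
  · simp only [div_eq_mul_inv, Finset.prod_mul_distrib]; ring
  · refine Finset.sum_congr rfl fun k _ => ?_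
    simp only [div_eq_mul_inv, Finset.prod_mul_distrib]
    rw [← Finset.mul_prod_erase Finset.univ (fun k => (p i - p (i.succAbove k))⁻¹)
      (Finset.mem_univ k)]
    ring

theorem abs_det_daJac {m : ℕ} {p : Fin (m + 1) → ℝ} (hp : StrictMono p) {q : Fin (m + 1) → ℝ}
    (hq : q ∈ daDomain p) : |(daJac p q).det| = q 0 ^ m * (vdm (Fin.tail q) / vdm p) := by
  have hy := strictMono_of_mem_interlaceBox hp hq.2
  rw [daJac, Matrix.det_mul, Matrix.det_mul, Matrix.det_diagonal, Matrix.det_diagonal, abs_mul,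
    abs_mul]
  have h := abs_det_eval_prod p (Fin.tail q) hy.injective
  simp only [Fin.tail] at h
  have h3 : |∏ i : Fin (m + 1), (Fin.cons 1 (fun _ => -q 0) : Fin (m + 1) → ℝ) i| = q 0 ^ m := by
    rw [Fin.prod_univ_succ]
    simp [abs_of_pos hq.1]
  have h2 : |∏ i, ∏ k : Fin m, (p i - p (i.succAbove k))⁻¹| = (vdm p ^ 2)⁻¹ := by
    rw [← prod_succAbove_abs, Finset.abs_prod, ← Finset.prod_inv_distrib]
    refine Finset.prod_congr rfl fun i _ => ?_
    rw [Finset.abs_prod, ← Finset.prod_inv_distrib]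
    exact Finset.prod_congr rfl fun k _ => abs_inv _
  have hvp := vdm_pos hp
  have hvy : 0 < vdm (Fin.tail q) := vdm_pos hy
  rw [h, h3, h2, abs_of_pos hvp, abs_of_pos hvy]
  field_simp

theorem lintegral_daDomain {m : ℕ} (p : Fin (m + 1) → ℝ) (f : ℝ → (Fin m → ℝ) → ENNReal)
    (hf : Measurable (Function.uncurry f)) :
    ∫⁻ q in daDomain p, f (q 0) (Fin.tail q) =
      ∫⁻ r in Set.Ioi (0 : ℝ), ∫⁻ y in interlaceBox p, f r y := by
  have h := (volume_preserving_piFinSuccAbove (fun _ : Fin (m + 1) => ℝ) 0)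
  have hs : daDomain p = (MeasurableEquiv.piFinSuccAbove (fun _ : Fin (m + 1) => ℝ) 0) ⁻¹'
      (Set.Ioi (0 : ℝ) ×ˢ interlaceBox p) := by
    ext q; simp [daDomain, MeasurableEquiv.piFinSuccAbove]
  have h2 := h.setLIntegral_comp_preimage_emb (MeasurableEquiv.measurableEmbedding _)
    (fun z : ℝ × (Fin m → ℝ) => f z.1 z.2) (Set.Ioi (0 : ℝ) ×ˢ interlaceBox p)
  rw [← hs] at h2
  have h3 : ∫⁻ q in daDomain p, f (q 0) (Fin.tail q) = ∫⁻ z in Set.Ioi (0 : ℝ) ×ˢ interlaceBox p,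
      f z.1 z.2 ∂((volume : Measure ℝ).prod (volume : Measure (Fin m → ℝ))) := h2
  rw [h3, ← Measure.prod_restrict]
  exact lintegral_prod _ hf.aemeasurable

theorem lintegral_vdm_interlaceBox {m : ℕ} {p : Fin (m + 1) → ℝ} (hp : StrictMono p) :
    ∫⁻ y in interlaceBox p, ENNReal.ofReal (vdm y) = ENNReal.ofReal (vdm p / m.factorial) := by
  have hI := integral_det_box (𝕜 := ℝ) (fun (j : Fin m) t => t ^ (j : ℕ))
    (fun k : Fin m => Set.Ioo (p k.castSucc) (p k.succ))
    (fun j k => ((continuous_pow _).integrableOn_Icc).mono_set Set.Ioo_subset_Icc_self)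
  have hv : (fun y : Fin m → ℝ => (Matrix.of fun k (j : Fin m) => y k ^ (j : ℕ)).det) = vdm := by
    ext y; rw [vdm_eq_det]; rfl
  rw [hv, ← interlaceBox] at hI
  have hms : MeasurableSet (interlaceBox p) :=
    MeasurableSet.univ_pi fun _ => measurableSet_Ioo
  have hnn : 0 ≤ᵐ[volume.restrict (interlaceBox p)] (vdm : (Fin m → ℝ) → ℝ) := by
    filter_upwards [ae_restrict_mem hms] with y hy
    exact (vdm_pos (strictMono_of_mem_interlaceBox hp hy)).le
  rw [← ofReal_integral_eq_lintegral_ofReal hI.1 hnn]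
  congr 1
  refine hI.2.trans ?_
  have h1 : (Matrix.of fun k j : Fin m => ∫ t in Set.Ioo (p k.castSucc) (p k.succ), t ^ (j : ℕ)) =
      (Matrix.of fun k j : Fin m => p k.succ ^ ((j : ℕ) + 1) - p k.castSucc ^ ((j : ℕ) + 1)) *
        Matrix.diagonal (fun j : Fin m => ((j : ℕ) + 1 : ℝ)⁻¹) := by
    ext k j
    rw [Matrix.mul_diagonal, Matrix.of_apply, Matrix.of_apply, ← integral_Ioc_eq_integral_Ioo,
      ← intervalIntegral.integral_of_le (hp.monotone (Fin.castSucc_lt_succ).le), integral_pow,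
      div_eq_mul_inv]
  rw [h1, Matrix.det_mul, Matrix.det_diagonal,
    det_increments (fun i (j : Fin m) => p i ^ ((j : ℕ) + 1)), div_eq_mul_inv]
  congr 1
  · rw [vdm_eq_det]
    congr 1
    ext i j
    refine Fin.cases ?_ (fun j => ?_) j <;> simp [Matrix.vandermonde_apply]
  · rw [Finset.prod_inv_distrib, ← Finset.prod_range_add_one_eq_factorial, Finset.prod_range]
    push_cast; rfl

theorem measurable_vdm {m : ℕ} : Measurable (vdm : (Fin m → ℝ) → ℝ) := by
  unfold vdm; fun_prop

theorem continuous_daMap {m : ℕ} (p : Fin (m + 1) → ℝ) : Continuous (daMap p) :=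
  continuous_iff_continuousAt.2 fun q => (hasFDerivAt_daMap p q).continuousAt

theorem lintegral_exp_neg_sum (m : ℕ) :
    ∫⁻ e in {e : Fin m → ℝ | ∀ i, 0 < e i}, ENNReal.ofReal (Real.exp (-∑ i, e i)) = 1 := by
  have hr : (volume : Measure (Fin m → ℝ)).restrict {e : Fin m → ℝ | ∀ i, 0 < e i} =
      Measure.pi fun _ => volume.restrict (Set.Ioi (0 : ℝ)) := by
    rw [← Measure.restrict_pi_pi, ← volume_pi]
    congr 1; ext e; simp
  rw [hr]
  have : ∀ e : Fin m → ℝ, Real.exp (-∑ i, e i) = ∏ i, Real.exp (-e i) := fun e => by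
    rw [← Finset.sum_neg_distrib, Real.exp_sum]
  simp only [this]
  rw [← ofReal_integral_eq_lintegral_ofReal
    (Integrable.fintype_prod (fun _ => integrableOn_exp_neg_Ioi 0))
    (Filter.Eventually.of_forall fun e => Finset.prod_nonneg fun i _ => (Real.exp_pos _).le),
    integral_fintype_prod_eq_prod (fun _ t => Real.exp (-t)), integral_exp_neg_Ioi_zero]
  simp

/-- The Dixon–Anderson change of variables, as an equality of measures on the positive orthant. -/
theorem map_daMap {m : ℕ} {p : Fin (m + 1) → ℝ} (hp : StrictMono p) :
    Measure.map (daMap p) ((volume.restrict (daDomain p)).withDensity fun q =>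
      ENNReal.ofReal (q 0 ^ m * (vdm (Fin.tail q) / vdm p))) =
    volume.restrict {e : Fin (m + 1) → ℝ | ∀ i, 0 < e i} := by
  have hmeasJ : Measurable fun q : Fin (m + 1) → ℝ =>
      ENNReal.ofReal (q 0 ^ m * (vdm (Fin.tail q) / vdm p)) := by
    have : Measurable fun q : Fin (m + 1) → ℝ => Fin.tail q := by unfold Fin.tail; fun_prop
    have := (measurable_vdm (m := m)).comp this
    simp only [Function.comp_def] at this
    fun_prop
  have hS := measurableSet_daDomain p
  have hfd : ∀ q ∈ daDomain p, HasFDerivWithinAt (daMap p)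
      (Matrix.toLin' (daJac p q)).toContinuousLinearMap (daDomain p) q :=
    fun q _ => (hasFDerivAt_daMap p q).hasFDerivWithinAt
  have himg : MeasurableSet (daMap p '' daDomain p) :=
    measurable_image_of_fderivWithin hS hfd (injOn_daMap hp)
  have hpos : MeasurableSet {e : Fin (m + 1) → ℝ | ∀ i, 0 < e i} := by
    simp only [Set.ofPred_forall]
    exact MeasurableSet.iInter fun i => measurableSet_lt measurable_const (measurable_pi_apply i)
  have hsub : daMap p '' daDomain p ⊆ {e : Fin (m + 1) → ℝ | ∀ i, 0 < e i} := by
    rintro _ ⟨q, hq, rfl⟩ i; exact daMap_pos hp hq i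
  have hcov : ∀ g : (Fin (m + 1) → ℝ) → ENNReal, Measurable g →
      ∫⁻ e in daMap p '' daDomain p, g e =
      ∫⁻ q in daDomain p, ENNReal.ofReal (q 0 ^ m * (vdm (Fin.tail q) / vdm p)) *
        g (daMap p q) := by
    intro g hg
    rw [lintegral_image_eq_lintegral_abs_det_fderiv_mul volume hS hfd (injOn_daMap hp)]
    refine setLIntegral_congr_fun hS fun q hq => ?_
    rw [← abs_det_daJac hp hq, ContinuousLinearMap.det]
    simp
  have hmass : ∫⁻ e in daMap p '' daDomain p, ENNReal.ofReal (Real.exp (-∑ i, e i)) = 1 := by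
    rw [hcov _ (by fun_prop)]
    simp only [daMap_sum hp]
    have h1 := lintegral_daDomain p (fun r y => ENNReal.ofReal (r ^ m * (vdm y / vdm p)) *
      ENNReal.ofReal (Real.exp (-r))) (by
        have : Measurable fun z : ℝ × (Fin m → ℝ) => vdm z.2 := measurable_vdm.comp measurable_snd
        unfold Function.uncurry
        fun_prop)
    rw [h1]
    have h2 : ∀ r ∈ Set.Ioi (0 : ℝ), ∫⁻ y in interlaceBox p, ENNReal.ofReal (r ^ m *
        (vdm y / vdm p)) * ENNReal.ofReal (Real.exp (-r)) =
        ENNReal.ofReal (Real.exp (-r) * r ^ ((m + 1 : ℝ) - 1)) *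
          ENNReal.ofReal (m.factorial : ℝ)⁻¹ := by
      intro r hr
      have e1 : ∀ y : Fin m → ℝ, ENNReal.ofReal (r ^ m * (vdm y / vdm p)) *
          ENNReal.ofReal (Real.exp (-r)) =
          ENNReal.ofReal (Real.exp (-r) * r ^ m / vdm p) * ENNReal.ofReal (vdm y) := by
        intro y
        have hr' : (0 : ℝ) < r := hr
        have := vdm_pos hp
        rw [← ENNReal.ofReal_mul' (Real.exp_pos _).le, ← ENNReal.ofReal_mul (by positivity)]
        congr 1; ring
      simp only [e1]
      rw [lintegral_const_mul _ (by have := measurable_vdm (m := m); fun_prop),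
        lintegral_vdm_interlaceBox hp]
      have hr' : (0 : ℝ) < r := hr
      have := vdm_pos hp
      rw [← ENNReal.ofReal_mul (by positivity), ← ENNReal.ofReal_mul (by positivity)]
      congr 1
      rw [show (m + 1 : ℝ) - 1 = m by ring, Real.rpow_natCast]
      field_simp
    rw [setLIntegral_congr_fun measurableSet_Ioi h2, lintegral_mul_const _ (by fun_prop),
      ← ofReal_integral_eq_lintegral_ofReal (Real.GammaIntegral_convergent (by positivity))
        (by
          filter_upwards [ae_restrict_mem measurableSet_Ioi] with r hr
          have hr' : (0 : ℝ) < r := hr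
          positivity), ← Real.Gamma_eq_integral (by positivity), Real.Gamma_nat_eq_factorial,
      ← ENNReal.ofReal_mul (by positivity), mul_inv_cancel₀ (by positivity), ENNReal.ofReal_one]
  have hnull : volume ({e : Fin (m + 1) → ℝ | ∀ i, 0 < e i} \ daMap p '' daDomain p) = 0 := by
    have h1 := lintegral_exp_neg_sum (m + 1)
    rw [← Set.sdiff_union_of_subset hsub, lintegral_union himg Set.disjoint_sdiff_left, hmass] at h1
    have h2 : ∫⁻ e in {e : Fin (m + 1) → ℝ | ∀ i, 0 < e i} \ daMap p '' daDomain p,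
        ENNReal.ofReal (Real.exp (-∑ i, e i)) = 0 := by
      have : (1 : ENNReal) ≠ ⊤ := ENNReal.one_ne_top
      exact (ENNReal.add_left_inj this).1 (by rw [h1, zero_add])
    rw [lintegral_eq_zero_iff (by fun_prop)] at h2
    rw [← Measure.restrict_eq_zero, ← ae_eq_bot]
    by_contra hne
    have : (ae (volume.restrict ({e : Fin (m + 1) → ℝ | ∀ i, 0 < e i} \
      daMap p '' daDomain p))).NeBot := ⟨hne⟩
    obtain ⟨e, he⟩ := h2.exists
    have := Real.exp_pos (-∑ i, e i)
    simp only [Pi.zero_apply, ENNReal.ofReal_eq_zero] at he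
    linarith
  refine Measure.ext_of_lintegral _ fun g hg => ?_
  rw [lintegral_map hg (continuous_daMap p).measurable]
  refine (lintegral_withDensity_eq_lintegral_mul _ hmeasJ
    (hg.comp (continuous_daMap p).measurable)).trans ?_
  simp only [Pi.mul_apply, Function.comp]
  rw [← hcov g hg]
  refine (setLIntegral_congr ?_)
  rw [ae_eq_set]
  exact ⟨by rw [Set.sdiff_eq_empty.2 hsub]; simp, hnull⟩

end DixonAnderson

end

noncomputable section

/-! ### Corners of conjugated antisymmetric matrices -/

section Corner

/-- The leading principal submatrix of size one less. -/
def corner {M : ℕ} (Y : Matrix (Fin (M + 1)) (Fin (M + 1)) ℝ) : Matrix (Fin M) (Fin M) ℝ :=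
  Y.submatrix Fin.castSucc Fin.castSucc

theorem corner_transpose {M : ℕ} {Y : Matrix (Fin (M + 1)) (Fin (M + 1)) ℝ} (hY : Yᵀ = -Y) :
    (corner Y)ᵀ = -corner Y := by
  rw [corner, Matrix.transpose_submatrix, hY]; rfl

/-- Extension by zero of the square roots of a finite family. -/
def rootExt {m : ℕ} (y : Fin m → ℝ) : ℕ → ℝ := fun l => if h : l < m then √(y ⟨l, h⟩) else 0

theorem rootExt_apply {m : ℕ} (y : Fin m → ℝ) (l : Fin m) : rootExt y l = √(y l) := by
  simp [rootExt]

theorem sq_det_sub_antisymm {N : ℕ} {b : ℕ → ℝ} (hb : N % 2 = 1 → b (N / 2) = 0)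
    {k : Matrix (Fin N) (Fin N) ℝ} (hk : k ∈ Matrix.orthogonalGroup (Fin N) ℝ) (z : ℝ) :
    (Matrix.scalar (Fin N) z - k * Dcan N b * kᵀ).det ^ 2 =
      ∏ i : Fin N, (z ^ 2 + b (i.val / 2) ^ 2) := by
  set A := Matrix.scalar (Fin N) z - Dcan N b with hA
  have h1 : Matrix.scalar (Fin N) z - k * Dcan N b * kᵀ = k * A * kᵀ := by
    rw [hA, Matrix.mul_sub, Matrix.sub_mul]
    congr 1
    rw [← (Matrix.scalar_commute z (fun _ => Commute.all _ _) k).eq, Matrix.mul_assoc,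
      orthogonal_mul_transpose hk, Matrix.mul_one]
  have h2 : A * Aᵀ = Matrix.diagonal fun i : Fin N => (z ^ 2 + b (i.val / 2) ^ 2) := by
    have e1 : Aᵀ = Matrix.scalar (Fin N) z - (Dcan N b)ᵀ := by
      rw [hA, Matrix.transpose_sub]; simp
    have e2 : A * Aᵀ = Matrix.scalar (Fin N) z * Matrix.scalar (Fin N) z +
        Dcan N b * (Dcan N b)ᵀ := by
      rw [e1, hA, Dcan_transpose]
      have := (Matrix.scalar_commute z (fun _ => Commute.all _ _) (Dcan N b)).eq
      simp only [sub_neg_eq_add, Matrix.sub_mul, Matrix.mul_add, this, Matrix.mul_neg]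
      abel
    rw [e2, Dcan_mul_transpose N b b hb]
    ext i j
    by_cases hij : i = j
    · subst hij; simp; ring
    · simp [hij]
  have h3 : A.det ^ 2 = ∏ i : Fin N, (z ^ 2 + b (i.val / 2) ^ 2) := by
    have := congrArg Matrix.det h2
    rw [Matrix.det_mul, Matrix.det_transpose, Matrix.det_diagonal] at this
    rw [sq, this]
  rw [h1, Matrix.det_mul, Matrix.det_mul, Matrix.det_transpose, mul_pow, mul_pow, h3]
  have := abs_det_of_mem_orthogonalGroup hk
  have hk2 : k.det ^ 2 = 1 := by rw [← sq_abs, this]; norm_num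
  rw [hk2]; ring

theorem sq_det_sub_corner {M : ℕ} {b : ℕ → ℝ} (hb : (M + 1) % 2 = 1 → b ((M + 1) / 2) = 0)
    {k : Matrix (Fin (M + 1)) (Fin (M + 1)) ℝ} (hk : k ∈ Matrix.orthogonalGroup (Fin (M + 1)) ℝ)
    {z : ℝ} (hz : 0 < z) :
    (Matrix.scalar (Fin M) z - corner (k * Dcan (M + 1) b * kᵀ)).det ^ 2 =
      (∏ i : Fin (M + 1), (z ^ 2 + b (i.val / 2) ^ 2)) *
        (∑ i : Fin (M + 1), k (Fin.last M) i ^ 2 * (z / (z ^ 2 + b (i.val / 2) ^ 2))) ^ 2 := by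
  set d : Fin (M + 1) → ℝ := fun i => z ^ 2 + b (i.val / 2) ^ 2 with hd
  have hdpos : ∀ i, 0 < d i := fun i => by positivity
  set A := Matrix.scalar (Fin (M + 1)) z - Dcan (M + 1) b with hA
  have h1 : Matrix.scalar (Fin (M + 1)) z - k * Dcan (M + 1) b * kᵀ = k * A * kᵀ := by
    rw [hA, Matrix.mul_sub, Matrix.sub_mul]
    congr 1
    rw [← (Matrix.scalar_commute z (fun _ => Commute.all _ _) k).eq, Matrix.mul_assoc,
      orthogonal_mul_transpose hk, Matrix.mul_one]
  have hdetA := sq_det_sub_antisymm hb hk z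
  rw [h1] at hdetA
  have h2 : A * (Aᵀ * Matrix.diagonal fun i => (d i)⁻¹) = 1 := by
    have e1 : Aᵀ = Matrix.scalar (Fin (M + 1)) z - (Dcan (M + 1) b)ᵀ := by
      rw [hA, Matrix.transpose_sub]; simp
    have e2 : A * Aᵀ = Matrix.scalar (Fin (M + 1)) z * Matrix.scalar (Fin (M + 1)) z +
        Dcan (M + 1) b * (Dcan (M + 1) b)ᵀ := by
      rw [e1, hA, Dcan_transpose]
      have := (Matrix.scalar_commute z (fun _ => Commute.all _ _) (Dcan (M + 1) b)).eq
      simp only [sub_neg_eq_add, Matrix.sub_mul, Matrix.mul_add, this, Matrix.mul_neg]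
      abel
    rw [← Matrix.mul_assoc, e2, Dcan_mul_transpose (M + 1) b b hb]
    ext i j
    by_cases hij : i = j
    · subst hij
      have := (hdpos i).ne'
      simp only [Matrix.mul_diagonal, Matrix.add_apply, Matrix.one_apply_eq,
        Matrix.diagonal_apply_eq, Matrix.scalar_apply, Matrix.diagonal_mul_diagonal]
      rw [show z * z + b (i.val / 2) * b (i.val / 2) = d i by simp only [hd]; ring,
        mul_inv_cancel₀ this]
    · simp [hij]
  have h3 : (k * A * kᵀ) * (k * (Aᵀ * Matrix.diagonal fun i => (d i)⁻¹) * kᵀ) = 1 := by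
    calc _ = k * A * (kᵀ * k) * (Aᵀ * Matrix.diagonal fun i => (d i)⁻¹) * kᵀ := by
          simp only [Matrix.mul_assoc]
      _ = k * (A * (Aᵀ * Matrix.diagonal fun i => (d i)⁻¹)) * kᵀ := by
          rw [orthogonal_transpose_mul hk, Matrix.mul_one]; simp only [Matrix.mul_assoc]
      _ = 1 := by rw [h2, Matrix.mul_one, orthogonal_mul_transpose hk]
  have h4 : (k * A * kᵀ).adjugate = (k * A * kᵀ).det •
      (k * (Aᵀ * Matrix.diagonal fun i => (d i)⁻¹) * kᵀ) := by
    generalize k * (Aᵀ * Matrix.diagonal fun i => (d i)⁻¹) * kᵀ = B at h3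
    generalize k * A * kᵀ = S at h3
    calc S.adjugate = S.adjugate * (S * B) := by rw [h3, Matrix.mul_one]
      _ = S.det • B := by rw [← Matrix.mul_assoc, Matrix.adjugate_mul]; simp
  have h5 : (Matrix.scalar (Fin M) z - corner (k * Dcan (M + 1) b * kᵀ)).det =
      (k * A * kᵀ).adjugate (Fin.last M) (Fin.last M) := by
    rw [Matrix.adjugate_fin_succ_eq_det_submatrix, ← h1]
    have : Even ((Fin.last M : ℕ) + (Fin.last M : ℕ)) := ⟨_, rfl⟩
    rw [this.neg_one_pow, one_mul]
    congr 1
    ext i j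
    simp [corner, Matrix.diagonal_apply]
  have h6 : (k * (Aᵀ * Matrix.diagonal fun i => (d i)⁻¹) * kᵀ) (Fin.last M) (Fin.last M) =
      ∑ i : Fin (M + 1), k (Fin.last M) i ^ 2 * (z / d i) := by
    have e1 : Aᵀ = Matrix.scalar (Fin (M + 1)) z + Dcan (M + 1) b := by
      rw [hA, Matrix.transpose_sub, Dcan_transpose]; simp
    set v := k (Fin.last M) with hv
    have e2 : (k * (Aᵀ * Matrix.diagonal fun i => (d i)⁻¹) * kᵀ) (Fin.last M) (Fin.last M) =
        ∑ j, ∑ i, v i * (Aᵀ i j * (d j)⁻¹) * v j := by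
      rw [Matrix.mul_apply]
      refine Finset.sum_congr rfl fun j _ => ?_
      rw [Matrix.mul_apply, Finset.sum_mul]
      refine Finset.sum_congr rfl fun i _ => ?_
      rw [Matrix.mul_diagonal]; rfl
    have e3 : ∑ j, ∑ i, v i * (Dcan (M + 1) b i j * (d j)⁻¹) * v j = 0 := by
      have hsw : ∑ j, ∑ i, v i * (Dcan (M + 1) b i j * (d j)⁻¹) * v j =
          -∑ j, ∑ i, v i * (Dcan (M + 1) b i j * (d j)⁻¹) * v j := by
        conv_lhs => rw [Finset.sum_comm]
        rw [← Finset.sum_neg_distrib]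
        refine Finset.sum_congr rfl fun i _ => ?_
        rw [← Finset.sum_neg_distrib]
        refine Finset.sum_congr rfl fun j _ => ?_
        have ha : Dcan (M + 1) b j i = -Dcan (M + 1) b i j :=
          congrFun (congrFun (Dcan_transpose (M + 1) b) i) j
        rw [ha]
        by_cases hij : i.val / 2 = j.val / 2
        · rw [show d i = d j by simp only [hd, hij]]; ring
        · rw [Dcan_apply, if_neg hij]; ring
      linarith
    rw [e2, e1]
    simp only [Matrix.add_apply, add_mul, mul_add, Finset.sum_add_distrib, e3, add_zero]
    refine Finset.sum_congr rfl fun j _ => ?_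
    rw [Finset.sum_eq_single j]
    · simp; ring
    · intro i _ hij; simp [hij]
    · intro h; exact absurd (Finset.mem_univ _) h
  rw [h5, h4, Matrix.smul_apply, h6, smul_eq_mul, mul_pow, hdetA]

/-- A monotone family is determined by the polynomial `∏ (t + β l)`. -/
theorem monotone_eq_of_prod_eq {m : ℕ} {β y : Fin m → ℝ} (hβ : Monotone β) (hy : Monotone y)
    (h : ∀ z : ℝ, 0 < z → ∏ l, (z ^ 2 + β l) = ∏ l, (z ^ 2 + y l)) : β = y := by
  have hpoly : ∏ l, (Polynomial.X - Polynomial.C (-β l)) =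
      ∏ l, (Polynomial.X - Polynomial.C (-y l)) := by
    refine Polynomial.eq_of_infinite_eval_eq _ _ ((Set.Ioi_infinite (0 : ℝ)).mono fun t ht => ?_)
    have := h (√t) (Real.sqrt_pos.2 ht)
    rw [Real.sq_sqrt (le_of_lt ht)] at this
    simpa [Polynomial.eval_prod] using this
  have hroots := congrArg Polynomial.roots hpoly
  have hm : ∀ f : Fin m → ℝ, (∏ l, (Polynomial.X - Polynomial.C (f l))).roots =
      Multiset.map f Finset.univ.val := fun f => by
    rw [← Polynomial.roots_multiset_prod_X_sub_C (Multiset.map f Finset.univ.val), Multiset.map_map]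
    rfl
  rw [hm, hm] at hroots
  have h2 := congrArg (Multiset.map fun t => -t) hroots
  simp only [Multiset.map_map, Function.comp_def, neg_neg] at h2
  rw [Fin.univ_val_map, Fin.univ_val_map] at h2
  exact List.ofFn_injective
    ((Multiset.coe_eq_coe.1 h2).eq_of_pairwise' hβ.sortedLE_ofFn.pairwise hy.sortedLE_ofFn.pairwise)

end Corner

end

noncomputable section

/-! ### Householder reflections -/

section Householder

variable {ι : Type*} [Fintype ι] [DecidableEq ι]

/-- A vector rescaled to Euclidean length one. -/
def unitVec (ξ : ι → ℝ) : ι → ℝ := fun i => ξ i / √(∑ j, ξ j ^ 2)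

/-- The reflection exchanging `ξ / ‖ξ‖` with the basis vector `e_j`. -/
def householder (j : ι) (ξ : ι → ℝ) : Matrix ι ι ℝ :=
  1 - (2 / ∑ i, (unitVec ξ - Pi.single j 1 : ι → ℝ) i ^ 2) •
    Matrix.vecMulVec (unitVec ξ - Pi.single j 1) (unitVec ξ - Pi.single j 1)

theorem householder_transpose (j : ι) (ξ : ι → ℝ) : (householder j ξ)ᵀ = householder j ξ := by
  ext i k
  simp [householder, Matrix.vecMulVec, Matrix.one_apply, eq_comm, mul_comm]

theorem householder_mem (j : ι) (ξ : ι → ℝ) :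
    householder j ξ ∈ Matrix.orthogonalGroup ι ℝ := by
  apply mem_orthogonalGroup_of_mul_transpose
  rw [householder_transpose]
  set u := unitVec ξ - Pi.single j 1 with hu
  have h1 : Matrix.vecMulVec u u * Matrix.vecMulVec u u = (∑ i, u i ^ 2) • Matrix.vecMulVec u u := by
    rw [Matrix.vecMulVec_mul_vecMulVec]
    ext a b
    simp only [Matrix.vecMulVec, dotProduct, Finset.sum_mul, Matrix.of_apply, Matrix.smul_apply,
      smul_eq_mul, Finset.mul_sum, Pi.smul_apply]
    exact Finset.sum_congr rfl fun i _ => by ring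
  rw [householder, ← hu]
  simp only [Matrix.sub_mul, Matrix.mul_sub, Matrix.smul_mul, Matrix.mul_smul, h1,
    Matrix.one_mul, Matrix.mul_one, smul_sub, smul_smul]
  by_cases h0 : ∑ i, u i ^ 2 = 0
  · simp [h0]
  · have : 2 / (∑ i, u i ^ 2) * (2 / (∑ i, u i ^ 2) * ∑ i, u i ^ 2) =
        2 / (∑ i, u i ^ 2) + 2 / (∑ i, u i ^ 2) := by field_simp; norm_num
    rw [this, add_smul]; abel

theorem sum_sq_unitVec {ξ : ι → ℝ} (hξ : ∑ i, ξ i ^ 2 ≠ 0) : ∑ i, unitVec ξ i ^ 2 = 1 := by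
  have h0 : 0 ≤ ∑ i, ξ i ^ 2 := Finset.sum_nonneg fun i _ => sq_nonneg _
  simp only [unitVec, div_pow, Real.sq_sqrt h0, ← Finset.sum_div]
  exact div_self hξ

theorem householder_apply (j : ι) {ξ : ι → ℝ} (hξ : ∑ i, ξ i ^ 2 ≠ 0) :
    householder j ξ j = unitVec ξ := by
  set w := unitVec ξ with hw
  have h1 : ∑ i, w i ^ 2 = 1 := sum_sq_unitVec hξ
  set u := w - Pi.single j 1 with hu
  have h2 : ∑ i, u i ^ 2 = -2 * u j := by
    have : ∀ i, u i ^ 2 = w i ^ 2 - 2 * (w i * (Pi.single j (1 : ℝ) : ι → ℝ) i) +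
        (Pi.single j (1 : ℝ) : ι → ℝ) i * (Pi.single j (1 : ℝ) : ι → ℝ) i := fun i => by
      simp only [hu, Pi.sub_apply]; ring
    simp only [this, Finset.sum_add_distrib, Finset.sum_sub_distrib, ← Finset.mul_sum, h1]
    simp [Pi.single_apply, hu]; ring
  ext i
  have h3 : householder j ξ j i = (1 : Matrix ι ι ℝ) j i - 2 / (∑ i, u i ^ 2) * (u j * u i) := by
    simp [householder, Matrix.vecMulVec, hu, hw]
  rw [h3]
  have h4 : w i = (1 : Matrix ι ι ℝ) j i + u i := by
    simp [hu, Matrix.one_apply, Pi.single_apply, eq_comm]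
  rw [h4]
  by_cases h0 : ∑ i, u i ^ 2 = 0
  · have : u i = 0 := by
      have := (Finset.sum_eq_zero_iff_of_nonneg fun i _ => sq_nonneg (u i)).1 h0 i
        (Finset.mem_univ _)
      simpa using this
    rw [this]; simp
  · have hj : u j ≠ 0 := fun h => h0 (by rw [h2, h]; simp)
    rw [h2]; field_simp; ring

theorem measurable_householder (j : ι) : Measurable (householder j) := by
  refine measurable_pi_lambda _ fun a => measurable_pi_lambda _ fun b => ?_
  simp only [householder, unitVec, Matrix.sub_apply, Matrix.smul_apply, Matrix.vecMulVec,
    Matrix.of_apply, Pi.sub_apply, smul_eq_mul]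
  fun_prop

end Householder

/-! ### The canonical form of a corner -/

section CornerCanon

theorem prod_fin_two_mul (n : ℕ) (f : ℕ → ℝ) :
    ∏ i : Fin (2 * n), f (i.val / 2) = (∏ l : Fin n, f l) ^ 2 := by
  rw [Fin.prod_univ_eq_prod_range (fun i => f (i / 2)) (2 * n),
    Fin.prod_univ_eq_prod_range (fun i => f i) n]
  induction n with
  | zero => simp
  | succ n ih =>
    rw [show 2 * (n + 1) = 2 * n + 1 + 1 by ring, Finset.prod_range_succ, Finset.prod_range_succ,
      ih, Finset.prod_range_succ, show (2 * n + 1) / 2 = n by omega, show 2 * n / 2 = n by omega]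
    ring

/-- Common bookkeeping of the spectra of a canonical matrix of size `M + 1` and of its corner, in
both parities: `p` lists the distinct values of the squared frequencies and `c` says which one
belongs to each coordinate. -/
structure CornerData (M m : ℕ) (b : ℕ → ℝ) (c : Fin (M + 1) → Fin (m + 1))
    (p : Fin (m + 1) → ℝ) : Prop where
  mono : StrictMono p
  nonneg : ∀ l, 0 ≤ p l
  freq : ∀ i, b (i.val / 2) ^ 2 = p (c i)
  half : M / 2 = m
  last : (M + 1) % 2 = 1 → b ((M + 1) / 2) = 0
  parity : ∀ β : ℕ → ℝ, IsCanon M β → ∀ z : ℝ, 0 < z →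
    (∏ i : Fin M, (z ^ 2 + β (i.val / 2) ^ 2)) * (∏ l, (z ^ 2 + p l)) ^ 2 =
      (∏ l : Fin m, (z ^ 2 + β l ^ 2)) ^ 2 * (∏ i : Fin (M + 1), (z ^ 2 + b (i.val / 2) ^ 2)) * z ^ 2

theorem cornerData_even {m : ℕ} {x : Fin (m + 1) → ℝ} (hx : StrictMono x) (hx0 : ∀ l, 0 ≤ x l) :
    CornerData (2 * m + 1) m (rootExt x) (fun i => ⟨i.val / 2, by omega⟩) x where
  mono := hx
  nonneg := hx0
  freq i := by
    have h : i.val / 2 < m + 1 := by omega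
    rw [rootExt, dif_pos h, Real.sq_sqrt (hx0 _)]
  half := by omega
  last h := by omega
  parity β hβ z hz := by
    have h1 : ∏ i : Fin (2 * m + 1), (z ^ 2 + β (i.val / 2) ^ 2) =
        (∏ l : Fin m, (z ^ 2 + β l ^ 2)) ^ 2 * z ^ 2 := by
      rw [Fin.prod_univ_castSucc]
      have := prod_fin_two_mul m fun l => z ^ 2 + β l ^ 2
      simp only [Fin.val_castSucc, Fin.val_last]
      rw [this, show 2 * m / 2 = m by omega, hβ.2.2 m (by omega)]; ring
    have h2 : ∏ i : Fin (2 * m + 1 + 1), (z ^ 2 + rootExt x (i.val / 2) ^ 2) =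
        (∏ l, (z ^ 2 + x l)) ^ 2 := by
      have := prod_fin_two_mul (m + 1) fun l => z ^ 2 + rootExt x l ^ 2
      refine this.trans ?_
      congr 1
      refine Finset.prod_congr rfl fun l _ => ?_
      rw [rootExt_apply, Real.sq_sqrt (hx0 _)]
    rw [h1, h2]; ring

theorem cornerData_odd {m : ℕ} {x : Fin m → ℝ} (hx : StrictMono x) (hx0 : ∀ l, 0 < x l) :
    CornerData (2 * m) m (rootExt x)
      (fun i => if h : i.val = 2 * m then 0 else ⟨i.val / 2 + 1, by have := i.isLt; omega⟩)
      (Fin.cons 0 x) where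
  mono := by
    refine Fin.strictMono_iff_lt_succ.2 fun i => ?_
    cases m with
    | zero => exact i.elim0
    | succ m =>
      refine Fin.cases ?_ (fun i => ?_) i
      · simpa using hx0 0
      · rw [Fin.castSucc_succ, Fin.cons_succ, Fin.cons_succ]
        exact hx Fin.castSucc_lt_succ
  nonneg l := by refine Fin.cases (by simp) (fun i => ?_) l; simpa using (hx0 i).le
  freq i := by
    by_cases h : i.val = 2 * m
    · simp only [h, dif_pos, Fin.cons_zero]
      rw [rootExt, dif_neg (by omega)]; simp
    · have h2 : i.val / 2 < m := by have := i.isLt; omega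
      rw [dif_neg h, rootExt, dif_pos h2, Real.sq_sqrt (hx0 _).le]
      exact (Fin.cons_succ (α := fun _ => ℝ) 0 x ⟨i.val / 2, h2⟩).symm
  half := by omega
  last h := by rw [rootExt, dif_neg (by omega)]
  parity β hβ z hz := by
    have h2 : ∏ i : Fin (2 * m + 1), (z ^ 2 + rootExt x (i.val / 2) ^ 2) =
        (∏ l, (z ^ 2 + x l)) ^ 2 * z ^ 2 := by
      rw [Fin.prod_univ_castSucc]
      have := prod_fin_two_mul m fun l => z ^ 2 + rootExt x l ^ 2
      simp only [Fin.val_castSucc, Fin.val_last]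
      rw [this, show 2 * m / 2 = m by omega]
      congr 1
      · congr 1
        refine Finset.prod_congr rfl fun l _ => ?_
        rw [rootExt_apply, Real.sq_sqrt (hx0 _).le]
      · rw [rootExt, dif_neg (by omega)]; ring
    have h3 := prod_fin_two_mul m fun l => z ^ 2 + β l ^ 2
    rw [h2, h3, Fin.prod_univ_succ]
    simp only [Fin.cons_zero, Fin.cons_succ]; ring

variable {M m : ℕ} {b : ℕ → ℝ} {c : Fin (M + 1) → Fin (m + 1)} {p : Fin (m + 1) → ℝ}

theorem CornerData.exists_canon (hd : CornerData M m b c p)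
    {k : Matrix (Fin (M + 1)) (Fin (M + 1)) ℝ} (hk : k ∈ Matrix.orthogonalGroup (Fin (M + 1)) ℝ) :
    ∃ y : Fin m → ℝ, Monotone y ∧ (∀ l, 0 ≤ y l) ∧
      (∃ k' ∈ Matrix.orthogonalGroup (Fin M) ℝ,
        corner (k * Dcan (M + 1) b * kᵀ) = k' * Dcan M (rootExt y) * k'ᵀ) ∧
      ∀ z : ℝ, 0 < z → ∏ l, (z ^ 2 + y l) = (∏ l, (z ^ 2 + p l)) *
        ∑ i, k (Fin.last M) i ^ 2 / (z ^ 2 + p (c i)) := by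
  have hanti : (k * Dcan (M + 1) b * kᵀ)ᵀ = -(k * Dcan (M + 1) b * kᵀ) :=
    transpose_conj_antisymm (Dcan_transpose _ _) k
  obtain ⟨k', hk', β, hβ, hX⟩ := exists_canonical_form (corner_transpose hanti)
  have hpb := hd.parity β hβ
  have hMm := hd.half
  refine ⟨fun l => β l ^ 2, ?_, fun l => sq_nonneg _, ⟨k', hk', ?_⟩, ?_⟩
  · intro l l' hl
    exact pow_le_pow_left₀ (hβ.1 _) (hβ.2.1 _ _ hl (by have := l'.isLt; omega)) 2
  · rw [hX]
    congr 2
    refine Dcan_congr fun l hl => ?_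
    have : l < m := by omega
    rw [rootExt, dif_pos this, Real.sqrt_sq (hβ.1 _)]
  · intro z hz
    have e1 := sq_det_sub_antisymm (b := β) (fun h => hβ.2.2 _ (by omega)) hk' z
    have e2 := sq_det_sub_corner hd.last hk hz
    rw [hX, e1] at e2
    have e3 := hpb z hz
    rw [e2] at e3
    have hb0 : 0 < ∏ i : Fin (M + 1), (z ^ 2 + b (i.val / 2) ^ 2) :=
      Finset.prod_pos fun i _ => by positivity
    have e4 : ∑ i, k (Fin.last M) i ^ 2 * (z / (z ^ 2 + b (i.val / 2) ^ 2)) =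
        z * ∑ i, k (Fin.last M) i ^ 2 / (z ^ 2 + p (c i)) := by
      rw [Finset.mul_sum]
      refine Finset.sum_congr rfl fun i _ => ?_
      rw [hd.freq]; ring
    rw [e4] at e3
    set B := ∏ i : Fin (M + 1), (z ^ 2 + b (i.val / 2) ^ 2)
    set Q := ∏ l, (z ^ 2 + p l)
    set S := ∑ i, k (Fin.last M) i ^ 2 / (z ^ 2 + p (c i))
    set Y := ∏ l : Fin m, (z ^ 2 + β l ^ 2)
    have hQ : 0 ≤ Q := Finset.prod_nonneg fun l _ => by have := hd.nonneg l; positivity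
    have hS : 0 ≤ S := Finset.sum_nonneg fun i _ => by have := hd.nonneg (c i); positivity
    have hY : 0 ≤ Y := Finset.prod_nonneg fun l _ => by positivity
    have : Y ^ 2 = (Q * S) ^ 2 := by
      have h0 : (B * z ^ 2) ≠ 0 := by positivity
      apply mul_left_cancel₀ h0
      linear_combination -e3
    exact (sq_eq_sq₀ hY (mul_nonneg hQ hS)).1 this

/-- An invariant function of the corner only depends on the interlacing family. -/
theorem CornerData.eq_of_prod (hd : CornerData M m b c p) {E : Type*}
    {Ψ : Matrix (Fin M) (Fin M) ℝ → E}
    (hΨ : ∀ X : Matrix (Fin M) (Fin M) ℝ, Xᵀ = -X →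
      ∀ k ∈ Matrix.orthogonalGroup (Fin M) ℝ, Ψ (k * X * kᵀ) = Ψ X)
    {k : Matrix (Fin (M + 1)) (Fin (M + 1)) ℝ} (hk : k ∈ Matrix.orthogonalGroup (Fin (M + 1)) ℝ)
    {y : Fin m → ℝ} (hy : Monotone y)
    (h : ∀ z : ℝ, 0 < z → ∏ l, (z ^ 2 + y l) = (∏ l, (z ^ 2 + p l)) *
        ∑ i, k (Fin.last M) i ^ 2 / (z ^ 2 + p (c i))) :
    Ψ (corner (k * Dcan (M + 1) b * kᵀ)) = Ψ (Dcan M (rootExt y)) := by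
  obtain ⟨y', hy', -, ⟨k', hk', hX⟩, h'⟩ := hd.exists_canon hk
  have : y' = y := monotone_eq_of_prod_eq hy' hy fun z hz => by rw [h z hz, h' z hz]
  rw [hX, this, hΨ _ (Dcan_transpose _ _) k' hk']

theorem sum_div_fiber (v : Fin (M + 1) → ℝ) (z : ℝ) :
    ∑ i, v i ^ 2 / (z ^ 2 + p (c i)) =
      ∑ l, (∑ i with c i = l, v i ^ 2) / (z ^ 2 + p l) := by
  rw [← Finset.sum_fiberwise _ c]
  refine Finset.sum_congr rfl fun l _ => ?_
  rw [Finset.sum_div]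
  refine Finset.sum_congr rfl fun i hi => ?_
  rw [(Finset.mem_filter.1 hi).2]

theorem CornerData.eq_of_weights (hd : CornerData M m b c p) {E : Type*}
    {Ψ : Matrix (Fin M) (Fin M) ℝ → E}
    (hΨ : ∀ X : Matrix (Fin M) (Fin M) ℝ, Xᵀ = -X →
      ∀ k ∈ Matrix.orthogonalGroup (Fin M) ℝ, Ψ (k * X * kᵀ) = Ψ X)
    {k k' : Matrix (Fin (M + 1)) (Fin (M + 1)) ℝ}
    (hk : k ∈ Matrix.orthogonalGroup (Fin (M + 1)) ℝ)
    (hk' : k' ∈ Matrix.orthogonalGroup (Fin (M + 1)) ℝ)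
    (h : ∀ l, ∑ i with c i = l, k (Fin.last M) i ^ 2 = ∑ i with c i = l, k' (Fin.last M) i ^ 2) :
    Ψ (corner (k * Dcan (M + 1) b * kᵀ)) = Ψ (corner (k' * Dcan (M + 1) b * k'ᵀ)) := by
  obtain ⟨y', hy', -, ⟨k'', hk'', hX⟩, h'⟩ := hd.exists_canon hk'
  rw [hX, hΨ _ (Dcan_transpose _ _) k'' hk'']
  refine hd.eq_of_prod hΨ hk hy' fun z hz => ?_
  rw [h' z hz, sum_div_fiber, sum_div_fiber]
  simp only [h]

end CornerCanon

end

noncomputable section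

/-! ### Gaussian vectors and the laws of their block energies -/

section Gaussian

open ProbabilityTheory

theorem pi_withDensity {ι : Type*} [Fintype ι] {α : ι → Type*} [∀ i, MeasurableSpace (α i)]
    (ν : ∀ i, Measure (α i)) [∀ i, SigmaFinite (ν i)] (ρ : ∀ i, α i → ℝ)
    (hm : ∀ i, Measurable (ρ i)) (h0 : ∀ i e, 0 ≤ ρ i e) (hint : ∀ i, Integrable (ρ i) (ν i)) :
    Measure.pi (fun i => (ν i).withDensity fun e => ENNReal.ofReal (ρ i e)) =
      (Measure.pi ν).withDensity fun e => ENNReal.ofReal (∏ i, ρ i (e i)) := by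
  refine Measure.pi_eq fun s hs => ?_
  rw [withDensity_apply _ (MeasurableSet.univ_pi hs), Measure.restrict_pi_pi,
    ← ofReal_integral_eq_lintegral_ofReal
      (Integrable.fintype_prod_dep fun i => (hint i).mono_measure Measure.restrict_le_self)
      (Filter.Eventually.of_forall fun e => Finset.prod_nonneg fun i _ => h0 i _),
    integral_fintype_prod_eq_prod (fun i => ρ i),
    ENNReal.ofReal_prod_of_nonneg fun i _ => integral_nonneg fun e => h0 i e]
  refine Finset.prod_congr rfl fun i _ => ?_
  rw [withDensity_apply _ (hs i), ← ofReal_integral_eq_lintegral_ofReal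
    ((hint i).mono_measure Measure.restrict_le_self) (Filter.Eventually.of_forall (h0 i))]

/-- The standard Gaussian measure on `ι → ℝ`. -/
def stdGauss (ι : Type*) [Fintype ι] : Measure (ι → ℝ) := Measure.pi fun _ => gaussianReal 0 1

instance (ι : Type*) [Fintype ι] : IsProbabilityMeasure (stdGauss ι) := by
  unfold stdGauss; infer_instance

theorem stdGauss_eq_withDensity (ι : Type*) [Fintype ι] : stdGauss ι =
    (volume : Measure (ι → ℝ)).withDensity
      fun ξ => ENNReal.ofReal ((√(2 * Real.pi))⁻¹ ^ Fintype.card ι *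
        Real.exp (-(∑ i, ξ i ^ 2) / 2)) := by
  have h1 : (gaussianReal 0 1) = (volume : Measure ℝ).withDensity
      fun e => ENNReal.ofReal (gaussianPDFReal 0 1 e) := gaussianReal_of_var_ne_zero 0 one_ne_zero
  rw [stdGauss, h1, pi_withDensity (fun _ : ι => volume) (fun _ => gaussianPDFReal 0 1)
    (fun _ => measurable_gaussianPDFReal _ _) (fun _ => gaussianPDFReal_nonneg _ _)
    (fun _ => integrable_gaussianPDFReal _ _), ← volume_pi]
  congr 1
  ext ξ
  congr 1
  simp only [gaussianPDFReal, Finset.prod_mul_distrib, Finset.prod_const, Finset.card_univ,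
    ← Real.exp_sum]
  simp [← Finset.sum_div, Finset.sum_neg_distrib]

variable {ι : Type*} [Fintype ι] [DecidableEq ι]

theorem sum_sq_vecMul {k : Matrix ι ι ℝ} (hk : k ∈ Matrix.orthogonalGroup ι ℝ) (ξ : ι → ℝ) :
    ∑ i, (ξ ᵥ* k) i ^ 2 = ∑ i, ξ i ^ 2 := by
  have h1 : ∀ v : ι → ℝ, ∑ i, v i ^ 2 = v ⬝ᵥ v := fun v => by simp [dotProduct, sq]
  rw [h1, h1, ← Matrix.dotProduct_mulVec, ← Matrix.vecMul_transpose, Matrix.vecMul_vecMul,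
    orthogonal_mul_transpose hk, Matrix.vecMul_one]

theorem map_vecMul_stdGauss {k : Matrix ι ι ℝ} (hk : k ∈ Matrix.orthogonalGroup ι ℝ) :
    MeasurePreserving (fun ξ : ι → ℝ => ξ ᵥ* k) (stdGauss ι) (stdGauss ι) := by
  have hmeas : Measurable fun ξ : ι → ℝ => ξ ᵥ* k := by
    refine measurable_pi_lambda _ fun i => ?_
    simp only [Matrix.vecMul, dotProduct]
    fun_prop
  have hdet := abs_det_of_mem_orthogonalGroup hk
  have hvol : Measure.map (fun ξ : ι → ℝ => ξ ᵥ* k) volume = volume := by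
    have h := Real.map_matrix_volume_pi_eq_smul_volume_pi (M := kᵀ)
      (by rw [Matrix.det_transpose]; intro h; rw [h] at hdet; simp at hdet)
    rw [Matrix.det_transpose, abs_inv, hdet] at h
    simp only [inv_one, ENNReal.ofReal_one, one_smul] at h
    convert h using 2
    ext ξ : 1
    rw [Matrix.toLin'_apply, Matrix.mulVec_transpose]
  refine ⟨hmeas, ?_⟩
  ext s hs
  rw [Measure.map_apply hmeas hs, stdGauss_eq_withDensity, withDensity_apply _ (hmeas hs),
    withDensity_apply _ hs]
  conv_rhs => rw [← hvol]
  rw [setLIntegral_map hs (by fun_prop) hmeas]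
  simp only [sum_sq_vecMul hk]

theorem stdGauss_ae_ne_zero [Nonempty ι] : ∀ᵐ ξ ∂(stdGauss ι), ∑ i, ξ i ^ 2 ≠ 0 := by
  have hac : stdGauss ι ≪ volume := by
    rw [stdGauss_eq_withDensity]; exact withDensity_absolutelyContinuous _ _
  refine hac.ae_le ?_
  have : ∀ᵐ ξ : ι → ℝ, ξ ≠ 0 := by
    have := Measure.ae_ne (volume : Measure (ι → ℝ)) 0
    exact this
  filter_upwards [this] with ξ hξ h0
  refine hξ (funext fun i => ?_)
  have := (Finset.sum_eq_zero_iff_of_nonneg fun i _ => sq_nonneg (ξ i)).1 h0 i (Finset.mem_univ _)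
  simpa using this

/-- Selecting coordinates of independent pairs along an injection. -/
theorem map_select_pi {ι κ : Type*} [Fintype ι] [Fintype κ] [DecidableEq κ] (c : ι → κ)
    (t : ι → Bool) (hct : Function.Injective fun i => (c i, t i)) (μ : Measure ℝ)
    [IsProbabilityMeasure μ] :
    Measure.map (fun (η : κ → ℝ × ℝ) i => if t i then (η (c i)).2 else (η (c i)).1)
      (Measure.pi fun _ => μ.prod μ) = Measure.pi fun _ => μ := by
  have hmeas : Measurable (fun (η : κ → ℝ × ℝ) i => if t i then (η (c i)).2 else (η (c i)).1) := by
    refine measurable_pi_lambda _ fun i => ?_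
    cases t i <;> simp <;> fun_prop
  refine (Measure.pi_eq fun s hs => ?_).symm
  rw [Measure.map_apply hmeas (MeasurableSet.univ_pi hs)]
  have hpre : (fun (η : κ → ℝ × ℝ) i => if t i then (η (c i)).2 else (η (c i)).1) ⁻¹'
      Set.univ.pi s = Set.univ.pi fun l =>
        (⋂ i ∈ Finset.univ.filter (fun i => c i = l ∧ t i = false), s i) ×ˢ
          (⋂ i ∈ Finset.univ.filter (fun i => c i = l ∧ t i = true), s i) := by
    ext η
    simp only [Set.mem_preimage, Set.mem_univ_pi, Set.mem_prod, Set.mem_iInter, Finset.mem_filter,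
      Finset.mem_univ, true_and]
    constructor
    · intro h l
      refine ⟨fun i hi => ?_, fun i hi => ?_⟩
      · have := h i; rw [hi.2, hi.1] at this; simpa using this
      · have := h i; rw [hi.2, hi.1] at this; simpa using this
    · intro h i
      cases hti : t i
      · simpa using (h (c i)).1 i ⟨rfl, hti⟩
      · simpa using (h (c i)).2 i ⟨rfl, hti⟩
  have hone : ∀ (A : Finset ι), (A : Set ι).Subsingleton → μ (⋂ i ∈ A, s i) = ∏ i ∈ A, μ (s i) := by
    intro A hA
    rcases Finset.eq_empty_or_nonempty A with rfl | ⟨a, ha⟩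
    · simp
    · have : A = {a} := Finset.eq_singleton_iff_unique_mem.2 ⟨ha, fun b hb => hA hb ha⟩
      rw [this]; simp
  have hsub : ∀ l (u : Bool), ((Finset.univ.filter (fun i => c i = l ∧ t i = u) : Finset ι) :
      Set ι).Subsingleton := by
    intro l u a ha b hb
    simp only [Finset.coe_filter, Finset.mem_univ, true_and, Set.mem_ofPred_eq] at ha hb
    exact hct (Prod.ext (ha.1.trans hb.1.symm) (ha.2.trans hb.2.symm))
  rw [hpre, Measure.pi_pi]
  simp only [Measure.prod_prod, hone _ (hsub _ _)]
  rw [← Finset.prod_fiberwise _ c]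
  refine Finset.prod_congr rfl fun l _ => ?_
  conv_rhs => rw [← Finset.prod_filter_mul_prod_filter_not _ (fun i => t i = false),
    Finset.filter_filter, Finset.filter_filter]
  simp

theorem lintegral_comp_half_sq (f : ℝ → ENNReal) :
    ∫⁻ r in Set.Ioi (0 : ℝ), ENNReal.ofReal r * f (r ^ 2 / 2) = ∫⁻ e in Set.Ioi (0 : ℝ), f e := by
  have him : (fun r : ℝ => r ^ 2 / 2) '' Set.Ioi 0 = Set.Ioi 0 := by
    ext e
    simp only [Set.mem_image, Set.mem_Ioi]
    constructor
    · rintro ⟨r, hr, rfl⟩; positivity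
    · intro he
      exact ⟨√(2 * e), by positivity, by rw [Real.sq_sqrt (by positivity)]; ring⟩
  have h := lintegral_image_eq_lintegral_abs_deriv_mul (f := fun r : ℝ => r ^ 2 / 2)
    (f' := fun r => r) measurableSet_Ioi (fun x _ => by
      have := ((hasDerivAt_pow 2 x).div_const 2).hasDerivWithinAt (s := Set.Ioi 0)
      exact this.congr_deriv (by push_cast; ring)) (fun x hx y hy hxy => by
      have hx' : 0 ≤ x := le_of_lt hx
      have hy' : 0 ≤ y := le_of_lt hy
      have h2 : x ^ 2 = y ^ 2 := by have : x ^ 2 / 2 = y ^ 2 / 2 := hxy; linarith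
      exact (pow_left_inj₀ hx' hy' two_ne_zero).1 h2) f
  rw [him] at h
  rw [h]
  refine setLIntegral_congr_fun measurableSet_Ioi fun r hr => ?_
  rw [abs_of_pos hr]

/-- Half the squared length of a planar Gaussian vector is exponentially distributed. -/
theorem map_half_sq_add_sq :
    Measure.map (fun z : ℝ × ℝ => (z.1 ^ 2 + z.2 ^ 2) / 2) ((gaussianReal 0 1).prod (gaussianReal 0 1))
      = (volume.restrict (Set.Ioi 0)).withDensity fun e => ENNReal.ofReal (Real.exp (-e)) := by
  have hmeas : Measurable fun z : ℝ × ℝ => (z.1 ^ 2 + z.2 ^ 2) / 2 := by fun_prop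
  have hmd : Measurable fun z : ℝ × ℝ => gaussianPDF 0 1 z.1 * gaussianPDF 0 1 z.2 :=
    ((measurable_gaussianPDF 0 1).comp measurable_fst).mul
      ((measurable_gaussianPDF 0 1).comp measurable_snd)
  ext s hs
  rw [Measure.map_apply hmeas hs, gaussianReal_of_var_ne_zero 0 one_ne_zero,
    prod_withDensity (measurable_gaussianPDF 0 1) (measurable_gaussianPDF 0 1),
    withDensity_apply _ (hmeas hs), withDensity_apply _ hs, ← lintegral_indicator (hmeas hs)]
  have hpd : ∀ z : ℝ × ℝ, gaussianPDF 0 1 z.1 * gaussianPDF 0 1 z.2 =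
      ENNReal.ofReal ((2 * Real.pi)⁻¹ * Real.exp (-((z.1 ^ 2 + z.2 ^ 2) / 2))) := by
    intro z
    rw [gaussianPDF, gaussianPDF, ← ENNReal.ofReal_mul (gaussianPDFReal_nonneg _ _ _)]
    congr 1
    simp only [gaussianPDFReal, NNReal.coe_one, mul_one, sub_zero]
    have h2 : (√(2 * Real.pi))⁻¹ * (√(2 * Real.pi))⁻¹ = (2 * Real.pi)⁻¹ := by
      rw [← mul_inv, Real.mul_self_sqrt (by positivity)]
    rw [show -((z.1 ^ 2 + z.2 ^ 2) / 2) = -z.1 ^ 2 / 2 + -z.2 ^ 2 / 2 by ring, Real.exp_add, ← h2]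
    ring
  simp only [hpd]
  set G : ℝ → ENNReal := fun e => s.indicator
    (fun e => ENNReal.ofReal ((2 * Real.pi)⁻¹ * Real.exp (-e))) e with hG
  have hGm : Measurable G := by
    refine Measurable.indicator ?_ hs; fun_prop
  have h1 : ∀ z : ℝ × ℝ, ((fun z : ℝ × ℝ => (z.1 ^ 2 + z.2 ^ 2) / 2) ⁻¹' s).indicator
      (fun z => ENNReal.ofReal ((2 * Real.pi)⁻¹ * Real.exp (-((z.1 ^ 2 + z.2 ^ 2) / 2)))) z =
      G ((z.1 ^ 2 + z.2 ^ 2) / 2) := fun z => Set.indicator_comp_right (s := s) (fun z : ℝ × ℝ => (z.1 ^ 2 + z.2 ^ 2) / 2)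
      (g := fun e => ENNReal.ofReal ((2 * Real.pi)⁻¹ * Real.exp (-e)))
  simp only [h1]
  have h2 := lintegral_comp_polarCoord_symm fun z : ℝ × ℝ => G ((z.1 ^ 2 + z.2 ^ 2) / 2)
  have hv : (volume : Measure ℝ).prod volume = (volume : Measure (ℝ × ℝ)) := rfl
  rw [hv, ← h2]
  have h3 : ∀ q : ℝ × ℝ, ENNReal.ofReal q.1 • G (((polarCoord.symm q).1 ^ 2 +
      (polarCoord.symm q).2 ^ 2) / 2) = ENNReal.ofReal q.1 * G (q.1 ^ 2 / 2) := fun q => by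
    rw [polarCoord_symm_apply, smul_eq_mul]
    congr 2
    simp only
    rw [mul_pow, mul_pow, ← mul_add, Real.cos_sq_add_sin_sq, mul_one]
  simp only [h3]
  rw [polarCoord_target, ← hv, ← Measure.prod_restrict, lintegral_prod _ (by fun_prop)]
  simp only [lintegral_const, Measure.restrict_apply_univ, Real.volume_Ioo, sub_neg_eq_add]
  rw [lintegral_mul_const _ (by fun_prop), lintegral_comp_half_sq, ← lintegral_mul_const _ hGm,
    Measure.restrict_restrict hs, ← lintegral_indicator (hs.inter measurableSet_Ioi),
    ← lintegral_indicator measurableSet_Ioi]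
  refine lintegral_congr fun e => ?_
  by_cases he : e ∈ s <;> by_cases he' : e ∈ Set.Ioi (0 : ℝ) <;>
    simp only [Set.indicator, hG, he, he', Set.mem_inter_iff, if_true, if_false, and_true,
      and_false, zero_mul, and_self, true_and, false_and]
  rw [← ENNReal.ofReal_mul (by positivity)]
  congr 1
  field_simp
  ring

/-- Half the square of a standard Gaussian variable. -/
theorem map_half_sq :
    Measure.map (fun z : ℝ × ℝ => z.1 ^ 2 / 2) ((gaussianReal 0 1).prod (gaussianReal 0 1))
      = (volume.restrict (Set.Ioi 0)).withDensity
        fun e => ENNReal.ofReal ((√Real.pi)⁻¹ * (√e)⁻¹ * Real.exp (-e)) := by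
  have hmeas : Measurable fun z : ℝ => z ^ 2 / 2 := by fun_prop
  have h0 : Measure.map (fun z : ℝ × ℝ => z.1 ^ 2 / 2)
      ((gaussianReal 0 1).prod (gaussianReal 0 1)) =
      Measure.map (fun z : ℝ => z ^ 2 / 2) (gaussianReal 0 1) := by
    have : (fun z : ℝ × ℝ => z.1 ^ 2 / 2) = (fun z : ℝ => z ^ 2 / 2) ∘ Prod.fst := rfl
    rw [this, ← Measure.map_map hmeas measurable_fst, Measure.map_fst_prod]; simp
  rw [h0]
  ext s hs
  rw [Measure.map_apply hmeas hs, gaussianReal_of_var_ne_zero 0 one_ne_zero,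
    withDensity_apply _ (hmeas hs), withDensity_apply _ hs, ← lintegral_indicator (hmeas hs)]
  set G : ℝ → ENNReal := fun e => s.indicator
    (fun e => ENNReal.ofReal ((√(2 * Real.pi))⁻¹ * Real.exp (-e))) e with hG
  have h1 : ∀ z : ℝ, ((fun z : ℝ => z ^ 2 / 2) ⁻¹' s).indicator (gaussianPDF 0 1) z =
      G (z ^ 2 / 2) := fun z => by
    have hgp : gaussianPDF 0 1 = (fun e => ENNReal.ofReal ((√(2 * Real.pi))⁻¹ * Real.exp (-e))) ∘
        fun z : ℝ => z ^ 2 / 2 := by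
      ext z
      simp [gaussianPDF, gaussianPDFReal, neg_div]
    rw [hgp]
    exact Set.indicator_comp_right (s := s) (fun z : ℝ => z ^ 2 / 2)
  simp only [h1]
  have hGm : Measurable G := by
    refine Measurable.indicator ?_ hs; fun_prop
  have h2 : ∫⁻ z : ℝ, G (z ^ 2 / 2) = 2 * ∫⁻ z in Set.Ioi (0 : ℝ), G (z ^ 2 / 2) := by
    rw [← lintegral_add_compl (fun z : ℝ => G (z ^ 2 / 2)) measurableSet_Ioi (A := Set.Ioi (0 : ℝ)),
      two_mul]
    congr 1
    have hn := (Measure.measurePreserving_neg (volume : Measure ℝ)).setLIntegral_comp_preimage_emb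
      (MeasurableEquiv.neg ℝ).measurableEmbedding (fun z => G (z ^ 2 / 2)) (Set.Ioi 0)
    simp only [neg_sq] at hn
    rw [← hn, Set.compl_Ioi]
    rw [show Neg.neg ⁻¹' Set.Ioi (0 : ℝ) = Set.Iio 0 by ext; simp]
    exact setLIntegral_congr Iio_ae_eq_Iic.symm
  have h3 : ∀ z ∈ Set.Ioi (0 : ℝ), G (z ^ 2 / 2) = ENNReal.ofReal z *
      (fun e => ENNReal.ofReal (√(2 * e))⁻¹ * G e) (z ^ 2 / 2) := by
    intro z hz
    have hz' : (0 : ℝ) < z := hz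
    simp only
    rw [show 2 * (z ^ 2 / 2) = z ^ 2 by ring, Real.sqrt_sq hz'.le, ← mul_assoc,
      ← ENNReal.ofReal_mul hz'.le, mul_inv_cancel₀ hz'.ne', ENNReal.ofReal_one, one_mul]
  rw [h2, setLIntegral_congr_fun measurableSet_Ioi h3,
    lintegral_comp_half_sq fun e => ENNReal.ofReal (√(2 * e))⁻¹ * G e,
    ← lintegral_const_mul _ (by fun_prop), Measure.restrict_restrict hs,
    ← lintegral_indicator (hs.inter measurableSet_Ioi), ← lintegral_indicator measurableSet_Ioi]
  refine lintegral_congr fun e => ?_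
  by_cases he : e ∈ s <;> by_cases he' : e ∈ Set.Ioi (0 : ℝ) <;>
    simp only [Set.indicator, hG, he, he', Set.mem_inter_iff, if_true, if_false, and_true,
      and_false, mul_zero, and_self, true_and, false_and]
  have he0 : (0 : ℝ) < e := he'
  rw [← ENNReal.ofReal_mul (by positivity), show (2 : ENNReal) = ENNReal.ofReal 2 by simp,
    ← ENNReal.ofReal_mul (by positivity)]
  congr 1
  rw [Real.sqrt_mul (by positivity), Real.sqrt_mul (by positivity)]
  have h5 : √(2 : ℝ) * √2 = 2 := Real.mul_self_sqrt (by positivity)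
  have : √(2 : ℝ) ≠ 0 := by positivity
  field_simp
  nlinarith [h5]

end Gaussian

end

noncomputable section

/-! ### The law of the corner of a randomly rotated antisymmetric matrix -/

section Compression

theorem measurable_corner {M : ℕ} :
    Measurable (corner : Matrix (Fin (M + 1)) (Fin (M + 1)) ℝ → Matrix (Fin M) (Fin M) ℝ) :=
  measurable_pi_lambda _ fun i => measurable_pi_lambda _ fun j =>
    (measurable_pi_apply (Fin.castSucc j)).comp (measurable_pi_apply (Fin.castSucc i))

theorem continuous_conj {ι : Type*} [Fintype ι] (X : Matrix ι ι ℝ) :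
    Continuous fun k : Matrix ι ι ℝ => k * X * kᵀ := by fun_prop

theorem unitVec_vecMul {ι : Type*} [Fintype ι] [DecidableEq ι] {k : Matrix ι ι ℝ}
    (hk : k ∈ Matrix.orthogonalGroup ι ℝ) (ξ : ι → ℝ) :
    unitVec (ξ ᵥ* k) = unitVec ξ ᵥ* k := by
  ext i
  simp only [unitVec, sum_sq_vecMul hk]
  simp only [Matrix.vecMul, dotProduct, Finset.sum_div]
  exact Finset.sum_congr rfl fun j _ => by simp only [unitVec]; ring

theorem unitVec_unitVec {ι : Type*} [Fintype ι] [DecidableEq ι] {ξ : ι → ℝ} (hξ : ∑ i, ξ i ^ 2 ≠ 0) :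
    unitVec (unitVec ξ) = unitVec ξ := by
  ext i
  rw [unitVec, sum_sq_unitVec hξ]; simp

theorem sum_sq_row {ι : Type*} [Fintype ι] [DecidableEq ι] {k : Matrix ι ι ℝ}
    (hk : k ∈ Matrix.orthogonalGroup ι ℝ) (j : ι) : ∑ i, k j i ^ 2 = 1 := by
  have := congrFun (congrFun (orthogonal_mul_transpose hk) j) j
  rw [Matrix.mul_apply] at this
  simpa [sq] using this

variable {M m : ℕ} {b : ℕ → ℝ} {c : Fin (M + 1) → Fin (m + 1)} {p : Fin (m + 1) → ℝ}

theorem integral_corner_eq_gauss (hd : CornerData M m b c p) {Ψ : Matrix (Fin M) (Fin M) ℝ → ℂ}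
    (hΨm : Measurable Ψ) {C : ℝ} (hΨb : ∀ X, ‖Ψ X‖ ≤ C)
    (hΨ : ∀ X : Matrix (Fin M) (Fin M) ℝ, Xᵀ = -X →
      ∀ k ∈ Matrix.orthogonalGroup (Fin M) ℝ, Ψ (k * X * kᵀ) = Ψ X) :
    ∫ k, Ψ (corner (k.1 * Dcan (M + 1) b * k.1ᵀ)) ∂(haarO (Fin (M + 1))) =
      ∫ ξ, Ψ (corner (householder (Fin.last M) ξ * Dcan (M + 1) b *
        (householder (Fin.last M) ξ)ᵀ)) ∂(stdGauss (Fin (M + 1))) := by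
  set D := Dcan (M + 1) b
  set q : (Fin (M + 1) → ℝ) → ℂ := fun ξ =>
    Ψ (corner (householder (Fin.last M) ξ * D * (householder (Fin.last M) ξ)ᵀ)) with hq
  have hqm : Measurable q := hΨm.comp (measurable_corner.comp
    ((continuous_conj D).measurable.comp (measurable_householder _)))
  have hqu : ∀ ξ ξ', unitVec ξ = unitVec ξ' → q ξ = q ξ' := by
    intro ξ ξ' h
    simp only [hq, householder, h]
  have hA : ∀ k : Matrix.orthogonalGroup (Fin (M + 1)) ℝ,
      Ψ (corner (k.1 * D * k.1ᵀ)) = q (k.1 (Fin.last M)) := by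
    intro k
    refine hd.eq_of_weights hΨ k.2 (householder_mem _ _) fun l => ?_
    have h1 := sum_sq_row k.2 (Fin.last M)
    rw [householder_apply _ (by rw [h1]; exact one_ne_zero)]
    have : unitVec (k.1 (Fin.last M)) = k.1 (Fin.last M) := by
      ext i; rw [unitVec, h1]; simp
    rw [this]
  simp only [hA]
  have hrow : ∀ (k k' : Matrix (Fin (M + 1)) (Fin (M + 1)) ℝ), (k * k') (Fin.last M) =
      k (Fin.last M) ᵥ* k' := fun k k' => rfl
  have hC : ∀ ξ : Fin (M + 1) → ℝ, ∑ i, ξ i ^ 2 ≠ 0 →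
      ∫ k, q (k.1 (Fin.last M)) ∂(haarO (Fin (M + 1))) =
        ∫ k, q (ξ ᵥ* k.1) ∂(haarO (Fin (M + 1))) := by
    intro ξ hξ
    rw [← integral_mul_left_eq_self (μ := haarO (Fin (M + 1))) _
      (⟨householder (Fin.last M) ξ, householder_mem _ _⟩ : Matrix.orthogonalGroup (Fin (M + 1)) ℝ)]
    refine integral_congr_ae (Filter.Eventually.of_forall fun k => ?_)
    refine hqu _ _ ?_
    have : ((⟨householder (Fin.last M) ξ, householder_mem _ _⟩ :
        Matrix.orthogonalGroup (Fin (M + 1)) ℝ) * k).1 (Fin.last M) = unitVec ξ ᵥ* k.1 := by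
      rw [← householder_apply (Fin.last M) hξ]; rfl
    rw [this, unitVec_vecMul k.2, unitVec_vecMul k.2, unitVec_unitVec hξ]
  have hmeas2 : Measurable fun z : (Fin (M + 1) → ℝ) × Matrix.orthogonalGroup (Fin (M + 1)) ℝ =>
      z.1 ᵥ* z.2.1 := by
    have : Continuous fun z : (Fin (M + 1) → ℝ) × Matrix.orthogonalGroup (Fin (M + 1)) ℝ =>
      z.1 ᵥ* z.2.1 := by fun_prop
    exact this.measurable
  have hswap : ∫ ξ, ∫ k, q (ξ ᵥ* k.1) ∂(haarO (Fin (M + 1))) ∂(stdGauss (Fin (M + 1))) =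
      ∫ k, ∫ ξ, q (ξ ᵥ* k.1) ∂(stdGauss (Fin (M + 1))) ∂(haarO (Fin (M + 1))) :=
    integral_integral_swap (Integrable.of_bound (hqm.comp hmeas2).aestronglyMeasurable C
      (Filter.Eventually.of_forall fun z => hΨb _))
  have hinv : ∀ k : Matrix.orthogonalGroup (Fin (M + 1)) ℝ,
      ∫ ξ, q (ξ ᵥ* k.1) ∂(stdGauss (Fin (M + 1))) = ∫ ξ, q ξ ∂(stdGauss (Fin (M + 1))) := by
    intro k
    have h := map_vecMul_stdGauss k.2
    conv_rhs => rw [← h.map_eq]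
    rw [integral_map h.measurable.aemeasurable hqm.aestronglyMeasurable]
  have hfin : ∫ ξ, ∫ k, q (ξ ᵥ* k.1) ∂(haarO (Fin (M + 1))) ∂(stdGauss (Fin (M + 1))) =
      ∫ _ξ, ∫ k, q (k.1 (Fin.last M)) ∂(haarO (Fin (M + 1))) ∂(stdGauss (Fin (M + 1))) := by
    refine integral_congr_ae ?_
    filter_upwards [stdGauss_ae_ne_zero] with ξ hξ
    exact (hC ξ hξ).symm
  rw [hswap] at hfin
  simp only [hinv, integral_const, probReal_univ, one_smul] at hfin
  exact hfin.symm

theorem integral_corner (hd : CornerData M m b c p) (i0 : Fin (m + 1) → Fin (M + 1))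
    (hi0 : ∀ l, c (i0 l) = l) {ρ : Fin (m + 1) → ℝ → ℝ} (hρm : ∀ l, Measurable (ρ l))
    (hρ : ∀ l e, 0 ≤ ρ l e)
    (hlaw : Measure.map (fun (ξ : Fin (M + 1) → ℝ) l => ∑ i with c i = l, ξ i ^ 2 / 2)
      (stdGauss (Fin (M + 1))) = (volume.restrict {e : Fin (m + 1) → ℝ | ∀ i, 0 < e i}).withDensity
        fun e => ENNReal.ofReal (∏ l, ρ l (e l)))
    {Ψ : Matrix (Fin M) (Fin M) ℝ → ℂ}
    (hΨm : Measurable Ψ) {C : ℝ} (hΨb : ∀ X, ‖Ψ X‖ ≤ C)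
    (hΨ : ∀ X : Matrix (Fin M) (Fin M) ℝ, Xᵀ = -X →
      ∀ k ∈ Matrix.orthogonalGroup (Fin M) ℝ, Ψ (k * X * kᵀ) = Ψ X) :
    ∫ k, Ψ (corner (k.1 * Dcan (M + 1) b * k.1ᵀ)) ∂(haarO (Fin (M + 1))) =
      ∫ q in daDomain p, ((q 0 ^ m * (vdm (Fin.tail q) / vdm p)) * ∏ l, ρ l (daMap p q l)) •
        Ψ (Dcan M (rootExt (Fin.tail q))) := by
  rw [integral_corner_eq_gauss hd hΨm hΨb hΨ]
  set D := Dcan (M + 1) b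
  set q : (Fin (M + 1) → ℝ) → ℂ := fun ξ =>
    Ψ (corner (householder (Fin.last M) ξ * D * (householder (Fin.last M) ξ)ᵀ)) with hq
  have hqm : Measurable q := hΨm.comp (measurable_corner.comp
    ((continuous_conj D).measurable.comp (measurable_householder _)))
  set sec : (Fin (m + 1) → ℝ) → Fin (M + 1) → ℝ := fun e i =>
    if i = i0 (c i) then √(2 * e (c i)) else 0 with hsec
  have hsecm : Measurable sec := measurable_pi_lambda _ fun i => by
    by_cases h : i = i0 (c i)
    · simp only [hsec, if_pos h]; fun_prop
    · simp only [hsec, if_neg h]; fun_prop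
  have hsecw : ∀ e : Fin (m + 1) → ℝ, (∀ l, 0 ≤ e l) → ∀ l, ∑ i with c i = l, sec e i ^ 2 =
      2 * e l := by
    intro e he l
    rw [Finset.sum_eq_single (i0 l)]
    · simp only [hsec, hi0, if_true]
      rw [Real.sq_sqrt (by have := he l; positivity)]
    · intro i hi hne
      have hc := (Finset.mem_filter.1 hi).2
      simp only [hsec]
      rw [if_neg (by rw [hc]; exact hne)]; simp
    · intro h; exact absurd (Finset.mem_filter.2 ⟨Finset.mem_univ (i0 l), hi0 l⟩) h
  have htot : ∀ ξ : Fin (M + 1) → ℝ, ∑ i, ξ i ^ 2 = ∑ l, ∑ i with c i = l, ξ i ^ 2 := fun ξ =>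
    (Finset.sum_fiberwise _ c _).symm
  have hw : ∀ ξ : Fin (M + 1) → ℝ, ∑ i, ξ i ^ 2 ≠ 0 → ∀ l, ∑ i with c i = l,
      (householder (Fin.last M) ξ) (Fin.last M) i ^ 2 =
        (∑ i with c i = l, ξ i ^ 2) / ∑ i, ξ i ^ 2 := by
    intro ξ hξ l
    rw [householder_apply _ hξ, Finset.sum_div]
    refine Finset.sum_congr rfl fun i _ => ?_
    rw [unitVec, div_pow, Real.sq_sqrt (Finset.sum_nonneg fun i _ => sq_nonneg _)]
  set en : (Fin (M + 1) → ℝ) → Fin (m + 1) → ℝ := fun ξ l => ∑ i with c i = l, ξ i ^ 2 / 2 with hen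
  have henm : Measurable en := by simp only [hen]; fun_prop
  have hqe : ∀ ξ : Fin (M + 1) → ℝ, ∑ i, ξ i ^ 2 ≠ 0 → q ξ = q (sec (en ξ)) := by
    intro ξ hξ
    have h1 : ∀ l, ∑ i with c i = l, sec (en ξ) i ^ 2 = ∑ i with c i = l, ξ i ^ 2 := fun l => by
      rw [hsecw (en ξ) (fun l => Finset.sum_nonneg fun i _ => by positivity)]
      simp only [hen]
      rw [← Finset.sum_div]; ring
    have h2 : ∑ i, sec (en ξ) i ^ 2 = ∑ i, ξ i ^ 2 := by rw [htot, htot ξ]; simp only [h1]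
    refine hd.eq_of_weights hΨ (householder_mem _ _) (householder_mem _ _) fun l => ?_
    rw [hw _ hξ, hw _ (by rw [h2]; exact hξ), h1, h2]
  have h1 : ∫ ξ, q ξ ∂(stdGauss (Fin (M + 1))) =
      ∫ ξ, q (sec (en ξ)) ∂(stdGauss (Fin (M + 1))) := by
    refine integral_congr_ae ?_
    filter_upwards [stdGauss_ae_ne_zero] with ξ hξ using hqe ξ hξ
  have hFm : Measurable fun e => q (sec e) := hqm.comp hsecm
  have hρm' : Measurable fun e : Fin (m + 1) → ℝ => ∏ l, ρ l (e l) :=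
    Finset.measurable_prod _ fun l _ => (hρm l).comp (measurable_pi_apply l)
  have htail : Measurable fun q : Fin (m + 1) → ℝ => vdm (Fin.tail q) :=
    measurable_vdm.comp (by unfold Fin.tail; fun_prop)
  have hFρ : Measurable fun e => (ENNReal.ofReal (∏ l, ρ l (e l))).toReal • q (sec e) :=
    hρm'.ennreal_ofReal.ennreal_toReal.smul hFm
  rw [h1, ← integral_map (φ := en) (f := fun e => q (sec e)) henm.aemeasurable
    hFm.aestronglyMeasurable, hlaw, ← map_daMap hd.mono,
    integral_withDensity_eq_integral_toReal_smul hρm'.ennreal_ofReal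
      (Filter.Eventually.of_forall fun _ => ENNReal.ofReal_lt_top),
    integral_map (continuous_daMap p).measurable.aemeasurable
      hFρ.aestronglyMeasurable,
    integral_withDensity_eq_integral_toReal_smul (by fun_prop)
      (Filter.Eventually.of_forall fun _ => ENNReal.ofReal_lt_top)]
  refine setIntegral_congr_fun (measurableSet_daDomain p) fun r hr => ?_
  have hty : StrictMono (Fin.tail r) := strictMono_of_mem_interlaceBox hd.mono hr.2
  have hJ : 0 ≤ r 0 ^ m * (vdm (Fin.tail r) / vdm p) :=
    mul_nonneg (pow_nonneg hr.1.le _) (div_nonneg (vdm_pos hty).le (vdm_pos hd.mono).le)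
  rw [ENNReal.toReal_ofReal hJ, ENNReal.toReal_ofReal (Finset.prod_nonneg fun l _ => hρ l _),
    smul_smul]
  congr 1
  have he : ∀ l, 0 ≤ daMap p r l := fun l => (daMap_pos hd.mono hr l).le
  have hsum : ∑ i, sec (daMap p r) i ^ 2 = 2 * r 0 := by
    rw [htot]; simp only [hsecw _ he, ← Finset.mul_sum, daMap_sum hd.mono]
  refine hd.eq_of_prod hΨ (householder_mem _ _) hty.monotone fun z hz => ?_
  have hr0 := hr.1
  rw [sum_div_fiber]
  simp only [hw (sec (daMap p r)) (by rw [hsum]; positivity), hsecw _ he, hsum]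
  have hev := daMap_eval hd.mono r (-z ^ 2)
  have hneg : ∀ f : Fin m → ℝ, ∏ k, (-z ^ 2 - f k) = (-1) ^ m * ∏ k, (z ^ 2 + f k) := fun f => by
    have : ∀ k, -z ^ 2 - f k = (-1) * (z ^ 2 + f k) := fun k => by ring
    simp only [this, Finset.prod_mul_distrib]; simp
  have hev' : ∑ i, daMap p r i * ∏ k : Fin m, (z ^ 2 + p (i.succAbove k)) =
      r 0 * ∏ k : Fin m, (z ^ 2 + r k.succ) := by
    have h3 : ∀ i : Fin (m + 1), ∏ k : Fin m, (-z ^ 2 - p (i.succAbove k)) =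
        (-1) ^ m * ∏ k : Fin m, (z ^ 2 + p (i.succAbove k)) := fun i =>
      hneg fun k => p (i.succAbove k)
    rw [hneg fun k => r k.succ] at hev
    simp only [h3] at hev
    have h4 : ((-1 : ℝ) ^ m) ≠ 0 := pow_ne_zero _ (by norm_num)
    apply mul_left_cancel₀ h4
    rw [Finset.mul_sum]
    rw [show (-1 : ℝ) ^ m * (r 0 * ∏ k : Fin m, (z ^ 2 + r k.succ)) =
      r 0 * ((-1) ^ m * ∏ k : Fin m, (z ^ 2 + r k.succ)) by ring, ← hev]
    exact Finset.sum_congr rfl fun i _ => by ring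
  have hstep : ∏ l, (z ^ 2 + Fin.tail r l) = (r 0)⁻¹ *
      ∑ i, daMap p r i * ∏ k : Fin m, (z ^ 2 + p (i.succAbove k)) := by
    rw [hev', ← mul_assoc, inv_mul_cancel₀ hr0.ne', one_mul]; rfl
  rw [hstep, Finset.mul_sum, Finset.mul_sum]
  refine Finset.sum_congr rfl fun l _ => ?_
  have hzl : z ^ 2 + p l ≠ 0 := by have := hd.nonneg l; positivity
  rw [Fin.prod_univ_succAbove (fun l => z ^ 2 + p l) l]
  field_simp

theorem integral_daDomain_mul (p : Fin (m + 1) → ℝ) (f : ℝ → ℝ) (g : (Fin m → ℝ) → ℂ) :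
    ∫ q in daDomain p, f (q 0) • g (Fin.tail q) =
      (∫ r in Set.Ioi (0 : ℝ), f r) • ∫ y in interlaceBox p, g y := by
  have h := (volume_preserving_piFinSuccAbove (fun _ : Fin (m + 1) => ℝ) 0)
  have hs : daDomain p = (MeasurableEquiv.piFinSuccAbove (fun _ : Fin (m + 1) => ℝ) 0) ⁻¹'
      (Set.Ioi (0 : ℝ) ×ˢ interlaceBox p) := by
    ext q; simp [daDomain, MeasurableEquiv.piFinSuccAbove]
  have h2 := h.setIntegral_preimage_emb (MeasurableEquiv.measurableEmbedding _)
    (fun z : ℝ × (Fin m → ℝ) => f z.1 • g z.2) (Set.Ioi (0 : ℝ) ×ˢ interlaceBox p)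
  rw [← hs] at h2
  have h3 : ∫ q in daDomain p, f (q 0) • g (Fin.tail q) = ∫ z in Set.Ioi (0 : ℝ) ×ˢ interlaceBox p,
      f z.1 • g z.2 ∂((volume : Measure ℝ).prod (volume : Measure (Fin m → ℝ))) := h2
  rw [h3, ← Measure.prod_restrict]
  exact integral_prod_smul _ _

open ProbabilityTheory in
theorem map_energy_stdGauss (c : Fin (M + 1) → Fin (m + 1)) (t : Fin (M + 1) → Bool)
    (hct : Function.Injective fun i => (c i, t i)) {T : Fin (m + 1) → ℝ × ℝ → ℝ}
    (hTm : ∀ l, Measurable (T l))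
    (hT : ∀ (η : Fin (m + 1) → ℝ × ℝ) l, ∑ i with c i = l,
      (if t i then (η (c i)).2 else (η (c i)).1) ^ 2 / 2 = T l (η l))
    {ρ : Fin (m + 1) → ℝ → ℝ} (hρm : ∀ l, Measurable (ρ l)) (hρ0 : ∀ l e, 0 ≤ ρ l e)
    (hρ : ∀ l, Measure.map (T l) ((gaussianReal 0 1).prod (gaussianReal 0 1)) =
      (volume.restrict (Set.Ioi 0)).withDensity fun e => ENNReal.ofReal (ρ l e)) :
    Measure.map (fun (ξ : Fin (M + 1) → ℝ) l => ∑ i with c i = l, ξ i ^ 2 / 2)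
      (stdGauss (Fin (M + 1))) = (volume.restrict {e : Fin (m + 1) → ℝ | ∀ i, 0 < e i}).withDensity
        fun e => ENNReal.ofReal (∏ l, ρ l (e l)) := by
  have hsel : Measurable (fun (η : Fin (m + 1) → ℝ × ℝ) i =>
      if t i then (η (c i)).2 else (η (c i)).1) := by
    refine measurable_pi_lambda _ fun i => ?_
    cases t i <;> simp <;> fun_prop
  rw [stdGauss, ← map_select_pi c t hct, Measure.map_map (by fun_prop) hsel]
  have hcomp : ((fun (ξ : Fin (M + 1) → ℝ) l => ∑ i with c i = l, ξ i ^ 2 / 2) ∘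
      fun (η : Fin (m + 1) → ℝ × ℝ) i => if t i then (η (c i)).2 else (η (c i)).1) =
      fun η l => T l (η l) := by
    ext η l; exact hT η l
  have hint : ∀ l, Integrable (ρ l) (volume.restrict (Set.Ioi 0)) := by
    intro l
    refine ⟨(hρm l).aestronglyMeasurable, ?_⟩
    rw [hasFiniteIntegral_iff_ofReal (Filter.Eventually.of_forall (hρ0 l))]
    have h1 := congrArg (fun μ => μ Set.univ) (hρ l)
    simp only [withDensity_apply _ MeasurableSet.univ, Measure.restrict_univ] at h1
    rw [← h1, Measure.map_apply (hTm l) MeasurableSet.univ]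
    exact measure_lt_top _ _
  haveI : ∀ l, SigmaFinite (((gaussianReal 0 1).prod (gaussianReal 0 1)).map (T l)) := fun l => by
    haveI := Measure.isProbabilityMeasure_map (μ := (gaussianReal 0 1).prod (gaussianReal 0 1))
      (hTm l).aemeasurable
    infer_instance
  have hr : (volume : Measure (Fin (m + 1) → ℝ)).restrict {e : Fin (m + 1) → ℝ | ∀ i, 0 < e i} =
      Measure.pi fun _ => volume.restrict (Set.Ioi (0 : ℝ)) := by
    rw [← Measure.restrict_pi_pi, ← volume_pi]
    congr 1; ext e; simp
  rw [hcomp, Measure.pi_map_pi fun l => (hTm l).aemeasurable]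
  simp only [hρ]
  rw [pi_withDensity (fun _ : Fin (m + 1) => volume.restrict (Set.Ioi (0 : ℝ))) ρ hρm hρ0 hint, hr]

/-- The corner of a uniformly rotated even-dimensional antisymmetric matrix. -/
theorem integral_corner_even {x : Fin (m + 1) → ℝ} (hx : StrictMono x) (hx0 : ∀ l, 0 ≤ x l)
    {Ψ : Matrix (Fin (2 * m + 1)) (Fin (2 * m + 1)) ℝ → ℂ}
    (hΨm : Measurable Ψ) {C : ℝ} (hΨb : ∀ X, ‖Ψ X‖ ≤ C)
    (hΨ : ∀ X : Matrix (Fin (2 * m + 1)) (Fin (2 * m + 1)) ℝ, Xᵀ = -X →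
      ∀ k ∈ Matrix.orthogonalGroup (Fin (2 * m + 1)) ℝ, Ψ (k * X * kᵀ) = Ψ X) :
    ∫ k, Ψ (corner (k.1 * Dcan (2 * m + 1 + 1) (rootExt x) * k.1ᵀ))
        ∂(haarO (Fin (2 * m + 1 + 1))) =
      ((m.factorial : ℝ) / vdm x) • ∫ y in interlaceBox x,
        (vdm y) • Ψ (Dcan (2 * m + 1) (rootExt y)) := by
  have hd := cornerData_even hx hx0
  have hlaw := map_energy_stdGauss (M := 2 * m + 1) (m := m) (fun i => ⟨i.val / 2, by omega⟩)
    (fun i => i.val % 2 = 1)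
    (by
      intro i j hij
      simp only [Prod.mk.injEq, Fin.mk.injEq, decide_eq_decide] at hij
      ext; omega)
    (T := fun _ z => (z.1 ^ 2 + z.2 ^ 2) / 2) (fun _ => by fun_prop)
    (by
      intro η l
      have hf : (Finset.univ.filter fun i : Fin (2 * m + 1 + 1) =>
          (⟨i.val / 2, by omega⟩ : Fin (m + 1)) = l) =
          {⟨2 * l.val, by omega⟩, ⟨2 * l.val + 1, by omega⟩} := by
        ext i
        simp only [Finset.mem_filter, Finset.mem_univ, true_and, Finset.mem_insert,
          Finset.mem_singleton, Fin.ext_iff]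
        omega
      rw [hf, Finset.sum_pair (by simp [Fin.ext_iff])]
      have e1 : (⟨2 * l.val / 2, by omega⟩ : Fin (m + 1)) = l := by ext; simp
      have e2 : (⟨(2 * l.val + 1) / 2, by omega⟩ : Fin (m + 1)) = l := by ext; simp; omega
      simp only [e1, e2]
      have e3 : ¬ (2 * l.val) % 2 = 1 := by omega
      have e4 : (2 * l.val + 1) % 2 = 1 := by omega
      simp only [e3, e4, decide_true, decide_false, if_true]
      simp; ring)
    (ρ := fun _ e => Real.exp (-e)) (fun _ => by fun_prop) (fun _ e => (Real.exp_pos _).le)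
    (fun _ => map_half_sq_add_sq)
  rw [integral_corner hd (fun l => ⟨2 * l.val, by omega⟩) (fun l => by ext; simp)
    (fun _ => by fun_prop) (fun _ e => (Real.exp_pos _).le) hlaw hΨm hΨb hΨ]
  have h1 := integral_daDomain_mul x (fun r => r ^ m * Real.exp (-r))
    (fun y => (vdm y / vdm x) • Ψ (Dcan (2 * m + 1) (rootExt y)))
  have h2 : ∫ r in Set.Ioi (0 : ℝ), r ^ m * Real.exp (-r) = (m.factorial : ℝ) := by
    rw [← Real.Gamma_nat_eq_factorial, Real.Gamma_eq_integral (by positivity)]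
    refine setIntegral_congr_fun measurableSet_Ioi fun r hr => ?_
    simp only [add_sub_cancel_right, Real.rpow_natCast]; ring
  rw [h2] at h1
  have h3 : ∀ y : Fin m → ℝ, (vdm y / vdm x) • Ψ (Dcan (2 * m + 1) (rootExt y)) =
      (vdm x)⁻¹ • (vdm y • Ψ (Dcan (2 * m + 1) (rootExt y))) := fun y => by
    rw [smul_smul]; congr 1; ring
  simp only [h3] at h1
  rw [integral_smul, smul_smul, ← div_eq_mul_inv] at h1
  rw [← h1]
  refine setIntegral_congr_fun (measurableSet_daDomain x) fun r hr => ?_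
  rw [← Real.exp_sum, Finset.sum_neg_distrib, daMap_sum hx, smul_smul, smul_smul]
  congr 1; ring

/-- The corner of a uniformly rotated odd-dimensional antisymmetric matrix. -/
theorem integral_corner_odd {x : Fin m → ℝ} (hx : StrictMono x) (hx0 : ∀ l, 0 < x l)
    {Ψ : Matrix (Fin (2 * m)) (Fin (2 * m)) ℝ → ℂ}
    (hΨm : Measurable Ψ) {C : ℝ} (hΨb : ∀ X, ‖Ψ X‖ ≤ C)
    (hΨ : ∀ X : Matrix (Fin (2 * m)) (Fin (2 * m)) ℝ, Xᵀ = -X →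
      ∀ k ∈ Matrix.orthogonalGroup (Fin (2 * m)) ℝ, Ψ (k * X * kᵀ) = Ψ X) :
    ∫ k, Ψ (corner (k.1 * Dcan (2 * m + 1) (rootExt x) * k.1ᵀ))
        ∂(haarO (Fin (2 * m + 1))) =
      (Real.Gamma (m + 1 / 2) / √Real.pi / (vdm x * ∏ l, √(x l))) •
        ∫ y in interlaceBox (Fin.cons 0 x),
          (vdm y * ∏ l, (√(y l))⁻¹) • Ψ (Dcan (2 * m) (rootExt y)) := by
  have hd := cornerData_odd hx hx0
  set p : Fin (m + 1) → ℝ := Fin.cons 0 x with hp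
  set c : Fin (2 * m + 1) → Fin (m + 1) := fun i => if h : i.val = 2 * m then 0 else
    ⟨i.val / 2 + 1, by have := i.isLt; omega⟩ with hc
  set ρ : Fin (m + 1) → ℝ → ℝ := fun l e => if l = 0 then (√Real.pi)⁻¹ * (√e)⁻¹ * Real.exp (-e)
    else Real.exp (-e) with hρ
  have hρm : ∀ l, Measurable (ρ l) := fun l => by
    by_cases h : l = 0
    · simp only [hρ, if_pos h]; fun_prop
    · simp only [hρ, if_neg h]; fun_prop
  have hρ0 : ∀ l e, 0 ≤ ρ l e := fun l e => by
    by_cases h : l = 0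
    · simp only [hρ, if_pos h]; positivity
    · simp only [hρ, if_neg h]; positivity
  have hlaw := map_energy_stdGauss (M := 2 * m) (m := m) c (fun i => i.val % 2 = 1)
    (by
      intro i j hij
      simp only [Prod.mk.injEq, decide_eq_decide, hc] at hij
      ext
      by_cases h1 : i.val = 2 * m <;> by_cases h2 : j.val = 2 * m <;>
        simp [h1, h2, Fin.ext_iff] at hij <;> omega)
    (T := fun l z => if l = 0 then z.1 ^ 2 / 2 else (z.1 ^ 2 + z.2 ^ 2) / 2)
    (fun l => by by_cases h : l = 0 <;> simp only [h, if_true, if_false] <;> fun_prop)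
    (by
      intro η l
      refine Fin.cases ?_ (fun l => ?_) l
      · have hf : (Finset.univ.filter fun i : Fin (2 * m + 1) => c i = 0) = {Fin.last (2 * m)} := by
          ext i
          simp only [Finset.mem_filter, Finset.mem_univ, true_and, Finset.mem_singleton,
            Fin.ext_iff, hc, Fin.val_last]
          by_cases h : i.val = 2 * m <;> simp [h]
        rw [hf, Finset.sum_singleton]
        simp [hc]
      · have hf : (Finset.univ.filter fun i : Fin (2 * m + 1) => c i = l.succ) =
            {⟨2 * l.val, by omega⟩, ⟨2 * l.val + 1, by omega⟩} := by
          ext i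
          simp only [Finset.mem_filter, Finset.mem_univ, true_and, Finset.mem_insert,
            Finset.mem_singleton, Fin.ext_iff, hc]
          by_cases h : i.val = 2 * m
          · simp [h]; omega
          · simp [h]; omega
        rw [hf, Finset.sum_pair (by simp [Fin.ext_iff])]
        have e1 : c ⟨2 * l.val, by omega⟩ = l.succ := by
          simp only [hc]; rw [dif_neg (by omega)]; ext; simp
        have e2 : c ⟨2 * l.val + 1, by omega⟩ = l.succ := by
          simp only [hc]; rw [dif_neg (by omega)]; ext; simp; omega
        simp only [e1, e2]
        have e3 : ¬ (2 * l.val) % 2 = 1 := by omega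
        have e4 : (2 * l.val + 1) % 2 = 1 := by omega
        simp only [e3, e4, decide_true, decide_false, if_true, Fin.succ_ne_zero, if_false]
        simp; ring)
    hρm hρ0
    (fun l => by
      by_cases h : l = 0
      · simp only [h, hρ, if_true]; exact map_half_sq
      · simp only [h, hρ, if_false]; exact map_half_sq_add_sq)
  rw [integral_corner hd (fun l => if h : l = 0 then Fin.last _ else ⟨2 * (l.val - 1), by omega⟩)
    (fun l => by
      by_cases h : l = 0
      · simp [h, hc]
      · have : l.val ≠ 0 := fun h' => h (Fin.ext h')
        rw [dif_neg h]
        simp only [hc]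
        rw [dif_neg (by omega)]; ext; simp; omega) hρm hρ0 hlaw hΨm hΨb hΨ]
  have h1 := integral_daDomain_mul p (fun r => r ^ m * (√r)⁻¹ * Real.exp (-r))
    (fun y => (vdm y / vdm p * ((√Real.pi)⁻¹ * (∏ l, √(x l)) * ∏ l, (√(y l))⁻¹)) •
      Ψ (Dcan (2 * m) (rootExt y)))
  have h2 : ∫ r in Set.Ioi (0 : ℝ), r ^ m * (√r)⁻¹ * Real.exp (-r) = Real.Gamma (m + 1 / 2) := by
    rw [Real.Gamma_eq_integral (by positivity)]
    refine setIntegral_congr_fun measurableSet_Ioi fun r hr => ?_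
    have hr' : (0 : ℝ) < r := hr
    rw [show (m : ℝ) + 1 / 2 - 1 = m - 1 / 2 by ring, Real.rpow_sub hr', Real.rpow_natCast,
      Real.sqrt_eq_rpow]
    ring
  rw [h2] at h1
  have hvp : vdm p = vdm x * (∏ l, √(x l)) * ∏ l, √(x l) := by
    have e0 : vdm p = (∏ l, x l) * vdm x := by
      rw [vdm_eq_det, vdm_eq_det, Matrix.det_vandermonde, Matrix.det_vandermonde,
        Fin.prod_univ_succ]
      congr 1
      · simp only [Fin.Ioi_zero_eq_map, Finset.prod_map]
        simp [hp]
      · refine Finset.prod_congr rfl fun i _ => ?_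
        simp only [Fin.Ioi_succ, Finset.prod_map]
        simp [hp]
    rw [e0, mul_assoc, ← Finset.prod_mul_distrib]
    simp only [Real.mul_self_sqrt (hx0 _).le]
    ring
  have hX : ∏ l, √(x l) ≠ 0 := Finset.prod_ne_zero_iff.2 fun l _ => (Real.sqrt_pos.2 (hx0 l)).ne'
  have hvx := (vdm_pos hx).ne'
  have h3 : ∀ y : Fin m → ℝ, (vdm y / vdm p * ((√Real.pi)⁻¹ * (∏ l, √(x l)) * ∏ l, (√(y l))⁻¹)) •
      Ψ (Dcan (2 * m) (rootExt y)) = ((√Real.pi)⁻¹ * (vdm x * ∏ l, √(x l))⁻¹) •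
      ((vdm y * ∏ l, (√(y l))⁻¹) • Ψ (Dcan (2 * m) (rootExt y))) := fun y => by
    rw [smul_smul]; congr 1; rw [hvp]; field_simp
  simp only [h3] at h1
  rw [integral_smul, smul_smul, ← mul_assoc, ← div_eq_mul_inv, ← div_eq_mul_inv] at h1
  rw [div_eq_mul_inv (Real.Gamma _) (√Real.pi), ← h1]
  refine setIntegral_congr_fun (measurableSet_daDomain p) fun r hr => ?_
  have hr0 : 0 < r 0 := hr.1
  have hy0 : ∀ l : Fin m, 0 < r l.succ := fun l =>
    lt_of_le_of_lt (hd.nonneg l.castSucc) ((mem_interlaceBox.1 hr.2) l).1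
  have hρprod : ∏ l, ρ l (daMap p r l) = (√Real.pi)⁻¹ * (√(daMap p r 0))⁻¹ * Real.exp (-r 0) := by
    rw [Fin.prod_univ_succ]
    simp only [hρ, if_true, Fin.succ_ne_zero, if_false]
    rw [← Real.exp_sum, mul_assoc, ← Real.exp_add, Finset.sum_neg_distrib, ← neg_add,
      ← Fin.sum_univ_succ (daMap p r), daMap_sum hd.mono]
  have hd0 : daMap p r 0 = r 0 * (∏ l : Fin m, r l.succ) / ∏ l, x l := by
    have e1 : ∀ l : Fin m, p 0 - r l.succ = -r l.succ := fun l => by simp [hp]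
    have e2 : ∀ l : Fin m, p 0 - p (Fin.succAbove 0 l) = -x l := fun l => by simp [hp]
    rw [daMap]
    simp only [e1, e2, neg_div_neg_eq, Finset.prod_div_distrib]
    ring
  have hsq : √(daMap p r 0) = √(r 0) * (∏ l : Fin m, √(r l.succ)) / ∏ l, √(x l) := by
    have e1 : ∏ l, x l = (∏ l, √(x l)) ^ 2 := by
      rw [← Finset.prod_pow]
      exact Finset.prod_congr rfl fun l _ => (Real.sq_sqrt (hx0 l).le).symm
    have e2 : ∏ l : Fin m, r l.succ = (∏ l : Fin m, √(r l.succ)) ^ 2 := by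
      rw [← Finset.prod_pow]
      exact Finset.prod_congr rfl fun l _ => (Real.sq_sqrt (hy0 l).le).symm
    have e3 : daMap p r 0 = (√(r 0) * (∏ l : Fin m, √(r l.succ)) / ∏ l, √(x l)) ^ 2 := by
      rw [hd0, e1, e2, div_pow, mul_pow, Real.sq_sqrt hr0.le]
    rw [e3, Real.sqrt_sq]
    have : 0 ≤ ∏ l : Fin m, √(r l.succ) := Finset.prod_nonneg fun l _ => Real.sqrt_nonneg _
    have : 0 ≤ ∏ l : Fin m, √(x l) := Finset.prod_nonneg fun l _ => Real.sqrt_nonneg _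
    positivity
  have h3' := h3 (Fin.tail r)
  rw [div_eq_mul_inv (√Real.pi)⁻¹, ← h3', hρprod, hsq, smul_smul]
  congr 1
  have e5 : ∏ l, (√(Fin.tail r l))⁻¹ = (∏ l : Fin m, √(r l.succ))⁻¹ := by
    rw [Finset.prod_inv_distrib]; rfl
  rw [e5]
  have hY : ∏ l : Fin m, √(r l.succ) ≠ 0 :=
    Finset.prod_ne_zero_iff.2 fun l _ => (Real.sqrt_pos.2 (hy0 l)).ne'
  rw [inv_div]
  field_simp

end Compression

end

noncomputable section

/-! ### Orbit averages -/

section OrbitAverage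

variable {N : ℕ}

/-- The average of a function over the conjugation orbit of a matrix under the orthogonal group. -/
def orbAvg (f : Matrix (Fin N) (Fin N) ℝ → ℂ) (X : Matrix (Fin N) (Fin N) ℝ) : ℂ :=
  ∫ k, f (k.1 * X * k.1ᵀ) ∂(haarO (Fin N))

theorem continuous_conj_prod : Continuous
    fun z : Matrix (Fin N) (Fin N) ℝ × Matrix.orthogonalGroup (Fin N) ℝ => z.2.1 * z.1 * z.2.1ᵀ := by
  fun_prop

theorem measurable_orbAvg {f : Matrix (Fin N) (Fin N) ℝ → ℂ} (hf : Measurable f) :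
    Measurable (orbAvg f) := by
  have h : StronglyMeasurable fun z : Matrix (Fin N) (Fin N) ℝ × Matrix.orthogonalGroup (Fin N) ℝ =>
      f (z.2.1 * z.1 * z.2.1ᵀ) := (hf.comp continuous_conj_prod.measurable).stronglyMeasurable
  exact h.integral_prod_right.measurable

theorem norm_orbAvg_le {f : Matrix (Fin N) (Fin N) ℝ → ℂ} {C : ℝ} (hC : ∀ X, ‖f X‖ ≤ C)
    (X : Matrix (Fin N) (Fin N) ℝ) : ‖orbAvg f X‖ ≤ C := by
  have := norm_integral_le_of_norm_le_const (μ := haarO (Fin N))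
    (f := fun k => f (k.1 * X * k.1ᵀ)) (C := C) (Filter.Eventually.of_forall fun k => hC _)
  simpa [orbAvg] using this

theorem orbAvg_conj (f : Matrix (Fin N) (Fin N) ℝ → ℂ) (X : Matrix (Fin N) (Fin N) ℝ)
    {k : Matrix (Fin N) (Fin N) ℝ} (hk : k ∈ Matrix.orthogonalGroup (Fin N) ℝ) :
    orbAvg f (k * X * kᵀ) = orbAvg f X := by
  rw [orbAvg, orbAvg]
  conv_rhs => rw [← integral_mul_right_eq_self (μ := haarO (Fin N)) _
    (⟨k, hk⟩ : Matrix.orthogonalGroup (Fin N) ℝ)]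
  refine integral_congr_ae (Filter.Eventually.of_forall fun u => ?_)
  simp only [Submonoid.coe_mul, Matrix.transpose_mul, Matrix.mul_assoc]

/-- A square matrix extended by a final diagonal one. -/
def extendOne {M : ℕ} (k : Matrix (Fin M) (Fin M) ℝ) : Matrix (Fin (M + 1)) (Fin (M + 1)) ℝ :=
  Matrix.of (Fin.snoc (α := fun _ => Fin (M + 1) → ℝ) (fun i => Fin.snoc (α := fun _ => ℝ) (k i) 0)
    (Fin.snoc (α := fun _ => ℝ) 0 1))

theorem extendOne_mul {M : ℕ} (k k' : Matrix (Fin M) (Fin M) ℝ) :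
    extendOne k * extendOne k' = extendOne (k * k') := by
  ext i j
  rw [Matrix.mul_apply, Fin.sum_univ_castSucc]
  refine Fin.lastCases ?_ (fun i => ?_) i <;> refine Fin.lastCases ?_ (fun j => ?_) j <;>
    simp [extendOne, Matrix.mul_apply]

theorem extendOne_transpose {M : ℕ} (k : Matrix (Fin M) (Fin M) ℝ) :
    (extendOne k)ᵀ = extendOne kᵀ := by
  ext i j
  refine Fin.lastCases ?_ (fun i => ?_) i <;> refine Fin.lastCases ?_ (fun j => ?_) j <;>
    simp [extendOne]

theorem extendOne_one {M : ℕ} : extendOne (1 : Matrix (Fin M) (Fin M) ℝ) = 1 := by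
  ext i j
  refine Fin.lastCases ?_ (fun i => ?_) i <;> refine Fin.lastCases ?_ (fun j => ?_) j <;>
    simp [extendOne, Matrix.one_apply, Fin.ext_iff]
  · intro h; have := j.isLt; omega
  · intro h; have := i.isLt; omega

theorem extendOne_mem {M : ℕ} {k : Matrix (Fin M) (Fin M) ℝ}
    (hk : k ∈ Matrix.orthogonalGroup (Fin M) ℝ) :
    extendOne k ∈ Matrix.orthogonalGroup (Fin (M + 1)) ℝ := by
  apply mem_orthogonalGroup_of_mul_transpose
  rw [extendOne_transpose, extendOne_mul, orthogonal_mul_transpose hk, extendOne_one]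

theorem corner_extendOne_conj {M : ℕ} (k : Matrix (Fin M) (Fin M) ℝ)
    (Y : Matrix (Fin (M + 1)) (Fin (M + 1)) ℝ) :
    corner (extendOne k * Y * (extendOne k)ᵀ) = k * corner Y * kᵀ := by
  ext i j
  simp only [corner, Matrix.submatrix_apply, Matrix.mul_apply, Fin.sum_univ_castSucc]
  simp [extendOne]

theorem orbAvg_comp_corner {M : ℕ} {f : Matrix (Fin M) (Fin M) ℝ → ℂ} (hf : Measurable f)
    {C : ℝ} (hC : ∀ X, ‖f X‖ ≤ C) (X : Matrix (Fin (M + 1)) (Fin (M + 1)) ℝ) :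
    orbAvg (fun Y => f (corner Y)) X = orbAvg (fun Y => orbAvg f (corner Y)) X := by
  have h1 : ∀ k' : Matrix.orthogonalGroup (Fin M) ℝ, orbAvg (fun Y => f (corner Y)) X =
      ∫ k, f (k'.1 * corner (k.1 * X * k.1ᵀ) * k'.1ᵀ) ∂(haarO (Fin (M + 1))) := by
    intro k'
    rw [orbAvg, ← integral_mul_left_eq_self (μ := haarO (Fin (M + 1))) _
      (⟨extendOne k'.1, extendOne_mem k'.2⟩ : Matrix.orthogonalGroup (Fin (M + 1)) ℝ)]
    refine integral_congr_ae (Filter.Eventually.of_forall fun k => ?_)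
    simp only [Submonoid.coe_mul, Matrix.transpose_mul]
    rw [← corner_extendOne_conj]
    simp only [Matrix.mul_assoc]
  have h2 : Measurable fun z : Matrix.orthogonalGroup (Fin M) ℝ ×
      Matrix.orthogonalGroup (Fin (M + 1)) ℝ =>
      f (z.1.1 * corner (z.2.1 * X * z.2.1ᵀ) * z.1.1ᵀ) := by
    have h3 : Continuous fun z : Matrix.orthogonalGroup (Fin M) ℝ ×
        Matrix.orthogonalGroup (Fin (M + 1)) ℝ => z.1.1 * corner (z.2.1 * X * z.2.1ᵀ) * z.1.1ᵀ := by
      unfold corner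
      fun_prop
    exact hf.comp h3.measurable
  have h4 : orbAvg (fun Y => f (corner Y)) X =
      ∫ k', ∫ k, f (k'.1 * corner (k.1 * X * k.1ᵀ) * k'.1ᵀ) ∂(haarO (Fin (M + 1)))
        ∂(haarO (Fin M)) := by
    simp only [← h1]; simp
  rw [h4, integral_integral_swap (Integrable.of_bound h2.aestronglyMeasurable C
    (Filter.Eventually.of_forall fun z => hC _))]
  rfl

end OrbitAverage

/-! ### Power functions of leading minors -/

section MinorPow

/-- The product `∏ |det X_j| ^ (μ_j - μ_{j+1})` over the leading minors of even size. -/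
def minorPow : (n : ℕ) → (Fin n → ℂ) → Matrix (Fin (2 * n)) (Fin (2 * n)) ℝ → ℂ
  | 0, _, _ => 1
  | n + 1, μ, X => ((|X.det| : ℝ) : ℂ) ^ μ (Fin.last n) *
      minorPow n (fun j => μ j.castSucc - μ (Fin.last n))
        (corner (M := 2 * n) (corner (M := 2 * n + 1) X))

theorem norm_ofReal_cpow_le_one {t : ℝ} (ht : 0 ≤ t) {μ : ℂ} (hμ : μ.re = 0) :
    ‖((t : ℝ) : ℂ) ^ μ‖ ≤ 1 := by
  rcases ht.eq_or_lt with rfl | h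
  · by_cases h0 : μ = 0
    · simp [h0]
    · rw [Complex.ofReal_zero, Complex.zero_cpow h0]; simp
  · rw [Complex.norm_cpow_eq_rpow_re_of_pos h, hμ, Real.rpow_zero]

theorem ofReal_prod_cpow {ι : Type*} (s : Finset ι) (x : ι → ℝ) (hx : ∀ i ∈ s, 0 ≤ x i) (μ : ℂ) :
    ((∏ i ∈ s, x i : ℝ) : ℂ) ^ μ = ∏ i ∈ s, ((x i : ℝ) : ℂ) ^ μ := by
  classical
  induction s using Finset.induction_on with
  | empty => simp
  | insert a s ha ih =>
    rw [Finset.prod_insert ha, Finset.prod_insert ha, Complex.ofReal_mul,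
      Complex.mul_cpow_ofReal_nonneg (hx _ (Finset.mem_insert_self _ _))
        (Finset.prod_nonneg fun i hi => hx i (Finset.mem_insert_of_mem hi)),
      ih fun i hi => hx i (Finset.mem_insert_of_mem hi)]

theorem norm_minorPow_le : ∀ (n : ℕ) (μ : Fin n → ℂ), (∀ j, (μ j).re = 0) →
    ∀ X : Matrix (Fin (2 * n)) (Fin (2 * n)) ℝ, ‖minorPow n μ X‖ ≤ 1
  | 0, _, _, _ => by simp [minorPow]
  | n + 1, μ, hμ, X => by
    rw [minorPow, norm_mul]
    exact mul_le_one₀ (norm_ofReal_cpow_le_one (abs_nonneg _) (hμ _)) (norm_nonneg _)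
      (norm_minorPow_le n _ (fun j => by simp [hμ]) _)

theorem measurable_minorPow : ∀ (n : ℕ) (μ : Fin n → ℂ), Measurable (minorPow n μ)
  | 0, _ => measurable_const
  | n + 1, μ => by
    have h1 : Measurable fun X : Matrix (Fin (2 * (n + 1))) (Fin (2 * (n + 1))) ℝ => X.det :=
      (continuous_id.matrix_det).measurable
    have h2 := (measurable_minorPow n fun j => μ j.castSucc - μ (Fin.last n)).comp
      (measurable_corner.comp measurable_corner)
    have h3 : Measurable fun X : Matrix (Fin (2 * (n + 1))) (Fin (2 * (n + 1))) ℝ =>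
        ((|X.det| : ℝ) : ℂ) ^ μ (Fin.last n) :=
      (Complex.measurable_ofReal.comp (continuous_abs.measurable.comp h1)).pow_const _
    exact h3.mul h2

/-- The exponents `κ_j = (n - 1 - j) + μ_j`. -/
def kap {n : ℕ} (μ : Fin n → ℂ) (j : Fin n) : ℂ := (n : ℂ) - 1 - (j : ℕ) + μ j

/-- The denominator of the spherical function. -/
def kapProd {n : ℕ} (κ : Fin n → ℂ) : ℂ :=
  ∏ k, ∏ j, if j < k then (κ j - κ k) * (κ j - κ k - 1 / 2) else 1

theorem kapProd_succ {n : ℕ} (κ : Fin (n + 1) → ℂ) : kapProd κ =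
    kapProd (fun j => κ j.castSucc) * ∏ j : Fin n,
      ((κ j.castSucc - κ (Fin.last n)) * (κ j.castSucc - κ (Fin.last n) - 1 / 2)) := by
  simp only [kapProd, Fin.prod_univ_castSucc, Fin.castSucc_lt_castSucc_iff, Fin.castSucc_lt_last,
    if_true, lt_self_iff_false, if_false, mul_one]
  congr 1
  refine Finset.prod_congr rfl fun k _ => ?_
  rw [if_neg (by simp [Fin.le_last]), mul_one]

theorem kapProd_sub_const {n : ℕ} (κ : Fin n → ℂ) (s : ℂ) :
    kapProd (fun j => κ j - s) = kapProd κ := by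
  simp only [kapProd, sub_sub_sub_cancel_right]

theorem measurableSet_interlaceBox {n : ℕ} (p : Fin (n + 1) → ℝ) :
    MeasurableSet (interlaceBox p) := MeasurableSet.univ_pi fun _ => measurableSet_Ioo

theorem integral_interlaceBox_det_cpow {n : ℕ} {p : Fin (n + 1) → ℝ} (hp : Monotone p)
    (r : Fin n → ℂ) (hr : ∀ j, -1 < (r j).re) :
    ∫ y in interlaceBox p, (Matrix.of fun i j : Fin n => ((y i : ℝ) : ℂ) ^ r j).det =
      (∏ j, (r j + 1)⁻¹) *
        (Matrix.of fun i : Fin (n + 1) => (Fin.cons (1 : ℂ) fun j => ((p i : ℝ) : ℂ) ^ (r j + 1) :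
          Fin (n + 1) → ℂ)).det := by
  have hint : ∀ (j k : Fin n), IntegrableOn (fun t : ℝ => ((t : ℝ) : ℂ) ^ r j)
      (Set.Ioo (p k.castSucc) (p k.succ)) := by
    intro j k
    have := intervalIntegral.intervalIntegrable_cpow' (a := p k.castSucc) (b := p k.succ) (hr j)
    rw [intervalIntegrable_iff_integrableOn_Ioc_of_le (hp (Fin.castSucc_lt_succ).le)] at this
    exact this.mono_set Set.Ioo_subset_Ioc_self
  have hI := (integral_det_box (fun (j : Fin n) t => ((t : ℝ) : ℂ) ^ r j)
    (fun k : Fin n => Set.Ioo (p k.castSucc) (p k.succ)) hint).2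
  rw [interlaceBox, hI]
  have h1 : (Matrix.of fun k j : Fin n => ∫ t in Set.Ioo (p k.castSucc) (p k.succ),
      ((t : ℝ) : ℂ) ^ r j) =
      (Matrix.of fun k j : Fin n => ((p k.succ : ℝ) : ℂ) ^ (r j + 1) -
        ((p k.castSucc : ℝ) : ℂ) ^ (r j + 1)) * Matrix.diagonal (fun j : Fin n => (r j + 1)⁻¹) := by
    ext k j
    rw [Matrix.mul_diagonal, Matrix.of_apply, Matrix.of_apply, ← integral_Ioc_eq_integral_Ioo,
      ← intervalIntegral.integral_of_le (hp (Fin.castSucc_lt_succ).le),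
      integral_cpow (Or.inl (hr j)), div_eq_mul_inv]
  rw [h1, Matrix.det_mul, Matrix.det_diagonal,
    det_increments (fun i (j : Fin n) => ((p i : ℝ) : ℂ) ^ (r j + 1)), mul_comm]

theorem det_Dcan_two_mul {n : ℕ} (x : Fin n → ℝ) (hx : ∀ i, 0 ≤ x i) :
    |(Dcan (2 * n) (rootExt x)).det| = ∏ i, x i := by
  have h := sq_det_sub_antisymm (N := 2 * n) (b := rootExt x) (by omega)
    (k := 1) (one_mem _) 0
  simp only [map_zero, zero_sub, Matrix.one_mul, Matrix.transpose_one, Matrix.mul_one] at h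
  rw [Matrix.det_neg] at h
  have h2 := prod_fin_two_mul n fun l => (0 : ℝ) ^ 2 + rootExt x l ^ 2
  rw [h2] at h
  have h3 : ∏ l : Fin n, ((0 : ℝ) ^ 2 + rootExt x l ^ 2) = ∏ i, x i := by
    refine Finset.prod_congr rfl fun l _ => ?_
    rw [rootExt_apply, Real.sq_sqrt (hx l)]; ring
  rw [h3, mul_pow, ← pow_mul, Fintype.card_fin, Even.neg_one_pow ⟨2 * n, by ring⟩, one_mul] at h
  have h4 : 0 ≤ ∏ i, x i := Finset.prod_nonneg fun i _ => hx i
  rw [← abs_of_nonneg h4]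
  exact (sq_eq_sq_iff_abs_eq_abs _ _).1 h

theorem det_conj_orthogonal {N : ℕ} {k : Matrix (Fin N) (Fin N) ℝ}
    (hk : k ∈ Matrix.orthogonalGroup (Fin N) ℝ) (X : Matrix (Fin N) (Fin N) ℝ) :
    |(k * X * kᵀ).det| = |X.det| := by
  rw [Matrix.det_mul, Matrix.det_mul, Matrix.det_transpose, abs_mul, abs_mul,
    abs_det_of_mem_orthogonalGroup hk]; ring

/-- The value of the spherical function of antisymmetric matrices. -/
theorem exists_orbAvg_minorPow (n : ℕ) : ∃ A : ℂ, A ≠ 0 ∧ ∀ μ : Fin n → ℂ, (∀ j, (μ j).re = 0) →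
    ∀ x : Fin n → ℝ, StrictMono x → (∀ i, 0 < x i) →
      orbAvg (minorPow n μ) (Dcan (2 * n) (rootExt x)) =
        A * (Matrix.of fun i j : Fin n => ((x i : ℝ) : ℂ) ^ kap μ j).det /
          ((vdm x : ℂ) * kapProd (kap μ)) := by
  induction n with
  | zero =>
    refine ⟨1, one_ne_zero, fun μ _ x _ _ => ?_⟩
    simp [orbAvg, minorPow, vdm, kapProd]
  | succ n ih =>
    obtain ⟨A, hA, ihA⟩ := ih
    have hcn : (0 : ℝ) < Real.Gamma (n + 1 / 2) / √Real.pi := by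
      have := Real.Gamma_pos_of_pos (s := n + 1 / 2) (by positivity)
      positivity
    refine ⟨A * ((Real.Gamma (n + 1 / 2) / √Real.pi : ℝ) : ℂ) * (n.factorial : ℂ) * (-1) ^ n,
      ?_, fun μ hμ x hx hx0 => ?_⟩
    · refine mul_ne_zero (mul_ne_zero (mul_ne_zero hA ?_) ?_) (pow_ne_zero _ (by norm_num))
      · exact_mod_cast hcn.ne'
      · exact_mod_cast n.factorial_ne_zero
    set cn : ℝ := Real.Gamma (n + 1 / 2) / √Real.pi with hcn_def
    set μ' : Fin n → ℂ := fun j => μ j.castSucc - μ (Fin.last n) with hμ'def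
    have hμ' : ∀ j, (μ' j).re = 0 := fun j => by simp [hμ'def, hμ]
    set f := minorPow n μ' with hf
    have hfm : Measurable f := measurable_minorPow n μ'
    have hfb : ∀ X, ‖f X‖ ≤ 1 := norm_minorPow_le n μ' hμ'
    have hκ' : ∀ j, kap μ' j = kap μ j.castSucc - kap μ (Fin.last n) - 1 := fun j => by
      simp [kap, hμ'def]; ring
    have hκre : ∀ j, 0 ≤ (kap μ' j).re := fun j => by
      have h1 : (kap μ' j).re = (n : ℝ) - 1 - (j : ℕ) := by simp [kap, hμ']
      have h2 : ((j : ℕ) : ℝ) + 1 ≤ n := by exact_mod_cast j.isLt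
      rw [h1]; linarith
    -- the odd-dimensional average
    have hodd : ∀ y : Fin n → ℝ, StrictMono y → (∀ l, 0 < y l) →
        vdm y • orbAvg (fun Y => orbAvg f (corner Y)) (Dcan (2 * n + 1) (rootExt y)) =
          (cn : ℂ) * A * (kapProd (kap μ'))⁻¹ * (∏ j, (kap μ' j + 1 / 2)⁻¹) *
            (Matrix.of fun i j : Fin n => ((y i : ℝ) : ℂ) ^ kap μ' j).det := by
      intro y hy hy0
      have hvy := (vdm_pos hy).ne'
      have h1 := integral_corner_odd hy hy0 (measurable_orbAvg hfm) (norm_orbAvg_le hfb)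
        (fun X _ k hk => orbAvg_conj f X hk)
      have hd := cornerData_odd hy hy0
      rw [orbAvg, h1, ← hcn_def]
      have h2 : ∀ w ∈ interlaceBox (Fin.cons 0 y : Fin (n + 1) → ℝ),
          (vdm w * ∏ l, (√(w l))⁻¹) • orbAvg f (Dcan (2 * n) (rootExt w)) =
            (A * (kapProd (kap μ'))⁻¹) * (Matrix.of fun i j : Fin n =>
              ((w i : ℝ) : ℂ) ^ (kap μ' j - 1 / 2)).det := by
        intro w hw
        have hws := strictMono_of_mem_interlaceBox hd.mono hw
        have hw0 : ∀ l, 0 < w l := fun l =>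
          lt_of_le_of_lt (hd.nonneg l.castSucc) ((mem_interlaceBox.1 hw) l).1
        have hvw : (vdm w : ℂ) ≠ 0 := by exact_mod_cast (vdm_pos hws).ne'
        rw [ihA μ' hμ' w hws hw0]
        have e1 : (Matrix.of fun i j : Fin n => ((w i : ℝ) : ℂ) ^ (kap μ' j - 1 / 2)) =
            Matrix.diagonal (fun i => (((√(w i))⁻¹ : ℝ) : ℂ)) *
              Matrix.of fun i j : Fin n => ((w i : ℝ) : ℂ) ^ kap μ' j := by
          ext i j
          rw [Matrix.diagonal_mul, Matrix.of_apply, Matrix.of_apply,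
            Complex.cpow_sub _ _ (by exact_mod_cast (hw0 i).ne'), Real.sqrt_eq_rpow,
            Complex.ofReal_inv, Complex.ofReal_cpow (hw0 i).le]
          push_cast
          ring
        rw [e1, Matrix.det_mul, Matrix.det_diagonal, Complex.real_smul]
        push_cast
        field_simp
      rw [setIntegral_congr_fun (measurableSet_interlaceBox _) h2,
        integral_const_mul, integral_interlaceBox_det_cpow hd.mono.monotone _ (fun j => by
          have := hκre j
          simp; linarith)]
      have h3 : (Matrix.of fun i : Fin (n + 1) => (Fin.cons (1 : ℂ) fun j =>
          (((Fin.cons 0 y : Fin (n + 1) → ℝ) i : ℝ) : ℂ) ^ (kap μ' j - 1 / 2 + 1) :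
          Fin (n + 1) → ℂ)).det = (∏ l, ((√(y l) : ℝ) : ℂ)) *
          (Matrix.of fun i j : Fin n => ((y i : ℝ) : ℂ) ^ kap μ' j).det := by
        rw [Matrix.det_succ_row_zero, Fin.sum_univ_succ]
        have hz : ∀ j : Fin n, (0 : ℂ) ^ (kap μ' j - 1 / 2 + 1) = 0 := fun j => by
          rw [Complex.zero_cpow]
          intro h
          have := congrArg Complex.re h
          have h4 := hκre j
          simp at this; linarith
        simp only [Matrix.of_apply, Fin.cons_zero, Fin.cons_succ, Complex.ofReal_zero, hz, mul_zero,
          zero_mul, Finset.sum_const_zero, add_zero, Fin.val_zero, pow_zero, one_mul]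
        have e2 : ((Matrix.of fun i : Fin (n + 1) => (Fin.cons (1 : ℂ) fun j =>
          (((Fin.cons 0 y : Fin (n + 1) → ℝ) i : ℝ) : ℂ) ^ (kap μ' j - 1 / 2 + 1) :
          Fin (n + 1) → ℂ)).submatrix Fin.succ (Fin.succAbove 0)) =
            Matrix.diagonal (fun i => ((√(y i) : ℝ) : ℂ)) *
              Matrix.of fun i j : Fin n => ((y i : ℝ) : ℂ) ^ kap μ' j := by
          ext i j
          simp only [Matrix.submatrix_apply, Matrix.of_apply, Fin.zero_succAbove, Fin.cons_succ,
            Matrix.diagonal_mul]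
          rw [show kap μ' j - 1 / 2 + 1 = 1 / 2 + kap μ' j by ring,
            Complex.cpow_add _ _ (by exact_mod_cast (hy0 i).ne'), Real.sqrt_eq_rpow,
            Complex.ofReal_cpow (hy0 i).le]
          push_cast
          ring
        rw [e2, Matrix.det_mul, Matrix.det_diagonal]
      rw [h3, Complex.real_smul, Complex.real_smul]
      have h5 : (∏ l, ((√(y l) : ℝ) : ℂ)) ≠ 0 := by
        refine Finset.prod_ne_zero_iff.2 fun l _ => ?_
        exact_mod_cast (Real.sqrt_pos.2 (hy0 l)).ne'
      have h6 : ∀ j, kap μ' j - 1 / 2 + 1 = kap μ' j + 1 / 2 := fun j => by ring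
      have hvy' : (vdm y : ℂ) ≠ 0 := by exact_mod_cast hvy
      simp only [h6]
      generalize ∏ j, (kap μ' j + 1 / 2)⁻¹ = R
      push_cast
      field_simp
    -- the even-dimensional average
    have heven := integral_corner_even (Ψ := orbAvg fun Y => orbAvg f (corner Y)) hx
      (fun l => (hx0 l).le)
      (measurable_orbAvg ((measurable_orbAvg hfm).comp measurable_corner))
      (norm_orbAvg_le fun X => norm_orbAvg_le hfb (corner X))
      (fun X _ k hk => orbAvg_conj (fun Y => orbAvg f (corner Y)) X hk)
    have hstep : orbAvg (minorPow (n + 1) μ) (Dcan (2 * (n + 1)) (rootExt x)) =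
        ((∏ i, x i : ℝ) : ℂ) ^ μ (Fin.last n) *
          orbAvg (fun Y => orbAvg (fun Z => orbAvg f (corner Z)) (corner Y))
            (Dcan (2 * n + 1 + 1) (rootExt x)) := by
      have e1 : orbAvg (minorPow (n + 1) μ) (Dcan (2 * (n + 1)) (rootExt x)) =
          ((∏ i, x i : ℝ) : ℂ) ^ μ (Fin.last n) *
            orbAvg (fun Y => f (corner (corner Y))) (Dcan (2 * n + 1 + 1) (rootExt x)) := by
        rw [orbAvg, orbAvg, ← integral_const_mul]
        refine integral_congr_ae (Filter.Eventually.of_forall fun k => ?_)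
        simp only [minorPow]
        rw [det_conj_orthogonal k.2, det_Dcan_two_mul x fun i => (hx0 i).le]
        rfl
      rw [e1, orbAvg_comp_corner (f := fun Z => f (corner Z)) (hfm.comp measurable_corner)
        (fun X => hfb _)]
      congr 2
      ext Y
      exact orbAvg_comp_corner hfm hfb _
    rw [hstep, orbAvg, heven]
    have h7 : ∀ y ∈ interlaceBox x, vdm y • orbAvg (fun Y => orbAvg f (corner Y))
        (Dcan (2 * n + 1) (rootExt y)) = ((cn : ℂ) * A * (kapProd (kap μ'))⁻¹ *
          (∏ j, (kap μ' j + 1 / 2)⁻¹)) *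
            (Matrix.of fun i j : Fin n => ((y i : ℝ) : ℂ) ^ kap μ' j).det := by
      intro y hy
      refine hodd y (strictMono_of_mem_interlaceBox hx hy) fun l => ?_
      exact (hx0 _).trans ((mem_interlaceBox.1 hy) l).1
    rw [setIntegral_congr_fun (measurableSet_interlaceBox _) h7,
      integral_const_mul, integral_interlaceBox_det_cpow hx.monotone _
        (fun j => by linarith [hκre j])]
    have h8 : ((∏ i, x i : ℝ) : ℂ) ^ μ (Fin.last n) * (Matrix.of fun i : Fin (n + 1) =>
        (Fin.cons (1 : ℂ) fun j => ((x i : ℝ) : ℂ) ^ (kap μ' j + 1) : Fin (n + 1) → ℂ)).det =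
        (-1) ^ n * (Matrix.of fun i j : Fin (n + 1) => ((x i : ℝ) : ℂ) ^ kap μ j).det := by
      have hlast : kap μ (Fin.last n) = μ (Fin.last n) := by simp [kap]
      have e1 : ((∏ i, x i : ℝ) : ℂ) ^ μ (Fin.last n) =
          ∏ i, ((x i : ℝ) : ℂ) ^ μ (Fin.last n) := by
        exact ofReal_prod_cpow _ _ (fun i _ => (hx0 i).le) _
      rw [e1, ← Matrix.det_diagonal, ← Matrix.det_mul]
      have e2 : (Matrix.diagonal (fun i => ((x i : ℝ) : ℂ) ^ μ (Fin.last n)) *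
          (Matrix.of fun i : Fin (n + 1) =>
        (Fin.cons (1 : ℂ) fun j => ((x i : ℝ) : ℂ) ^ (kap μ' j + 1) : Fin (n + 1) → ℂ))) =
          (Matrix.of fun i j : Fin (n + 1) => ((x i : ℝ) : ℂ) ^ kap μ j).submatrix id
            (finRotate (n + 1)).symm := by
        ext i j
        rw [Matrix.diagonal_mul, Matrix.submatrix_apply, Matrix.of_apply, Matrix.of_apply, id]
        refine Fin.cases ?_ (fun j => ?_) j
        · have : (finRotate (n + 1)).symm 0 = Fin.last n := by
            rw [Equiv.symm_apply_eq, finRotate_last]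
          rw [this, Fin.cons_zero, mul_one, hlast]
        · have : (finRotate (n + 1)).symm j.succ = j.castSucc := by
            rw [Equiv.symm_apply_eq]
            ext
            rw [coe_finRotate_of_ne_last (by simp [Fin.ext_iff]; have := j.isLt; omega)]; simp
          rw [this, Fin.cons_succ, ← Complex.cpow_add _ _ (by exact_mod_cast (hx0 i).ne'), hκ' j,
            hlast]
          congr 1; ring
      rw [e2, Matrix.det_permute']
      simp
    have h9 : kapProd (kap μ) = kapProd (kap μ') *
        ∏ j, ((kap μ' j + 1) * (kap μ' j + 1 / 2)) := by
      rw [kapProd_succ]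
      congr 1
      · rw [← kapProd_sub_const _ (kap μ (Fin.last n) + 1)]
        congr 1; ext j; rw [hκ' j]; ring
      · refine Finset.prod_congr rfl fun j _ => ?_
        rw [hκ' j]; ring
    rw [h9, Complex.real_smul, Finset.prod_mul_distrib, Finset.prod_inv_distrib,
      Finset.prod_inv_distrib]
    push_cast at h8 ⊢
    set Q := (∏ i, ((x i : ℝ) : ℂ)) ^ μ (Fin.last n)
    have h10 : ∀ a b c d e d1: ℂ, Q * (a / b * (c * (d * d1))) = a / b * c * d * (Q * d1) := by
      intros; ring
    rw [h10 _ _ _ _ 0, h8]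
    simp only [div_eq_mul_inv, mul_inv]
    ring

end MinorPow

end

noncomputable section

/-! ### Splitting coordinates -/

section Glue

/-- Glue two families along a partition of the index type. -/
def glue {α β γ E : Type*} (e : α ⊕ β ≃ γ) (p : (α → E) × (β → E)) : γ → E :=
  fun c => Sum.elim p.1 p.2 (e.symm c)

variable {α β γ : Type*}

@[simp] theorem glue_inl {E : Type*} (e : α ⊕ β ≃ γ) (p : (α → E) × (β → E)) (a : α) :
    glue e p (e (Sum.inl a)) = p.1 a := by simp [glue]

@[simp] theorem glue_inr {E : Type*} (e : α ⊕ β ≃ γ) (p : (α → E) × (β → E)) (b : β) :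
    glue e p (e (Sum.inr b)) = p.2 b := by simp [glue]

variable [Fintype α] [Fintype β] [Fintype γ]

theorem measurePreserving_glue {E : Type*} [MeasureSpace E] [SigmaFinite (volume : Measure E)]
    (e : α ⊕ β ≃ γ) :
    MeasurePreserving (glue (E := E) e) volume volume := by
  have h1 := volume_measurePreserving_sumPiEquivProdPi_symm (fun _ : α ⊕ β => E)
  have h2 := volume_measurePreserving_piCongrLeft (fun _ : γ => E) e
  have h3 := h2.comp h1
  convert h3 using 1
  ext p c
  obtain ⟨s, rfl⟩ := e.surjective c
  rw [Function.comp_apply, MeasurableEquiv.coe_piCongrLeft, Equiv.piCongrLeft_apply_apply]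
  cases s <;> simp [glue, MeasurableEquiv.coe_sumPiEquivProdPi_symm, Equiv.sumPiEquivProdPi]

theorem lintegral_glue {E : Type*} [MeasureSpace E] [SigmaFinite (volume : Measure E)]
    (e : α ⊕ β ≃ γ) {f : (γ → E) → ENNReal} (hf : Measurable f) :
    ∫⁻ x, f x = ∫⁻ a : α → E, ∫⁻ b : β → E, f (glue e (a, b)) := by
  have h := measurePreserving_glue (E := E) e
  rw [← h.map_eq, lintegral_map hf h.measurable]
  exact lintegral_prod _ (hf.comp h.measurable).aemeasurable

/-- A block-diagonal matrix. -/
def blockDiag [DecidableEq γ] (e : α ⊕ β ≃ γ) (k : Matrix α α ℝ) (k' : Matrix β β ℝ) : Matrix γ γ ℝ :=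
  (Matrix.fromBlocks k 0 0 k').submatrix e.symm e.symm

variable [DecidableEq α] [DecidableEq β] [DecidableEq γ]

theorem blockDiag_mem (e : α ⊕ β ≃ γ) {k : Matrix α α ℝ} {k' : Matrix β β ℝ}
    (hk : k ∈ Matrix.orthogonalGroup α ℝ) (hk' : k' ∈ Matrix.orthogonalGroup β ℝ) :
    blockDiag e k k' ∈ Matrix.orthogonalGroup γ ℝ := by
  apply mem_orthogonalGroup_of_mul_transpose
  rw [blockDiag, Matrix.transpose_submatrix, Matrix.submatrix_mul_equiv,
    Matrix.fromBlocks_transpose, Matrix.fromBlocks_multiply]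
  simp [orthogonal_mul_transpose hk, orthogonal_mul_transpose hk', Matrix.fromBlocks_one]

theorem glue_vecMul_blockDiag (e : α ⊕ β ≃ γ) (p : (α → ℝ) × (β → ℝ)) (k : Matrix α α ℝ)
    (k' : Matrix β β ℝ) :
    glue e p ᵥ* blockDiag e k k' = glue e (p.1 ᵥ* k, p.2 ᵥ* k') := by
  ext c
  obtain ⟨s, rfl⟩ := e.surjective c
  simp only [Matrix.vecMul, dotProduct]
  rw [← e.sum_comp, Fintype.sum_sum_type]
  cases s <;> simp [blockDiag, Matrix.vecMul, dotProduct]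

end Glue

/-! ### Polar coordinates for rotation invariant functions of one and two rows -/

section Polar

variable {γ : Type*} [Fintype γ] [DecidableEq γ]

theorem vecMul_invariant_eq_single {f : (γ → ℝ) → ENNReal}
    (hinv : ∀ r, ∀ k ∈ Matrix.orthogonalGroup γ ℝ, f (r ᵥ* k) = f r) (j : γ) (r : γ → ℝ) :
    f r = f (Pi.single j √(∑ i, r i ^ 2)) := by
  by_cases h : ∑ i, r i ^ 2 = 0
  · have : r = 0 := by
      ext i
      have := (Finset.sum_eq_zero_iff_of_nonneg fun i _ => sq_nonneg (r i)).1 h i (Finset.mem_univ _)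
      simpa using this
    rw [h, this]; simp
  · have h0 : 0 ≤ ∑ i, r i ^ 2 := Finset.sum_nonneg fun i _ => sq_nonneg _
    have h1 := hinv (Pi.single j √(∑ i, r i ^ 2)) _ (householder_mem j r)
    rw [← h1]
    congr 1
    ext i
    rw [Matrix.single_vecMul, Pi.smul_apply]
    have : householder j r j i = unitVec r i := by rw [householder_apply j h]
    rw [Matrix.row_apply, this, unitVec, smul_eq_mul]
    have : √(∑ i, r i ^ 2) ≠ 0 := (Real.sqrt_pos.2 (lt_of_le_of_ne h0 (Ne.symm h))).ne'
    field_simp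

theorem measurable_single {ι : Type*} [DecidableEq ι] (j : ι) :
    Measurable fun ρ : ℝ => (Pi.single j ρ : ι → ℝ) :=
  measurable_pi_lambda _ fun i => by
    by_cases h : i = j
    · subst h; simp only [Pi.single_eq_same]; exact measurable_id
    · simp [h]

theorem exists_lintegral_radial (γ : Type*) [Fintype γ] [DecidableEq γ] [Nonempty γ] (j : γ) :
    ∃ c : ENNReal, c ≠ 0 ∧ c ≠ ⊤ ∧ ∀ f : (γ → ℝ) → ENNReal, Measurable f →
      (∀ r, ∀ k ∈ Matrix.orthogonalGroup γ ℝ, f (r ᵥ* k) = f r) →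
        ∫⁻ r, f r = c * ∫⁻ ρ in Set.Ioi (0 : ℝ),
          ENNReal.ofReal (ρ ^ (Fintype.card γ - 1)) * f (Pi.single j ρ) := by
  let E := EuclideanSpace ℝ γ
  haveI : Nontrivial E := by
    refine ⟨WithLp.toLp 2 (fun _ => 1), 0, fun h => ?_⟩
    have := congrArg (fun v : E => v (Classical.arbitrary γ)) h
    simp at this
  have hdim : Module.finrank ℝ E = Fintype.card γ := finrank_euclideanSpace
  refine ⟨(volume : Measure E).toSphere Set.univ, ?_, measure_ne_top _ _, fun f hf hinv => ?_⟩
  · rw [Measure.toSphere_apply_univ]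
    refine mul_ne_zero ?_ ?_
    · rw [hdim]; exact_mod_cast Fintype.card_ne_zero
    · exact (Metric.measure_ball_pos _ _ one_pos).ne'
  · have h1 : ∫⁻ r, f r = ∫⁻ x : E, f (Pi.single j ‖x‖) := by
      have hmp := EuclideanSpace.volume_preserving_symm_measurableEquiv_toLp γ
      rw [← (EuclideanSpace.volume_preserving_symm_measurableEquiv_toLp γ).lintegral_comp hf]
      refine lintegral_congr fun x => ?_
      rw [vecMul_invariant_eq_single hinv j, EuclideanSpace.norm_eq]
      congr 3
      refine Finset.sum_congr rfl fun i _ => ?_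
      rw [Real.norm_eq_abs, sq_abs]; rfl
    have hfs : Measurable fun ρ : ℝ => f (Pi.single j ρ) :=
      hf.comp (measurable_single j)
    have h2 : ∫⁻ x : E, f (Pi.single j ‖x‖) = ∫⁻ x : ({(0 : E)}ᶜ : Set E),
        f (Pi.single j ‖x.1‖) ∂((volume : Measure E).comap Subtype.val) := by
      rw [lintegral_subtype_comap (measurableSet_singleton _).compl
        (fun x : E => f (Pi.single j ‖x‖)), restrict_compl_singleton]
    have h3 := (volume : Measure E).measurePreserving_homeomorphUnitSphereProd.lintegral_comp_emb
      (Homeomorph.measurableEmbedding _) (fun z => f (Pi.single j (z.2 : ℝ)))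
    simp only [homeomorphUnitSphereProd_apply_snd_coe] at h3
    rw [h1, h2, h3, lintegral_prod _ (by
      exact (hfs.comp (measurable_subtype_coe.comp measurable_snd)).aemeasurable)]
    simp only [lintegral_const]
    rw [mul_comm]
    congr 1
    have hfs' : Measurable fun y : Set.Ioi (0 : ℝ) => f (Pi.single j y.1) :=
      hfs.comp measurable_subtype_coe
    have hden : Measurable fun r : Set.Ioi (0 : ℝ) =>
      ENNReal.ofReal (r.1 ^ (Module.finrank ℝ E - 1)) := by fun_prop
    rw [Measure.volumeIoiPow, lintegral_withDensity_eq_lintegral_mul _ hden hfs', hdim]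
    exact lintegral_subtype_comap measurableSet_Ioi
      (fun ρ : ℝ => ENNReal.ofReal (ρ ^ (Fintype.card γ - 1)) * f (Pi.single j ρ))

/-- A matrix with two given rows. -/
def twoRows (r s : γ → ℝ) : Matrix (Fin 2) γ ℝ := Matrix.of ![r, s]

theorem twoRows_mul (r s : γ → ℝ) (k : Matrix γ γ ℝ) :
    twoRows r s * k = twoRows (r ᵥ* k) (s ᵥ* k) := by
  ext i j
  fin_cases i <;> rfl

theorem measurable_twoRows : Measurable fun p : (γ → ℝ) × (γ → ℝ) => twoRows p.1 p.2 := by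
  refine measurable_pi_lambda _ fun i => ?_
  fin_cases i
  · exact measurable_fst
  · exact measurable_snd

theorem lintegral_twoRows {I : Matrix (Fin 2) γ ℝ → ENNReal} (hI : Measurable I) :
    ∫⁻ R, I R = ∫⁻ r, ∫⁻ s, I (twoRows r s) := by
  have h := (volume_preserving_finTwoArrow (γ → ℝ)).symm
  have h1 : ∫⁻ R, I R = ∫⁻ p : (γ → ℝ) × (γ → ℝ), I (twoRows p.1 p.2) := by
    have := h.lintegral_comp (f := I) hI
    exact this.symm
  rw [h1]
  exact lintegral_prod _ (hI.comp measurable_twoRows).aemeasurable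

variable {κ : Type*} [Fintype κ] [DecidableEq κ]

theorem measurePreserving_vecMul {k : Matrix γ γ ℝ} (hk : k ∈ Matrix.orthogonalGroup γ ℝ) :
    MeasurePreserving (fun ξ : γ → ℝ => ξ ᵥ* k) volume volume := by
  have h := measurePreserving_mul_right (l := Unit) hk
  have h2 := (volume_preserving_funUnique Unit (γ → ℝ))
  exact (h2.comp h).comp h2.symm

theorem exists_lintegral_twoRows (e : Unit ⊕ κ ≃ γ) [Nonempty κ] (j : κ) :
    ∃ c : ENNReal, c ≠ 0 ∧ c ≠ ⊤ ∧ ∀ I : Matrix (Fin 2) γ ℝ → ENNReal, Measurable I →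
      (∀ R, ∀ k ∈ Matrix.orthogonalGroup γ ℝ, I (R * k) = I R) →
        ∫⁻ R, I R = c * ∫⁻ ρ in Set.Ioi (0 : ℝ), ENNReal.ofReal (ρ ^ Fintype.card κ) *
          ∫⁻ x : Unit → ℝ, ∫⁻ τ in Set.Ioi (0 : ℝ), ENNReal.ofReal (τ ^ (Fintype.card κ - 1)) *
            I (twoRows (Pi.single (e (Sum.inl ())) ρ) (glue e (x, Pi.single j τ))) := by
  haveI : Nonempty γ := ⟨e (Sum.inl ())⟩
  obtain ⟨c₁, h10, h1t, h1⟩ := exists_lintegral_radial γ (e (Sum.inl ()))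
  obtain ⟨c₂, h20, h2t, h2⟩ := exists_lintegral_radial κ j
  have hcard : Fintype.card γ - 1 = Fintype.card κ := by
    rw [← Fintype.card_congr e, Fintype.card_sum]; simp
  refine ⟨c₁ * c₂, mul_ne_zero h10 h20, ENNReal.mul_ne_top h1t h2t, fun I hI hinv => ?_⟩
  have hI2 : Measurable fun p : (γ → ℝ) × (γ → ℝ) => I (twoRows p.1 p.2) := hI.comp measurable_twoRows
  rw [lintegral_twoRows hI, h1 _ hI2.lintegral_prod_right', hcard, mul_assoc]
  · congr 1
    rw [← lintegral_const_mul' _ _ h2t]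
    refine setLIntegral_congr_fun measurableSet_Ioi fun ρ hρ => ?_
    rw [← mul_assoc, mul_comm c₂, mul_assoc]
    congr 1
    have hI3 : Measurable fun s => I (twoRows (Pi.single (e (Sum.inl ())) ρ) s) :=
      hI2.comp measurable_prodMk_left
    rw [lintegral_glue e hI3, ← lintegral_const_mul' _ _ h2t]
    refine lintegral_congr fun x => ?_
    have hg : Measurable fun s : κ → ℝ => glue e (x, s) :=
      (measurePreserving_glue e).measurable.comp measurable_prodMk_left
    refine h2 _ (hI3.comp hg) ?_
    · intro s k hk
      have hb := hinv (twoRows (Pi.single (e (Sum.inl ())) ρ) (glue e (x, s))) _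
        (blockDiag_mem e (one_mem (Matrix.orthogonalGroup Unit ℝ)) hk)
      rw [twoRows_mul, glue_vecMul_blockDiag] at hb
      have hs : (Pi.single (e (Sum.inl ())) ρ : γ → ℝ) = glue e (fun _ => ρ, 0) := by
        ext c
        obtain ⟨s, rfl⟩ := e.surjective c
        cases s <;> simp [Pi.single_apply]
      rw [hs] at hb ⊢
      rw [glue_vecMul_blockDiag] at hb
      simpa using hb
  · intro r k hk
    have hmp := measurePreserving_vecMul hk
    have hI3 : Measurable fun s => I (twoRows (r ᵥ* k) s) := hI2.comp measurable_prodMk_left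
    rw [← hmp.lintegral_comp hI3]
    refine lintegral_congr fun s => ?_
    rw [← twoRows_mul, hinv _ k hk]

/-- The two summands of `Fin 2`. -/
def finTwoSplit : Unit ⊕ Unit ≃ Fin 2 where
  toFun := Sum.elim (fun _ => 0) (fun _ => 1)
  invFun i := if i = 0 then Sum.inl () else Sum.inr ()
  left_inv s := by cases s <;> simp
  right_inv i := by fin_cases i <;> simp

variable {β : Type*} [Fintype β] [DecidableEq β]

/-- A matrix padded with zero columns on the right. -/
def padRight {δ : Type*} (e : Fin 2 ⊕ β ≃ γ) (z : Matrix δ (Fin 2) ℝ) : Matrix δ γ ℝ :=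
  Matrix.of fun i => glue e (z i, 0)

theorem measurable_padRight {δ : Type*} [Fintype δ] (e : Fin 2 ⊕ β ≃ γ) :
    Measurable (padRight e : Matrix δ (Fin 2) ℝ → Matrix δ γ ℝ) :=
  measurable_pi_lambda _ fun i => (measurePreserving_glue e).measurable.comp
    ((measurable_pi_apply i).prodMk measurable_const)

theorem padRight_mul {δ : Type*} (e : Fin 2 ⊕ β ≃ γ) (z : Matrix δ (Fin 2) ℝ)
    (k : Matrix (Fin 2) (Fin 2) ℝ) : padRight e (z * k) = padRight e z * blockDiag e k 1 := by
  ext i j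
  have := congrFun (glue_vecMul_blockDiag e (z i, 0) k 1) j
  simp only [Matrix.zero_vecMul] at this
  exact this.symm

theorem exists_lintegral_padRight (ee : Fin 2 ⊕ β ≃ γ) :
    ∃ c : ENNReal, ∀ I : Matrix (Fin 2) γ ℝ → ENNReal, Measurable I →
      (∀ R, ∀ k ∈ Matrix.orthogonalGroup γ ℝ, I (R * k) = I R) →
        ∫⁻ R, I R = c * ∫⁻ z : Matrix (Fin 2) (Fin 2) ℝ,
          ENNReal.ofReal (|z.det| ^ Fintype.card β) * I (padRight ee z) := by
  let e : Unit ⊕ (Unit ⊕ β) ≃ γ := (Equiv.sumAssoc Unit Unit β).symm.trans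
    ((Equiv.sumCongr finTwoSplit (Equiv.refl β)).trans ee)
  obtain ⟨c₁, -, -, h1⟩ := exists_lintegral_twoRows e (Sum.inl ())
  obtain ⟨c₂, h20, h2t, h2⟩ := exists_lintegral_twoRows finTwoSplit ()
  refine ⟨c₁ * c₂⁻¹, fun I hI hinv => ?_⟩
  have hJ := h2 (fun z => ENNReal.ofReal (|z.det| ^ Fintype.card β) * I (padRight ee z))
    (by
      have : Measurable fun z : Matrix (Fin 2) (Fin 2) ℝ => z.det :=
        (continuous_id.matrix_det).measurable
      exact ((this.abs).pow_const _).ennreal_ofReal.mul (hI.comp (measurable_padRight ee)))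
    (by
      intro z k hk
      rw [padRight_mul, hinv _ _ (blockDiag_mem ee hk (one_mem _)), Matrix.det_mul, abs_mul,
        abs_det_of_mem_orthogonalGroup hk, mul_one])
  rw [hJ, h1 I hI hinv, mul_assoc, ← mul_assoc c₂⁻¹, ENNReal.inv_mul_cancel h20 h2t, one_mul]
  congr 1
  refine setLIntegral_congr_fun measurableSet_Ioi fun ρ hρ => ?_
  have hρ' : (0 : ℝ) < ρ := hρ
  rw [Fintype.card_sum, Fintype.card_unit, pow_add, ENNReal.ofReal_mul (by positivity), mul_assoc]
  congr 1
  rw [← lintegral_const_mul' _ _ ENNReal.ofReal_ne_top]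
  refine lintegral_congr fun x => ?_
  rw [← lintegral_const_mul' _ _ ENNReal.ofReal_ne_top]
  refine setLIntegral_congr_fun measurableSet_Ioi fun τ hτ => ?_
  have hτ' : (0 : ℝ) < τ := hτ
  have hz : ∀ i : Fin 2, (i = 0 ∧ finTwoSplit.symm i = Sum.inl ()) ∨
      (i = 1 ∧ finTwoSplit.symm i = Sum.inr ()) := by
    intro i; fin_cases i <;> simp [finTwoSplit]
  have hmat : padRight ee (twoRows (Pi.single (finTwoSplit (Sum.inl ())) ρ)
      (glue finTwoSplit (x, Pi.single () τ))) =
      twoRows (Pi.single (e (Sum.inl ())) ρ) (glue e (x, Pi.single (Sum.inl ()) τ)) := by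
    ext i j
    obtain ⟨s, rfl⟩ := e.surjective j
    have he1 : e (Sum.inl ()) = ee (Sum.inl 0) := rfl
    have he2 : e (Sum.inr (Sum.inl ())) = ee (Sum.inl 1) := rfl
    have he3 : ∀ b, e (Sum.inr (Sum.inr b)) = ee (Sum.inr b) := fun b => rfl
    have ht0 : finTwoSplit (Sum.inl ()) = 0 := rfl
    have ht1 : finTwoSplit (Sum.inr ()) = 1 := rfl
    have hg1 : ∀ q : (Unit → ℝ) × (Unit → ℝ), glue finTwoSplit q 0 = q.1 () := fun q =>
      glue_inl finTwoSplit q ()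
    have hg2 : ∀ q : (Unit → ℝ) × (Unit → ℝ), glue finTwoSplit q 1 = q.2 () := fun q =>
      glue_inr finTwoSplit q ()
    fin_cases i
    · rcases s with ⟨⟩ | ⟨⟩ | b
      · simp [padRight, twoRows, he1, ht0]
      · simp [padRight, twoRows, he1, he2, ht0, Pi.single_apply]
      · simp [padRight, twoRows, he1, he3, ht0, Pi.single_apply]
    · rcases s with ⟨⟩ | ⟨⟩ | b
      · have := glue_inl e (x, Pi.single (Sum.inl ()) τ) ()
        simp [padRight, twoRows, this]
        simp [he1, hg1]
      · have := glue_inr e (x, Pi.single (Sum.inl ()) τ) (Sum.inl ())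
        simp [padRight, twoRows, this]
        simp [he2, hg2]
      · have := glue_inr e (x, Pi.single (Sum.inl ()) τ) (Sum.inr b)
        simp [padRight, twoRows, this]
        simp [he3]
  have hdet : |(twoRows (Pi.single (finTwoSplit (Sum.inl ())) ρ)
      (glue finTwoSplit (x, Pi.single () τ))).det| = ρ * τ := by
    have h00 : finTwoSplit (Sum.inl ()) = 0 := rfl
    have hg2 : glue finTwoSplit (x, Pi.single () τ) 1 = τ := by
      have := glue_inr finTwoSplit (x, Pi.single () τ) ()
      have h1 : (Pi.single () τ : Unit → ℝ) () = τ := by simp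
      exact this.trans h1
    rw [Matrix.det_fin_two]
    simp [twoRows, h00, hg2, abs_of_pos hρ', abs_of_pos hτ']
  rw [hmat, hdet, mul_pow, ENNReal.ofReal_mul (by positivity)]
  simp only [Fintype.card_unit, le_refl, Nat.sub_eq_zero_of_le, pow_zero, ENNReal.ofReal_one,
    one_mul, add_tsub_cancel_left]
  ring

end Polar

end

noncomputable section

/-! ### Integration in block-triangular coordinates -/

section BlockLQ

theorem lintegral_rows {α β γ δ : Type*} [Fintype α] [Fintype β] [Fintype γ] [Fintype δ]
    (e : α ⊕ β ≃ γ) {f : Matrix γ δ ℝ → ENNReal} (hf : Measurable f) :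
    ∫⁻ g, f g = ∫⁻ R : Matrix α δ ℝ, ∫⁻ S : Matrix β δ ℝ, f (Matrix.of (glue e (R, S))) :=
  lintegral_glue (E := δ → ℝ) e hf

theorem measurable_glue_rows {α β γ δ : Type*} [Fintype α] [Fintype β] [Fintype γ] [Fintype δ]
    (e : α ⊕ β ≃ γ) : Measurable fun p : Matrix α δ ℝ × Matrix β δ ℝ =>
      (Matrix.of (glue e (p.1, p.2)) : Matrix γ δ ℝ) :=
  (measurePreserving_glue (E := δ → ℝ) e).measurable

/-- Two matrices side by side. -/
def besideCols {α β γ δ : Type*} (e : α ⊕ β ≃ γ) (C : Matrix δ α ℝ) (D : Matrix δ β ℝ) :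
    Matrix δ γ ℝ := Matrix.of fun i => glue e (C i, D i)

theorem measurable_besideCols {α β γ δ : Type*} [Fintype α] [Fintype β] [Fintype γ] [Fintype δ]
    (e : α ⊕ β ≃ γ) : Measurable fun p : Matrix δ α ℝ × Matrix δ β ℝ => besideCols e p.1 p.2 :=
  measurable_pi_lambda _ fun i => (measurePreserving_glue e).measurable.comp
    (((measurable_pi_apply i).comp measurable_fst).prodMk
      ((measurable_pi_apply i).comp measurable_snd))

theorem lintegral_cols {α β γ δ : Type*} [Fintype α] [Fintype β] [Fintype γ] [Fintype δ]
    (e : α ⊕ β ≃ γ) {f : Matrix δ γ ℝ → ENNReal} (hf : Measurable f) :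
    ∫⁻ g, f g = ∫⁻ C : Matrix δ α ℝ, ∫⁻ D : Matrix δ β ℝ, f (besideCols e C D) := by
  have h1 := (volume_measurePreserving_arrowProdEquivProdArrow (α → ℝ) (β → ℝ) δ).symm
  have h2 := volume_preserving_pi (fun _ : δ => measurePreserving_glue (E := ℝ) e)
  have h3 : MeasurePreserving (fun p : Matrix δ α ℝ × Matrix δ β ℝ => besideCols e p.1 p.2)
    volume volume := h2.comp h1
  rw [← h3.lintegral_comp hf]
  exact lintegral_prod _ (hf.comp h3.measurable).aemeasurable

/-- `Fin n × Fin 2 ≃ Fin (2 * n)` by `(a, b) ↦ 2 a + b`. -/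
def pairEquiv (n : ℕ) : Fin n × Fin 2 ≃ Fin (2 * n) where
  toFun p := ⟨2 * p.1.val + p.2.val, by omega⟩
  invFun i := (⟨i.val / 2, by omega⟩, ⟨i.val % 2, by omega⟩)
  left_inv p := by ext <;> simp <;> omega
  right_inv i := by ext; simp; omega

/-- Stack `2`-row blocks. -/
def stackBlocks {n : ℕ} {E : Type*} (w : Fin n → Fin 2 → E) : Fin (2 * n) → E :=
  fun i => w ((pairEquiv n).symm i).1 ((pairEquiv n).symm i).2

theorem measurePreserving_stackBlocks {n : ℕ} {E : Type*} [MeasureSpace E]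
    [SigmaFinite (volume : Measure E)] :
    MeasurePreserving (stackBlocks (n := n) (E := E)) volume volume := by
  have hm : Measurable (stackBlocks (n := n) (E := E)) :=
    measurable_pi_lambda _ fun i => (measurable_pi_apply _).comp (measurable_pi_apply _)
  refine ⟨hm, ?_⟩
  refine (Measure.pi_eq fun s hs => ?_).symm
  rw [Measure.map_apply hm (MeasurableSet.univ_pi hs)]
  have hpre : stackBlocks (n := n) (E := E) ⁻¹' Set.univ.pi s =
      Set.univ.pi fun a => Set.univ.pi fun b => s (pairEquiv n (a, b)) := by
    ext w
    simp only [Set.mem_preimage, Set.mem_univ_pi, stackBlocks]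
    constructor
    · intro h a b
      simpa using h (pairEquiv n (a, b))
    · intro h i
      simpa using h ((pairEquiv n).symm i).1 ((pairEquiv n).symm i).2
  rw [hpre, volume_pi_pi]
  simp only [volume_pi_pi]
  rw [← (pairEquiv n).prod_comp, Fintype.prod_prod_type]

/-- A matrix assembled from `2 × 2` blocks. -/
def ofBlocks {n : ℕ} (A : Fin n → Fin n → Matrix (Fin 2) (Fin 2) ℝ) :
    Matrix (Fin (2 * n)) (Fin (2 * n)) ℝ :=
  Matrix.of fun i j => A ((pairEquiv n).symm i).1 ((pairEquiv n).symm j).1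
    ((pairEquiv n).symm i).2 ((pairEquiv n).symm j).2

theorem ofBlocks_mul {n : ℕ} (A B : Fin n → Fin n → Matrix (Fin 2) (Fin 2) ℝ) :
    ofBlocks A * ofBlocks B = ofBlocks fun a b => ∑ c, A a c * B c b := by
  ext i j
  rw [Matrix.mul_apply, ← (pairEquiv n).sum_comp, Fintype.sum_prod_type]
  simp [ofBlocks, Matrix.sum_apply, Matrix.mul_apply]

theorem Tmat_eq_ofBlocks {n : ℕ}
    (c : {ij : Fin n × Fin n // ij.2 < ij.1} → Matrix (Fin 2) (Fin 2) ℝ) :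
    Tmat c = ofBlocks fun a b => if h : b < a then c ⟨(a, b), h⟩ else if a = b then 1 else 0 := by
  ext i j
  simp only [Tmat, ofBlocks, Matrix.of_apply, pairEquiv, Equiv.coe_fn_symm_mk]
  by_cases h : j.val / 2 < i.val / 2
  · simp [h]
  · by_cases h' : i.val / 2 = j.val / 2
    · have : (⟨i.val % 2, by omega⟩ : Fin 2) = ⟨j.val % 2, by omega⟩ ↔ i.val % 2 = j.val % 2 := by
        simp [Fin.ext_iff]
      simp [h', Matrix.one_apply, this]
    · have h2 : ¬ (⟨j.val / 2, by omega⟩ : Fin n) < ⟨i.val / 2, by omega⟩ := h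
      simp [h, h']

theorem Zmat_eq_ofBlocks {n : ℕ} (z : Fin n → Matrix (Fin 2) (Fin 2) ℝ) :
    Zmat z = ofBlocks fun a b => if a = b then z a else 0 := by
  ext i j
  simp only [Zmat, ofBlocks, Matrix.of_apply, pairEquiv, Equiv.coe_fn_symm_mk]
  by_cases h' : i.val / 2 = j.val / 2
  · simp [h']
  · simp [h']

theorem Tmat_mul_Zmat {n : ℕ}
    (c : {ij : Fin n × Fin n // ij.2 < ij.1} → Matrix (Fin 2) (Fin 2) ℝ)
    (z : Fin n → Matrix (Fin 2) (Fin 2) ℝ) :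
    Tmat c * Zmat z = ofBlocks fun a b => if h : b < a then c ⟨(a, b), h⟩ * z b else
      if a = b then z a else 0 := by
  rw [Tmat_eq_ofBlocks, Zmat_eq_ofBlocks, ofBlocks_mul]
  congr 1
  ext a b : 2
  rw [Finset.sum_eq_single b]
  · by_cases h : b < a
    · simp [h]
    · by_cases h' : a = b
      · simp [h']
      · simp [h, h']
  · intro k _ hk; simp [hk]
  · intro h; exact absurd (Finset.mem_univ _) h

/-- Splitting off the first two indices. -/
def headSplit (n : ℕ) : Fin 2 ⊕ Fin (2 * n) ≃ Fin (2 * (n + 1)) :=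
  finSumFinEquiv.trans (finCongr (by ring))

theorem headSplit_inl_val (n : ℕ) (i : Fin 2) : (headSplit n (Sum.inl i)).val = i.val := by
  simp [headSplit]

theorem headSplit_inr_val (n : ℕ) (i : Fin (2 * n)) :
    (headSplit n (Sum.inr i)).val = 2 + i.val := by
  simp [headSplit, add_comm]

theorem pairEquiv_symm_headSplit_inl (n : ℕ) (i : Fin 2) :
    (pairEquiv (n + 1)).symm (headSplit n (Sum.inl i)) = (0, i) := by
  rw [Equiv.symm_apply_eq]; ext; rw [headSplit_inl_val]; simp [pairEquiv]

theorem pairEquiv_symm_headSplit_inr (n : ℕ) (i : Fin (2 * n)) :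
    (pairEquiv (n + 1)).symm (headSplit n (Sum.inr i)) =
      (((pairEquiv n).symm i).1.succ, ((pairEquiv n).symm i).2) := by
  rw [Equiv.symm_apply_eq]; ext; rw [headSplit_inr_val]; simp [pairEquiv]; omega

/-- The strictly lower index pairs of size `n + 1`: the first column and the rest. -/
def lowerSplit (n : ℕ) : Fin n ⊕ {ij : Fin n × Fin n // ij.2 < ij.1} ≃
    {ij : Fin (n + 1) × Fin (n + 1) // ij.2 < ij.1} :=
  Equiv.ofBijective (Sum.elim (fun i => ⟨(i.succ, 0), Fin.succ_pos i⟩)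
    (fun p => ⟨(p.1.1.succ, p.1.2.succ), Fin.succ_lt_succ_iff.2 p.2⟩)) (by
    constructor
    · rintro (a | ⟨⟨a, b⟩, h⟩) (a' | ⟨⟨a', b'⟩, h'⟩) heq
      · simpa using heq
      · simp [(Fin.succ_ne_zero _).symm] at heq
      · simp at heq
      · simpa using heq
    · rintro ⟨⟨a, b⟩, h⟩
      rcases Fin.eq_zero_or_eq_succ a with rfl | ⟨a, rfl⟩
      · exact absurd h (Fin.not_lt_zero _)
      rcases Fin.eq_zero_or_eq_succ b with rfl | ⟨b, rfl⟩
      · exact ⟨Sum.inl a, rfl⟩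
      · exact ⟨Sum.inr ⟨(a, b), Fin.succ_lt_succ_iff.1 h⟩, rfl⟩)

theorem besideCols_headSplit {n : ℕ} (z : Matrix (Fin 2) (Fin 2) ℝ)
    (cc : Fin n → Matrix (Fin 2) (Fin 2) ℝ)
    (c : {ij : Fin n × Fin n // ij.2 < ij.1} → Matrix (Fin 2) (Fin 2) ℝ)
    (z' : Fin n → Matrix (Fin 2) (Fin 2) ℝ) :
    (Matrix.of (glue (headSplit n) (padRight (headSplit n) z,
      besideCols (headSplit n) ((Matrix.of (stackBlocks cc) : Matrix (Fin (2 * n)) (Fin 2) ℝ) * z)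
        (Tmat c * Zmat z'))) : Matrix (Fin (2 * (n + 1))) (Fin (2 * (n + 1))) ℝ) =
      Tmat (glue (lowerSplit n) (cc, c)) *
        Zmat (Fin.cons z z' : Fin (n + 1) → Matrix (Fin 2) (Fin 2) ℝ) := by
  rw [Tmat_mul_Zmat, Tmat_mul_Zmat]
  ext i j
  obtain ⟨s, rfl⟩ := (headSplit n).surjective i
  obtain ⟨t, rfl⟩ := (headSplit n).surjective j
  have h1 : ∀ (a : Fin n) (h : (0 : Fin (n + 1)) < a.succ),
      glue (lowerSplit n) (cc, c) ⟨(a.succ, 0), h⟩ = cc a := fun a h =>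
    glue_inl (lowerSplit n) (cc, c) a
  have h2 : ∀ (a b : Fin n) (h : b.succ < a.succ),
      glue (lowerSplit n) (cc, c) ⟨(a.succ, b.succ), h⟩ = c ⟨(a, b), Fin.succ_lt_succ_iff.1 h⟩ :=
    fun a b h => glue_inr (lowerSplit n) (cc, c) ⟨(a, b), Fin.succ_lt_succ_iff.1 h⟩
  rcases s with s | s <;> rcases t with t | t
  · simp [padRight, ofBlocks, pairEquiv_symm_headSplit_inl]
  · simp [padRight, ofBlocks, pairEquiv_symm_headSplit_inl, pairEquiv_symm_headSplit_inr,
      (Fin.succ_ne_zero _).symm]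
  · simp [besideCols, ofBlocks, pairEquiv_symm_headSplit_inl, pairEquiv_symm_headSplit_inr,
      h1, stackBlocks, Matrix.mul_apply]
  · simp only [besideCols, ofBlocks, pairEquiv_symm_headSplit_inr, Matrix.of_apply, glue_inr,
      Fin.succ_lt_succ_iff, h2, Fin.succ_inj, Fin.cons_succ]

theorem lintegral_mul_right_det {n : ℕ} {h : Matrix (Fin (2 * n)) (Fin 2) ℝ → ENNReal}
    (hh : Measurable h) {z : Matrix (Fin 2) (Fin 2) ℝ} (hz : z.det ≠ 0) :
    ∫⁻ C, h C = ENNReal.ofReal (|z.det| ^ (2 * n)) *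
      ∫⁻ cc : Fin n → Matrix (Fin 2) (Fin 2) ℝ,
        h ((Matrix.of (stackBlocks cc) : Matrix (Fin (2 * n)) (Fin 2) ℝ) * z) := by
  have h1 := map_mul_right_volume (l := Fin (2 * n)) z hz
  have hm : Measurable fun g : Matrix (Fin (2 * n)) (Fin 2) ℝ => g * z :=
    (by fun_prop : Continuous fun g : Matrix (Fin (2 * n)) (Fin 2) ℝ => g * z).measurable
  have h2 : ∫⁻ cc : Fin n → Matrix (Fin 2) (Fin 2) ℝ,
      h ((Matrix.of (stackBlocks cc) : Matrix (Fin (2 * n)) (Fin 2) ℝ) * z) =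
      ∫⁻ C : Matrix (Fin (2 * n)) (Fin 2) ℝ, h (C * z) :=
    (measurePreserving_stackBlocks (n := n) (E := Fin 2 → ℝ)).lintegral_comp (hh.comp hm)
  have hd : (0 : ℝ) < |z.det| ^ (2 * n) := pow_pos (abs_pos.2 hz) _
  rw [h2, ← lintegral_map hh hm, h1, lintegral_smul_measure, smul_eq_mul, ← mul_assoc,
    Fintype.card_fin, ← ENNReal.ofReal_mul hd.le, mul_inv_cancel₀ hd.ne', ENNReal.ofReal_one,
    one_mul]

theorem continuous_Tmat {n : ℕ} : Continuous (Tmat (n := n)) := by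
  refine continuous_matrix fun i j => ?_
  simp only [Tmat, Matrix.of_apply]
  split_ifs <;> fun_prop

theorem continuous_Zmat {n : ℕ} : Continuous (Zmat (n := n)) := by
  refine continuous_matrix fun i j => ?_
  simp only [Zmat, Matrix.of_apply]
  split_ifs <;> fun_prop

theorem measurable_Tmat_mul_Zmat {n : ℕ} : Measurable
    fun p : (Fin n → Matrix (Fin 2) (Fin 2) ℝ) ×
      ({ij : Fin n × Fin n // ij.2 < ij.1} → Matrix (Fin 2) (Fin 2) ℝ) => Tmat p.2 * Zmat p.1 := by
  have : Continuous fun p : (Fin n → Matrix (Fin 2) (Fin 2) ℝ) ×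
      ({ij : Fin n × Fin n // ij.2 < ij.1} → Matrix (Fin 2) (Fin 2) ℝ) => Tmat p.2 * Zmat p.1 :=
    (continuous_Tmat.comp continuous_snd).mul (continuous_Zmat.comp continuous_fst)
  exact this.measurable

end BlockLQ

end

noncomputable section

/-! ### Zero sets of functions that are polynomial along lines -/

section LinePoly

variable {E : Type*} [AddCommGroup E] [Module ℝ E]

/-- A function on a real vector space whose restriction to every line is a polynomial. -/
def LinePoly (f : E → ℝ) : Prop :=
  ∀ g h : E, ∃ p : Polynomial ℝ, ∀ t : ℝ, f (g + t • h) = p.eval t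

theorem LinePoly.const (c : ℝ) : LinePoly fun _ : E => c := fun _ _ => ⟨Polynomial.C c, by simp⟩

theorem LinePoly.mul {f₁ f₂ : E → ℝ} (h₁ : LinePoly f₁) (h₂ : LinePoly f₂) :
    LinePoly fun x => f₁ x * f₂ x := fun g h => by
  obtain ⟨p, hp⟩ := h₁ g h
  obtain ⟨q, hq⟩ := h₂ g h
  exact ⟨p * q, fun t => by simp only [hp, hq, Polynomial.eval_mul]⟩

theorem LinePoly.sum {ι : Type*} (s : Finset ι) {f : ι → E → ℝ} (hf : ∀ i ∈ s, LinePoly (f i)) :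
    LinePoly fun x => ∑ i ∈ s, f i x := fun g h => by
  choose! p hp using fun i (hi : i ∈ s) => hf i hi g h
  refine ⟨∑ i ∈ s, p i, fun t => ?_⟩
  rw [Polynomial.eval_finsetSum]
  exact Finset.sum_congr rfl fun i hi => hp i hi t

theorem LinePoly.prod {ι : Type*} (s : Finset ι) {f : ι → E → ℝ} (hf : ∀ i ∈ s, LinePoly (f i)) :
    LinePoly fun x => ∏ i ∈ s, f i x := fun g h => by
  choose! p hp using fun i (hi : i ∈ s) => hf i hi g h
  refine ⟨∏ i ∈ s, p i, fun t => ?_⟩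
  rw [Polynomial.eval_prod]
  exact Finset.prod_congr rfl fun i hi => hp i hi t

theorem LinePoly.det {m : Type*} [Fintype m] [DecidableEq m] {M : E → Matrix m m ℝ}
    (hM : ∀ i j, LinePoly fun x => M x i j) : LinePoly fun x => (M x).det := by
  simp only [Matrix.det_apply']
  exact LinePoly.sum _ fun σ _ => (LinePoly.const _).mul (LinePoly.prod _ fun i _ => hM _ _)

theorem LinePoly.matrix_mul {l m p : Type*} [Fintype m] {A : E → Matrix l m ℝ}
    {B : E → Matrix m p ℝ} (hA : ∀ i j, LinePoly fun x => A x i j)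
    (hB : ∀ i j, LinePoly fun x => B x i j) (i : l) (j : p) :
    LinePoly fun x => (A x * B x) i j := by
  simp only [Matrix.mul_apply]
  exact LinePoly.sum _ fun k _ => (hA i k).mul (hB k j)

theorem LinePoly.entry {l m : Type*} (i : l) (j : m) :
    LinePoly fun g : Matrix l m ℝ => g i j :=
  fun g h => ⟨Polynomial.C (g i j) + Polynomial.C (h i j) * Polynomial.X, fun t => by simp; ring⟩

theorem LinePoly.ae_ne_zero {E : Type*} [NormedAddCommGroup E] [NormedSpace ℝ E]
    [FiniteDimensional ℝ E] [MeasurableSpace E] [BorelSpace E] (μ : Measure E)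
    [μ.IsAddHaarMeasure] {f : E → ℝ} (hf : LinePoly f) (hm : Measurable f) {g₀ : E}
    (h0 : f g₀ ≠ 0) : ∀ᵐ x ∂μ, f x ≠ 0 := by
  set B : Set E := {h | f (g₀ + h) = 0} with hB
  have hBm : MeasurableSet B := (hm.comp (measurable_const_add g₀)) (measurableSet_singleton 0)
  have hline : ∀ h : E, volume {t : ℝ | t • h ∈ B} = 0 := by
    intro h
    obtain ⟨p, hp⟩ := hf g₀ h
    have hp0 : p ≠ 0 := by
      rintro rfl
      apply h0
      simpa using hp 0
    have : {t : ℝ | t • h ∈ B} ⊆ (p.roots.toFinset : Set ℝ) := by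
      intro t ht
      simp only [Finset.mem_coe, Multiset.mem_toFinset, Polynomial.mem_roots hp0]
      rw [Polynomial.IsRoot, ← hp]
      exact ht
    exact measure_mono_null this (Finset.measure_zero _ _)
  have hS : MeasurableSet {q : ℝ × E | q.1 • q.2 ∈ B} := (measurable_fst.smul measurable_snd) hBm
  have h1 : (volume.prod μ) {q : ℝ × E | q.1 • q.2 ∈ B} = 0 := by
    rw [Measure.prod_apply_symm hS]
    exact lintegral_eq_zero_of_ae_eq_zero (Filter.Eventually.of_forall hline)
  have h2 : ∀ᵐ t : ℝ, μ {h : E | t • h ∈ B} = 0 := Measure.ae_ae_of_ae_prod (p := fun q => q ∉ {q : ℝ × E | q.1 • q.2 ∈ B}) (by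
    simpa [ae_iff] using h1) |>.mono fun t ht => by simpa [ae_iff] using ht
  have h3 : ∀ᵐ t : ℝ, t ≠ 0 := by simp [ae_iff]
  obtain ⟨t, ht, ht0⟩ := (h2.and h3).exists
  have h4 : μ B = 0 := by
    have := Measure.addHaar_preimage_smul μ ht0 B
    rw [Set.preimage] at this
    rw [ht] at this
    rcases mul_eq_zero.1 this.symm with h | h
    · rw [ENNReal.ofReal_eq_zero] at h
      exact absurd h (not_le.2 (abs_pos.2 (inv_ne_zero (pow_ne_zero _ ht0))))
    · exact h
  have h5 := (measurePreserving_add_left μ (-g₀)).measure_preimage hBm.nullMeasurableSet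
  rw [ae_iff]
  rw [h4] at h5
  simpa [hB, Set.preimage] using h5

theorem LinePoly.ae_ne_zero_matrix {l m : Type*} [Fintype l] [Fintype m]
    {f : Matrix l m ℝ → ℝ} (hf : LinePoly f) (hm : Measurable f) {g₀ : Matrix l m ℝ}
    (h0 : f g₀ ≠ 0) : ∀ᵐ x : Matrix l m ℝ, f x ≠ 0 :=
  LinePoly.ae_ne_zero (E := l → m → ℝ) volume hf hm h0

theorem ae_det_ne_zero (m : Type*) [Fintype m] [DecidableEq m] :
    ∀ᵐ z : Matrix m m ℝ, z.det ≠ 0 :=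
  LinePoly.ae_ne_zero_matrix (LinePoly.det (M := fun z : Matrix m m ℝ => z) LinePoly.entry)
    (continuous_id.matrix_det).measurable (g₀ := 1) (by simp)

end LinePoly

/-! ### The block-triangular integration formula -/

section LQ

/-- The density of the diagonal blocks in block-triangular coordinates. -/
def lqWeight {n : ℕ} (z : Fin n → Matrix (Fin 2) (Fin 2) ℝ) : ENNReal :=
  ENNReal.ofReal (∏ j : Fin n, |(z j).det| ^ (4 * (n - 1 - j.val)))

theorem measurable_lqWeight {n : ℕ} : Measurable (lqWeight (n := n)) := by
  have : Continuous fun z : Fin n → Matrix (Fin 2) (Fin 2) ℝ =>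
      ∏ j : Fin n, |(z j).det| ^ (4 * (n - 1 - j.val)) :=
    continuous_finsetProd _ fun j _ => ((continuous_apply j).matrix_det.abs.pow _)
  exact this.measurable.ennreal_ofReal

theorem lqWeight_cons {n : ℕ} (z : Matrix (Fin 2) (Fin 2) ℝ)
    (z' : Fin n → Matrix (Fin 2) (Fin 2) ℝ) :
    lqWeight (Fin.cons z z' : Fin (n + 1) → Matrix (Fin 2) (Fin 2) ℝ) =
      ENNReal.ofReal (|z.det| ^ (4 * n)) * lqWeight z' := by
  rw [lqWeight, lqWeight, ← ENNReal.ofReal_mul (by positivity), Fin.prod_univ_succ]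
  congr 2
  refine Finset.prod_congr rfl fun j _ => ?_
  have : n + 1 - 1 - (j.val + 1) = n - 1 - j.val := by omega
  simp only [Fin.cons_succ, Fin.val_succ, this]

theorem glue_rows_mul {α β γ δ : Type*} [Fintype δ] (e : α ⊕ β ≃ γ) (R : Matrix α δ ℝ)
    (S : Matrix β δ ℝ) (k : Matrix δ δ ℝ) :
    (Matrix.of (glue e (R * k, S * k)) : Matrix γ δ ℝ) = Matrix.of (glue e (R, S)) * k := by
  ext i j
  obtain ⟨s, rfl⟩ := e.surjective i
  rcases s with s | s <;> simp [Matrix.mul_apply]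

theorem besideCols_mul_blockDiag {α β γ δ : Type*} [Fintype α] [Fintype β] [Fintype γ]
    [DecidableEq α] [DecidableEq β] [DecidableEq γ] (e : α ⊕ β ≃ γ)
    (C : Matrix δ α ℝ) (D : Matrix δ β ℝ) (k : Matrix β β ℝ) :
    besideCols e C D * blockDiag e 1 k = besideCols e C (D * k) := by
  ext i j
  have := congrFun (glue_vecMul_blockDiag e (C i, D i) 1 k) j
  simp only [Matrix.vecMul_one] at this
  exact this

theorem padRight_mul_blockDiag {β γ δ : Type*} [Fintype β] [Fintype γ] [DecidableEq β]
    [DecidableEq γ] (e : Fin 2 ⊕ β ≃ γ) (z : Matrix δ (Fin 2) ℝ) (k : Matrix β β ℝ) :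
    padRight e z * blockDiag e 1 k = padRight e z := by
  have := besideCols_mul_blockDiag e z (0 : Matrix δ β ℝ) k
  rwa [Matrix.zero_mul] at this

theorem lintegral_fin_cons {n : ℕ} {E : Type*} [MeasureSpace E] [SigmaFinite (volume : Measure E)]
    {f : (Fin (n + 1) → E) → ENNReal} (hf : Measurable f) :
    ∫⁻ z, f z = ∫⁻ z : E, ∫⁻ z' : Fin n → E, f (Fin.cons z z') := by
  have h := (volume_preserving_piFinSuccAbove (fun _ : Fin (n + 1) => E) 0).symm
  rw [← h.lintegral_comp hf]
  refine (lintegral_prod _ (hf.comp h.measurable).aemeasurable).trans ?_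
  refine lintegral_congr fun z => lintegral_congr fun z' => ?_
  exact congrArg f (Fin.insertNth_zero' z z')

theorem measurable_fin_cons {n : ℕ} {E : Type*} [MeasurableSpace E] :
    Measurable fun p : E × (Fin n → E) => (Fin.cons p.1 p.2 : Fin (n + 1) → E) := by
  refine measurable_pi_lambda _ fun i => ?_
  refine Fin.cases ?_ (fun i => ?_) i
  · simpa using measurable_fst
  · simp only [Fin.cons_succ]
    exact (measurable_pi_apply i).comp measurable_snd

theorem lintegral_lq_reassemble {E ι κ υ : Type*} [MeasureSpace E] [Fintype ι] [Fintype κ]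
    [Fintype υ] [SigmaFinite (volume : Measure E)] {n : ℕ} (e : ι ⊕ κ ≃ υ)
    {w : (Fin n → E) → ENNReal} (hw : Measurable w) {Φ : (Fin (n + 1) → E) × (υ → E) → ENNReal}
    (hΦ : Measurable Φ) (z : E) (C : ENNReal) :
    ∫⁻ cc : ι → E, C * ∫⁻ z' : Fin n → E, w z' *
      ∫⁻ c : κ → E, Φ (Fin.cons z z', glue e (cc, c)) =
    C * ∫⁻ z' : Fin n → E, w z' * ∫⁻ c, Φ (Fin.cons z z', c) := by
  have h0 : Measurable fun v : ((ι → E) × (Fin n → E)) × (κ → E) =>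
      Φ (Fin.cons z v.1.2, glue e (v.1.1, v.2)) := by
    refine hΦ.comp (Measurable.prodMk ?_ ?_)
    · exact measurable_fin_cons.comp (measurable_const.prodMk (measurable_snd.comp measurable_fst))
    · exact (measurePreserving_glue e).measurable.comp
        ((measurable_fst.comp measurable_fst).prodMk measurable_snd)
  have h1 : Measurable fun q : (ι → E) × (Fin n → E) => w q.2 *
      ∫⁻ c : κ → E, Φ (Fin.cons z q.2, glue e (q.1, c)) :=
    (hw.comp measurable_snd).mul h0.lintegral_prod_right'
  rw [lintegral_const_mul _ h1.lintegral_prod_right', lintegral_lintegral_swap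
    (f := fun cc z' => w z' * ∫⁻ c : κ → E, Φ (Fin.cons z z', glue e (cc, c))) h1.aemeasurable]
  congr 1
  refine lintegral_congr fun z' => ?_
  have hT : Measurable fun c => Φ (Fin.cons z z', c) :=
    hΦ.comp (measurable_const.prodMk measurable_id)
  rw [lintegral_const_mul, lintegral_glue e hT]
  exact (hT.comp (measurePreserving_glue e).measurable).lintegral_prod_right'

theorem exists_lintegral_lq (n : ℕ) : ∃ C : ENNReal,
    ∀ f : Matrix (Fin (2 * n)) (Fin (2 * n)) ℝ → ENNReal, Measurable f →
      (∀ g, ∀ k ∈ Matrix.orthogonalGroup (Fin (2 * n)) ℝ, f (g * k) = f g) →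
      ∫⁻ g, f g = C * ∫⁻ z : Fin n → Matrix (Fin 2) (Fin 2) ℝ, lqWeight z *
        ∫⁻ c, f (Tmat c * Zmat z) := by
  induction n with
  | zero =>
    refine ⟨1, fun f _ _ => ?_⟩
    have hM : (volume : Measure (Matrix (Fin (2 * 0)) (Fin (2 * 0)) ℝ)) Set.univ = 1 :=
      haveI : IsEmpty (Fin (2 * 0)) := by simpa using Fin.isEmpty
      Measure.pi_empty_univ _
    have hZ : (volume : Measure (Fin 0 → Matrix (Fin 2) (Fin 2) ℝ)) Set.univ = 1 :=
      Measure.pi_empty_univ _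
    have hC : (volume : Measure ({ij : Fin 0 × Fin 0 // ij.2 < ij.1} →
      Matrix (Fin 2) (Fin 2) ℝ)) Set.univ = 1 := Measure.pi_empty_univ _
    have hs : ∀ g, f g = f 0 := fun g => congrArg f (by ext i; exact absurd i.2 (by omega))
    simp [hs, hM, hZ, hC, lqWeight]
  | succ n ih =>
    obtain ⟨C, hC⟩ := ih
    obtain ⟨c₀, hc₀⟩ := exists_lintegral_padRight (headSplit n)
    refine ⟨c₀ * C, fun f hf hinv => ?_⟩
    have hI : Measurable fun R : Matrix (Fin 2) (Fin (2 * (n + 1))) ℝ =>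
        ∫⁻ S : Matrix (Fin (2 * n)) (Fin (2 * (n + 1))) ℝ,
          f (Matrix.of (glue (headSplit n) (R, S))) :=
      (hf.comp (measurable_glue_rows (headSplit n))).lintegral_prod_right'
    rw [lintegral_rows (headSplit n) hf, hc₀ _ hI ?_, mul_assoc]
    swap
    · intro R k hk
      have h1 := (measurePreserving_mul_right (l := Fin (2 * n)) hk)
      rw [← h1.lintegral_comp (f := fun S => f (Matrix.of (glue (headSplit n) (R * k, S))))
        (hf.comp ((measurable_glue_rows (headSplit n)).comp (measurable_const.prodMk measurable_id)))]
      simp only [glue_rows_mul, hinv _ _ hk]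
    congr 1
    have hTZ := hf.comp (measurable_Tmat_mul_Zmat (n := n + 1))
    have hG0 : Measurable fun z : Fin (n + 1) → Matrix (Fin 2) (Fin 2) ℝ =>
        ∫⁻ c, f (Tmat c * Zmat z) := hTZ.lintegral_prod_right'
    have hwG : Measurable fun z : Fin (n + 1) → Matrix (Fin 2) (Fin 2) ℝ =>
        lqWeight z * ∫⁻ c, f (Tmat c * Zmat z) := measurable_lqWeight.mul hG0
    rw [lintegral_fin_cons hwG,
      ← lintegral_const_mul]
    swap
    · exact (hwG.comp measurable_fin_cons).lintegral_prod_right'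
    refine lintegral_congr_ae ?_
    filter_upwards [ae_det_ne_zero (Fin 2)] with z hz
    have hfz : Measurable fun S : Matrix (Fin (2 * n)) (Fin (2 * (n + 1))) ℝ =>
        f (Matrix.of (glue (headSplit n) (padRight (headSplit n) z, S))) :=
      hf.comp ((measurable_glue_rows (headSplit n)).comp (measurable_const.prodMk measurable_id))
    have hfz2 : Measurable fun C : Matrix (Fin (2 * n)) (Fin 2) ℝ =>
        ∫⁻ D : Matrix (Fin (2 * n)) (Fin (2 * n)) ℝ,
          f (Matrix.of (glue (headSplit n) (padRight (headSplit n) z,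
            besideCols (headSplit n) C D))) :=
      (hfz.comp (measurable_besideCols (δ := Fin (2 * n)) (headSplit n))).lintegral_prod_right'
    rw [lintegral_cols (headSplit n) hfz, lintegral_mul_right_det hfz2 hz]
    have hkey : ∀ cc : Fin n → Matrix (Fin 2) (Fin 2) ℝ,
        ∫⁻ D, f (Matrix.of (glue (headSplit n) (padRight (headSplit n) z,
          besideCols (headSplit n)
            ((Matrix.of (stackBlocks cc) : Matrix (Fin (2 * n)) (Fin 2) ℝ) * z) D))) =
        C * ∫⁻ z' : Fin n → Matrix (Fin 2) (Fin 2) ℝ, lqWeight z' *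
          ∫⁻ c, f (Tmat (glue (lowerSplit n) (cc, c)) *
            Zmat (Fin.cons z z' : Fin (n + 1) → Matrix (Fin 2) (Fin 2) ℝ)) := by
      intro cc
      refine (hC _ (hfz.comp ((measurable_besideCols (headSplit n)).comp
        (measurable_const.prodMk measurable_id))) ?_).trans ?_
      rotate_left
      · simp only [← besideCols_headSplit]
        rfl
      · intro g k hk
        have hb := blockDiag_mem (headSplit n) (one_mem _) hk
        have := hinv (Matrix.of (glue (headSplit n) (padRight (headSplit n) z,
          besideCols (headSplit n)
            ((Matrix.of (stackBlocks cc) : Matrix (Fin (2 * n)) (Fin 2) ℝ) * z) g))) _ hb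
        rwa [← glue_rows_mul, besideCols_mul_blockDiag, padRight_mul_blockDiag] at this
    simp only [hkey]
    have hre := lintegral_lq_reassemble (lowerSplit n) (measurable_lqWeight (n := n)) hTZ z C
    refine (congrArg (fun t => ENNReal.ofReal (|z.det| ^ Fintype.card (Fin (2 * n))) *
      (ENNReal.ofReal (|z.det| ^ (2 * n)) * t)) hre).trans ?_
    simp only [Function.comp_apply]
    simp only [lqWeight_cons]
    simp only [mul_assoc]
    rw [lintegral_const_mul]
    swap
    · exact measurable_lqWeight.mul (hG0.comp (measurable_fin_cons.comp
        (measurable_const.prodMk measurable_id)))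
    rw [Fintype.card_fin, mul_left_comm C, ← mul_assoc (ENNReal.ofReal _), ← mul_assoc, ← mul_assoc,
      ← ENNReal.ofReal_mul (by positivity), ← pow_add, show 2 * n + 2 * n = 4 * n by ring]

/-- Lebesgue measure in block-triangular coordinates, followed by an orthogonal matrix. -/
theorem exists_volume_eq_map_lq (n : ℕ) : ∃ C : ENNReal,
    (volume : Measure (Matrix (Fin (2 * n)) (Fin (2 * n)) ℝ)) =
      C • (((volume : Measure (Fin n → Matrix (Fin 2) (Fin 2) ℝ)).withDensity lqWeight).prod
        ((volume : Measure ({ij : Fin n × Fin n // ij.2 < ij.1} → Matrix (Fin 2) (Fin 2) ℝ)).prod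
          (haarO (Fin (2 * n))))).map fun q => Tmat q.2.1 * Zmat q.1 * q.2.2.1 := by
  obtain ⟨C, hC⟩ := exists_lintegral_lq n
  refine ⟨C, Measure.ext_of_lintegral _ fun f hf => ?_⟩
  have hk : Measurable fun q : Matrix (Fin (2 * n)) (Fin (2 * n)) ℝ ×
      Matrix.orthogonalGroup (Fin (2 * n)) ℝ => q.1 * q.2.1 :=
    (by fun_prop : Continuous fun q : Matrix (Fin (2 * n)) (Fin (2 * n)) ℝ ×
      Matrix.orthogonalGroup (Fin (2 * n)) ℝ => q.1 * q.2.1).measurable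
  have hfk : Measurable fun q : Matrix (Fin (2 * n)) (Fin (2 * n)) ℝ ×
      Matrix.orthogonalGroup (Fin (2 * n)) ℝ => f (q.1 * q.2.1) := hf.comp hk
  have h1 : ∫⁻ g, f g = ∫⁻ g, ∫⁻ k, f (g * k.1) ∂(haarO (Fin (2 * n))) := by
    rw [lintegral_lintegral_swap (f := fun g (k : Matrix.orthogonalGroup (Fin (2 * n)) ℝ) => f (g * k.1)) hfk.aemeasurable]
    have : ∀ k : Matrix.orthogonalGroup (Fin (2 * n)) ℝ, ∫⁻ g, f (g * k.1) = ∫⁻ g, f g := fun k =>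
      (measurePreserving_mul_right k.2).lintegral_comp hf
    simp [this]
  have hΨ : Measurable fun q : (Fin n → Matrix (Fin 2) (Fin 2) ℝ) ×
      (({ij : Fin n × Fin n // ij.2 < ij.1} → Matrix (Fin 2) (Fin 2) ℝ) ×
        Matrix.orthogonalGroup (Fin (2 * n)) ℝ) => Tmat q.2.1 * Zmat q.1 * q.2.2.1 :=
    hk.comp ((measurable_Tmat_mul_Zmat.comp
      (measurable_fst.prodMk (measurable_fst.comp measurable_snd))).prodMk
        (measurable_snd.comp measurable_snd))
  have hfΨ : Measurable fun q : (Fin n → Matrix (Fin 2) (Fin 2) ℝ) ×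
      (({ij : Fin n × Fin n // ij.2 < ij.1} → Matrix (Fin 2) (Fin 2) ℝ) ×
        Matrix.orthogonalGroup (Fin (2 * n)) ℝ) => f (Tmat q.2.1 * Zmat q.1 * q.2.2.1) :=
    hf.comp hΨ
  rw [h1, hC _ hfk.lintegral_prod_right', lintegral_smul_measure, smul_eq_mul,
    lintegral_map hf hΨ, lintegral_prod _ hfΨ.aemeasurable,
    lintegral_withDensity_eq_lintegral_mul _ measurable_lqWeight
      hfΨ.lintegral_prod_right']
  · congr 1
    refine lintegral_congr fun z => ?_
    simp only [Pi.mul_apply]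
    congr 1
    rw [lintegral_prod]
    exact (hf.comp (hΨ.comp (measurable_const.prodMk measurable_id))).aemeasurable
  · intro g k hk
    have := lintegral_mul_left_eq_self (μ := haarO (Fin (2 * n))) (fun u => f (g * u.1))
      (⟨k, hk⟩ : Matrix.orthogonalGroup (Fin (2 * n)) ℝ)
    simpa [Matrix.mul_assoc] using this

end LQ

end

noncomputable section

/-! ### The functional equation of the minor powers -/

section FunctionalEquation

theorem det_ofBlocks_of_lower {n : ℕ} (A : Fin n → Fin n → Matrix (Fin 2) (Fin 2) ℝ)
    (hA : ∀ a b, a < b → A a b = 0) : (ofBlocks A).det = ∏ a, (A a a).det := by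
  have hT : Matrix.BlockTriangular (ofBlocks A)ᵀ fun i => ((pairEquiv n).symm i).1 := by
    intro i j hij
    simp [ofBlocks, hA _ _ hij]
  rw [← Matrix.det_transpose, hT.det_fintype]
  refine Finset.prod_congr rfl fun a _ => ?_
  let e : Fin 2 ≃ {i : Fin (2 * n) // ((pairEquiv n).symm i).1 = a} :=
    { toFun := fun t => ⟨pairEquiv n (a, t), by simp⟩
      invFun := fun i => ((pairEquiv n).symm i.1).2
      left_inv := fun t => by simp
      right_inv := fun i => by
        ext1
        obtain ⟨i, rfl⟩ := i
        simp }
  rw [← Matrix.det_submatrix_equiv_self e, ← Matrix.det_transpose (A a a)]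
  congr 1
  ext s t
  simp [Matrix.toSquareBlock_def, ofBlocks, e]

theorem corner_corner_ofBlocks {n : ℕ} (A : Fin (n + 1) → Fin (n + 1) → Matrix (Fin 2) (Fin 2) ℝ) :
    corner (M := 2 * n) (corner (M := 2 * n + 1) (ofBlocks A)) =
      ofBlocks fun a b => A a.castSucc b.castSucc := by
  ext i j
  rfl

theorem corner_corner_conj {n : ℕ} (A : Fin (n + 1) → Fin (n + 1) → Matrix (Fin 2) (Fin 2) ℝ)
    (hA : ∀ a b, a < b → A a b = 0) (X : Matrix (Fin (2 * (n + 1))) (Fin (2 * (n + 1))) ℝ) :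
    corner (M := 2 * n) (corner (M := 2 * n + 1) (ofBlocks A * X * (ofBlocks A)ᵀ)) =
      ofBlocks (fun a b => A a.castSucc b.castSucc) *
        corner (M := 2 * n) (corner (M := 2 * n + 1) X) *
          (ofBlocks fun a b => A a.castSucc b.castSucc)ᵀ := by
  have hz : ∀ (i : Fin (2 * n)) (j : Fin (2 * (n + 1))), 2 * n ≤ j.val →
      ofBlocks A ((i.castSucc : Fin (2 * n + 1)).castSucc : Fin (2 * n + 1 + 1)) j = 0 := by
    intro i j hj
    have : ((pairEquiv (n + 1)).symm ((i.castSucc : Fin (2 * n + 1)).castSucc : Fin (2 * n + 1 + 1))).1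
        < ((pairEquiv (n + 1)).symm j).1 := by
      rw [Fin.lt_def]
      show i.val / 2 < j.val / 2
      have := i.isLt
      omega
    simp [ofBlocks, hA _ _ this]
  have hs : ∀ f : Fin (2 * (n + 1)) → ℝ, (∀ j : Fin (2 * (n + 1)), 2 * n ≤ j.val → f j = 0) →
      ∑ j, f j = ∑ j : Fin (2 * n), f ((j.castSucc : Fin (2 * n + 1)).castSucc : Fin (2 * n + 1 + 1)) := by
    intro f hf
    have h1 := Fin.sum_univ_castSucc (n := 2 * n + 1) f
    rw [Fin.sum_univ_castSucc (n := 2 * n)] at h1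
    rw [hf (Fin.last (2 * n + 1)) (by simp), hf (Fin.castSucc (Fin.last (2 * n))) (by simp),
      add_zero, add_zero] at h1
    exact h1
  rw [← corner_corner_ofBlocks]
  ext i j
  simp only [corner, Matrix.submatrix_apply, Matrix.mul_apply, Matrix.transpose_apply]
  rw [hs _ fun l hl => by rw [hz j l hl, mul_zero]]
  refine Finset.sum_congr rfl fun l _ => ?_
  rw [hs _ fun q hq => by rw [hz i q hq, zero_mul]]

theorem minorPow_ofBlocks_conj : ∀ (n : ℕ) (μ : Fin n → ℂ)
    (A : Fin n → Fin n → Matrix (Fin 2) (Fin 2) ℝ), (∀ a b, a < b → A a b = 0) →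
    (∀ a, (A a a).det ≠ 0) → ∀ X : Matrix (Fin (2 * n)) (Fin (2 * n)) ℝ,
    minorPow n μ (ofBlocks A * X * (ofBlocks A)ᵀ) =
      (∏ a, ((|(A a a).det| : ℝ) : ℂ) ^ (2 * μ a)) * minorPow n μ X
  | 0, _, _, _, _, _ => by simp [minorPow]
  | n + 1, μ, A, hA, hd, X => by
    have hne : ∀ a, ((|(A a a).det| : ℝ) : ℂ) ≠ 0 := fun a => by simpa using hd a
    rw [minorPow, minorPow, corner_corner_conj A hA, minorPow_ofBlocks_conj n _
      (fun a b => A a.castSucc b.castSucc) (fun a b h => hA _ _ (by simpa using h))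
      (fun a => hd _)]
    have h1 : |(ofBlocks A * X * (ofBlocks A)ᵀ).det| =
        (∏ a, |(A a a).det| ^ 2) * |X.det| := by
      rw [Matrix.det_mul, Matrix.det_mul, Matrix.det_transpose, det_ofBlocks_of_lower A hA,
        abs_mul, abs_mul, Finset.abs_prod, Finset.prod_pow]
      ring
    have h2 : ∀ a, ((|(A a a).det| ^ 2 : ℝ) : ℂ) ^ μ (Fin.last n) =
        ((|(A a a).det| : ℝ) : ℂ) ^ (2 * μ (Fin.last n)) := by
      intro a
      rw [sq, Complex.ofReal_mul, Complex.mul_cpow_ofReal_nonneg (abs_nonneg _) (abs_nonneg _),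
        ← Complex.cpow_add _ _ (hne a)]
      ring_nf
    rw [h1, Complex.ofReal_mul, Complex.mul_cpow_ofReal_nonneg
      (Finset.prod_nonneg fun a _ => sq_nonneg _) (abs_nonneg _),
      ofReal_prod_cpow _ _ (fun a _ => sq_nonneg _)]
    simp only [h2]
    rw [Fin.prod_univ_castSucc, Fin.prod_univ_castSucc]
    have h3 : ∀ a : Fin n, ((|(A a.castSucc a.castSucc).det| : ℝ) : ℂ) ^ (2 * μ a.castSucc) =
        ((|(A a.castSucc a.castSucc).det| : ℝ) : ℂ) ^ (2 * μ (Fin.last n)) *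
          ((|(A a.castSucc a.castSucc).det| : ℝ) : ℂ) ^ (2 * (μ a.castSucc - μ (Fin.last n))) := by
      intro a
      rw [← Complex.cpow_add _ _ (hne _)]
      ring_nf
    simp only [h3, Finset.prod_mul_distrib]
    ring

theorem minorPow_lower_conj {n : ℕ} (μ : Fin n → ℂ)
    (c : {ij : Fin n × Fin n // ij.2 < ij.1} → Matrix (Fin 2) (Fin 2) ℝ)
    (z : Fin n → Matrix (Fin 2) (Fin 2) ℝ) (hz : ∀ j, (z j).det ≠ 0)
    (X : Matrix (Fin (2 * n)) (Fin (2 * n)) ℝ) :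
    minorPow n μ (Tmat c * Zmat z * X * (Tmat c * Zmat z)ᵀ) =
      (∏ a, ((|(z a).det| : ℝ) : ℂ) ^ (2 * μ a)) * minorPow n μ X := by
  rw [Tmat_mul_Zmat, minorPow_ofBlocks_conj]
  · simp
  · intro a b hab
    simp [hab.not_gt, hab.ne]
  · intro a
    simpa using hz a

/-- The law of `|det z|` under an integrable weight with determinant density `h`. -/
theorem IsDetDensity.map_eq {σw : Matrix (Fin 2) (Fin 2) ℝ → ℝ} {h : ℝ → ℝ}
    (hdet : IsDetDensity σw h) (hσ : ∀ z, 0 ≤ σw z) (hσi : Integrable σw)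
    (hh : IntegrableOn h (Set.Ioi 0)) :
    (volume.withDensity fun z => ENNReal.ofReal (σw z)).map (fun z => |z.det|) =
      (volume.restrict (Set.Ioi 0)).withDensity fun t => ENNReal.ofReal (h t) := by
  have hm : Measurable fun z : Matrix (Fin 2) (Fin 2) ℝ => |z.det| :=
    (continuous_id.matrix_det.abs).measurable
  have hh0 : 0 ≤ᵐ[volume.restrict (Set.Ioi (0 : ℝ))] h := by
    filter_upwards [ae_restrict_mem measurableSet_Ioi] with t ht using hdet.1 t ht
  ext s hs
  have key := hdet.2 (s.indicator 1) (measurable_one.indicator hs)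
    ⟨1, fun t => by by_cases ht : t ∈ s <;> simp [ht]⟩
  have e1 : ∀ z : Matrix (Fin 2) (Fin 2) ℝ, σw z * s.indicator 1 |z.det| =
      ((fun z : Matrix (Fin 2) (Fin 2) ℝ => |z.det|) ⁻¹' s).indicator σw z := by
    intro z
    by_cases hz : |z.det| ∈ s <;> simp [hz]
  have e2 : ∀ t, h t * s.indicator 1 t = s.indicator h t := by
    intro t
    by_cases hz : t ∈ s <;> simp [hz]
  simp only [e1, e2] at key
  rw [integral_indicator (hm hs), integral_indicator hs] at key
  rw [Measure.map_apply hm hs, withDensity_apply _ (hm hs), withDensity_apply _ hs,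
    ← ofReal_integral_eq_lintegral_ofReal hσi.integrableOn (Filter.Eventually.of_forall hσ),
    ← ofReal_integral_eq_lintegral_ofReal (Integrable.integrableOn hh) (ae_restrict_of_ae hh0), key]

theorem IsDetDensity.integral_eq {σw : Matrix (Fin 2) (Fin 2) ℝ → ℝ} {h : ℝ → ℝ}
    (hdet : IsDetDensity σw h) (hσ : ∀ z, 0 ≤ σw z) (hσi : Integrable σw)
    (hh : IntegrableOn h (Set.Ioi 0)) {ψ : ℝ → ℂ} (hψ : Measurable ψ) :
    ∫ z, (σw z : ℂ) * ψ |z.det| = ∫ t in Set.Ioi (0 : ℝ), (h t : ℂ) * ψ t := by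
  have hm : Measurable fun z : Matrix (Fin 2) (Fin 2) ℝ => |z.det| :=
    (continuous_id.matrix_det.abs).measurable
  have h1 := integral_map (μ := volume.withDensity fun z => ENNReal.ofReal (σw z)) hm.aemeasurable
    hψ.aestronglyMeasurable
  rw [hdet.map_eq hσ hσi hh, integral_withDensity_eq_integral_toReal_smul₀
    hσi.aemeasurable.ennreal_ofReal (Filter.Eventually.of_forall fun _ => ENNReal.ofReal_lt_top),
    integral_withDensity_eq_integral_toReal_smul₀
    (AEMeasurable.ennreal_ofReal hh.aemeasurable)
    (Filter.Eventually.of_forall fun _ => ENNReal.ofReal_lt_top)] at h1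
  have e1 : ∀ z, (ENNReal.ofReal (σw z)).toReal • ψ |z.det| = (σw z : ℂ) * ψ |z.det| := fun z => by
    rw [ENNReal.toReal_ofReal (hσ z)]; simp
  simp only [e1] at h1
  rw [← h1]
  refine setIntegral_congr_fun measurableSet_Ioi fun t ht => ?_
  simp only [ENNReal.toReal_ofReal (hdet.1 t ht)]
  simp

theorem lqWeight_factor {n : ℕ} (μ : Fin n → ℂ) (z : Fin n → Matrix (Fin 2) (Fin 2) ℝ)
    (hz : ∀ j, (z j).det ≠ 0) :
    ((lqWeight z).toReal : ℂ) * ∏ a, ((|(z a).det| : ℝ) : ℂ) ^ (2 * μ a) =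
      ((∏ j : Fin n, (z j * (z j)ᵀ).det ^ (n - 1 - j.val) : ℝ) : ℂ) *
        ∏ a, ((|(z a).det| : ℝ) : ℂ) ^ (2 * kap μ a) := by
  rw [lqWeight, ENNReal.toReal_ofReal (Finset.prod_nonneg fun j _ => by positivity),
    Complex.ofReal_prod, Complex.ofReal_prod, ← Finset.prod_mul_distrib, ← Finset.prod_mul_distrib]
  refine Finset.prod_congr rfl fun j _ => ?_
  have hne : ((|(z j).det| : ℝ) : ℂ) ≠ 0 := by simpa using hz j
  have h1 : (2 * kap μ j) = ((2 * (n - 1 - j.val) : ℕ) : ℂ) + 2 * μ j := by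
    have := j.isLt
    rw [kap, show n - 1 - j.val = n - (1 + j.val) by omega]
    push_cast [Nat.cast_sub (show 1 + j.val ≤ n by omega)]
    ring
  have h2 : (z j * (z j)ᵀ).det = |(z j).det| ^ 2 := by
    rw [Matrix.det_mul, Matrix.det_transpose, sq_abs, sq]
  rw [h1, Complex.cpow_add _ _ hne, Complex.cpow_natCast, h2]
  push_cast
  rw [← mul_assoc, ← pow_mul, ← pow_add]
  ring_nf

theorem exists_integral_mul_minorPow {n : ℕ} {P : Matrix (Fin (2 * n)) (Fin (2 * n)) ℝ → ℝ}
    {σw : Matrix (Fin 2) (Fin 2) ℝ → ℝ} (hfac : IsFactorizing n P σw) :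
    ∃ C : ℝ, ∀ μ : Fin n → ℂ, (∀ j, (μ j).re = 0) → ∀ X,
      ∫ g, (P g : ℂ) * minorPow n μ (g * X * gᵀ) = C * (orbAvg (minorPow n μ) X *
        ∏ j, ∫ z : Matrix (Fin 2) (Fin 2) ℝ, (σw z : ℂ) * ((|z.det| : ℝ) : ℂ) ^ (2 * kap μ j)) := by
  obtain ⟨C, hC⟩ := exists_volume_eq_map_lq n
  have hΨ : Measurable fun q : (Fin n → Matrix (Fin 2) (Fin 2) ℝ) ×
      (({ij : Fin n × Fin n // ij.2 < ij.1} → Matrix (Fin 2) (Fin 2) ℝ) ×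
        Matrix.orthogonalGroup (Fin (2 * n)) ℝ) => Tmat q.2.1 * Zmat q.1 * q.2.2.1 := by
    have : Continuous fun q : (Fin n → Matrix (Fin 2) (Fin 2) ℝ) ×
      (({ij : Fin n × Fin n // ij.2 < ij.1} → Matrix (Fin 2) (Fin 2) ℝ) ×
        Matrix.orthogonalGroup (Fin (2 * n)) ℝ) => Tmat q.2.1 * Zmat q.1 * q.2.2.1 :=
      ((continuous_Tmat.comp (continuous_fst.comp continuous_snd)).mul
        (continuous_Zmat.comp continuous_fst)).mul
          (continuous_subtype_val.comp (continuous_snd.comp continuous_snd))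
    exact this.measurable
  set ν := ((volume : Measure (Fin n → Matrix (Fin 2) (Fin 2) ℝ)).withDensity lqWeight).prod
        ((volume : Measure ({ij : Fin n × Fin n // ij.2 < ij.1} → Matrix (Fin 2) (Fin 2) ℝ)).prod
          (haarO (Fin (2 * n)))) with hν
  have hone : ∫⁻ g, ENNReal.ofReal (P g) = 1 := by
    rw [← ofReal_integral_eq_lintegral_ofReal hfac.integrable
      (Filter.Eventually.of_forall hfac.nonneg), hfac.prob, ENNReal.ofReal_one]
  rw [hC, lintegral_smul_measure, smul_eq_mul] at hone
  have hC0 : C ≠ 0 := by rintro rfl; simp at hone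
  have hCt : C ≠ ⊤ := by
    rintro rfl
    rw [ENNReal.top_mul'] at hone
    split_ifs at hone <;> simp at hone
  refine ⟨C.toReal, fun μ hμ X => ?_⟩
  have hF : Measurable fun g : Matrix (Fin (2 * n)) (Fin (2 * n)) ℝ => minorPow n μ (g * X * gᵀ) :=
    (measurable_minorPow n μ).comp (by fun_prop :
      Continuous fun g : Matrix (Fin (2 * n)) (Fin (2 * n)) ℝ => g * X * gᵀ).measurable
  have hint : Integrable (fun g => (P g : ℂ) * minorPow n μ (g * X * gᵀ)) :=
    hfac.integrable.ofReal.mul_bdd (c := 1) hF.aestronglyMeasurable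
      (Filter.Eventually.of_forall fun g => norm_minorPow_le n μ hμ _)
  have hint' : Integrable (fun g => (P g : ℂ) * minorPow n μ (g * X * gᵀ))
      (ν.map fun q => Tmat q.2.1 * Zmat q.1 * q.2.2.1) := by
    rw [hC] at hint
    exact (integrable_smul_measure hC0 hCt).1 hint
  rw [hC, integral_smul_measure, integral_map hΨ.aemeasurable hint'.1]
  have hint2 : Integrable (fun q : (Fin n → Matrix (Fin 2) (Fin 2) ℝ) ×
      (({ij : Fin n × Fin n // ij.2 < ij.1} → Matrix (Fin 2) (Fin 2) ℝ) ×
        Matrix.orthogonalGroup (Fin (2 * n)) ℝ) => (P (Tmat q.2.1 * Zmat q.1 * q.2.2.1) : ℂ) *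
      minorPow n μ (Tmat q.2.1 * Zmat q.1 * q.2.2.1 * X * (Tmat q.2.1 * Zmat q.1 * q.2.2.1)ᵀ)) ν :=
    hint'.comp_measurable hΨ
  rw [hν, integral_prod _ hint2, integral_withDensity_eq_integral_toReal_smul₀
    measurable_lqWeight.aemeasurable
    (Filter.Eventually.of_forall fun _ => ENNReal.ofReal_lt_top), Complex.real_smul]
  congr 1
  rw [← integral_fintype_prod_volume_eq_prod, ← integral_const_mul]
  refine integral_congr_ae ?_
  have hdz : ∀ᵐ z : Fin n → Matrix (Fin 2) (Fin 2) ℝ, ∀ j, (z j).det ≠ 0 :=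
    ae_all_iff.2 fun j => (Measure.quasiMeasurePreserving_eval
      (fun _ : Fin n => (volume : Measure (Matrix (Fin 2) (Fin 2) ℝ))) j).ae
        (ae_det_ne_zero (Fin 2))
  filter_upwards [hdz, hfac.factor] with z hz hzf
  have h1 : ∀ q : ({ij : Fin n × Fin n // ij.2 < ij.1} → Matrix (Fin 2) (Fin 2) ℝ) ×
        Matrix.orthogonalGroup (Fin (2 * n)) ℝ,
      (P (Tmat q.1 * Zmat z * q.2.1) : ℂ) *
        minorPow n μ (Tmat q.1 * Zmat z * q.2.1 * X * (Tmat q.1 * Zmat z * q.2.1)ᵀ) =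
      (((∏ a, ((|(z a).det| : ℝ) : ℂ) ^ (2 * μ a))) * (P (Tmat q.1 * Zmat z) : ℂ)) *
        minorPow n μ (q.2.1 * X * q.2.1ᵀ) := by
    intro q
    have hP : P (Tmat q.1 * Zmat z * q.2.1) = P (Tmat q.1 * Zmat z) := by
      have := hfac.invariant (Tmat q.1 * Zmat z) 1 (one_mem _) q.2.1 q.2.2
      rwa [Matrix.one_mul] at this
    have hX : Tmat q.1 * Zmat z * q.2.1 * X * (Tmat q.1 * Zmat z * q.2.1)ᵀ =
        Tmat q.1 * Zmat z * (q.2.1 * X * q.2.1ᵀ) * (Tmat q.1 * Zmat z)ᵀ := by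
      rw [Matrix.transpose_mul (Tmat q.1 * Zmat z)]
      simp only [Matrix.mul_assoc]
    rw [hP, hX, minorPow_lower_conj μ q.1 z hz]
    ring
  simp only [h1]
  rw [integral_prod_mul (fun c => (∏ a, ((|(z a).det| : ℝ) : ℂ) ^ (2 * μ a)) *
      (P (Tmat c * Zmat z) : ℂ))
    (fun k : Matrix.orthogonalGroup (Fin (2 * n)) ℝ => minorPow n μ (k.1 * X * k.1ᵀ)),
    integral_const_mul, integral_complex_ofReal, Complex.real_smul]
  have h2 := lqWeight_factor μ z hz
  have h3 := congrArg (fun t : ℝ => (t : ℂ)) hzf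
  simp only [Complex.ofReal_mul, Complex.ofReal_prod (f := fun j => σw (z j))] at h3
  rw [Finset.prod_mul_distrib, ← h3, orbAvg]
  linear_combination (∫ c, P (Tmat c * Zmat z) : ℝ) *
    (∫ k, minorPow n μ (k.1 * X * k.1ᵀ) ∂(haarO (Fin (2 * n)))) * h2

theorem minorPow_zero : ∀ (n : ℕ) (X : Matrix (Fin (2 * n)) (Fin (2 * n)) ℝ),
    minorPow n 0 X = 1
  | 0, _ => rfl
  | n + 1, X => by
    rw [minorPow]
    have : (fun j : Fin n => (0 : Fin (n + 1) → ℂ) j.castSucc - (0 : Fin (n + 1) → ℂ) (Fin.last n))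
      = 0 := by ext; simp
    rw [this, minorPow_zero n]
    simp

/-- The complex Mellin transform `∫ h(t) t^s dt`. -/
def mellC (h : ℝ → ℝ) (s : ℂ) : ℂ := ∫ t in Set.Ioi (0 : ℝ), (h t : ℂ) * (t : ℂ) ^ s

theorem mellC_ofReal (h : ℝ → ℝ) (s : ℝ) : mellC h s = (mellH h (s + 1) : ℂ) := by
  rw [mellC, mellH, ← integral_complex_ofReal]
  refine setIntegral_congr_fun measurableSet_Ioi fun t ht => ?_
  simp only [add_sub_cancel_right]
  push_cast
  rw [Complex.ofReal_cpow (le_of_lt ht)]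

theorem IsFactorizing.integrable_weight {σw : Matrix (Fin 2) (Fin 2) ℝ → ℝ} {h : ℝ → ℝ}
    (hdet : IsDetDensity σw h) (hh : 0 < mellH h 1) : Integrable σw := by
  by_contra hni
  have := hdet.2 (fun _ => 1) measurable_const ⟨1, by simp⟩
  simp only [mul_one] at this
  rw [integral_undef hni] at this
  simp [mellH, ← this] at hh

theorem integral_mul_minorPow {n : ℕ} {P : Matrix (Fin (2 * n)) (Fin (2 * n)) ℝ → ℝ}
    {σw : Matrix (Fin 2) (Fin 2) ℝ → ℝ} (hfac : IsFactorizing n P σw) {h : ℝ → ℝ}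
    (hdet : IsDetDensity σw h) (hh : IntegrableOn h (Set.Ioi 0)) (h1 : 0 < mellH h 1)
    {μ : Fin n → ℂ} (hμ : ∀ j, (μ j).re = 0) (X : Matrix (Fin (2 * n)) (Fin (2 * n)) ℝ) :
    (∫ g, (P g : ℂ) * minorPow n μ (g * X * gᵀ)) *
      ∏ j : Fin n, (mellH h (2 * ((j.val : ℝ) + 1) - 1) : ℂ) =
    orbAvg (minorPow n μ) X * ∏ j, mellC h (2 * kap μ j) := by
  obtain ⟨C, hC⟩ := exists_integral_mul_minorPow hfac
  have hσi := IsFactorizing.integrable_weight hdet h1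
  have hm : ∀ s : ℂ, ∫ z : Matrix (Fin 2) (Fin 2) ℝ, (σw z : ℂ) * ((|z.det| : ℝ) : ℂ) ^ s =
      mellC h s := fun s => hdet.integral_eq hfac.wnonneg hσi hh
        (Complex.measurable_ofReal.pow_const s)
  simp only [hm] at hC
  have h0 := hC 0 (by simp) X
  have hO : orbAvg (minorPow n 0) X = 1 := by simp [orbAvg, minorPow_zero]
  simp only [minorPow_zero, mul_one, hO, one_mul] at h0
  rw [integral_complex_ofReal, hfac.prob] at h0
  have hk : ∏ j, mellC h (2 * kap (0 : Fin n → ℂ) j) =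
      ∏ j : Fin n, (mellH h (2 * ((j.val : ℝ) + 1) - 1) : ℂ) := by
    rw [← Equiv.prod_comp Fin.revPerm]
    refine Finset.prod_congr rfl fun j _ => ?_
    have : 2 * kap (0 : Fin n → ℂ) (Fin.revPerm j) = ((2 * (j.val : ℝ) : ℝ) : ℂ) := by
      rw [kap, Fin.revPerm_apply, Fin.val_rev]
      have := j.isLt
      push_cast [Nat.cast_sub (show j.val + 1 ≤ n by omega)]
      simp
    rw [this, mellC_ofReal]
    congr 2; ring
  rw [hk] at h0
  rw [hC μ hμ X]
  push_cast at h0 ⊢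
  linear_combination (-(orbAvg (minorPow n μ) X * ∏ j, mellC h (2 * kap μ j))) * h0

end FunctionalEquation

end

noncomputable section

/-! ### The spectral parameters of an antisymmetric matrix -/

section SpecParam

variable {n : ℕ}

theorem Dmat_eq_Dcan {a : Fin n → ℝ} {b : ℕ → ℝ} (h : ∀ i : Fin n, b i = a i) :
    Dmat a = Dcan (2 * n) b := by
  ext i j
  simp only [Dmat, Matrix.of_apply, Dcan_apply]
  rw [← h]

theorem Dmat_transpose (a : Fin n → ℝ) : (Dmat a)ᵀ = -Dmat a := by
  rw [Dmat_eq_Dcan (b := fun l => if h : l < n then a ⟨l, h⟩ else 0) (fun i => by simp),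
    Dcan_transpose]

theorem Dmat_mul_transpose (a : Fin n → ℝ) : Dmat a * (Dmat a)ᵀ =
    Matrix.diagonal fun i : Fin (2 * n) => a ⟨i.val / 2, by omega⟩ ^ 2 := by
  rw [Dmat_eq_Dcan (b := fun l => if h : l < n then a ⟨l, h⟩ else 0) (fun i => by simp),
    Dcan_mul_transpose _ _ _ (by omega)]
  congr 1
  ext i
  rw [dif_pos (by omega : i.val / 2 < n), sq]

theorem Dmat_eq_rootExt {a : Fin n → ℝ} (ha : ∀ i, 0 ≤ a i) :
    Dmat a = Dcan (2 * n) (rootExt fun i => a i ^ 2) :=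
  Dmat_eq_Dcan fun i => by rw [rootExt_apply, Real.sqrt_sq (ha i)]

theorem continuous_Dmat : Continuous (Dmat (n := n)) := by
  refine continuous_matrix fun i j => ?_
  simp only [Dmat, Matrix.of_apply]
  split_ifs <;> fun_prop

theorem abs_det_Dmat {a : Fin n → ℝ} (ha : ∀ i, 0 ≤ a i) : |(Dmat a).det| = ∏ i, a i ^ 2 := by
  rw [Dmat_eq_rootExt ha, det_Dcan_two_mul _ fun i => sq_nonneg _]

theorem exists_Dmat_form {X : Matrix (Fin (2 * n)) (Fin (2 * n)) ℝ} (hX : Xᵀ = -X) :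
    ∃ a : Fin n → ℝ, Monotone a ∧ (∀ i, 0 ≤ a i) ∧
      ∃ k ∈ Matrix.orthogonalGroup (Fin (2 * n)) ℝ, X = k * Dmat a * kᵀ := by
  obtain ⟨k, hk, b, hb, hX⟩ := exists_canonical_form hX
  refine ⟨fun i => b i, fun i j hij => hb.2.1 _ _ hij (by omega), fun i => hb.1 _, k, hk, ?_⟩
  rw [hX, ← Dmat_eq_Dcan fun _ => rfl]

theorem Dmat_form_unique {a a' : Fin n → ℝ} (ha : Monotone a) (ha0 : ∀ i, 0 ≤ a i)
    (ha' : Monotone a') (ha0' : ∀ i, 0 ≤ a' i) {k k' : Matrix (Fin (2 * n)) (Fin (2 * n)) ℝ}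
    (hk : k ∈ Matrix.orthogonalGroup (Fin (2 * n)) ℝ)
    (hk' : k' ∈ Matrix.orthogonalGroup (Fin (2 * n)) ℝ)
    (h : k * Dmat a * kᵀ = k' * Dmat a' * k'ᵀ) : a = a' := by
  have key : ∀ {a : Fin n → ℝ} (_ : ∀ i, 0 ≤ a i) {k : Matrix (Fin (2 * n)) (Fin (2 * n)) ℝ}
      (_ : k ∈ Matrix.orthogonalGroup (Fin (2 * n)) ℝ) (z : ℝ),
      (Matrix.scalar (Fin (2 * n)) z - k * Dmat a * kᵀ).det ^ 2 =
        (∏ l, (z ^ 2 + a l ^ 2)) ^ 2 := by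
    intro a ha k hk z
    rw [Dmat_eq_rootExt ha, sq_det_sub_antisymm (by omega) hk,
      prod_fin_two_mul n fun l => z ^ 2 + rootExt (fun i => a i ^ 2) l ^ 2]
    simp only [rootExt_apply, Real.sqrt_sq (ha _)]
  have hsq : (fun l => a l ^ 2) = fun l => a' l ^ 2 := by
    refine monotone_eq_of_prod_eq (fun i j hij => pow_le_pow_left₀ (ha0 i) (ha hij) 2)
      (fun i j hij => pow_le_pow_left₀ (ha0' i) (ha' hij) 2) fun z hz => ?_
    have h1 := key ha0 hk z
    rw [h, key ha0' hk' z] at h1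
    exact ((pow_left_inj₀ (by positivity) (by positivity) two_ne_zero).1 h1).symm
  ext i
  exact (pow_left_inj₀ (ha0 i) (ha0' i) two_ne_zero).1 (congrFun hsq i)

/-- The ordered nonnegative spectral parameters of an antisymmetric matrix. -/
def specParam (X : Matrix (Fin (2 * n)) (Fin (2 * n)) ℝ) : Fin n → ℝ :=
  open Classical in if h : Xᵀ = -X then (exists_Dmat_form h).choose else 0

theorem specParam_spec {X : Matrix (Fin (2 * n)) (Fin (2 * n)) ℝ} (hX : Xᵀ = -X) :
    Monotone (specParam X) ∧ (∀ i, 0 ≤ specParam X i) ∧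
      ∃ k ∈ Matrix.orthogonalGroup (Fin (2 * n)) ℝ, X = k * Dmat (specParam X) * kᵀ := by
  rw [specParam, dif_pos hX]
  exact (exists_Dmat_form hX).choose_spec

theorem measurable_specParam : Measurable (specParam (n := n)) := by
  refine measurable_of_isClosed fun C hC => ?_
  have hanti : MeasurableSet {X : Matrix (Fin (2 * n)) (Fin (2 * n)) ℝ | Xᵀ = -X} :=
    (isClosed_eq (by fun_prop) (by fun_prop)).measurableSet
  let Φ : Matrix.orthogonalGroup (Fin (2 * n)) ℝ × (Fin n → ℝ) → Matrix (Fin (2 * n)) (Fin (2 * n)) ℝ :=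
    fun q => q.1.1 * Dmat q.2 * q.1.1ᵀ
  have hΦ : Continuous Φ := by
    have := continuous_Dmat (n := n)
    fun_prop
  have hch : IsClosed {a : Fin n → ℝ | Monotone a ∧ ∀ i, 0 ≤ a i} := by
    simp only [Monotone, Set.setOf_and, Set.setOf_forall]
    refine IsClosed.inter ?_ ?_
    · exact isClosed_iInter fun i => isClosed_iInter fun j => isClosed_iInter fun _ =>
        isClosed_le (continuous_apply i) (continuous_apply j)
    · exact isClosed_iInter fun i => isClosed_le continuous_const (continuous_apply i)
  have hpre : specParam (n := n) ⁻¹' C = (⋃ m : ℕ, Φ '' (Set.univ ×ˢ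
      (C ∩ {a : Fin n → ℝ | Monotone a ∧ ∀ i, 0 ≤ a i} ∩ Metric.closedBall 0 m))) ∪
      ({X | Xᵀ = -X}ᶜ ∩ {_X | (0 : Fin n → ℝ) ∈ C}) := by
    ext X
    simp only [Set.mem_preimage, Set.mem_union, Set.mem_iUnion, Set.mem_image, Set.mem_prod,
      Set.mem_univ, true_and, Set.mem_inter_iff, Set.mem_compl_iff, Set.mem_setOf_eq, Prod.exists]
    by_cases hX : Xᵀ = -X
    · obtain ⟨h1, h2, k, hk, h3⟩ := specParam_spec hX
      constructor
      · intro hXC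
        obtain ⟨m, hm⟩ := exists_nat_ge (dist (specParam X) 0)
        exact Or.inl ⟨m, ⟨k, hk⟩, specParam X, ⟨⟨hXC, h1, h2⟩, hm⟩, h3.symm⟩
      · rintro (⟨m, k', a, ⟨⟨haC, ha1, ha2⟩, -⟩, ha3⟩ | ⟨h, -⟩)
        · have := Dmat_form_unique ha1 ha2 h1 h2 k'.2 hk (ha3.trans h3)
          rwa [← this]
        · exact absurd hX h
    · constructor
      · intro h
        refine Or.inr ⟨hX, ?_⟩
        rwa [specParam, dif_neg hX] at h
      · rintro (⟨m, k', a, -, ha3⟩ | ⟨-, h⟩)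
        · exact absurd (ha3 ▸ transpose_conj_antisymm (Dmat_transpose a) k'.1) hX
        · rwa [specParam, dif_neg hX]
  rw [hpre]
  refine MeasurableSet.union (MeasurableSet.iUnion fun m => ?_)
    (hanti.compl.inter (MeasurableSet.const _))
  refine (IsCompact.image ?_ hΦ).isClosed.measurableSet
  exact isCompact_univ.prod ((isCompact_closedBall _ _).inter_left (hC.inter hch))

/-- The matrix `g D(1) gᵀ`. -/
def stdConj (g : Matrix (Fin (2 * n)) (Fin (2 * n)) ℝ) : Matrix (Fin (2 * n)) (Fin (2 * n)) ℝ :=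
  g * Dmat (fun _ => 1) * gᵀ

theorem continuous_stdConj : Continuous (stdConj (n := n)) := by
  unfold stdConj; fun_prop

theorem stdConj_transpose (g : Matrix (Fin (2 * n)) (Fin (2 * n)) ℝ) :
    (stdConj g)ᵀ = -stdConj g :=
  transpose_conj_antisymm (Dmat_transpose _) g

theorem linePoly_stdConj (i j : Fin (2 * n)) : LinePoly fun g => stdConj g i j :=
  LinePoly.matrix_mul (A := fun g => g * Dmat fun _ : Fin n => (1 : ℝ)) (B := fun g => gᵀ)
    (LinePoly.matrix_mul (A := fun g => g) (B := fun _ => Dmat fun _ : Fin n => (1 : ℝ))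
      LinePoly.entry fun _ _ => LinePoly.const _)
    (fun i j => LinePoly.entry j i) i j

theorem LinePoly.matrix_pow {E : Type*} [AddCommGroup E] [Module ℝ E] {m : Type*} [Fintype m]
    [DecidableEq m] {A : E → Matrix m m ℝ} (hA : ∀ i j, LinePoly fun x => A x i j) (r : ℕ) :
    ∀ i j, LinePoly fun x => (A x ^ r) i j := by
  induction r with
  | zero => exact fun i j => by simpa using LinePoly.const _
  | succ r ih => exact fun i j => by simpa only [pow_succ] using LinePoly.matrix_mul ih hA i j

/-- The Hankel determinant of the power sums of the squared spectral parameters. -/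
def powerSumDet (X : Matrix (Fin (2 * n)) (Fin (2 * n)) ℝ) : ℝ :=
  (Matrix.of fun i j : Fin n => ((X * Xᵀ) ^ (i.val + j.val)).trace).det

theorem sum_fin_two_mul (n : ℕ) (f : Fin n → ℝ) :
    ∑ i : Fin (2 * n), f ⟨i.val / 2, by omega⟩ = 2 * ∑ l, f l := by
  rw [← (pairEquiv n).sum_comp, Fintype.sum_prod_type, Finset.mul_sum]
  refine Finset.sum_congr rfl fun l _ => ?_
  have : ∀ t : Fin 2, (⟨(pairEquiv n (l, t)).val / 2, by omega⟩ : Fin n) = l := fun t => by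
    ext; simp [pairEquiv]; omega
  simp only [this]
  simp

theorem powerSumDet_conj {a : Fin n → ℝ} {k : Matrix (Fin (2 * n)) (Fin (2 * n)) ℝ}
    (hk : k ∈ Matrix.orthogonalGroup (Fin (2 * n)) ℝ) :
    powerSumDet (k * Dmat a * kᵀ) = 2 ^ n * vdm (fun i => a i ^ 2) ^ 2 := by
  have h1 : k * Dmat a * kᵀ * (k * Dmat a * kᵀ)ᵀ =
      k * (Matrix.diagonal fun i : Fin (2 * n) => a ⟨i.val / 2, by omega⟩ ^ 2) * kᵀ := by
    rw [← Dmat_mul_transpose, Matrix.transpose_mul, Matrix.transpose_mul,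
      Matrix.transpose_transpose]
    calc _ = k * Dmat a * (kᵀ * k) * ((Dmat a)ᵀ * kᵀ) := by simp only [Matrix.mul_assoc]
      _ = _ := by rw [orthogonal_transpose_mul hk, Matrix.mul_one]; simp only [Matrix.mul_assoc]
  have h2 : ∀ r : ℕ, (k * (Matrix.diagonal fun i : Fin (2 * n) => a ⟨i.val / 2, by omega⟩ ^ 2) *
      kᵀ) ^ r = k * (Matrix.diagonal fun i : Fin (2 * n) => (a ⟨i.val / 2, by omega⟩ ^ 2) ^ r) *
        kᵀ := by
    intro r
    induction r with
    | zero => simp [orthogonal_mul_transpose hk]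
    | succ r ih =>
      rw [pow_succ, ih]
      calc _ = k * (Matrix.diagonal fun i : Fin (2 * n) => (a ⟨i.val / 2, by omega⟩ ^ 2) ^ r) *
            (kᵀ * k) * ((Matrix.diagonal fun i : Fin (2 * n) => a ⟨i.val / 2, by omega⟩ ^ 2) *
              kᵀ) := by simp only [Matrix.mul_assoc]
        _ = k * ((Matrix.diagonal fun i : Fin (2 * n) => (a ⟨i.val / 2, by omega⟩ ^ 2) ^ r) *
            (Matrix.diagonal fun i : Fin (2 * n) => a ⟨i.val / 2, by omega⟩ ^ 2)) * kᵀ := by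
          rw [orthogonal_transpose_mul hk, Matrix.mul_one]; simp only [Matrix.mul_assoc]
        _ = _ := by rw [Matrix.diagonal_mul_diagonal]; rfl
  have h3 : (Matrix.of fun i j : Fin n => ((k * Dmat a * kᵀ * (k * Dmat a * kᵀ)ᵀ) ^
      (i.val + j.val)).trace) = (2 : ℝ) • ((Matrix.vandermonde fun i => a i ^ 2)ᵀ *
        Matrix.vandermonde fun i => a i ^ 2) := by
    ext i j
    rw [Matrix.of_apply, h1, h2, Matrix.trace_mul_cycle, orthogonal_transpose_mul hk,
      Matrix.one_mul, Matrix.trace_diagonal,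
      sum_fin_two_mul n fun l => (a l ^ 2) ^ (i.val + j.val)]
    simp [Matrix.mul_apply, Matrix.vandermonde_apply, pow_add]
  rw [powerSumDet, h3, Matrix.det_smul, Matrix.det_mul, Matrix.det_transpose, ← vdm_eq_det,
    Fintype.card_fin]
  ring

theorem exists_stdConj_eq_Dmat {a : Fin n → ℝ} (ha : ∀ i, 0 ≤ a i) :
    stdConj (Matrix.diagonal fun i : Fin (2 * n) => √(a ⟨i.val / 2, by omega⟩)) = Dmat a := by
  ext i j
  rw [stdConj, Matrix.diagonal_transpose, Matrix.mul_diagonal, Matrix.diagonal_mul]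
  simp only [Dmat, Matrix.of_apply]
  by_cases h : i.val / 2 = j.val / 2
  · simp only [h, if_true]
    have := Real.mul_self_sqrt (ha ⟨j.val / 2, by omega⟩)
    linear_combination (if i.val % 2 = 0 ∧ j.val % 2 = 1 then (1 : ℝ)
      else if i.val % 2 = 1 ∧ j.val % 2 = 0 then -1 else 0) * this
  · simp [h]

theorem ae_specParam_stdConj : ∀ᵐ g : Matrix (Fin (2 * n)) (Fin (2 * n)) ℝ,
    StrictMono (specParam (stdConj g)) ∧ ∀ i, 0 < specParam (stdConj g) i := by
  have hpoly : LinePoly fun g : Matrix (Fin (2 * n)) (Fin (2 * n)) ℝ => powerSumDet (stdConj g) := by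
    refine LinePoly.det fun i j => ?_
    simp only [Matrix.of_apply, Matrix.trace, Matrix.diag]
    exact LinePoly.sum _ fun l _ => LinePoly.matrix_pow
      (LinePoly.matrix_mul linePoly_stdConj fun i j => linePoly_stdConj j i) _ l l
  have hcont : Continuous fun g : Matrix (Fin (2 * n)) (Fin (2 * n)) ℝ => powerSumDet (stdConj g) := by
    have := continuous_stdConj (n := n)
    unfold powerSumDet
    refine Continuous.matrix_det (continuous_matrix fun i j => ?_)
    simp only [Matrix.of_apply]
    fun_prop
  have hne := hpoly.ae_ne_zero_matrix hcont.measurable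
    (g₀ := Matrix.diagonal fun i : Fin (2 * n) => √((i.val / 2 : ℕ) : ℝ)) (by
      have h0 := exists_stdConj_eq_Dmat (a := fun i : Fin n => ((i.val : ℕ) : ℝ))
        fun i => Nat.cast_nonneg _
      simp only at h0
      have h1 := powerSumDet_conj (n := n) (a := fun i : Fin n => ((i.val : ℕ) : ℝ)) (one_mem _)
      rw [Matrix.one_mul, Matrix.transpose_one, Matrix.mul_one] at h1
      rw [h0, h1]
      have : StrictMono fun i : Fin n => ((i.val : ℕ) : ℝ) ^ 2 := fun i j hij =>
        pow_lt_pow_left₀ (Nat.cast_lt.2 hij) (Nat.cast_nonneg _) two_ne_zero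
      have := vdm_pos this
      positivity)
  filter_upwards [hne, ae_det_ne_zero (Fin (2 * n))] with g hg hdet
  obtain ⟨h1, h2, k, hk, h3⟩ := specParam_spec (stdConj_transpose g)
  constructor
  · refine h1.strictMono_of_injective fun i j hij => ?_
    rw [h3, powerSumDet_conj hk, vdm_eq_det] at hg
    have h4 : (Matrix.vandermonde fun i => specParam (stdConj g) i ^ 2).det ≠ 0 := by
      intro h; simp [h] at hg
    exact Matrix.det_vandermonde_ne_zero_iff.1 h4 (by simp only [hij])
  · intro i
    refine lt_of_le_of_ne (h2 i) fun h0 => ?_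
    have h5 : |(stdConj g).det| = ∏ i, specParam (stdConj g) i ^ 2 := by
      conv_lhs => rw [h3]
      rw [det_conj_orthogonal hk, abs_det_Dmat h2]
    rw [Finset.prod_eq_zero (Finset.mem_univ i) (by rw [← h0]; simp), abs_eq_zero, stdConj,
      Matrix.det_mul, Matrix.det_mul, Matrix.det_transpose] at h5
    have h6 : (Dmat fun _ : Fin n => (1 : ℝ)).det ≠ 0 := by
      have := abs_det_Dmat (a := fun _ : Fin n => (1 : ℝ)) fun _ => zero_le_one
      intro h; simp [h] at this
    exact (mul_ne_zero (mul_ne_zero hdet h6) hdet) h5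

/-- All leading minors of even size are nonzero. -/
def MinorsNeZero : (n : ℕ) → Matrix (Fin (2 * n)) (Fin (2 * n)) ℝ → Prop
  | 0, _ => True
  | n + 1, X => X.det ≠ 0 ∧ MinorsNeZero n (corner (M := 2 * n) (corner (M := 2 * n + 1) X))

theorem continuousAt_minorPow : ∀ (n : ℕ) (μ : Fin n → ℂ)
    (X : Matrix (Fin (2 * n)) (Fin (2 * n)) ℝ), MinorsNeZero n X → ContinuousAt (minorPow n μ) X
  | 0, _, _, _ => continuousAt_const
  | n + 1, μ, X, hX => by
    have h1 : ContinuousAt (fun X : Matrix (Fin (2 * (n + 1))) (Fin (2 * (n + 1))) ℝ =>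
        ((|X.det| : ℝ) : ℂ) ^ μ (Fin.last n)) X :=
      (Complex.continuousAt_ofReal_cpow_const _ _ (Or.inr (abs_ne_zero.2 hX.1))).comp
        (f := fun X : Matrix (Fin (2 * (n + 1))) (Fin (2 * (n + 1))) ℝ => |X.det|)
        (continuous_id.matrix_det.abs).continuousAt
    have hc : Continuous fun X : Matrix (Fin (2 * (n + 1))) (Fin (2 * (n + 1))) ℝ =>
        corner (M := 2 * n) (corner (M := 2 * n + 1) X) := by
      unfold corner
      exact (continuous_id.matrix_submatrix _ _).matrix_submatrix _ _
    exact h1.mul (ContinuousAt.comp (f := fun X : Matrix (Fin (2 * (n + 1))) (Fin (2 * (n + 1))) ℝ =>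
      corner (M := 2 * n) (corner (M := 2 * n + 1) X)) (continuousAt_minorPow n _ _ hX.2)
      hc.continuousAt)

theorem ae_minorsNeZero {l m : Type*} [Fintype l] [Fintype m] : ∀ (n : ℕ)
    {M : Matrix l m ℝ → Matrix (Fin (2 * n)) (Fin (2 * n)) ℝ}, Continuous M →
    (∀ i j, LinePoly fun g => M g i j) → ∀ {g₀}, MinorsNeZero n (M g₀) →
    ∀ᵐ g, MinorsNeZero n (M g)
  | 0, _, _, _, _, _ => Filter.Eventually.of_forall fun _ => trivial
  | n + 1, M, hM, hp, g₀, h0 => by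
    filter_upwards [(LinePoly.det hp).ae_ne_zero_matrix hM.matrix_det.measurable h0.1,
      ae_minorsNeZero n (M := fun g => corner (M := 2 * n) (corner (M := 2 * n + 1) (M g)))
        ((hM.matrix_submatrix _ _).matrix_submatrix _ _) (fun i j => hp _ _) h0.2] with g h1 h2
    exact ⟨h1, h2⟩

theorem minorsNeZero_Dmat_one : ∀ n : ℕ, MinorsNeZero n (Dmat fun _ : Fin n => (1 : ℝ))
  | 0 => trivial
  | n + 1 => by
    refine ⟨?_, ?_⟩
    · have := abs_det_Dmat (a := fun _ : Fin (n + 1) => (1 : ℝ)) fun _ => zero_le_one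
      intro h; simp [h] at this
    · exact minorsNeZero_Dmat_one n

theorem ae_minorsNeZero_stdConj : ∀ᵐ g : Matrix (Fin (2 * n)) (Fin (2 * n)) ℝ,
    MinorsNeZero n (stdConj g) :=
  ae_minorsNeZero n continuous_stdConj linePoly_stdConj (g₀ := 1) (by
    simpa [stdConj] using minorsNeZero_Dmat_one n)

end SpecParam

end

noncomputable section

/-! ### The spherical transform of the law of the spectral parameters -/

section SphericalTransform

open Filter Topology

variable {n : ℕ}

theorem tendsto_det_vandermonde_exp (v : Fin n → ℂ) :
    Tendsto (fun ε : ℝ => (Matrix.vandermonde fun j => Complex.exp (ε * v j)).det /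
      ∏ i : Fin n, ∏ _j ∈ Finset.Ioi i, (ε : ℂ)) (𝓝[>] 0) (𝓝 (Matrix.vandermonde v).det) := by
  simp only [Matrix.det_vandermonde, ← Finset.prod_div_distrib]
  refine tendsto_finsetProd _ fun i _ => tendsto_finsetProd _ fun j _ => ?_
  have h : ∀ w : ℂ, HasDerivAt (fun ε : ℝ => Complex.exp (ε * w)) w 0 := fun w => by
    have h1 : HasDerivAt (fun z : ℂ => Complex.exp (z * w)) w ((0 : ℝ) : ℂ) := by
      simpa using ((hasDerivAt_id (𝕜 := ℂ) ((0 : ℝ) : ℂ)).mul_const w).cexp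
    exact h1.comp_ofReal
  have h2 := ((h (v j)).sub (h (v i))).tendsto_slope_zero_right
  refine h2.congr' ?_
  filter_upwards [self_mem_nhdsWithin] with ε _
  simp [div_eq_inv_mul]

theorem kapProd_ne_zero {μ : Fin n → ℂ} (hμ : ∀ j, (μ j).re = 0) : kapProd (kap μ) ≠ 0 := by
  rw [kapProd]
  refine Finset.prod_ne_zero_iff.2 fun k _ => Finset.prod_ne_zero_iff.2 fun j _ => ?_
  split_ifs with h
  · have hre : (kap μ j - kap μ k).re = (k.val : ℝ) - j.val := by
      simp [kap, hμ]
    have hlt : (1 : ℝ) ≤ (k.val : ℝ) - j.val := by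
      have : (j.val : ℝ) + 1 ≤ k.val := by exact_mod_cast h
      linarith
    refine mul_ne_zero (fun h0 => ?_) (fun h0 => ?_)
    · rw [h0] at hre; simp at hre; linarith
    · have h1 := congrArg Complex.re h0
      rw [Complex.sub_re, hre] at h1
      norm_num at h1; linarith
  · exact one_ne_zero

theorem tendsto_orbAvg_confluent {A : ℂ} {μ : Fin n → ℂ}
    (hA : ∀ x : Fin n → ℝ, StrictMono x → (∀ i, 0 < x i) →
      orbAvg (minorPow n μ) (Dcan (2 * n) (rootExt x)) =
        A * (Matrix.of fun i j : Fin n => ((x i : ℝ) : ℂ) ^ kap μ j).det /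
          ((vdm x : ℂ) * kapProd (kap μ))) :
    Tendsto (fun ε : ℝ => orbAvg (minorPow n μ) (Dmat fun i : Fin n => Real.exp (ε * i / 2)))
      (𝓝[>] 0) (𝓝 (A * (Matrix.vandermonde (kap μ)).det /
        ((Matrix.vandermonde fun j : Fin n => ((j.val : ℕ) : ℂ)).det * kapProd (kap μ)))) := by
  have h0 : (Matrix.vandermonde fun j : Fin n => ((j.val : ℕ) : ℂ)).det ≠ 0 :=
    Matrix.det_vandermonde_ne_zero_iff.2 fun i j hij => by
      ext; exact_mod_cast hij
  have h1 := ((tendsto_det_vandermonde_exp (kap μ)).div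
    (tendsto_det_vandermonde_exp fun j : Fin n => ((j.val : ℕ) : ℂ)) h0).const_mul
      (A / kapProd (kap μ))
  have h2 : A / kapProd (kap μ) * ((Matrix.vandermonde (kap μ)).det /
      (Matrix.vandermonde fun j : Fin n => ((j.val : ℕ) : ℂ)).det) =
      A * (Matrix.vandermonde (kap μ)).det /
        ((Matrix.vandermonde fun j : Fin n => ((j.val : ℕ) : ℂ)).det * kapProd (kap μ)) := by
    rw [div_mul_div_comm, mul_comm (kapProd _)]
  rw [h2] at h1
  refine h1.congr' ?_
  filter_upwards [self_mem_nhdsWithin] with ε (hε : 0 < ε)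
  have hsq : ∀ i : Fin n, Real.exp (ε * i / 2) ^ 2 = Real.exp (ε * i) := fun i => by
    rw [← Real.exp_nat_mul]; congr 1; push_cast; ring
  have hpr : ∏ i : Fin n, ∏ _j ∈ Finset.Ioi i, (ε : ℂ) ≠ 0 :=
    Finset.prod_ne_zero_iff.2 fun i _ => Finset.prod_ne_zero_iff.2 fun j _ => by
      exact_mod_cast hε.ne'
  rw [Dmat_eq_rootExt fun i => (Real.exp_pos _).le]
  simp only [hsq]
  rw [hA _ (fun i j hij => Real.exp_lt_exp.2 (mul_lt_mul_of_pos_left (by exact_mod_cast hij) hε))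
    fun i => Real.exp_pos _]
  have hd1 : (Matrix.of fun i j : Fin n => ((Real.exp (ε * i) : ℝ) : ℂ) ^ kap μ j) =
      (Matrix.vandermonde fun j => Complex.exp (ε * kap μ j))ᵀ := by
    ext i j
    rw [Matrix.transpose_apply, Matrix.vandermonde_apply, Matrix.of_apply, ← Complex.exp_nat_mul,
      Complex.cpow_def_of_ne_zero (by exact_mod_cast (Real.exp_pos _).ne'),
      ← Complex.ofReal_log (Real.exp_pos _).le, Real.log_exp]
    congr 1; push_cast; ring
  have hd2 : ((vdm fun i : Fin n => Real.exp (ε * i) : ℝ) : ℂ) =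
      (Matrix.vandermonde fun j : Fin n => Complex.exp (ε * ((j.val : ℕ) : ℂ))).det := by
    rw [vdm_eq_det, Matrix.det_vandermonde, Matrix.det_vandermonde]
    push_cast
    rfl
  rw [hd1, Matrix.det_transpose, hd2]
  simp only [Pi.div_apply]
  rw [div_div_div_cancel_right₀ hpr, div_mul_div_comm, mul_comm (kapProd _)]

theorem integral_mul_orbAvg {P : Matrix (Fin (2 * n)) (Fin (2 * n)) ℝ → ℝ} (hP : Integrable P)
    (hinv : ∀ g, ∀ k ∈ Matrix.orthogonalGroup (Fin (2 * n)) ℝ, P (k * g) = P g)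
    {F : Matrix (Fin (2 * n)) (Fin (2 * n)) ℝ → ℂ} (hF : Measurable F) {B : ℝ}
    (hB : ∀ X, ‖F X‖ ≤ B) :
    ∫ g, (P g : ℂ) * orbAvg F (stdConj g) = ∫ g, (P g : ℂ) * F (stdConj g) := by
  have hm : Measurable fun q : Matrix (Fin (2 * n)) (Fin (2 * n)) ℝ ×
      Matrix.orthogonalGroup (Fin (2 * n)) ℝ => F (q.2.1 * stdConj q.1 * q.2.1ᵀ) :=
    hF.comp (continuous_conj_prod.comp
      ((continuous_stdConj.comp continuous_fst).prodMk continuous_snd)).measurable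
  have hint : Integrable (fun q : Matrix (Fin (2 * n)) (Fin (2 * n)) ℝ ×
      Matrix.orthogonalGroup (Fin (2 * n)) ℝ => (P q.1 : ℂ) * F (q.2.1 * stdConj q.1 * q.2.1ᵀ))
      (volume.prod (haarO (Fin (2 * n)))) := by
    have h1 : Integrable (fun q : Matrix (Fin (2 * n)) (Fin (2 * n)) ℝ ×
      Matrix.orthogonalGroup (Fin (2 * n)) ℝ => (P q.1 : ℂ))
      (volume.prod (haarO (Fin (2 * n)))) := 
      Integrable.comp_fst (f := fun g => (P g : ℂ)) hP.ofReal _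
    exact h1.mul_bdd (c := B) hm.aestronglyMeasurable (Eventually.of_forall fun q => hB _)
  simp only [orbAvg, ← integral_const_mul]
  rw [integral_integral_swap hint]
  have hk : ∀ k : Matrix.orthogonalGroup (Fin (2 * n)) ℝ,
      ∫ g, (P g : ℂ) * F (k.1 * stdConj g * k.1ᵀ) = ∫ g, (P g : ℂ) * F (stdConj g) := by
    intro k
    have hmp := measurePreserving_mul_left (m := Fin (2 * n)) k.2
    have hsm : AEStronglyMeasurable (fun g => (P g : ℂ) * F (stdConj g)) :=
      hP.ofReal.1.mul (hF.comp continuous_stdConj.measurable).aestronglyMeasurable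
    have himap := integral_map (μ := volume) hmp.measurable.aemeasurable
      (f := fun g => (P g : ℂ) * F (stdConj g)) (by rw [hmp.map_eq]; exact hsm)
    rw [hmp.map_eq] at himap
    rw [himap]
    refine integral_congr_ae (Eventually.of_forall fun g => ?_)
    simp only [hinv g k.1 k.2, stdConj, Matrix.transpose_mul, Matrix.mul_assoc]
  simp [hk]

theorem orbAvg_stdConj {A : ℂ} {μ : Fin n → ℂ}
    (hA : ∀ x : Fin n → ℝ, StrictMono x → (∀ i, 0 < x i) →
      orbAvg (minorPow n μ) (Dcan (2 * n) (rootExt x)) =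
        A * (Matrix.of fun i j : Fin n => ((x i : ℝ) : ℂ) ^ kap μ j).det /
          ((vdm x : ℂ) * kapProd (kap μ)))
    {g : Matrix (Fin (2 * n)) (Fin (2 * n)) ℝ} (h1 : StrictMono (specParam (stdConj g)))
    (h2 : ∀ i, 0 < specParam (stdConj g) i) :
    orbAvg (minorPow n μ) (stdConj g) = A / kapProd (kap μ) *
      ((Matrix.of fun i j : Fin n => ((specParam (stdConj g) i ^ 2 : ℝ) : ℂ) ^ kap μ j).det /
        (vdm (fun i => specParam (stdConj g) i ^ 2) : ℂ)) := by
  obtain ⟨-, h3, k, hk, h4⟩ := specParam_spec (stdConj_transpose g)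
  conv_lhs => rw [h4]
  rw [orbAvg_conj _ _ hk, Dmat_eq_rootExt h3, hA _ (fun i j hij =>
    pow_lt_pow_left₀ (h1 hij) (h3 i) two_ne_zero) fun i => pow_pos (h2 i) 2,
    div_mul_div_comm, mul_comm (kapProd _)]

theorem integral_spherical {P : Matrix (Fin (2 * n)) (Fin (2 * n)) ℝ → ℝ}
    {σw : Matrix (Fin 2) (Fin 2) ℝ → ℝ} (hfac : IsFactorizing n P σw) {h : ℝ → ℝ}
    (hdet : IsDetDensity σw h) (hh : IntegrableOn h (Set.Ioi 0)) (h1 : 0 < mellH h 1)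
    {μ : Fin n → ℂ} (hμ : ∀ j, (μ j).re = 0) :
    (∫ g, (P g : ℂ) * ((Matrix.of fun i j : Fin n =>
        ((specParam (stdConj g) i ^ 2 : ℝ) : ℂ) ^ kap μ j).det /
          (vdm (fun i => specParam (stdConj g) i ^ 2) : ℂ))) *
      ∏ j : Fin n, (mellH h (2 * ((j.val : ℝ) + 1) - 1) : ℂ) =
    (∏ j, mellC h (2 * kap μ j)) * ((Matrix.vandermonde (kap μ)).det /
      (Matrix.vandermonde fun j : Fin n => ((j.val : ℕ) : ℂ)).det) := by
  obtain ⟨A, hA0, hA⟩ := exists_orbAvg_minorPow n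
  replace hA := hA μ hμ
  have hk0 := kapProd_ne_zero hμ
  have hlim : Tendsto (fun ε : ℝ => ∫ g, (P g : ℂ) *
      minorPow n μ (g * (Dmat fun i : Fin n => Real.exp (ε * i / 2)) * gᵀ)) (𝓝[>] 0)
      (𝓝 (∫ g, (P g : ℂ) * minorPow n μ (stdConj g))) := by
    refine tendsto_integral_filter_of_dominated_convergence (fun g => P g)
      (Eventually.of_forall fun ε => ?_) (Eventually.of_forall fun ε =>
        Eventually.of_forall fun g => ?_) hfac.integrable ?_
    · refine hfac.integrable.ofReal.1.mul ((measurable_minorPow n μ).comp ?_).aestronglyMeasurable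
      exact (by fun_prop : Continuous fun g : Matrix (Fin (2 * n)) (Fin (2 * n)) ℝ =>
        g * (Dmat fun i : Fin n => Real.exp (ε * i / 2)) * gᵀ).measurable
    · rw [norm_mul, Complex.norm_real, Real.norm_of_nonneg (hfac.nonneg g)]
      exact mul_le_of_le_one_right (hfac.nonneg g) (norm_minorPow_le n μ hμ _)
    · filter_upwards [ae_minorsNeZero_stdConj (n := n)] with g hg
      refine Tendsto.const_mul _ ?_
      have hc : Continuous fun ε : ℝ =>
          g * (Dmat fun i : Fin n => Real.exp (ε * i / 2)) * gᵀ := by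
        have := continuous_Dmat (n := n)
        fun_prop
      have hc0 : g * (Dmat fun i : Fin n => Real.exp (0 * i / 2)) * gᵀ = stdConj g := by
        simp [stdConj]
      have := ContinuousAt.comp (x := (0 : ℝ))
        (f := fun ε : ℝ => g * (Dmat fun i : Fin n => Real.exp (ε * i / 2)) * gᵀ)
        (hc0 ▸ continuousAt_minorPow n μ (stdConj g) hg) hc.continuousAt
      have h2 := this.tendsto
      simp only [Function.comp_apply, hc0] at h2
      exact h2.mono_left nhdsWithin_le_nhds
  have hlim2 := (tendsto_orbAvg_confluent hA).mul_const (∏ j, mellC h (2 * kap μ j))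
  have heq := tendsto_nhds_unique (hlim.mul_const
    (∏ j : Fin n, (mellH h (2 * ((j.val : ℝ) + 1) - 1) : ℂ))) (hlim2.congr fun ε =>
      (integral_mul_minorPow hfac hdet hh h1 hμ _).symm)
  have hinv : ∀ g, ∀ k ∈ Matrix.orthogonalGroup (Fin (2 * n)) ℝ, P (k * g) = P g := fun g k hk => by
    simpa using hfac.invariant g k hk 1 (one_mem _)
  rw [← integral_mul_orbAvg hfac.integrable hinv (measurable_minorPow n μ)
    (norm_minorPow_le n μ hμ)] at heq
  have hae : ∫ g, (P g : ℂ) * orbAvg (minorPow n μ) (stdConj g) = A / kapProd (kap μ) *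
      ∫ g, (P g : ℂ) * ((Matrix.of fun i j : Fin n =>
        ((specParam (stdConj g) i ^ 2 : ℝ) : ℂ) ^ kap μ j).det /
          (vdm (fun i => specParam (stdConj g) i ^ 2) : ℂ)) := by
    rw [← integral_const_mul]
    refine integral_congr_ae ?_
    filter_upwards [ae_specParam_stdConj (n := n)] with g hg
    rw [orbAvg_stdConj hA hg.1 hg.2]
    ring
  rw [hae] at heq
  have hcancel : A / kapProd (kap μ) ≠ 0 := div_ne_zero hA0 hk0
  apply mul_left_cancel₀ hcancel
  rw [← mul_assoc, heq, mul_comm ((Matrix.vandermonde fun j : Fin n => ((j.val : ℕ) : ℂ)).det),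
    mul_div_mul_comm]
  ring

/-- The integrand of the spherical transform grows at most polynomially in the parameters. -/
theorem exists_norm_det_div_le (n : ℕ) : ∃ K : ℝ, 0 ≤ K ∧ ∀ μ : Fin n → ℂ, (∀ j, (μ j).re = 0) →
    ∀ x : Fin n → ℝ, StrictMono x → (∀ i, 0 < x i) →
      ‖(Matrix.of fun i j : Fin n => ((x i : ℝ) : ℂ) ^ kap μ j).det / (vdm x : ℂ)‖ ≤
        K * ‖kapProd (kap μ)‖ := by
  obtain ⟨A, hA0, hA⟩ := exists_orbAvg_minorPow n
  refine ⟨‖A‖⁻¹, by positivity, fun μ hμ x hx hx0 => ?_⟩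
  have h1 := norm_orbAvg_le (norm_minorPow_le n μ hμ) (Dcan (2 * n) (rootExt x))
  rw [hA μ hμ x hx hx0, mul_comm (vdm x : ℂ), mul_div_mul_comm, norm_mul, norm_div] at h1
  have hA' : 0 < ‖A‖ := norm_pos_iff.2 hA0
  have hk' : 0 < ‖kapProd (kap μ)‖ := norm_pos_iff.2 (kapProd_ne_zero hμ)
  rw [inv_mul_eq_div, le_div_iff₀ hA']
  rw [div_mul_eq_mul_div, div_le_one hk'] at h1
  linarith

end SphericalTransform

end

noncomputable section

/-! ### Mellin inversion against smooth test functions -/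

section MellinInversion

open Filter Topology FourierTransform Real

/-- Multiplication by `e^{-wl}`. -/
def expTwist (w : ℝ) (ψ : ℝ → ℂ) (l : ℝ) : ℂ := Complex.exp (-(w * l)) * ψ l

theorem HasCompactSupport.expTwist {ψ : ℝ → ℂ} (hψ : HasCompactSupport ψ) (w : ℝ) :
    HasCompactSupport (expTwist w ψ) := hψ.mul_left

theorem contDiff_expTwist {ψ : ℝ → ℂ} (hψ : ContDiff ℝ (↑(⊤ : ℕ∞)) ψ) (w : ℝ) :
    ContDiff ℝ (↑(⊤ : ℕ∞)) (expTwist w ψ) := by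
  have h1 : ContDiff ℝ (↑(⊤ : ℕ∞)) fun l : ℝ => (-(w * l) : ℂ) :=
    (contDiff_const.mul Complex.ofRealCLM.contDiff).neg
  exact h1.cexp.mul hψ

theorem deriv_expTwist {ψ : ℝ → ℂ} (hψ : Differentiable ℝ ψ) (w l : ℝ) :
    deriv (expTwist w ψ) l = -(w * expTwist w ψ l) + expTwist w (deriv ψ) l := by
  have h1 : HasDerivAt (fun l : ℝ => (-(w * l) : ℂ)) (-w) l := by
    have h := ((Complex.ofRealCLM.hasDerivAt (x := l)).const_mul (w : ℂ)).neg
    simp only [Complex.ofRealCLM_apply, Complex.ofReal_one, mul_one] at h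
    exact h
  have := (h1.cexp.mul (hψ l).hasDerivAt).deriv
  rw [show expTwist w ψ = (fun l : ℝ => Complex.exp (-(w * l))) * ψ from rfl, this]
  simp only [expTwist, Pi.mul_apply]
  ring

theorem integrable_of_smooth {ψ : ℝ → ℂ} (hc : HasCompactSupport ψ)
    (hs : ContDiff ℝ (↑(⊤ : ℕ∞)) ψ) : Integrable ψ :=
  hs.continuous.integrable_of_hasCompactSupport hc

theorem integrable_pow_mul_fourier {ψ : ℝ → ℂ} (hc : HasCompactSupport ψ)
    (hs : ContDiff ℝ (↑(⊤ : ℕ∞)) ψ) (N : ℕ) :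
    Integrable fun ξ : ℝ => (1 + |ξ|) ^ N * ‖𝓕 ψ ξ‖ := by
  have h0 := SchwartzMap.fourier_coe (hc.toSchwartzMap hs)
  have h1 : ∀ ξ : ℝ, (1 + |ξ|) ^ N * ‖𝓕 ψ ξ‖ = ∑ m ∈ Finset.range (N + 1), (N.choose m : ℝ) *
      (‖ξ‖ ^ m * ‖(𝓕 (hc.toSchwartzMap hs) : SchwartzMap ℝ ℂ) ξ‖) := by
    intro ξ
    rw [h0, add_comm, add_pow, Finset.sum_mul]
    refine Finset.sum_congr rfl fun m _ => ?_
    rw [one_pow, Real.norm_eq_abs, show ⇑(hc.toSchwartzMap hs) = ψ from rfl]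
    ring
  simp only [h1]
  exact integrable_finsetSum _ fun m _ =>
    ((𝓕 (hc.toSchwartzMap hs) : SchwartzMap ℝ ℂ).integrable_pow_mul volume m).const_mul _

theorem continuous_fourier_of_smooth {ψ : ℝ → ℂ} (hc : HasCompactSupport ψ)
    (hs : ContDiff ℝ (↑(⊤ : ℕ∞)) ψ) : Continuous (𝓕 ψ) := by
  have h0 := SchwartzMap.fourier_coe (hc.toSchwartzMap hs)
  have := (𝓕 (hc.toSchwartzMap hs) : SchwartzMap ℝ ℂ).continuous
  rwa [h0] at this

theorem integrable_fourier_of_smooth {ψ : ℝ → ℂ} (hc : HasCompactSupport ψ)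
    (hs : ContDiff ℝ (↑(⊤ : ℕ∞)) ψ) : Integrable (𝓕 ψ) := by
  have := integrable_pow_mul_fourier hc hs 0
  simp only [pow_zero, one_mul] at this
  exact (integrable_norm_iff (continuous_fourier_of_smooth hc hs).aestronglyMeasurable).1 this

theorem integral_fourier_mul_exp {ψ : ℝ → ℂ} (hc : HasCompactSupport ψ)
    (hs : ContDiff ℝ (↑(⊤ : ℕ∞)) ψ) (l : ℝ) :
    ∫ ξ : ℝ, 𝓕 ψ ξ * Complex.exp (2 * π * Complex.I * ξ * l) = ψ l := by
  have h1 := congrFun (hs.continuous.fourierInv_fourier_eq (integrable_of_smooth hc hs)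
    (integrable_fourier_of_smooth hc hs)) l
  rw [Real.fourierInv_eq'] at h1
  rw [← h1]
  refine integral_congr_ae (Eventually.of_forall fun ξ => ?_)
  simp only [smul_eq_mul, mul_comm (𝓕 ψ ξ)]
  congr 2
  simp only [RCLike.inner_apply, conj_trivial]
  push_cast
  ring

theorem fourier_expTwist_deriv {ψ : ℝ → ℂ} (hc : HasCompactSupport ψ)
    (hs : ContDiff ℝ (↑(⊤ : ℕ∞)) ψ) (w ξ : ℝ) :
    𝓕 (expTwist w (deriv ψ)) ξ = (w + 2 * π * Complex.I * ξ) * 𝓕 (expTwist w ψ) ξ := by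
  have hct := hc.expTwist w
  have hst := contDiff_expTwist hs w
  have hd := (contDiff_infty_iff_deriv.1 hst).2
  have h1 := congrFun (Real.fourier_deriv (integrable_of_smooth hct hst)
    (contDiff_infty_iff_deriv.1 hst).1 (integrable_of_smooth hct.deriv hd)) ξ
  have h2 : expTwist w (deriv ψ) = fun l => (w : ℂ) * expTwist w ψ l + deriv (expTwist w ψ) l := by
    ext l
    rw [deriv_expTwist (contDiff_infty_iff_deriv.1 hs).1]
    ring
  have hi : ∀ {f : ℝ → ℂ}, Integrable f → Integrable fun v : ℝ =>
      Complex.exp (((-2 * π * inner ℝ v ξ : ℝ) : ℂ) * Complex.I) • f v := by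
    intro f hf
    simp only [smul_eq_mul]
    refine hf.bdd_mul (c := 1) ?_ (Eventually.of_forall fun v => ?_)
    · exact (by fun_prop : Continuous fun v : ℝ =>
        Complex.exp (((-2 * π * inner ℝ v ξ : ℝ) : ℂ) * Complex.I)).aestronglyMeasurable
    · rw [Complex.norm_exp_ofReal_mul_I]
  rw [add_mul, ← smul_eq_mul (2 * π * Complex.I * ξ : ℂ), ← h1, h2]
  simp only [Real.fourier_eq']
  rw [← integral_const_mul, ← integral_add]
  · refine integral_congr_ae (Eventually.of_forall fun v => ?_)
    simp only [smul_eq_mul]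
    ring
  · exact (hi (integrable_of_smooth hct hst)).const_mul _
  · exact hi (integrable_of_smooth hct.deriv hd)

theorem HasCompactSupport.iterate_deriv {ψ : ℝ → ℂ} (hc : HasCompactSupport ψ) (c : ℕ) :
    HasCompactSupport (deriv^[c] ψ) := by
  induction c with
  | zero => exact hc
  | succ c ih => rw [Function.iterate_succ_apply']; exact ih.deriv

theorem fourier_expTwist_iterate {ψ : ℝ → ℂ} (hc : HasCompactSupport ψ)
    (hs : ContDiff ℝ (↑(⊤ : ℕ∞)) ψ) (w ξ : ℝ) (c : ℕ) :
    𝓕 (expTwist w (deriv^[c] ψ)) ξ = (w + 2 * π * Complex.I * ξ) ^ c * 𝓕 (expTwist w ψ) ξ := by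
  induction c with
  | zero => simp
  | succ c ih =>
    rw [Function.iterate_succ_apply', fourier_expTwist_deriv (hc.iterate_deriv c)
      (hs.iterate_deriv c), ih]
    ring

theorem ofReal_cpow_add_mul_I {t : ℝ} (ht : 0 < t) (r ξ : ℝ) :
    (t : ℂ) ^ ((r : ℂ) + 2 * π * Complex.I * ξ) =
      ((t ^ r : ℝ) : ℂ) * Complex.exp (2 * π * Complex.I * ξ * Real.log t) := by
  have h0 : (t : ℂ) ≠ 0 := by exact_mod_cast ht.ne'
  rw [Complex.cpow_add _ _ h0, ← Complex.ofReal_cpow ht.le,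
    Complex.cpow_def_of_ne_zero h0 (2 * π * Complex.I * ξ), ← Complex.ofReal_log ht.le]
  ring_nf

theorem integral_fourier_mul_mellC {ρ : ℝ → ℂ} (hc : HasCompactSupport ρ)
    (hs : ContDiff ℝ (↑(⊤ : ℕ∞)) ρ) {h : ℝ → ℝ} {r : ℝ}
    (hh : IntegrableOn (fun t => h t * t ^ r) (Set.Ioi 0)) :
    Integrable (fun ξ : ℝ => 𝓕 ρ ξ * mellC h (r + 2 * π * Complex.I * ξ)) ∧
    ∫ ξ : ℝ, 𝓕 ρ ξ * mellC h (r + 2 * π * Complex.I * ξ) =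
      ∫ t in Set.Ioi (0 : ℝ), ((h t * t ^ r : ℝ) : ℂ) * ρ (Real.log t) := by
  set f : ℝ → ℝ → ℂ := fun ξ t => 𝓕 ρ ξ * ((h t * t ^ r : ℝ) : ℂ) *
    Complex.exp (2 * π * Complex.I * ξ * Real.log t) with hf
  have hint : Integrable (Function.uncurry f) (volume.prod (volume.restrict (Set.Ioi 0))) := by
    have h1 := (integrable_fourier_of_smooth hc hs).mul_prod
      (Integrable.ofReal (𝕜 := ℂ) hh)
    refine h1.mul_bdd (c := 1) ?_ (Eventually.of_forall fun q => ?_)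
    · refine Measurable.aestronglyMeasurable ?_
      have hl : Measurable fun q : ℝ × ℝ => Real.log q.2 := Real.measurable_log.comp measurable_snd
      fun_prop
    · rw [show (2 * π * Complex.I * q.1 * Real.log q.2 : ℂ) =
        ((2 * π * q.1 * Real.log q.2 : ℝ) : ℂ) * Complex.I by push_cast; ring,
        Complex.norm_exp_ofReal_mul_I]
  have h2 : ∀ ξ : ℝ, ∫ t in Set.Ioi (0 : ℝ), f ξ t = 𝓕 ρ ξ * mellC h (r + 2 * π * Complex.I * ξ) := by
    intro ξ
    rw [mellC, ← integral_const_mul]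
    refine setIntegral_congr_fun measurableSet_Ioi fun t ht => ?_
    simp only [hf]
    rw [ofReal_cpow_add_mul_I ht]
    push_cast
    ring
  constructor
  · have := hint.integral_prod_left
    exact this.congr (Eventually.of_forall h2)
  · rw [← integral_congr_ae (Eventually.of_forall h2), integral_integral_swap hint]
    refine setIntegral_congr_fun measurableSet_Ioi fun t ht => ?_
    simp only [hf]
    rw [← integral_fourier_mul_exp hc hs, ← integral_const_mul]
    refine integral_congr_ae (Eventually.of_forall fun ξ => ?_)
    ring

variable {n : ℕ}

/-- The exponents `2j + 2πiξ_j`. -/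
def mellExp (ξ : Fin n → ℝ) (j : Fin n) : ℂ :=
  ((2 * (j.val : ℝ) : ℝ) : ℂ) + 2 * π * Complex.I * ξ j

/-- The imaginary parameters corresponding to `mellExp`. -/
def mellPar (ξ : Fin n → ℝ) (j : Fin n) : ℂ := π * Complex.I * ξ (Fin.rev j)

theorem two_mul_kap_mellPar (ξ : Fin n → ℝ) (j : Fin n) :
    2 * kap (mellPar ξ) (Fin.rev j) = mellExp ξ j := by
  have := j.isLt
  rw [kap, mellPar, mellExp, Fin.rev_rev, Fin.val_rev]
  push_cast [Nat.cast_sub (show j.val + 1 ≤ n by omega)]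
  ring

theorem mellPar_re (ξ : Fin n → ℝ) (j : Fin n) : (mellPar ξ j).re = 0 := by
  simp [mellPar]

theorem det_cpow_kap {a : Fin n → ℝ} (ha : ∀ i, 0 < a i) (ξ : Fin n → ℝ) :
    (Matrix.of fun i j : Fin n => (a i : ℂ) ^ mellExp ξ j).det =
      ((Equiv.Perm.sign (Fin.revPerm (n := n)) : ℤ) : ℂ) *
        (Matrix.of fun i j : Fin n => ((a i ^ 2 : ℝ) : ℂ) ^ kap (mellPar ξ) j).det := by
  rw [← Matrix.det_permute']
  congr 1
  ext i j
  have h0 : (a i : ℂ) ≠ 0 := by exact_mod_cast (ha i).ne'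
  simp only [Matrix.of_apply, Matrix.submatrix_apply, id, Fin.revPerm_apply]
  rw [← two_mul_kap_mellPar, sq, Complex.ofReal_mul,
    Complex.mul_cpow_ofReal_nonneg (ha i).le (ha i).le, ← Complex.cpow_add _ _ h0, two_mul]

theorem det_vandermonde_smul {R : Type*} [CommRing R] (c : R) (v : Fin n → R) :
    (Matrix.vandermonde fun j => c * v j).det =
      c ^ (n * (n - 1) / 2) * (Matrix.vandermonde v).det := by
  have : (Matrix.vandermonde fun j => c * v j) =
      Matrix.of fun i j : Fin n => c ^ j.val * Matrix.vandermonde v i j := by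
    ext i j; simp [Matrix.vandermonde_apply, mul_pow]
  rw [this, Matrix.det_mul_row fun j : Fin n => c ^ j.val, Finset.prod_pow_eq_pow_sum,
    Fin.sum_univ_eq_sum_range fun i => i, Finset.sum_range_id]

theorem det_vandermonde_kap (ξ : Fin n → ℝ) :
    (Matrix.vandermonde fun j => mellExp ξ j + 1).det = 2 ^ (n * (n - 1) / 2) *
      (((Equiv.Perm.sign (Fin.revPerm (n := n)) : ℤ) : ℂ) *
        (Matrix.vandermonde (kap (mellPar ξ))).det) := by
  have h1 := Matrix.det_vandermonde_sub (fun j => mellExp ξ j + 1) 1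
  simp only [add_sub_cancel_right] at h1
  have h2 : (Matrix.vandermonde (kap (mellPar ξ))).submatrix Fin.revPerm id =
      Matrix.vandermonde fun j => kap (mellPar ξ) (Fin.rev j) := by
    ext i j; simp [Matrix.vandermonde_apply]
  rw [← h1, ← Matrix.det_permute, h2, ← det_vandermonde_smul]
  simp only [two_mul_kap_mellPar]

theorem norm_kapProd_le (ξ : Fin n → ℝ) : ‖kapProd (kap (mellPar ξ))‖ ≤
    ((n + 9) * ∏ j, (1 + |ξ j|)) ^ (2 * (n * n)) := by
  set W := ∏ j, (1 + |ξ j|) with hW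
  have hW1 : ∀ j, 1 + |ξ j| ≤ W := fun j => by
    rw [hW, ← Finset.mul_prod_erase _ _ (Finset.mem_univ j)]
    refine le_mul_of_one_le_right (by positivity) ?_
    calc (1 : ℝ) = ∏ i ∈ Finset.univ.erase j, (1 : ℝ) := by simp
      _ ≤ _ := Finset.prod_le_prod (fun _ _ => zero_le_one) fun i _ => by simp
  have hW0 : 1 ≤ W := by
    calc (1 : ℝ) = ∏ i : Fin n, (1 : ℝ) := by simp
      _ ≤ _ := Finset.prod_le_prod (fun _ _ => zero_le_one) fun i _ => by simp
  have hB : 1 ≤ ((n : ℝ) + 9) * W := by nlinarith [(Nat.cast_nonneg n : (0 : ℝ) ≤ n)]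
  have hfac : ∀ k j : Fin n, ‖(if j < k then (kap (mellPar ξ) j - kap (mellPar ξ) k) *
      (kap (mellPar ξ) j - kap (mellPar ξ) k - 1 / 2) else 1 : ℂ)‖ ≤ (((n : ℝ) + 9) * W) ^ 2 := by
    intro k j
    have hk : ‖kap (mellPar ξ) j - kap (mellPar ξ) k‖ ≤ n + 8 * W := by
      have h1 : kap (mellPar ξ) j - kap (mellPar ξ) k = (((k.val : ℝ) - j.val : ℝ) : ℂ) +
          (((π * (ξ (Fin.rev j) - ξ (Fin.rev k)) : ℝ) : ℂ)) * Complex.I := by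
        simp only [kap, mellPar]; push_cast; ring
      have h2 : |(k.val : ℝ) - j.val| ≤ n := by
        have hk : (k.val : ℝ) < n := by exact_mod_cast k.isLt
        have hj : (j.val : ℝ) < n := by exact_mod_cast j.isLt
        have hk0 : (0 : ℝ) ≤ k.val := Nat.cast_nonneg _
        have hj0 : (0 : ℝ) ≤ j.val := Nat.cast_nonneg _
        rw [abs_le]; constructor <;> linarith
      have h3 : |ξ (Fin.rev j) - ξ (Fin.rev k)| ≤ 2 * W := by
        have := abs_sub (ξ (Fin.rev j)) (ξ (Fin.rev k))
        have := hW1 (Fin.rev j)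
        have := hW1 (Fin.rev k)
        linarith
      rw [h1]
      refine (norm_add_le _ _).trans (add_le_add ?_ ?_)
      · rw [Complex.norm_real]; exact h2
      · rw [norm_mul, Complex.norm_I, mul_one, Complex.norm_real, Real.norm_eq_abs, abs_mul,
          abs_of_pos Real.pi_pos]
        nlinarith [Real.pi_le_four, Real.pi_pos, abs_nonneg (ξ (Fin.rev j) - ξ (Fin.rev k))]
    have hn0 : (0 : ℝ) ≤ n := Nat.cast_nonneg n
    split_ifs
    · rw [norm_mul, sq]
      refine mul_le_mul (hk.trans (by nlinarith)) ?_ (norm_nonneg _) (by positivity)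
      refine (norm_sub_le _ _).trans ?_
      have : ‖(1 / 2 : ℂ)‖ = 1 / 2 := by norm_num
      rw [this]
      nlinarith
    · rw [norm_one]
      exact one_le_pow₀ hB
  rw [kapProd, norm_prod]
  calc _ ≤ ∏ _k : Fin n, ∏ _j : Fin n, (((n : ℝ) + 9) * W) ^ 2 := by
        refine Finset.prod_le_prod (fun _ _ => norm_nonneg _) fun k _ => ?_
        rw [norm_prod]
        exact Finset.prod_le_prod (fun _ _ => norm_nonneg _) fun j _ => hfac k j
    _ = _ := by
        simp only [Finset.prod_const, Finset.card_univ, Fintype.card_fin, ← pow_mul]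
        congr 1
        ring

/-- The spherical transform in the coordinates of `mellExp`. -/
theorem exists_norm_det_mellExp_le (n : ℕ) : ∃ (K : ℝ) (N : ℕ), 0 ≤ K ∧ ∀ (ξ : Fin n → ℝ)
    (a : Fin n → ℝ), StrictMono a → (∀ i, 0 < a i) →
      ‖(Matrix.of fun i j : Fin n => (a i : ℂ) ^ mellExp ξ j).det /
        (vdm (fun i => a i ^ 2) : ℂ)‖ ≤ K * ∏ j, (1 + |ξ j|) ^ N := by
  obtain ⟨K, hK, hb⟩ := exists_norm_det_div_le n
  refine ⟨K * (n + 9) ^ (2 * (n * n)), 2 * (n * n), by positivity, fun ξ a ha ha0 => ?_⟩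
  have hs : ‖((Equiv.Perm.sign (Fin.revPerm (n := n)) : ℤ) : ℂ)‖ = 1 := by
    rcases Int.units_eq_one_or (Equiv.Perm.sign (Fin.revPerm (n := n))) with h | h <;> simp [h]
  rw [det_cpow_kap ha0, mul_div_assoc, norm_mul, hs, one_mul]
  refine (hb _ (mellPar_re ξ) _ (fun i j hij => pow_lt_pow_left₀ (ha hij) (ha0 i).le two_ne_zero)
    fun i => pow_pos (ha0 i) 2).trans ?_
  refine (mul_le_mul_of_nonneg_left (norm_kapProd_le ξ) hK).trans_eq ?_
  rw [mul_pow, Finset.prod_pow, mul_assoc]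

theorem integral_det_mellExp {M : Measure (Fin n → ℝ)} (hM : ∀ᵐ a ∂M, ∀ i, 0 < a i) {h : ℝ → ℝ}
    {Z : ℂ} (hZ : Z ≠ 0) (ξ : Fin n → ℝ)
    (hsph : (∫ a, (Matrix.of fun i j : Fin n => ((a i ^ 2 : ℝ) : ℂ) ^ kap (mellPar ξ) j).det /
        (vdm (fun i => a i ^ 2) : ℂ) ∂M) * Z =
      (∏ j, mellC h (2 * kap (mellPar ξ) j)) * ((Matrix.vandermonde (kap (mellPar ξ))).det /
        (Matrix.vandermonde fun j : Fin n => ((j.val : ℕ) : ℂ)).det)) :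
    ∫ a, (Matrix.of fun i j : Fin n => (a i : ℂ) ^ mellExp ξ j).det /
        (vdm (fun i => a i ^ 2) : ℂ) ∂M =
      (Z * 2 ^ (n * (n - 1) / 2) *
        (Matrix.vandermonde fun j : Fin n => ((j.val : ℕ) : ℂ)).det)⁻¹ *
      (Matrix.of fun j c : Fin n => mellC h (mellExp ξ j) * (mellExp ξ j + 1) ^ c.val).det := by
  have h1 : ∫ a, (Matrix.of fun i j : Fin n => (a i : ℂ) ^ mellExp ξ j).det /
        (vdm (fun i => a i ^ 2) : ℂ) ∂M = ((Equiv.Perm.sign (Fin.revPerm (n := n)) : ℤ) : ℂ) *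
      ∫ a, (Matrix.of fun i j : Fin n => ((a i ^ 2 : ℝ) : ℂ) ^ kap (mellPar ξ) j).det /
        (vdm (fun i => a i ^ 2) : ℂ) ∂M := by
    rw [← integral_const_mul]
    refine integral_congr_ae ?_
    filter_upwards [hM] with a ha
    rw [det_cpow_kap ha, mul_div_assoc]
  have h2 : ∏ j, mellC h (2 * kap (mellPar ξ) j) = ∏ j, mellC h (mellExp ξ j) := by
    rw [← Equiv.prod_comp Fin.revPerm]
    simp only [Fin.revPerm_apply, two_mul_kap_mellPar]
  have h3 : (Matrix.of fun j c : Fin n => mellC h (mellExp ξ j) * (mellExp ξ j + 1) ^ c.val).det =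
      (∏ j, mellC h (mellExp ξ j)) * (Matrix.vandermonde fun j => mellExp ξ j + 1).det :=
    Matrix.det_mul_column _ _
  rw [h1, h3, det_vandermonde_kap, eq_div_of_mul_eq hZ hsph, h2, mul_inv, mul_inv]
  have h4 : (2 : ℂ) ^ (n * (n - 1) / 2) ≠ 0 := pow_ne_zero _ two_ne_zero
  field_simp

theorem integral_fourier_expTwist_cpow {ψ : ℝ → ℂ} (hc : HasCompactSupport ψ)
    (hs : ContDiff ℝ (↑(⊤ : ℕ∞)) ψ) {a : ℝ} (ha : 0 < a) (r : ℝ) :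
    ∫ ξ : ℝ, 𝓕 (expTwist (r + 1) ψ) ξ * (a : ℂ) ^ ((r : ℂ) + 2 * π * Complex.I * ξ) =
      (a : ℂ)⁻¹ * ψ (Real.log a) := by
  simp only [ofReal_cpow_add_mul_I ha, mul_left_comm _ ((a ^ r : ℝ) : ℂ)]
  rw [integral_const_mul, integral_fourier_mul_exp (hc.expTwist _) (contDiff_expTwist hs _),
    expTwist, ← mul_assoc]
  congr 1
  rw [show (-(((r + 1 : ℝ) : ℂ) * (Real.log a : ℂ)) : ℂ) = ((Real.log a * (-(r + 1)) : ℝ) : ℂ) by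
    push_cast; ring, ← Complex.ofReal_exp, ← Real.rpow_def_of_pos ha, ← Complex.ofReal_mul,
    ← Real.rpow_add ha, ← Complex.ofReal_inv, ← Real.rpow_neg_one]
  congr 2
  ring

theorem integral_det_smooth {M : Measure (Fin n → ℝ)} [IsFiniteMeasure M]
    (hM : ∀ᵐ a ∂M, StrictMono a ∧ ∀ i, 0 < a i) {h : ℝ → ℝ} {Z : ℂ}
    (hh : ∀ j : Fin n, IntegrableOn (fun t => h t * t ^ (2 * (j.val : ℝ))) (Set.Ioi 0))
    (hsph : ∀ ξ : Fin n → ℝ, ∫ a, (Matrix.of fun i j : Fin n => (a i : ℂ) ^ mellExp ξ j).det /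
        (vdm (fun i => a i ^ 2) : ℂ) ∂M = Z * (Matrix.of fun j c : Fin n =>
          mellC h (mellExp ξ j) * (mellExp ξ j + 1) ^ c.val).det)
    {ψ : Fin n → ℝ → ℂ} (hc : ∀ j, HasCompactSupport (ψ j))
    (hs : ∀ j, ContDiff ℝ (↑(⊤ : ℕ∞)) (ψ j)) :
    ∫ a, (Matrix.of fun i j : Fin n => (a i : ℂ)⁻¹ * ψ j (Real.log (a i))).det /
        (vdm (fun i => a i ^ 2) : ℂ) ∂M =
      Z * (Matrix.of fun j c : Fin n => ∫ t in Set.Ioi (0 : ℝ),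
        (h t : ℂ) * ((t : ℂ)⁻¹ * deriv^[c.val] (ψ j) (Real.log t))).det := by
  set w : Fin n → ℝ := fun j => 2 * (j.val : ℝ) + 1 with hw
  set θ : Fin n → ℝ → ℂ := fun j => 𝓕 (expTwist (w j) (ψ j)) with hθ
  have hθc : ∀ j, Continuous (θ j) := fun j =>
    continuous_fourier_of_smooth ((hc j).expTwist _) (contDiff_expTwist (hs j) _)
  obtain ⟨K, N, hK, hbd⟩ := exists_norm_det_mellExp_le n
  set D : (Fin n → ℝ) → (Fin n → ℝ) → ℂ := fun ξ a =>
    (Matrix.of fun i j : Fin n => (a i : ℂ) ^ mellExp ξ j).det / (vdm (fun i => a i ^ 2) : ℂ) with hD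
  have hDm : Measurable (Function.uncurry D) := by
    have hv : Measurable fun q : (Fin n → ℝ) × (Fin n → ℝ) => vdm fun i => q.2 i ^ 2 :=
      measurable_vdm.comp (by fun_prop)
    refine Measurable.div ?_ (Complex.measurable_ofReal.comp hv)
    simp only [Matrix.det_apply, Matrix.of_apply, mellExp]
    refine Finset.measurable_sum _ fun σ _ => Measurable.const_smul ?_ _
    refine Finset.measurable_prod _ fun i _ => Measurable.pow ?_ ?_
    · exact Complex.measurable_ofReal.comp ((measurable_pi_apply _).comp measurable_snd)
    · exact measurable_const.add (measurable_const.mul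
        (Complex.measurable_ofReal.comp ((measurable_pi_apply _).comp measurable_fst)))
  have hint : Integrable (Function.uncurry fun ξ a => (∏ j, θ j (ξ j)) * D ξ a)
      ((volume : Measure (Fin n → ℝ)).prod M) := by
    have h1 : Integrable fun ξ : Fin n → ℝ => K * ∏ j, (1 + |ξ j|) ^ N * ‖θ j (ξ j)‖ :=
      (Integrable.fintype_prod fun j => integrable_pow_mul_fourier ((hc j).expTwist _)
        (contDiff_expTwist (hs j) _) N).const_mul K
    have h2 : Integrable (fun q : (Fin n → ℝ) × (Fin n → ℝ) =>
        K * ∏ j, (1 + |q.1 j|) ^ N * ‖θ j (q.1 j)‖) ((volume : Measure (Fin n → ℝ)).prod M) :=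
      h1.comp_fst M
    refine h2.mono' ?_ ?_
    · refine (Measurable.mul (f := fun q : (Fin n → ℝ) × (Fin n → ℝ) => ∏ j, θ j (q.1 j)) ?_
        hDm).aestronglyMeasurable
      exact Finset.measurable_prod _ fun j _ => (hθc j).measurable.comp
        ((measurable_pi_apply j).comp measurable_fst)
    · have h3 : ∀ᵐ q ∂((volume : Measure (Fin n → ℝ)).prod M), StrictMono q.2 ∧ ∀ i, 0 < q.2 i :=
        Measure.quasiMeasurePreserving_snd.ae hM
      filter_upwards [h3] with q hq
      simp only [Function.uncurry]
      rw [norm_mul, norm_prod, Finset.prod_mul_distrib, mul_comm (∏ j, ‖θ j (q.1 j)‖), ← mul_assoc]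
      exact mul_le_mul_of_nonneg_right (hbd _ _ hq.1 hq.2)
        (Finset.prod_nonneg fun _ _ => norm_nonneg _)
  have hswap := integral_integral_swap hint
  have hL : ∫ a, (∫ ξ : Fin n → ℝ, (∏ j, θ j (ξ j)) * D ξ a) ∂M =
      ∫ a, (Matrix.of fun i j : Fin n => (a i : ℂ)⁻¹ * ψ j (Real.log (a i))).det /
        (vdm (fun i => a i ^ 2) : ℂ) ∂M := by
    refine integral_congr_ae ?_
    filter_upwards [hM] with a ha
    have h1 : ∀ ξ : Fin n → ℝ, (∏ j, θ j (ξ j)) * D ξ a = (vdm (fun i => a i ^ 2) : ℂ)⁻¹ *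
        (Matrix.of fun j i : Fin n => θ j (ξ j) *
          (a i : ℂ) ^ (((2 * (j.val : ℝ) : ℝ) : ℂ) + 2 * π * Complex.I * ξ j)).det := by
      intro ξ
      have h2 := Matrix.det_mul_column (fun j => θ j (ξ j))
        (Matrix.of fun j i : Fin n => (a i : ℂ) ^ mellExp ξ j)
      rw [← Matrix.det_transpose (Matrix.of fun j i : Fin n => (a i : ℂ) ^ mellExp ξ j)] at h2
      refine Eq.trans ?_ (congrArg (fun t => (vdm (fun i => a i ^ 2) : ℂ)⁻¹ * t) h2.symm)
      simp only [hD]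
      rw [div_eq_mul_inv, ← mul_assoc, mul_comm]
      rfl
    simp only [h1]
    rw [integral_const_mul, div_eq_inv_mul]
    congr 1
    have h3 := (integral_det_pi (fun _ : Fin n => (volume : Measure ℝ)) (fun j i ξ => θ j ξ *
      (a i : ℂ) ^ (((2 * (j.val : ℝ) : ℝ) : ℂ) + 2 * π * Complex.I * ξ)) fun j i => ?_).2
    · rw [volume_pi, h3, ← Matrix.det_transpose]
      congr 1
      ext i j
      simp only [Matrix.transpose_apply, Matrix.of_apply, hθ, hw]
      exact integral_fourier_expTwist_cpow (hc j) (hs j) (ha.2 i) _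
    · have h4 := integrable_fourier_of_smooth ((hc j).expTwist (w j)) (contDiff_expTwist (hs j) _)
      refine h4.mul_bdd (c := a i ^ (2 * (j.val : ℝ))) ?_ (Eventually.of_forall fun ξ => ?_)
      · refine Measurable.aestronglyMeasurable ?_
        fun_prop
      · rw [Complex.norm_cpow_eq_rpow_re_of_pos (ha.2 i)]
        simp
  have hR : ∫ ξ : Fin n → ℝ, ∫ a, (∏ j, θ j (ξ j)) * D ξ a ∂M = Z * (Matrix.of fun j c : Fin n =>
      ∫ t in Set.Ioi (0 : ℝ), (h t : ℂ) * ((t : ℂ)⁻¹ * deriv^[c.val] (ψ j) (Real.log t))).det := by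
    have h1 : ∀ ξ : Fin n → ℝ, ∫ a, (∏ j, θ j (ξ j)) * D ξ a ∂M = Z * (Matrix.of fun j c : Fin n =>
        𝓕 (expTwist (w j) (deriv^[c.val] (ψ j))) (ξ j) *
          mellC h (((2 * (j.val : ℝ) : ℝ) : ℂ) + 2 * π * Complex.I * ξ j)).det := by
      intro ξ
      rw [integral_const_mul, hsph, mul_left_comm, ← Matrix.det_mul_column]
      congr 3
      ext j c
      simp only [Matrix.of_apply, hθ]
      rw [fourier_expTwist_iterate (hc j) (hs j), mellExp]
      have : ((2 * (j.val : ℝ) : ℝ) : ℂ) + 2 * π * Complex.I * ξ j + 1 =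
          (w j : ℂ) + 2 * π * Complex.I * ξ j := by simp only [hw]; push_cast; ring
      rw [this]
      ring
    simp only [h1]
    rw [integral_const_mul]
    have h2 : ∀ j c : Fin n, _ := fun j c => integral_fourier_mul_mellC
      (((hc j).iterate_deriv c.val).expTwist (w j))
      (contDiff_expTwist ((hs j).iterate_deriv c.val) (w j)) (hh j)
    rw [volume_pi, (integral_det_pi (fun _ : Fin n => (volume : Measure ℝ)) (fun j c ξ =>
      𝓕 (expTwist (w j) (deriv^[c.val] (ψ j))) ξ *
        mellC h (((2 * (j.val : ℝ) : ℝ) : ℂ) + 2 * π * Complex.I * ξ)) fun j c => (h2 j c).1).2]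
    congr 2
    ext j c
    simp only [Matrix.of_apply]
    rw [(h2 j c).2]
    refine setIntegral_congr_fun measurableSet_Ioi fun t (ht : 0 < t) => ?_
    simp only [expTwist]
    rw [show (-((w j : ℂ) * (Real.log t : ℂ)) : ℂ) = ((Real.log t * (-w j) : ℝ) : ℂ) by
      push_cast; ring, ← Complex.ofReal_exp, ← Real.rpow_def_of_pos ht, Complex.ofReal_mul, mul_assoc,
      ← mul_assoc (_ : ℂ) _ (deriv^[c.val] (ψ j) (Real.log t)), ← Complex.ofReal_mul,
      ← Real.rpow_add ht]
    simp only [hw]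
    rw [show 2 * (j.val : ℝ) + -(2 * (j.val : ℝ) + 1) = -1 by ring, Real.rpow_neg_one,
      Complex.ofReal_inv]
  rw [← hL, ← hswap, hR]

end MellinInversion

end

noncomputable section

/-! ### Regularity of the iterated derivatives and integration by parts -/

section IterDeriv

open Filter Topology Real

/-- The first `k` derivatives exist on the positive axis. -/
def DiffTimes (k : ℕ) (f : ℝ → ℝ) : Prop :=
  ∀ i < k, DifferentiableOn ℝ (iteratedDeriv i f) (Set.Ioi 0)

theorem DiffTimes.iteratedDeriv_neg_mul_deriv {k : ℕ} {f : ℝ → ℝ} (hf : DiffTimes (k + 1) f) (i : ℕ)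
    (hi : i ≤ k) : ∀ a ∈ Set.Ioi (0 : ℝ), iteratedDeriv i (fun a => -a * deriv f a) a =
      -(a * iteratedDeriv (i + 1) f a + i * iteratedDeriv i f a) := by
  induction i with
  | zero => intro a _; simp [iteratedDeriv_one]
  | succ i ih =>
    intro a ha
    have hloc : iteratedDeriv i (fun a => -a * deriv f a) =ᶠ[𝓝 a] fun a =>
        -(a * iteratedDeriv (i + 1) f a + i * iteratedDeriv i f a) := by
      filter_upwards [isOpen_Ioi.mem_nhds ha] with b hb using ih (by omega) b hb
    have h1 : HasDerivAt (iteratedDeriv (i + 1) f) (iteratedDeriv (i + 2) f a) a := by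
      rw [iteratedDeriv_succ (n := i + 1)]
      exact ((hf (i + 1) (by omega)).differentiableAt (isOpen_Ioi.mem_nhds ha)).hasDerivAt
    have h2 : HasDerivAt (iteratedDeriv i f) (iteratedDeriv (i + 1) f a) a := by
      rw [iteratedDeriv_succ]
      exact ((hf i (by omega)).differentiableAt (isOpen_Ioi.mem_nhds ha)).hasDerivAt
    have h3 : HasDerivAt (fun a => -(a * iteratedDeriv (i + 1) f a + i * iteratedDeriv i f a))
        (-(1 * iteratedDeriv (i + 1) f a + a * iteratedDeriv (i + 2) f a +
          i * iteratedDeriv (i + 1) f a)) a :=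
      (((hasDerivAt_id a).mul h1).add (h2.const_mul (i : ℝ))).neg
    rw [iteratedDeriv_succ, hloc.deriv_eq, h3.deriv]
    push_cast
    ring

theorem DiffTimes.neg_mul_deriv {k : ℕ} {f : ℝ → ℝ} (hf : DiffTimes (k + 1) f) :
    DiffTimes k fun a => -a * deriv f a := by
  intro i hi
  have h1 : DifferentiableOn ℝ (fun a =>
      -(a * iteratedDeriv (i + 1) f a + i * iteratedDeriv i f a)) (Set.Ioi 0) :=
    ((differentiableOn_id.mul (hf (i + 1) (by omega))).add
      ((differentiableOn_const (i : ℝ)).mul (hf i (by omega)))).neg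
  exact h1.congr (hf.iteratedDeriv_neg_mul_deriv i hi.le)

theorem DiffTimes.negADeriv {k : ℕ} {f : ℝ → ℝ} : ∀ m : ℕ, DiffTimes (k + m) f →
    DiffTimes k (negADeriv m f)
  | 0, hf => hf
  | m + 1, hf => by
    have := DiffTimes.negADeriv (k := k + 1) m (by rwa [add_assoc, add_comm 1 m])
    exact this.neg_mul_deriv

theorem DiffTimes.hasDerivAt_negADeriv {k : ℕ} {h : ℝ → ℝ} (hh : DiffTimes k h) {m : ℕ}
    (hm : m < k) {a : ℝ} (ha : 0 < a) :
    HasDerivAt (_root_.negADeriv m h) (-(_root_.negADeriv (m + 1) h a / a)) a := by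
  have h1 : DiffTimes (k - m) (_root_.negADeriv m h) :=
    DiffTimes.negADeriv m (by rwa [Nat.sub_add_cancel hm.le])
  have h2 := ((h1 0 (by omega)).differentiableAt (isOpen_Ioi.mem_nhds ha)).hasDerivAt
  rw [iteratedDeriv_zero] at h2
  refine h2.congr_deriv ?_
  have h3 : _root_.negADeriv (m + 1) h a = -a * deriv (_root_.negADeriv m h) a := rfl
  rw [h3]
  field_simp

theorem DiffTimes.continuousOn_negADeriv {k : ℕ} {h : ℝ → ℝ} (hh : DiffTimes k h) {m : ℕ}
    (hm : m < k) : ContinuousOn (_root_.negADeriv m h) (Set.Ioi 0) := fun _ ha =>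
  (hh.hasDerivAt_negADeriv hm ha).continuousAt.continuousWithinAt

/-- A primitive of `a ↦ (-a d/da)^c h (a) / a`. -/
def negAPrim (h : ℝ → ℝ) : ℕ → ℝ → ℝ
  | 0, a => ∫ s in (1 : ℝ)..a, h s / s
  | c + 1, a => -negADeriv c h a

theorem DiffTimes.hasDerivAt_negAPrim {k : ℕ} {h : ℝ → ℝ} (hh : DiffTimes k h) (hk : 0 < k)
    {c : ℕ} (hc : c ≤ k) {a : ℝ} (ha : 0 < a) :
    HasDerivAt (negAPrim h c) (_root_.negADeriv c h a / a) a := by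
  cases c with
  | zero =>
    have hcont : ContinuousOn (fun s => h s / s) (Set.Ioi 0) :=
      (hh.continuousOn_negADeriv (m := 0) hk).div continuousOn_id fun s hs => (ne_of_gt hs)
    have hsub : Set.uIcc 1 a ⊆ Set.Ioi 0 := fun s hs =>
      lt_of_lt_of_le (lt_min zero_lt_one ha) hs.1
    exact intervalIntegral.integral_hasDerivAt_right
      (hcont.mono hsub).intervalIntegrable
      (hcont.stronglyMeasurableAtFilter isOpen_Ioi a ha)
      (hcont.continuousAt (isOpen_Ioi.mem_nhds ha))
  | succ c =>
    have := (hh.hasDerivAt_negADeriv (m := c) (by omega) ha).neg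
    rwa [neg_neg] at this

theorem integrableOn_of_zero_off {f : ℝ → ℂ} (hf : ContinuousOn f (Set.Ioi 0)) {α β : ℝ}
    (hα : 0 < α) (h0 : ∀ t, 0 < t → t ∉ Set.Icc α β → f t = 0) : IntegrableOn f (Set.Ioi 0) :=
  ((hf.mono fun _ ht => lt_of_lt_of_le hα ht.1).integrableOn_Icc).of_forall_diff_eq_zero
    measurableSet_Ioi fun t ht => h0 t ht.1 ht.2

theorem integral_mul_deriv_log {k : ℕ} {h : ℝ → ℝ} (hh : DiffTimes k h) {m : ℕ} (hm : m + 1 < k)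
    {φ : ℝ → ℂ} (hφ : ContDiff ℝ (↑(⊤ : ℕ∞)) φ) (hc : HasCompactSupport φ) :
    ∫ t in Set.Ioi (0 : ℝ), (negADeriv m h t : ℂ) * ((t : ℂ)⁻¹ * deriv φ (Real.log t)) =
      ∫ t in Set.Ioi (0 : ℝ), (negADeriv (m + 1) h t : ℂ) * ((t : ℂ)⁻¹ * φ (Real.log t)) := by
  obtain ⟨R, hR⟩ := (isBounded_iff_forall_norm_le.1 hc.isCompact.isBounded)
  have hφ0 : ∀ l, R < |l| → φ l = 0 := fun l hl => by
    by_contra hne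
    exact absurd (hR l (subset_tsupport _ hne)) (not_le.2 hl)
  have hφ0' : ∀ l, R < |l| → deriv φ l = 0 := fun l hl => by
    by_contra hne
    exact absurd (hR l (support_deriv_subset hne)) (not_le.2 hl)
  have hout : ∀ t : ℝ, 0 < t → t ∉ Set.Icc (Real.exp (-R)) (Real.exp R) → R < |Real.log t| := by
    intro t ht0 ht
    by_contra hle
    have h2 := abs_le.1 (not_lt.1 hle)
    exact ht ⟨(Real.le_log_iff_exp_le ht0).1 h2.1, (Real.log_le_iff_le_exp ht0).1 h2.2⟩
  have hlog : ContinuousOn Real.log (Set.Ioi 0) := Real.continuousOn_log.mono fun t ht => ne_of_gt ht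
  have hinv : ContinuousOn (fun t : ℝ => (t : ℂ)⁻¹) (Set.Ioi 0) :=
    Complex.continuous_ofReal.continuousOn.inv₀ fun t ht => by
      exact_mod_cast (ne_of_gt ht)
  have hT : ∀ i < k, ContinuousOn (fun t => (negADeriv i h t : ℂ)) (Set.Ioi 0) := fun i hi =>
    Complex.continuous_ofReal.comp_continuousOn (hh.continuousOn_negADeriv hi)
  have hd1 : Continuous (deriv φ) := (contDiff_infty_iff_deriv.1 hφ).2.continuous
  have hu : ∀ t ∈ Set.Ioi (0 : ℝ), HasDerivAt (fun t => (negADeriv m h t : ℂ))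
      (-(negADeriv (m + 1) h t : ℂ) * (t : ℂ)⁻¹) t := fun t ht => by
    have := (hh.hasDerivAt_negADeriv (m := m) (by omega) ht).ofReal_comp
    refine this.congr_deriv ?_
    push_cast
    rw [div_eq_mul_inv, neg_mul]
  have hv : ∀ t ∈ Set.Ioi (0 : ℝ), HasDerivAt (fun t => φ (Real.log t))
      ((t : ℂ)⁻¹ * deriv φ (Real.log t)) t := fun t ht => by
    have h1 := (((contDiff_infty_iff_deriv.1 hφ).1 (Real.log t)).hasDerivAt.scomp t
      (Real.hasDerivAt_log (ne_of_gt ht)))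
    refine h1.congr_deriv ?_
    rw [Complex.real_smul, Complex.ofReal_inv]
  have key := integral_Ioi_mul_deriv_eq_deriv_mul (a := (0 : ℝ)) (a' := (0 : ℂ)) (b' := (0 : ℂ))
    hu hv ?_ ?_ ?_ ?_
  · rw [key, sub_self, zero_sub, ← integral_neg]
    refine setIntegral_congr_fun measurableSet_Ioi fun t _ => ?_
    ring
  · refine integrableOn_of_zero_off ((hT m (by omega)).mul (hinv.mul
      (hd1.comp_continuousOn hlog))) (exp_pos (-R)) (β := exp R) fun t ht0 ht => ?_
    simp [hφ0' _ (hout t ht0 ht)]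
  · refine integrableOn_of_zero_off (((hT (m + 1) hm).neg.mul hinv).mul
      (hφ.continuous.comp_continuousOn hlog)) (exp_pos (-R)) (β := exp R) fun t ht0 ht => ?_
    simp [hφ0 _ (hout t ht0 ht)]
  · refine tendsto_const_nhds.congr' ?_
    filter_upwards [Ioo_mem_nhdsGT (exp_pos (-R))] with t ht
    simp [hφ0 _ (hout t ht.1 fun h => not_lt.2 h.1 ht.2)]
  · refine tendsto_const_nhds.congr' ?_
    filter_upwards [eventually_gt_atTop (exp R)] with t ht
    simp [hφ0 _ (hout t ((exp_pos R).trans ht) fun h => not_lt.2 h.2 ht)]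

theorem integral_mul_iterate_deriv_log {k : ℕ} {h : ℝ → ℝ} (hh : DiffTimes k h) {φ : ℝ → ℂ}
    (hφ : ContDiff ℝ (↑(⊤ : ℕ∞)) φ) (hc : HasCompactSupport φ) (c : ℕ) (hck : c < k) :
    ∫ t in Set.Ioi (0 : ℝ), (h t : ℂ) * ((t : ℂ)⁻¹ * deriv^[c + 1] φ (Real.log t)) =
      ∫ t in Set.Ioi (0 : ℝ), (negADeriv c h t : ℂ) * ((t : ℂ)⁻¹ * deriv φ (Real.log t)) := by
  have key : ∀ m ≤ c, ∫ t in Set.Ioi (0 : ℝ), (h t : ℂ) *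
      ((t : ℂ)⁻¹ * deriv^[c + 1] φ (Real.log t)) = ∫ t in Set.Ioi (0 : ℝ), (negADeriv m h t : ℂ) *
      ((t : ℂ)⁻¹ * deriv^[c + 1 - m] φ (Real.log t)) := by
    intro m hm
    induction m with
    | zero => rfl
    | succ m ih =>
      rw [ih (by omega), show c + 1 - m = (c + 1 - (m + 1)) + 1 by omega,
        Function.iterate_succ_apply', integral_mul_deriv_log hh (by omega)
          (hφ.iterate_deriv _) (hc.iterate_deriv _)]
  rw [key c le_rfl, show c + 1 - c = 1 by omega, Function.iterate_one]

/-! ### Smooth approximations of the indicator of an interval -/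

theorem deriv_smoothTransition_eq_zero {s : ℝ} (hs : s ∉ Set.Ioo (0 : ℝ) 1) :
    deriv Real.smoothTransition s = 0 := by
  rw [Set.mem_Ioo, not_and_or, not_lt, not_lt] at hs
  rcases hs with h | h
  · refine IsLocalMin.deriv_eq_zero (Eventually.of_forall fun t => ?_)
    rw [Real.smoothTransition.zero_of_nonpos h]
    exact Real.smoothTransition.nonneg t
  · refine IsLocalMax.deriv_eq_zero (Eventually.of_forall fun t => ?_)
    rw [Real.smoothTransition.one_of_one_le h]
    exact Real.smoothTransition.le_one t

theorem continuous_deriv_smoothTransition : Continuous (deriv Real.smoothTransition) :=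
  (contDiff_infty_iff_deriv.1 (Real.smoothTransition.contDiff (n := ⊤))).2.continuous

theorem integral_mul_deriv_smoothTransition {u : ℝ → ℝ} {ε : ℝ} (hε : ε ≠ 0)
    (X : ℝ) : ∫ l, u l * (|ε|⁻¹ * deriv Real.smoothTransition ((l - X) / ε + 1)) =
      ∫ s in (0 : ℝ)..1, u (X + (s - 1) * ε) * deriv Real.smoothTransition s := by
  rw [intervalIntegral.integral_eq_integral_of_support_subset]
  · have h1 : ∀ l, u l * (|ε|⁻¹ * deriv Real.smoothTransition ((l - X) / ε + 1)) =
        |ε|⁻¹ * (fun s => u (X + (s - 1) * ε) * deriv Real.smoothTransition s)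
          ((fun l => (fun r => r + 1) (l / ε)) (l - X)) := by
      intro l
      simp only
      rw [show X + ((l - X) / ε + 1 - 1) * ε = l by field_simp; ring]
      ring
    simp only [h1]
    rw [integral_const_mul, integral_sub_right_eq_self (fun l =>
      u (X + (l / ε + 1 - 1) * ε) * deriv Real.smoothTransition (l / ε + 1)) X,
      Measure.integral_comp_div (fun r => u (X + (r + 1 - 1) * ε) *
        deriv Real.smoothTransition (r + 1)) ε, integral_add_right_eq_self (fun s =>
          u (X + (s - 1) * ε) * deriv Real.smoothTransition s) 1, smul_eq_mul, ← mul_assoc,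
      inv_mul_cancel₀ (abs_ne_zero.2 hε), one_mul]
  · intro s hs
    have : s ∈ Set.Ioo (0 : ℝ) 1 := by
      by_contra h
      exact hs (by simp [deriv_smoothTransition_eq_zero h])
    exact ⟨this.1, this.2.le⟩

theorem tendsto_integral_mul_deriv_smoothTransition {u : ℝ → ℝ} (hu : Continuous u) (X : ℝ) :
    Tendsto (fun ε : ℝ => ∫ s in (0 : ℝ)..1, u (X + (s - 1) * ε) *
      deriv Real.smoothTransition s) (𝓝 0) (𝓝 (u X)) := by
  have hc := continuous_deriv_smoothTransition
  have h1 : Continuous fun ε : ℝ => ∫ s in (0 : ℝ)..1, u (X + (s - 1) * ε) *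
      deriv Real.smoothTransition s :=
    intervalIntegral.continuous_parametric_intervalIntegral_of_continuous' (by
      simp only [Function.uncurry_def]; fun_prop) 0 1
  have h2 := h1.tendsto 0
  have h3 : ∫ s in (0 : ℝ)..1, deriv Real.smoothTransition s = 1 := by
    rw [intervalIntegral.integral_deriv_eq_sub
      (fun s _ => (contDiff_infty_iff_deriv.1 (Real.smoothTransition.contDiff (n := ⊤))).1 s)
      (hc.intervalIntegrable _ _)]
    simp
  simpa [h3] using h2

/-- A smooth function equal to one on `[X, Y]` and to zero outside `[X - ε, Y + ε]`. -/
def plateau (X Y ε l : ℝ) : ℝ :=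
  Real.smoothTransition ((l - X) / ε + 1) + Real.smoothTransition ((Y - l) / ε + 1) - 1

theorem contDiff_plateau (X Y ε : ℝ) : ContDiff ℝ (↑(⊤ : ℕ∞)) (plateau X Y ε) :=
  ((Real.smoothTransition.contDiff.comp (by fun_prop)).add
    (Real.smoothTransition.contDiff.comp (by fun_prop))).sub contDiff_const

theorem plateau_eq_one {X Y ε l : ℝ} (hε : 0 < ε) (h1 : X ≤ l) (h2 : l ≤ Y) :
    plateau X Y ε l = 1 := by
  rw [plateau, Real.smoothTransition.one_of_one_le (by
    have := div_nonneg (sub_nonneg.2 h1) hε.le; linarith),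
    Real.smoothTransition.one_of_one_le (by
      have := div_nonneg (sub_nonneg.2 h2) hε.le; linarith)]
  ring

theorem plateau_eq_zero {X Y ε l : ℝ} (hε : 0 < ε) (hXY : X ≤ Y)
    (h : l ∉ Set.Icc (X - ε) (Y + ε)) : plateau X Y ε l = 0 := by
  rw [Set.mem_Icc, not_and_or, not_le, not_le] at h
  rcases h with h | h
  · have h1 : (l - X) / ε + 1 ≤ 0 := by
      have : (l - X) / ε ≤ -1 := by rw [div_le_iff₀ hε]; linarith
      linarith
    have h2 : 1 ≤ (Y - l) / ε + 1 := by
      have : 0 ≤ (Y - l) / ε := div_nonneg (by linarith) hε.le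
      linarith
    rw [plateau, Real.smoothTransition.zero_of_nonpos h1, Real.smoothTransition.one_of_one_le h2]
    ring
  · have h1 : (Y - l) / ε + 1 ≤ 0 := by
      have : (Y - l) / ε ≤ -1 := by rw [div_le_iff₀ hε]; linarith
      linarith
    have h2 : 1 ≤ (l - X) / ε + 1 := by
      have : 0 ≤ (l - X) / ε := div_nonneg (by linarith) hε.le
      linarith
    rw [plateau, Real.smoothTransition.zero_of_nonpos h1, Real.smoothTransition.one_of_one_le h2]
    ring

theorem abs_plateau_le {X Y ε l : ℝ} : |plateau X Y ε l| ≤ 1 := by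
  have h1 := Real.smoothTransition.le_one ((l - X) / ε + 1)
  have h2 := Real.smoothTransition.le_one ((Y - l) / ε + 1)
  have h3 := Real.smoothTransition.nonneg ((l - X) / ε + 1)
  have h4 := Real.smoothTransition.nonneg ((Y - l) / ε + 1)
  rw [abs_le, plateau]
  constructor <;> linarith

theorem deriv_plateau {X Y ε : ℝ} (hε : 0 < ε) (l : ℝ) : deriv (plateau X Y ε) l =
    |ε|⁻¹ * deriv Real.smoothTransition ((l - X) / ε + 1) -
      |-ε|⁻¹ * deriv Real.smoothTransition ((l - Y) / (-ε) + 1) := by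
  have hd := (contDiff_infty_iff_deriv.1 (Real.smoothTransition.contDiff (n := ⊤))).1
  have h1 : HasDerivAt (fun l => (l - X) / ε + 1) ε⁻¹ l := by
    simpa using (((hasDerivAt_id l).sub_const X).div_const ε).add_const 1
  have h2 : HasDerivAt (fun l => (Y - l) / ε + 1) (-ε⁻¹) l := by
    have := (((hasDerivAt_id l).const_sub Y).div_const ε).add_const 1
    rwa [neg_div, one_div] at this
  have h3 : HasDerivAt (plateau X Y ε) (deriv Real.smoothTransition ((l - X) / ε + 1) * ε⁻¹ +
      deriv Real.smoothTransition ((Y - l) / ε + 1) * -ε⁻¹) l :=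
    (((hd _).hasDerivAt.comp l h1).add ((hd _).hasDerivAt.comp l h2)).sub_const 1
  rw [h3.deriv, abs_neg, abs_of_pos hε, show (l - Y) / -ε = (Y - l) / ε by rw [div_neg, ← neg_div, neg_sub]]
  ring

theorem tendsto_integral_mul_deriv_plateau {u : ℝ → ℝ} (hu : Continuous u) (X Y : ℝ) :
    Tendsto (fun ε => ∫ l, u l * deriv (plateau X Y ε) l) (𝓝[>] 0) (𝓝 (u X - u Y)) := by
  have h1 := (tendsto_integral_mul_deriv_smoothTransition hu X).mono_left
    (nhdsWithin_le_nhds (s := Set.Ioi 0))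
  have h2 : Tendsto (fun ε : ℝ => ∫ s in (0 : ℝ)..1, u (Y + (s - 1) * -ε) *
      deriv Real.smoothTransition s) (𝓝[>] 0) (𝓝 (u Y)) :=
    (tendsto_integral_mul_deriv_smoothTransition hu Y).comp
      ((continuous_neg.tendsto' (0 : ℝ) 0 neg_zero).mono_left nhdsWithin_le_nhds)
  refine (h1.sub h2).congr' ?_
  filter_upwards [self_mem_nhdsWithin] with ε (hε : 0 < ε)
  have hi : ∀ {ε : ℝ}, ε ≠ 0 → ∀ X, Integrable fun l =>
      u l * (|ε|⁻¹ * deriv Real.smoothTransition ((l - X) / ε + 1)) := by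
    intro ε hε X
    have hc := continuous_deriv_smoothTransition
    refine Continuous.integrable_of_hasCompactSupport (by fun_prop) ?_
    refine HasCompactSupport.of_support_subset_isCompact
      (isCompact_closedBall X |ε|) fun l hl => ?_
    have h3 : (l - X) / ε + 1 ∈ Set.Ioo (0 : ℝ) 1 := by
      by_contra h
      exact hl (by simp [deriv_smoothTransition_eq_zero h])
    have h4 : |(l - X) / ε| ≤ 1 := by
      rw [abs_le]; constructor <;> linarith [h3.1, h3.2]
    rw [abs_div, div_le_one (abs_pos.2 hε)] at h4
    exact h4
  rw [← integral_mul_deriv_smoothTransition hε.ne', ← integral_mul_deriv_smoothTransition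
    (neg_ne_zero.2 hε.ne'), ← integral_sub (hi hε.ne' X) (hi (neg_ne_zero.2 hε.ne') Y)]
  refine integral_congr_ae (Eventually.of_forall fun l => ?_)
  simp only [deriv_plateau hε]
  ring

theorem integral_Ioi_comp_log {f : ℝ → ℝ} {T : ℝ → ℝ} :
    ∫ t in Set.Ioi (0 : ℝ), T t * (t⁻¹ * f (Real.log t)) = ∫ l, T (Real.exp l) * f l := by
  have h1 := integral_image_eq_integral_abs_deriv_smul (s := Set.univ) (f := Real.exp)
    (f' := Real.exp) MeasurableSet.univ (fun x _ => (Real.hasDerivAt_exp x).hasDerivWithinAt)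
    Real.exp_injective.injOn (fun t => T t * (t⁻¹ * f (Real.log t)))
  rw [Set.image_univ, Real.range_exp, setIntegral_univ] at h1
  rw [h1]
  refine integral_congr_ae (Eventually.of_forall fun l => ?_)
  simp only [abs_of_pos (Real.exp_pos l), Real.log_exp, smul_eq_mul]
  have := (Real.exp_pos l).ne'
  field_simp

theorem tendsto_integral_deriv_plateau_log {T : ℝ → ℝ} (hT : ContinuousOn T (Set.Ioi 0)) {x y : ℝ}
    (hx : 0 < x) (hy : 0 < y) :
    Tendsto (fun ε => ∫ t in Set.Ioi (0 : ℝ), T t *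
      (t⁻¹ * deriv (plateau (Real.log x) (Real.log y) ε) (Real.log t))) (𝓝[>] 0)
      (𝓝 (T x - T y)) := by
  simp only [integral_Ioi_comp_log]
  have hu : Continuous fun l => T (Real.exp l) :=
    hT.comp_continuous Real.continuous_exp fun l => Real.exp_pos l
  have := tendsto_integral_mul_deriv_plateau hu (Real.log x) (Real.log y)
  simpa only [Real.exp_log hx, Real.exp_log hy] using this

end IterDeriv

end

noncomputable section

/-! ### The measure of boxes in the chamber -/

section BoxFormula

open Filter Topology

variable {n : ℕ}

theorem det_eq_prod_diag {R : Type*} [CommRing R] (A : Matrix (Fin n) (Fin n) R)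
    (hA : ∀ σ : Equiv.Perm (Fin n), (∀ i, A (σ i) i ≠ 0) → σ = 1) : A.det = ∏ i, A i i := by
  rw [Matrix.det_apply, Finset.sum_eq_single 1]
  · simp
  · intro σ _ hσ
    have : ∃ i, A (σ i) i = 0 := by
      by_contra h
      push Not at h
      exact hσ (hA σ h)
    obtain ⟨i, hi⟩ := this
    rw [Finset.prod_eq_zero (f := fun i => A (σ i) i) (Finset.mem_univ i) hi, smul_zero]
  · intro h; exact absurd (Finset.mem_univ _) h

theorem perm_eq_one_of_strictMono {σ : Equiv.Perm (Fin n)} (hσ : StrictMono σ) : σ = 1 := by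
  have h1 : (σ : Fin n → Fin n) = id :=
    (hσ.range_inj strictMono_id).1 (by simp [σ.surjective.range_eq])
  ext i
  simp [h1]

theorem tendsto_det {ι : Type*} {l : Filter ι} {A : ι → Matrix (Fin n) (Fin n) ℝ}
    {B : Matrix (Fin n) (Fin n) ℝ} (h : ∀ i j, Tendsto (fun t => A t i j) l (𝓝 (B i j))) :
    Tendsto (fun t => (A t).det) l (𝓝 B.det) := by
  have h1 : Continuous fun M : Matrix (Fin n) (Fin n) ℝ => M.det := continuous_id.matrix_det
  exact (h1.tendsto B).comp (tendsto_pi_nhds.2 fun i => tendsto_pi_nhds.2 fun j => h i j)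

/-- The weight `1 / (∏ a_i Δ(a²))`. -/
def chamberWeight (a : Fin n → ℝ) : ℝ := (∏ i, (a i)⁻¹) / vdm fun i => a i ^ 2

theorem vdm_sq_pos {a : Fin n → ℝ} (ha : StrictMono a) (ha0 : ∀ i, 0 < a i) :
    0 < vdm fun i => a i ^ 2 :=
  vdm_pos fun i _ hij => pow_lt_pow_left₀ (ha hij) (ha0 i).le two_ne_zero

theorem continuous_vdm : Continuous (vdm : (Fin n → ℝ) → ℝ) := by
  unfold vdm; fun_prop

theorem continuousAt_chamberWeight {a : Fin n → ℝ} (ha : StrictMono a) (ha0 : ∀ i, 0 < a i) :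
    ContinuousAt chamberWeight a := by
  have h1 : Continuous fun a : Fin n → ℝ => vdm fun i => a i ^ 2 :=
    continuous_vdm.comp (by fun_prop)
  exact ContinuousAt.div (tendsto_finsetProd _ fun i _ =>
    ((continuous_apply i).continuousAt (x := a)).inv₀ (ha0 i).ne') h1.continuousAt
      (vdm_sq_pos ha ha0).ne'

theorem measurable_chamberWeight : Measurable (chamberWeight (n := n)) :=
  (Finset.measurable_prod _ fun i _ => (measurable_pi_apply i).inv).div
    (measurable_vdm.comp (by fun_prop))

theorem tendsto_plateau {X Y l : ℝ} (hXY : X ≤ Y) (h : l ∉ Set.Icc X Y) :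
    ∀ᶠ ε in 𝓝[>] (0 : ℝ), plateau X Y ε l = 0 := by
  rw [Set.mem_Icc, not_and_or, not_le, not_le] at h
  rcases h with h | h
  · filter_upwards [Ioo_mem_nhdsGT (sub_pos.2 h)] with ε hε
    exact plateau_eq_zero hε.1 hXY fun hl => by linarith [hl.1, hε.2]
  · filter_upwards [Ioo_mem_nhdsGT (sub_pos.2 h)] with ε hε
    exact plateau_eq_zero hε.1 hXY fun hl => by linarith [hl.2, hε.2]

theorem tendsto_integral_plateau_log {h : ℝ → ℝ} (hh : IntegrableOn h (Set.Ioi 0)) {x y : ℝ}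
    (hx : 0 < x) (hxy : x ≤ y) :
    Tendsto (fun ε => ∫ t in Set.Ioi (0 : ℝ),
      h t * (t⁻¹ * plateau (Real.log x) (Real.log y) ε (Real.log t))) (𝓝[>] 0)
      (𝓝 (∫ s in x..y, h s / s)) := by
  have hy := hx.trans_le hxy
  have hlog := Real.log_le_log hx hxy
  have hlim : ∫ s in x..y, h s / s =
      ∫ t in Set.Ioi (0 : ℝ), (Set.Icc x y).indicator (fun t => h t / t) t := by
    have hI : Set.Ioi (0 : ℝ) ∩ Set.Icc x y = Set.Icc x y :=
      Set.inter_eq_right.2 fun t ht => lt_of_lt_of_le hx ht.1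
    rw [intervalIntegral.integral_of_le hxy, ← integral_Icc_eq_integral_Ioc,
      setIntegral_indicator measurableSet_Icc, hI]
  rw [hlim]
  refine tendsto_integral_filter_of_dominated_convergence
    (fun t => |h t| * Real.exp (1 - Real.log x)) ?_ ?_ (Integrable.mul_const hh.abs _) ?_
  · refine Eventually.of_forall fun ε => hh.aestronglyMeasurable.mul ?_
    have := (contDiff_plateau (Real.log x) (Real.log y) ε).continuous.measurable.comp
      Real.measurable_log
    exact (measurable_inv.mul this).aestronglyMeasurable
  · filter_upwards [Ioo_mem_nhdsGT (zero_lt_one' ℝ)] with ε hε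
    filter_upwards [ae_restrict_mem measurableSet_Ioi] with t (ht : 0 < t)
    rw [norm_mul, Real.norm_eq_abs]
    refine mul_le_mul_of_nonneg_left ?_ (abs_nonneg _)
    by_cases hl : Real.log t ∈ Set.Icc (Real.log x - ε) (Real.log y + ε)
    · rw [norm_mul, Real.norm_eq_abs, Real.norm_eq_abs]
      refine (mul_le_of_le_one_right (abs_nonneg _) abs_plateau_le).trans ?_
      rw [abs_of_pos (inv_pos.2 ht), ← Real.exp_log (inv_pos.2 ht), Real.log_inv, Real.exp_le_exp]
      linarith [hl.1, hε.2]
    · rw [plateau_eq_zero hε.1 hlog hl]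
      simp [Real.exp_nonneg]
  · filter_upwards [ae_restrict_mem measurableSet_Ioi] with t (ht : 0 < t)
    refine tendsto_const_nhds.congr' ?_
    by_cases htI : t ∈ Set.Icc x y
    · filter_upwards [self_mem_nhdsWithin] with ε hε
      rw [plateau_eq_one hε (Real.log_le_log hx htI.1) (Real.log_le_log ht htI.2),
        Set.indicator_of_mem htI]
      ring
    · have : Real.log t ∉ Set.Icc (Real.log x) (Real.log y) := fun h =>
        htI ⟨(Real.log_le_log_iff hx ht).1 h.1, (Real.log_le_log_iff ht hy).1 h.2⟩
      filter_upwards [tendsto_plateau hlog this] with ε hε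
      rw [hε, Set.indicator_of_notMem htI]
      ring

theorem deriv_ofReal_plateau (X Y ε l : ℝ) :
    deriv (fun l => (plateau X Y ε l : ℂ)) l = ((deriv (plateau X Y ε) l : ℝ) : ℂ) :=
  (((contDiff_infty_iff_deriv.1 (contDiff_plateau X Y ε)).1 l).hasDerivAt.ofReal_comp).deriv

theorem hasCompactSupport_plateau {X Y ε : ℝ} (hε : 0 < ε) (hXY : X ≤ Y) :
    HasCompactSupport fun l => (plateau X Y ε l : ℂ) :=
  HasCompactSupport.of_support_subset_isCompact (isCompact_Icc (a := X - ε) (b := Y + ε))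
    fun l hl => by
      by_contra h
      exact hl (by simp [plateau_eq_zero hε hXY h])

theorem integral_plateau_prod {M : Measure (Fin n → ℝ)} [IsFiniteMeasure M]
    (hM : ∀ᵐ a ∂M, StrictMono a ∧ ∀ i, 0 < a i) {h : ℝ → ℝ} {Z : ℝ}
    (hh : ∀ j : Fin n, IntegrableOn (fun t => h t * t ^ (2 * (j.val : ℝ))) (Set.Ioi 0))
    (hd : DiffTimes (n - 1) h)
    (hsph : ∀ ξ : Fin n → ℝ, ∫ a, (Matrix.of fun i j : Fin n => (a i : ℂ) ^ mellExp ξ j).det /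
        (vdm (fun i => a i ^ 2) : ℂ) ∂M = Z * (Matrix.of fun j c : Fin n =>
          mellC h (mellExp ξ j) * (mellExp ξ j + 1) ^ c.val).det)
    {X Y : Fin n → ℝ} (hXY : ∀ i, X i ≤ Y i) {ε : ℝ} (hε : 0 < ε)
    (hsep : ∀ i j, i < j → Y i + ε < X j - ε) :
    ∫ a, (∏ i, plateau (X i) (Y i) ε (Real.log (a i))) * chamberWeight a ∂M =
      Z * (Matrix.of fun j c : Fin n => ∫ t in Set.Ioi (0 : ℝ), (match c.val with
        | 0 => h t * (t⁻¹ * plateau (X j) (Y j) ε (Real.log t))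
        | c + 1 => negADeriv c h t * (t⁻¹ * deriv (plateau (X j) (Y j) ε) (Real.log t)))).det := by
  have hs : ∀ j, ContDiff ℝ (↑(⊤ : ℕ∞)) fun l => (plateau (X j) (Y j) ε l : ℂ) := fun j =>
    Complex.ofRealCLM.contDiff.comp (contDiff_plateau _ _ _)
  have hc := fun j => hasCompactSupport_plateau hε (hXY j)
  have key := integral_det_smooth hM hh hsph hc hs
  have hL : ∫ a, (Matrix.of fun i j : Fin n => (a i : ℂ)⁻¹ *
        (plateau (X j) (Y j) ε (Real.log (a i)) : ℂ)).det / (vdm (fun i => a i ^ 2) : ℂ) ∂M =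
      ((∫ a, (∏ i, plateau (X i) (Y i) ε (Real.log (a i))) * chamberWeight a ∂M : ℝ) : ℂ) := by
    rw [← integral_complex_ofReal]
    refine integral_congr_ae ?_
    filter_upwards [hM] with a ha
    rw [det_eq_prod_diag]
    · simp only [Matrix.of_apply, chamberWeight, Finset.prod_mul_distrib]
      push_cast
      ring
    · intro σ hσ
      refine perm_eq_one_of_strictMono fun i j hij => ?_
      have hmem : ∀ i, Real.log (a (σ i)) ∈ Set.Icc (X i - ε) (Y i + ε) := fun i => by
        by_contra hn
        exact hσ i (by simp [plateau_eq_zero hε (hXY i) hn])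
      have hlt : Real.log (a (σ i)) < Real.log (a (σ j)) :=
        (hmem i).2.trans_lt ((hsep i j hij).trans_le (hmem j).1)
      exact ha.1.lt_iff_lt.1 ((Real.log_lt_log_iff (ha.2 _) (ha.2 _)).1 hlt)
  rw [hL] at key
  have hR : (Matrix.of fun j c : Fin n => ∫ t in Set.Ioi (0 : ℝ), (h t : ℂ) * ((t : ℂ)⁻¹ *
      deriv^[c.val] (fun l => (plateau (X j) (Y j) ε l : ℂ)) (Real.log t))) =
      Complex.ofRealHom.mapMatrix (Matrix.of fun j c : Fin n => ∫ t in Set.Ioi (0 : ℝ), (match c.val with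
        | 0 => h t * (t⁻¹ * plateau (X j) (Y j) ε (Real.log t))
        | c + 1 => negADeriv c h t * (t⁻¹ * deriv (plateau (X j) (Y j) ε) (Real.log t)))) := by
    ext j c
    simp only [Matrix.of_apply, RingHom.mapMatrix_apply, Matrix.map_apply, Complex.ofRealHom_eq_coe]
    rw [← integral_complex_ofReal]
    obtain ⟨c, hcn⟩ := c
    cases c with
    | zero => simp
    | succ c =>
      rw [integral_mul_iterate_deriv_log hd (hs j) (hc j) c (by omega)]
      simp only [deriv_ofReal_plateau]
      push_cast
      rfl
  rw [hR, ← RingHom.map_det] at key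
  rw [Complex.ofRealHom_eq_coe] at key
  exact_mod_cast key

theorem integral_chamberWeight_Icc {M : Measure (Fin n → ℝ)} [IsFiniteMeasure M]
    (hM : ∀ᵐ a ∂M, StrictMono a ∧ ∀ i, 0 < a i) {h : ℝ → ℝ} {Z : ℝ}
    (hh : ∀ j : Fin n, IntegrableOn (fun t => h t * t ^ (2 * (j.val : ℝ))) (Set.Ioi 0))
    (hn : 2 ≤ n) (hd : DiffTimes (n - 1) h)
    (hsph : ∀ ξ : Fin n → ℝ, ∫ a, (Matrix.of fun i j : Fin n => (a i : ℂ) ^ mellExp ξ j).det /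
        (vdm (fun i => a i ^ 2) : ℂ) ∂M = Z * (Matrix.of fun j c : Fin n =>
          mellC h (mellExp ξ j) * (mellExp ξ j + 1) ^ c.val).det)
    {x y : Fin n → ℝ} (hx : ∀ i, 0 < x i) (hxy : ∀ i, x i ≤ y i) (hsep : ∀ i j, i < j → y i < x j) :
    ∫ a in Set.Icc x y, chamberWeight a ∂M =
      Z * (Matrix.of fun j c : Fin n => negAPrim h c.val (y j) - negAPrim h c.val (x j)).det := by
  have hy : ∀ i, 0 < y i := fun i => (hx i).trans_le (hxy i)
  have hlog : ∀ i, Real.log (x i) ≤ Real.log (y i) := fun i => Real.log_le_log (hx i) (hxy i)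
  have hev : ∀ᶠ ε in 𝓝[>] (0 : ℝ), ∀ i j, i < j →
      Real.log (y i) + ε < Real.log (x j) - ε := by
    refine eventually_all.2 fun i => eventually_all.2 fun j => ?_
    by_cases hij : i < j
    · have hlt := Real.log_lt_log (hy i) (hsep i j hij)
      filter_upwards [Ioo_mem_nhdsGT (half_pos (sub_pos.2 hlt))] with ε hε _
      linarith [hε.2]
    · exact Eventually.of_forall fun ε h => absurd h hij
  have hh0 : IntegrableOn h (Set.Ioi 0) := by
    have := hh ⟨0, by omega⟩
    simpa using this
  have hcont : ContinuousOn h (Set.Ioi 0) := hd.continuousOn_negADeriv (m := 0) (by omega)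
  -- the right-hand side
  have hR : Tendsto (fun ε => Z * (Matrix.of fun j c : Fin n => ∫ t in Set.Ioi (0 : ℝ),
      (match c.val with
        | 0 => h t * (t⁻¹ * plateau (Real.log (x j)) (Real.log (y j)) ε (Real.log t))
        | c + 1 => negADeriv c h t *
            (t⁻¹ * deriv (plateau (Real.log (x j)) (Real.log (y j)) ε) (Real.log t)))).det) (𝓝[>] 0)
      (𝓝 (Z * (Matrix.of fun j c : Fin n =>
        negAPrim h c.val (y j) - negAPrim h c.val (x j)).det)) := by
    refine Tendsto.const_mul _ (tendsto_det fun j c => ?_)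
    obtain ⟨c, hcn⟩ := c
    cases c with
    | zero =>
      have h1 := tendsto_integral_plateau_log hh0 (hx j) (hxy j)
      have h2 : ∫ s in (x j)..(y j), h s / s = negAPrim h 0 (y j) - negAPrim h 0 (x j) := by
        have hc : ContinuousOn (fun s => h s / s) (Set.Ioi 0) :=
          hcont.div continuousOn_id fun s hs => ne_of_gt hs
        have hi : ∀ b, 0 < b → IntervalIntegrable (fun s => h s / s) volume 1 b := fun b hb =>
          (hc.mono fun s hs => lt_of_lt_of_le (lt_min zero_lt_one hb) hs.1).intervalIntegrable
        simp only [negAPrim]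
        rw [intervalIntegral.integral_interval_sub_left (hi _ (hy j)) (hi _ (hx j))]
      rw [h2] at h1
      exact h1
    | succ c =>
      have h1 := tendsto_integral_deriv_plateau_log
        (hd.continuousOn_negADeriv (m := c) (by omega)) (hx j) (hy j)
      have h2 : negADeriv c h (x j) - negADeriv c h (y j) =
          negAPrim h (c + 1) (y j) - negAPrim h (c + 1) (x j) := by
        simp only [negAPrim]; ring
      rw [h2] at h1
      exact h1
  -- the left-hand side
  obtain ⟨δ, hδsep, hδ⟩ := (hev.and self_mem_nhdsWithin).exists
  replace hδ : 0 < δ := hδ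
  set lo : Fin n → ℝ := fun i => Real.exp (Real.log (x i) - δ) with hlo
  set hi : Fin n → ℝ := fun i => Real.exp (Real.log (y i) + δ) with hhi
  have hbox : ∀ a ∈ Set.Icc lo hi, StrictMono a ∧ ∀ i, 0 < a i := fun a ha =>
    ⟨fun i j hij => (ha.2 i).trans_lt ((Real.exp_lt_exp.2 (hδsep i j hij)).trans_le (ha.1 j)),
      fun i => (Real.exp_pos _).trans_le (ha.1 i)⟩
  obtain ⟨K, hK⟩ := (isCompact_Icc (a := lo) (b := hi)).exists_bound_of_continuousOn
    (f := chamberWeight) fun a ha =>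
      (continuousAt_chamberWeight (hbox a ha).1 (hbox a ha).2).continuousWithinAt
  have hL : Tendsto (fun ε => ∫ a, (∏ i, plateau (Real.log (x i)) (Real.log (y i)) ε
      (Real.log (a i))) * chamberWeight a ∂M) (𝓝[>] 0)
      (𝓝 (∫ a in Set.Icc x y, chamberWeight a ∂M)) := by
    rw [← integral_indicator measurableSet_Icc]
    refine tendsto_integral_filter_of_dominated_convergence (fun _ => |K|)
      (Eventually.of_forall fun ε => ?_) ?_ (integrable_const _) ?_
    · refine (Measurable.mul (Finset.measurable_prod _ fun i _ => ?_)
        measurable_chamberWeight).aestronglyMeasurable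
      exact (contDiff_plateau _ _ ε).continuous.measurable.comp
        (Real.measurable_log.comp (measurable_pi_apply i))
    · filter_upwards [Ioo_mem_nhdsGT hδ] with ε hε
      filter_upwards [hM] with a ha
      by_cases hmem : ∀ i, Real.log (a i) ∈ Set.Icc (Real.log (x i) - ε) (Real.log (y i) + ε)
      · have ha' : a ∈ Set.Icc lo hi := by
          constructor
          · intro i
            rw [hlo, ← Real.le_log_iff_exp_le (ha.2 i)]
            linarith [(hmem i).1, hε.2]
          · intro i
            rw [hhi, ← Real.log_le_iff_le_exp (ha.2 i)]
            linarith [(hmem i).2, hε.2]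
        rw [norm_mul, norm_prod]
        refine (mul_le_of_le_one_left (norm_nonneg _) ?_).trans ((hK a ha').trans (le_abs_self K))
        exact Finset.prod_le_one (fun _ _ => norm_nonneg _) fun i _ => abs_plateau_le
      · push Not at hmem
        obtain ⟨i, hi⟩ := hmem
        rw [Finset.prod_eq_zero (Finset.mem_univ i) (plateau_eq_zero hε.1 (hlog i) hi), zero_mul,
          norm_zero]
        exact abs_nonneg _
    · filter_upwards [hM] with a ha
      refine tendsto_const_nhds.congr' ?_
      by_cases haI : a ∈ Set.Icc x y
      · filter_upwards [self_mem_nhdsWithin] with ε hε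
        rw [Set.indicator_of_mem haI, Finset.prod_eq_one fun i _ => plateau_eq_one hε
          (Real.log_le_log (hx i) (haI.1 i)) (Real.log_le_log (ha.2 i) (haI.2 i)), one_mul]
      · have : ∃ i, a i ∉ Set.Icc (x i) (y i) := by
          by_contra hne
          push Not at hne
          exact haI ⟨fun i => (hne i).1, fun i => (hne i).2⟩
        obtain ⟨i, hi⟩ := this
        have hl : Real.log (a i) ∉ Set.Icc (Real.log (x i)) (Real.log (y i)) := fun hl =>
          hi ⟨(Real.log_le_log_iff (hx i) (ha.2 i)).1 hl.1,
            (Real.log_le_log_iff (ha.2 i) (hy i)).1 hl.2⟩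
        filter_upwards [tendsto_plateau (hlog i) hl] with ε hε
        rw [Set.indicator_of_notMem haI, Finset.prod_eq_zero (Finset.mem_univ i) hε, zero_mul]
  refine tendsto_nhds_unique hL (hR.congr' ?_)
  filter_upwards [hev, self_mem_nhdsWithin] with ε hε1 hε2
  exact (integral_plateau_prod hM hh hd hsph hlog hε2 hε1).symm

end BoxFormula

end

noncomputable section

/-! ### Recovering the density from the measure of small cubes -/

section Density

open Filter Topology

variable {n : ℕ}

theorem absolutelyContinuous_of_tendsto_closedBall {M : Measure (Fin n → ℝ)} [IsFiniteMeasure M]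
    {q : (Fin n → ℝ) → ENNReal} (hlim : ∀ᵐ a ∂M, q a ≠ ⊤ ∧
      Tendsto (fun r => M (Metric.closedBall a r) / volume (Metric.closedBall a r)) (𝓝[>] 0)
        (𝓝 (q a))) : M ≪ volume := by
  refine Measure.AbsolutelyContinuous.mk fun S hS hS0 => ?_
  have h1 : ∫⁻ x in S, (volume : Measure (Fin n → ℝ)).rnDeriv M x ∂M = 0 := by
    rw [← withDensity_apply _ hS]
    exact le_antisymm ((Measure.le_iff.1 (Measure.withDensity_rnDeriv_le _ _) S hS).trans hS0.le)
      zero_le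
  rw [lintegral_eq_zero_iff (Measure.measurable_rnDeriv _ _)] at h1
  have h2 : ∀ᵐ x ∂M.restrict S, False := by
    filter_upwards [h1, ae_restrict_of_ae hlim,
      ae_restrict_of_ae (Besicovitch.ae_tendsto_rnDeriv volume M)] with x hx1 hx2 hx3
    rw [hx1] at hx3
    have h4 := ENNReal.tendsto_inv_iff.2 hx3
    have h5 : Tendsto (fun r => M (Metric.closedBall x r) / volume (Metric.closedBall x r))
        (𝓝[>] 0) (𝓝 ⊤) := by
      have : ((0 : (Fin n → ℝ) → ENNReal) x)⁻¹ = ⊤ := by simp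
      rw [this] at h4
      refine h4.congr' ?_
      filter_upwards [self_mem_nhdsWithin] with r (hr : 0 < r)
      exact ENNReal.inv_div (Or.inl (measure_ne_top _ _))
        (Or.inr (Metric.measure_closedBall_pos _ _ hr).ne')
    exact hx2.1 (tendsto_nhds_unique hx2.2 h5)
  rw [ae_iff] at h2
  simpa using h2

theorem eq_withDensity_of_tendsto_closedBall {M : Measure (Fin n → ℝ)} [IsFiniteMeasure M]
    {Ω : Set (Fin n → ℝ)} (hΩ : MeasurableSet Ω) (hM : ∀ᵐ a ∂M, a ∈ Ω)
    {q : (Fin n → ℝ) → ENNReal} (hq : ∀ a ∈ Ω, q a ≠ ⊤)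
    (hlim : ∀ a ∈ Ω, Tendsto (fun r => M (Metric.closedBall a r) /
      volume (Metric.closedBall a r)) (𝓝[>] 0) (𝓝 (q a))) :
    M = (volume.restrict Ω).withDensity q := by
  have hac : M ≪ volume := absolutelyContinuous_of_tendsto_closedBall (q := q) (by
    filter_upwards [hM] with a ha using ⟨hq a ha, hlim a ha⟩)
  calc M = M.restrict Ω := (Measure.restrict_eq_self_of_ae_mem hM).symm
    _ = (volume.withDensity (M.rnDeriv volume)).restrict Ω := by
      rw [Measure.withDensity_rnDeriv_eq _ _ hac]
    _ = (volume.restrict Ω).withDensity (M.rnDeriv volume) := restrict_withDensity hΩ _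
    _ = (volume.restrict Ω).withDensity q := by
      refine withDensity_congr_ae ?_
      filter_upwards [ae_restrict_mem hΩ,
        ae_restrict_of_ae (Besicovitch.ae_tendsto_rnDeriv M volume)] with a ha h1
      exact tendsto_nhds_unique h1 (hlim a ha)

theorem tendsto_symm_quotient {F : ℝ → ℝ} {F' a : ℝ} (hF : HasDerivAt F F' a) :
    Tendsto (fun r => (2 * r)⁻¹ * (F (a + r) - F (a - r))) (𝓝[>] 0) (𝓝 F') := by
  have h1 : HasDerivAt (fun r => F (a + r) - F (a - r)) (F' + F') 0 := by
    have ha : HasDerivAt F F' (a + 0) := by simpa using hF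
    have ha' : HasDerivAt F F' (a - 0) := by simpa using hF
    have h2 := ha.comp_const_add a 0
    have h3 := ha'.comp_const_sub a 0
    exact (h2.sub h3).congr_deriv (by ring)
  have h4 := (hasDerivAt_iff_tendsto_slope.1 h1).mono_left
    (nhdsWithin_mono 0 fun r (hr : 0 < r) => hr.ne')
  have h5 := h4.const_mul (2⁻¹ : ℝ)
  refine (h5.congr fun r => ?_).trans (le_of_eq (by congr 1; ring))
  simp only [slope_def_field, add_zero, sub_zero, sub_self]
  rw [mul_inv]
  ring

/-- The open Weyl chamber `0 < a₁ < ⋯ < aₙ`. -/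
def chamber (n : ℕ) : Set (Fin n → ℝ) := {a | StrictMono a ∧ ∀ i, 0 < a i}

theorem measurableSet_chamber : MeasurableSet (chamber n) := by
  have h1 : chamber n = {a | ∀ i j, i < j → a i < a j} ∩ {a | ∀ i, 0 < a i} := by
    ext a; exact ⟨fun h => ⟨fun i j hij => h.1 hij, h.2⟩, fun h => ⟨fun i j hij => h.1 i j hij, h.2⟩⟩
  rw [h1]
  refine MeasurableSet.inter ?_ ?_
  · simp only [Set.setOf_forall]
    exact MeasurableSet.iInter fun i => MeasurableSet.iInter fun j => MeasurableSet.iInter fun _ =>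
      measurableSet_lt (measurable_pi_apply i) (measurable_pi_apply j)
  · simp only [Set.setOf_forall]
    exact MeasurableSet.iInter fun i => measurableSet_lt measurable_const (measurable_pi_apply i)

theorem closedBall_eq_Icc (a : Fin n → ℝ) {r : ℝ} (hr : 0 ≤ r) :
    Metric.closedBall a r = Set.Icc (fun i => a i - r) (fun i => a i + r) := by
  rw [closedBall_pi _ hr, ← Set.pi_univ_Icc]
  simp only [Real.closedBall_eq_Icc]

theorem tendsto_measureReal_closedBall {M : Measure (Fin n → ℝ)} [IsFiniteMeasure M]
    (hM : ∀ᵐ a ∂M, StrictMono a ∧ ∀ i, 0 < a i) {h : ℝ → ℝ} {Z : ℝ}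
    (hh : ∀ j : Fin n, IntegrableOn (fun t => h t * t ^ (2 * (j.val : ℝ))) (Set.Ioi 0))
    (hn : 2 ≤ n) (hd : DiffTimes (n - 1) h)
    (hsph : ∀ ξ : Fin n → ℝ, ∫ a, (Matrix.of fun i j : Fin n => (a i : ℂ) ^ mellExp ξ j).det /
        (vdm (fun i => a i ^ 2) : ℂ) ∂M = Z * (Matrix.of fun j c : Fin n =>
          mellC h (mellExp ξ j) * (mellExp ξ j + 1) ^ c.val).det)
    {a : Fin n → ℝ} (ha : a ∈ chamber n) :
    Tendsto (fun r => M.real (Metric.closedBall a r) / (2 * r) ^ n) (𝓝[>] 0)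
      (𝓝 (Z * (vdm fun i => a i ^ 2) *
        (Matrix.of fun b c : Fin n => negADeriv c.val h (a b)).det)) := by
  have hv := vdm_sq_pos ha.1 ha.2
  have hp : (0 : ℝ) < ∏ i, (a i)⁻¹ := Finset.prod_pos fun i _ => inv_pos.2 (ha.2 i)
  have hw : 0 < chamberWeight a := div_pos hp hv
  have hsmall : ∀ᶠ r in 𝓝[>] (0 : ℝ), (∀ i, 0 < a i - r) ∧ ∀ i j, i < j → a i + r < a j - r := by
    refine (eventually_all.2 fun i => ?_).and
      (eventually_all.2 fun i => eventually_all.2 fun j => ?_)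
    · filter_upwards [Ioo_mem_nhdsGT (ha.2 i)] with r hr
      linarith [hr.2]
    · by_cases hij : i < j
      · filter_upwards [Ioo_mem_nhdsGT (half_pos (sub_pos.2 (ha.1 hij)))] with r hr _
        linarith [hr.2]
      · exact Eventually.of_forall fun r h => absurd h hij
  have hI : Tendsto (fun r => ((2 * r) ^ n)⁻¹ * ∫ b in Metric.closedBall a r, chamberWeight b ∂M)
      (𝓝[>] 0) (𝓝 (Z * (Matrix.of fun j c : Fin n => negADeriv c.val h (a j) / a j).det)) := by
    have h1 : Tendsto (fun r => Z * (Matrix.of fun j c : Fin n => (2 * r)⁻¹ *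
        (negAPrim h c.val (a j + r) - negAPrim h c.val (a j - r))).det) (𝓝[>] 0)
        (𝓝 (Z * (Matrix.of fun j c : Fin n => negADeriv c.val h (a j) / a j).det)) :=
      Tendsto.const_mul _ (tendsto_det fun j c =>
        tendsto_symm_quotient (hd.hasDerivAt_negAPrim (by omega) (by have := c.isLt; omega) (ha.2 j)))
    refine h1.congr' ?_
    filter_upwards [hsmall, self_mem_nhdsWithin] with r hr (hr0 : 0 < r)
    rw [closedBall_eq_Icc a hr0.le, integral_chamberWeight_Icc hM hh hn hd hsph hr.1
      (fun i => by linarith) hr.2]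
    have h2 : (Matrix.of fun j c : Fin n => (2 * r)⁻¹ *
        (negAPrim h c.val (a j + r) - negAPrim h c.val (a j - r))) = (2 * r)⁻¹ •
        (Matrix.of fun j c : Fin n => negAPrim h c.val (a j + r) - negAPrim h c.val (a j - r)) := by
      ext j c; rfl
    rw [h2, Matrix.det_smul, Fintype.card_fin, inv_pow]
    ring
  have hsets : Tendsto (fun r => Metric.closedBall a r) (𝓝[>] 0) (𝓝 a).smallSets :=
    (tendsto_closedBall_smallSets a).mono_left nhdsWithin_le_nhds
  have hlo := (continuousAt_chamberWeight ha.1 ha.2).integral_sub_linear_isLittleO_ae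
    (μ := M) measurable_chamberWeight.stronglyMeasurable.stronglyMeasurableAtFilter hsets
  have heq : Asymptotics.IsEquivalent (𝓝[>] 0)
      (fun r => ((2 * r) ^ n)⁻¹ * ∫ b in Metric.closedBall a r, chamberWeight b ∂M)
      (fun r => ((2 * r) ^ n)⁻¹ * (M.real (Metric.closedBall a r) * chamberWeight a)) := by
    refine (Asymptotics.IsEquivalent.refl).mul ?_
    refine hlo.trans_isBigO ?_
    exact (Asymptotics.isBigO_refl _ _).trans
      (Asymptotics.isBigO_const_mul_self (chamberWeight a)⁻¹ _ _ |>.congr_left fun r => by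
        field_simp)
  have hlim := (heq.tendsto_nhds hI).mul_const (chamberWeight a)⁻¹
  have hval : Z * (Matrix.of fun j c : Fin n => negADeriv c.val h (a j) / a j).det *
      (chamberWeight a)⁻¹ = Z * (vdm fun i => a i ^ 2) *
        (Matrix.of fun b c : Fin n => negADeriv c.val h (a b)).det := by
    have h2 : (Matrix.of fun j c : Fin n => negADeriv c.val h (a j) / a j).det =
        (∏ i, (a i)⁻¹) * (Matrix.of fun b c : Fin n => negADeriv c.val h (a b)).det := by
      rw [← Matrix.det_mul_column]
      congr 1
      ext j c
      simp only [Matrix.of_apply]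
      ring
    rw [h2, chamberWeight]
    generalize ∏ i, (a i)⁻¹ = p at hp
    field_simp
  rw [hval] at hlim
  refine hlim.congr fun r => ?_
  rw [mul_assoc, mul_inv_cancel_right₀ hw.ne']
  ring

theorem tendsto_measure_closedBall {M : Measure (Fin n → ℝ)} [IsFiniteMeasure M] {a : Fin n → ℝ}
    {q : ℝ} (h : Tendsto (fun r => M.real (Metric.closedBall a r) / (2 * r) ^ n) (𝓝[>] 0) (𝓝 q)) :
    Tendsto (fun r => M (Metric.closedBall a r) / volume (Metric.closedBall a r)) (𝓝[>] 0)
      (𝓝 (ENNReal.ofReal q)) := by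
  refine (ENNReal.tendsto_ofReal h).congr' ?_
  filter_upwards [self_mem_nhdsWithin] with r (hr : 0 < r)
  rw [Real.volume_pi_closedBall _ hr.le, Fintype.card_fin, ENNReal.ofReal_div_of_pos (by positivity),
    Measure.real, ENNReal.ofReal_toReal (measure_ne_top M (Metric.closedBall a r))]

theorem eq_withDensity_chamber {M : Measure (Fin n → ℝ)} [IsFiniteMeasure M]
    (hM : ∀ᵐ a ∂M, StrictMono a ∧ ∀ i, 0 < a i) {h : ℝ → ℝ} {Z : ℝ}
    (hh : ∀ j : Fin n, IntegrableOn (fun t => h t * t ^ (2 * (j.val : ℝ))) (Set.Ioi 0))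
    (hn : 2 ≤ n) (hd : DiffTimes (n - 1) h)
    (hsph : ∀ ξ : Fin n → ℝ, ∫ a, (Matrix.of fun i j : Fin n => (a i : ℂ) ^ mellExp ξ j).det /
        (vdm (fun i => a i ^ 2) : ℂ) ∂M = Z * (Matrix.of fun j c : Fin n =>
          mellC h (mellExp ξ j) * (mellExp ξ j + 1) ^ c.val).det) :
    (∀ a ∈ chamber n, 0 ≤ Z * (vdm fun i => a i ^ 2) *
      (Matrix.of fun b c : Fin n => negADeriv c.val h (a b)).det) ∧
    M = (volume.restrict (chamber n)).withDensity fun a => ENNReal.ofReal (Z *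
      (vdm fun i => a i ^ 2) * (Matrix.of fun b c : Fin n => negADeriv c.val h (a b)).det) := by
  refine ⟨fun a ha => ge_of_tendsto (tendsto_measureReal_closedBall hM hh hn hd hsph ha) ?_,
    eq_withDensity_of_tendsto_closedBall measurableSet_chamber hM (fun _ _ => ENNReal.ofReal_ne_top)
      fun _ ha => tendsto_measure_closedBall (tendsto_measureReal_closedBall hM hh hn hd hsph ha)⟩
  filter_upwards [self_mem_nhdsWithin] with r (hr : 0 < r)
  positivity

end Density

end

noncomputable section

/-! ### Permutation symmetry -/

section Symmetry

variable {n : ℕ}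

/-- A permutation of the `2 × 2` blocks. -/
def blockPerm (w : Equiv.Perm (Fin n)) : Equiv.Perm (Fin (2 * n)) where
  toFun i := ⟨2 * (w ⟨i.val / 2, by omega⟩).val + i.val % 2, by
    have := (w ⟨i.val / 2, by omega⟩).isLt; omega⟩
  invFun i := ⟨2 * (w.symm ⟨i.val / 2, by omega⟩).val + i.val % 2, by
    have := (w.symm ⟨i.val / 2, by omega⟩).isLt; omega⟩
  left_inv i := by
    apply Fin.ext
    have h (v : ℕ) : (2 * v + i.val % 2) / 2 = v := by omega
    have h' (v : ℕ) : (2 * v + i.val % 2) % 2 = i.val % 2 := by omega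
    simp only [h, h', Fin.eta, Equiv.symm_apply_apply]
    omega
  right_inv i := by
    apply Fin.ext
    have h (v : ℕ) : (2 * v + i.val % 2) / 2 = v := by omega
    have h' (v : ℕ) : (2 * v + i.val % 2) % 2 = i.val % 2 := by omega
    simp only [h, h', Fin.eta, Equiv.apply_symm_apply]
    omega

theorem blockPerm_val (w : Equiv.Perm (Fin n)) (i : Fin (2 * n)) :
    (blockPerm w i).val = 2 * (w ⟨i.val / 2, by omega⟩).val + i.val % 2 := rfl

theorem Dmat_submatrix_blockPerm (w : Equiv.Perm (Fin n)) (a : Fin n → ℝ) :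
    (Dmat a).submatrix (blockPerm w) (blockPerm w) = Dmat (a ∘ w) := by
  ext i j
  have h (i v : ℕ) : (2 * v + i % 2) / 2 = v := by omega
  have h' (i v : ℕ) : (2 * v + i % 2) % 2 = i % 2 := by omega
  simp only [Matrix.submatrix_apply, Dmat, Matrix.of_apply, blockPerm_val, h, h', Fin.eta,
    Function.comp_apply, Fin.val_inj, EmbeddingLike.apply_eq_iff_eq, Fin.mk.injEq]

theorem IsInvTest.comp_perm {φ : Matrix (Fin (2 * n)) (Fin (2 * n)) ℝ → ℝ}
    (hφ : IsInvTest (2 * n) φ) (w : Equiv.Perm (Fin n)) (a : Fin n → ℝ) :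
    φ (Dmat (a ∘ w)) = φ (Dmat a) := by
  obtain ⟨k, hk, hkY⟩ := exists_orthogonal_submatrix (blockPerm w)
  rw [← Dmat_submatrix_blockPerm, ← hkY]
  exact hφ.2.2 _ (Dmat_transpose a) k hk

theorem vdm_mul_det_comp_perm (F : Fin n → ℝ → ℝ) (w : Equiv.Perm (Fin n)) (a : Fin n → ℝ) :
    (vdm fun i => (a ∘ w) i ^ 2) * (Matrix.of fun b c : Fin n => F c ((a ∘ w) b)).det =
      (vdm fun i => a i ^ 2) * (Matrix.of fun b c : Fin n => F c (a b)).det := by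
  have h1 : Matrix.vandermonde (fun i => (a ∘ w) i ^ 2) =
      (Matrix.vandermonde fun i => a i ^ 2).submatrix w id := rfl
  have h2 : (Matrix.of fun b c : Fin n => F c ((a ∘ w) b)) =
      (Matrix.of fun b c : Fin n => F c (a b)).submatrix w id := rfl
  have hs : ((Equiv.Perm.sign w : ℤ) : ℝ) * ((Equiv.Perm.sign w : ℤ) : ℝ) = 1 := by
    rw [← Int.cast_mul, ← Units.val_mul, Int.units_mul_self]; simp
  rw [vdm_eq_det, vdm_eq_det, h1, h2, Matrix.det_permute, Matrix.det_permute]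
  linear_combination ((Matrix.vandermonde fun i => a i ^ 2).det *
    (Matrix.of fun b c : Fin n => F c (a b)).det) * hs

theorem svDensity_comp_perm (h : ℝ → ℝ) (w : Equiv.Perm (Fin n)) (a : Fin n → ℝ) :
    svDensity n h (a ∘ w) = svDensity n h a := by
  have := vdm_mul_det_comp_perm (fun c => negADeriv c.val h) w a
  simp only [svDensity, mul_assoc] at this ⊢
  rw [this]

theorem ae_injective : ∀ᵐ a : Fin n → ℝ, Function.Injective a := by
  have h : ∀ i j : Fin n, ∀ᵐ a : Fin n → ℝ, a i = a j → i = j := by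
    intro i j
    by_cases hij : i = j
    · exact Filter.Eventually.of_forall fun _ _ => hij
    · let S : Submodule ℝ (Fin n → ℝ) := LinearMap.ker
        (LinearMap.proj (R := ℝ) (φ := fun _ : Fin n => ℝ) i - LinearMap.proj j)
      have hS : S ≠ ⊤ := fun htop => by
        have : (Pi.single i 1 : Fin n → ℝ) ∈ S := htop ▸ Submodule.mem_top
        simp [S, LinearMap.mem_ker, Pi.single_apply, Ne.symm hij] at this
      rw [ae_iff]
      refine measure_mono_null (fun a ha => ?_) (Measure.addHaar_submodule volume S hS)
      simp only [Set.mem_setOf_eq, Classical.not_imp] at ha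
      simp [S, LinearMap.mem_ker, ha.1]
  filter_upwards [ae_all_iff.2 fun i => ae_all_iff.2 fun j => h i j] with a ha i j hij
  exact ha i j hij

/-- The integral of a symmetric function over the positive orthant is `n!` times the integral over
the chamber. -/
theorem integral_pos_eq_factorial_mul {f : (Fin n → ℝ) → ℝ}
    (hsymm : ∀ (w : Equiv.Perm (Fin n)) a, f (a ∘ w) = f a) (hf : IntegrableOn f (chamber n)) :
    ∫ a in {a : Fin n → ℝ | ∀ j, 0 < a j}, f a = n.factorial * ∫ a in chamber n, f a := by
  let e (w : Equiv.Perm (Fin n)) := MeasurableEquiv.piCongrLeft (fun _ : Fin n => ℝ) w.symm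
  have he : ∀ w a, e w a = a ∘ w := by
    intro w a
    ext j
    obtain ⟨i, rfl⟩ := w.symm.surjective j
    simp only [e, MeasurableEquiv.coe_piCongrLeft, Function.comp_apply, Equiv.apply_symm_apply]
    exact Equiv.piCongrLeft_apply_apply (fun _ : Fin n => ℝ) w.symm a i
  have hmp : ∀ w, MeasurePreserving (e w) volume volume := fun w =>
    volume_measurePreserving_piCongrLeft (fun _ : Fin n => ℝ) w.symm
  have hfe : ∀ w, f ∘ e w = f := fun w => funext fun a => by
    rw [Function.comp_apply, he, hsymm]
  have hset : {a : Fin n → ℝ | ∀ j, 0 < a j} =ᵐ[volume] ⋃ w, e w ⁻¹' chamber n := by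
    filter_upwards [ae_injective] with a ha
    refine propext ⟨fun hpos => ?_, fun hmem => ?_⟩
    · refine Set.mem_iUnion.2 ⟨Tuple.sort a, ?_⟩
      rw [Set.mem_preimage, he]
      exact ⟨(Tuple.monotone_sort a).strictMono_of_injective
        (ha.comp (Tuple.sort a).injective), fun i => hpos _⟩
    · obtain ⟨w, hw⟩ := Set.mem_iUnion.1 hmem
      rw [Set.mem_preimage, he] at hw
      intro j
      have := hw.2 (w.symm j)
      rwa [Function.comp_apply, Equiv.apply_symm_apply] at this
  rw [setIntegral_congr_set hset, integral_iUnion_fintype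
    (fun w => (e w).measurable measurableSet_chamber)]
  · have : ∀ w, ∫ a in e w ⁻¹' chamber n, f a = ∫ a in chamber n, f a := fun w => by
      rw [← (hmp w).setIntegral_preimage_emb (e w).measurableEmbedding f (chamber n)]
      exact integral_congr_ae (Filter.Eventually.of_forall fun a => (congrFun (hfe w) a).symm)
    simp only [this, Finset.sum_const, Finset.card_univ, Fintype.card_perm, Fintype.card_fin,
      nsmul_eq_mul]
  · intro w w' hww
    refine Set.disjoint_left.2 fun a ha ha' => hww ?_
    rw [Set.mem_preimage, he] at ha ha'
    have hr : Set.range (a ∘ w) = Set.range (a ∘ w') := by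
      rw [w.surjective.range_comp, w'.surjective.range_comp]
    have h1 : a ∘ w = a ∘ w' := (ha.1.range_inj ha'.1).1 hr
    have hinj : Function.Injective a := by
      have := ha.1.injective.comp w.symm.injective
      rwa [Function.comp_assoc, Equiv.self_comp_symm, Function.comp_id] at this
    exact Equiv.ext fun i => hinj (congrFun h1 i)
  · intro w
    have := ((hmp w).integrableOn_comp_preimage (e w).measurableEmbedding (f := f)
      (s := chamber n)).2 hf
    rwa [hfe w] at this

end Symmetry

/-! ### The case of a single block -/

section SingleBlock

theorem stdConj_two (g : Matrix (Fin 2) (Fin 2) ℝ) :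
    stdConj (n := 1) g = Dmat (fun _ : Fin 1 => g.det) := by
  ext i j
  change Fin 2 at i j
  have h := Matrix.det_fin_two g
  fin_cases i <;> fin_cases j <;>
    simp [stdConj, Matrix.mul_apply, Fin.sum_univ_two, Dmat, h] <;> ring

theorem IsInvTest.neg_single {φ : Matrix (Fin 2) (Fin 2) ℝ → ℝ} (hφ : IsInvTest 2 φ) (t : ℝ) :
    φ (Dmat (fun _ : Fin 1 => -t)) = φ (Dmat fun _ : Fin 1 => t) := by
  obtain ⟨k, hk, hkY⟩ := exists_orthogonal_submatrix (Fin.revPerm (n := 2))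
  have h : Dmat (fun _ : Fin 1 => -t) =
      Matrix.submatrix (Dmat fun _ : Fin 1 => t) (Fin.revPerm (n := 2)) (Fin.revPerm (n := 2)) := by
    ext i j
    change Fin 2 at i j
    fin_cases i <;> fin_cases j <;> simp [Dmat]
  rw [h, ← hkY]
  exact hφ.2.2 _ (Dmat_transpose _) k hk

theorem IsFactorizing.ae_eq_weight {P : Matrix (Fin 2) (Fin 2) ℝ → ℝ}
    {σw : Matrix (Fin 2) (Fin 2) ℝ → ℝ} (hfac : IsFactorizing 1 P σw) : P =ᵐ[volume] σw := by
  have hmp := (volume_preserving_funUnique (Fin 1) (Matrix (Fin 2) (Fin 2) ℝ)).symm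
  have h := hmp.quasiMeasurePreserving.ae hfac.factor
  filter_upwards [h] with z hz
  have : IsEmpty {ij : Fin 1 × Fin 1 // ij.2 < ij.1} :=
    ⟨fun x => absurd x.2 (by simp [Subsingleton.elim x.1.2 x.1.1])⟩
  rw [Measure.volume_pi_eq_dirac, integral_dirac] at hz
  have hZ : ∀ c : {ij : Fin 1 × Fin 1 // ij.2 < ij.1} → Matrix (Fin 2) (Fin 2) ℝ,
      Tmat c * Zmat (fun _ : Fin 1 => z) = z := by
    intro c
    ext i j
    change Fin 2 at i j
    fin_cases i <;> fin_cases j <;> simp [Tmat, Zmat, Matrix.mul_apply, Fin.sum_univ_two]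
  have hz' : (MeasurableEquiv.funUnique (Fin 1) (Matrix (Fin 2) (Fin 2) ℝ)).symm z =
      fun _ => z := rfl
  rw [hz', hZ] at hz
  simpa using hz

theorem integral_single_block {P : Matrix (Fin 2) (Fin 2) ℝ → ℝ}
    {σw : Matrix (Fin 2) (Fin 2) ℝ → ℝ} (hfac : IsFactorizing 1 P σw) {h : ℝ → ℝ}
    (hdet : IsDetDensity σw h) {φ : Matrix (Fin 2) (Fin 2) ℝ → ℝ} (hφ : IsInvTest 2 φ) :
    ∫ g, P g * φ (stdConj (n := 1) g) =
      ∫ a in {a : Fin 1 → ℝ | ∀ j, 0 < a j}, φ (Dmat a) * svDensity 1 h a := by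
  have hPσ := hfac.ae_eq_weight
  have hm1 : mellH h 1 = 1 := by
    have h1 := hdet.2 (fun _ => 1) measurable_const ⟨1, by simp⟩
    simp only [mul_one] at h1
    have h2 : ∫ z, P z = ∫ z, σw z := integral_congr_ae hPσ
    simp only [mellH, sub_self, Real.rpow_zero, mul_one]
    rw [← h1, ← h2]
    exact hfac.prob
  obtain ⟨C, hC⟩ := hφ.2.1
  have hcont : Continuous fun t : ℝ => Dmat fun _ : Fin 1 => t :=
    continuous_Dmat.comp (continuous_pi fun _ => continuous_id)
  have key := hdet.2 (fun t => φ (Dmat fun _ : Fin 1 => t)) (hφ.1.comp hcont.measurable)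
    ⟨C, fun t => hC _⟩
  have hL : ∫ g, P g * φ (stdConj (n := 1) g) =
      ∫ z, σw z * φ (Dmat fun _ : Fin 1 => |z.det|) := by
    refine integral_congr_ae ?_
    filter_upwards [hPσ] with z hz
    rw [hz, stdConj_two]
    rcases abs_choice z.det with hd | hd
    · rw [hd]
    · rw [hd, hφ.neg_single]
  have hR : ∫ a in {a : Fin 1 → ℝ | ∀ j, 0 < a j}, φ (Dmat a) * svDensity 1 h a =
      ∫ t in Set.Ioi (0 : ℝ), h t * φ (Dmat fun _ : Fin 1 => t) := by
    have hmp := (volume_preserving_funUnique (Fin 1) ℝ).symm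
    refine (hmp.setIntegral_preimage_emb (MeasurableEquiv.measurableEmbedding _) _ _).symm.trans ?_
    have hs : (MeasurableEquiv.funUnique (Fin 1) ℝ).symm ⁻¹' {a : Fin 1 → ℝ | ∀ j, 0 < a j} =
        Set.Ioi 0 := by
      ext t
      exact ⟨fun ht => ht 0, fun ht _ => ht⟩
    rw [hs]
    refine integral_congr_ae (Filter.Eventually.of_forall fun t => ?_)
    have ht : (MeasurableEquiv.funUnique (Fin 1) ℝ).symm t = fun _ => t := rfl
    simp only [ht]
    have : svDensity 1 h (fun _ => t) = h t := by
      have hv : vdm (fun _ : Fin 1 => t ^ 2) = 1 := by simp [vdm_eq_det]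
      simp [svDensity, hv, negADeriv, show (2 : ℝ) - 1 = 1 by norm_num, hm1]
    rw [this, mul_comm]
  rw [hL, hR]
  exact key

end SingleBlock

/-! ### The main theorem -/

section Main

variable {n : ℕ}

theorem aestronglyMeasurable_negADeriv_det {h : ℝ → ℝ} (hc : ContinuousOn h (Set.Ioi 0)) :
    AEStronglyMeasurable (fun a : Fin n → ℝ =>
      (Matrix.of fun b c : Fin n => negADeriv c.val h (a b)).det) (volume.restrict (chamber n)) := by
  simp only [Matrix.det_apply, Matrix.of_apply]
  refine Finset.aestronglyMeasurable_fun_sum _ fun σ _ => AEStronglyMeasurable.const_smul ?_ _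
  refine Finset.aestronglyMeasurable_fun_prod _ fun i _ => ?_
  generalize i.val = c
  cases c with
  | zero =>
    refine ContinuousOn.aestronglyMeasurable ?_ measurableSet_chamber
    exact hc.comp (continuous_apply _).continuousOn fun a ha => ha.2 _
  | succ c =>
    have : Measurable (negADeriv (c + 1) h) := (measurable_id.neg).mul (measurable_deriv _)
    exact (this.comp (measurable_pi_apply _)).aestronglyMeasurable

theorem factorial_mul_det_vandermonde (hn : 1 ≤ n) :
    (n.factorial : ℝ) * (Matrix.vandermonde fun j : Fin n => ((j.val : ℕ) : ℝ)).det =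
      ∏ j : Fin n, ((j.val + 1).factorial : ℝ) := by
  obtain ⟨m, rfl⟩ := Nat.exists_eq_add_of_le' hn
  rw [Matrix.det_vandermonde_id_eq_superFactorial, ← Nat.cast_mul, ← Nat.superFactorial_succ,
    ← Nat.prod_range_factorial_succ, ← Fin.prod_univ_eq_prod_range]
  push_cast
  rfl

/-- Integration against the law of the parameters of `g D(1) gᵀ`. -/
theorem integral_map_specParam {P : Matrix (Fin (2 * n)) (Fin (2 * n)) ℝ → ℝ}
    {σw : Matrix (Fin 2) (Fin 2) ℝ → ℝ} (hfac : IsFactorizing n P σw) {E : Type*}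
    [NormedAddCommGroup E] [NormedSpace ℝ E] {F : (Fin n → ℝ) → E} (hF : StronglyMeasurable F) :
    ∫ a, F a ∂((volume.withDensity fun g => ENNReal.ofReal (P g)).map fun g =>
      specParam (stdConj g)) = ∫ g, P g • F (specParam (stdConj g)) := by
  have hS : Measurable fun g : Matrix (Fin (2 * n)) (Fin (2 * n)) ℝ => specParam (stdConj g) :=
    measurable_specParam.comp continuous_stdConj.measurable
  rw [integral_map hS.aemeasurable hF.aestronglyMeasurable, integral_withDensity_eq_integral_toReal_smul₀
    hfac.integrable.1.aemeasurable.ennreal_ofReal (Filter.Eventually.of_forall fun _ =>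
      ENNReal.ofReal_lt_top)]
  refine integral_congr_ae (Filter.Eventually.of_forall fun g => ?_)
  simp only [ENNReal.toReal_ofReal (hfac.nonneg g)]

theorem IsInvTest.stdConj_eq {φ : Matrix (Fin (2 * n)) (Fin (2 * n)) ℝ → ℝ}
    (hφ : IsInvTest (2 * n) φ) (g : Matrix (Fin (2 * n)) (Fin (2 * n)) ℝ) :
    φ (stdConj g) = φ (Dmat (specParam (stdConj g))) := by
  obtain ⟨k, hk, hX⟩ := (specParam_spec (stdConj_transpose g)).2.2
  conv_lhs => rw [hX]
  exact hφ.2.2 _ (Dmat_transpose _) k hk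

theorem isProbabilityMeasure_withDensity {P : Matrix (Fin (2 * n)) (Fin (2 * n)) ℝ → ℝ}
    {σw : Matrix (Fin 2) (Fin 2) ℝ → ℝ} (hfac : IsFactorizing n P σw) :
    IsProbabilityMeasure (volume.withDensity fun g => ENNReal.ofReal (P g)) := by
  refine ⟨?_⟩
  rw [withDensity_apply _ MeasurableSet.univ, Measure.restrict_univ,
    ← ofReal_integral_eq_lintegral_ofReal hfac.integrable (Filter.Eventually.of_forall hfac.nonneg),
    hfac.prob, ENNReal.ofReal_one]

theorem integral_mul_stdConj (hn : 2 ≤ n) {P : Matrix (Fin (2 * n)) (Fin (2 * n)) ℝ → ℝ}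
    {σw : Matrix (Fin 2) (Fin 2) ℝ → ℝ} (hfac : IsFactorizing n P σw) {h : ℝ → ℝ}
    (hdet : IsDetDensity σw h) (hmellpos : ∀ j : Fin n, 0 < mellH h (2 * ((j.val : ℝ) + 1) - 1))
    (hh : ∀ j : Fin n, IntegrableOn (fun t => h t * t ^ (2 * (j.val : ℝ))) (Set.Ioi 0))
    (hd : DiffTimes (n - 1) h) {φ : Matrix (Fin (2 * n)) (Fin (2 * n)) ℝ → ℝ}
    (hφ : IsInvTest (2 * n) φ) :
    ∫ g, P g * φ (stdConj g) =
      ∫ a in {a : Fin n → ℝ | ∀ j, 0 < a j}, φ (Dmat a) * svDensity n h a := by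
  have hprob := isProbabilityMeasure_withDensity hfac
  have hS : Measurable fun g : Matrix (Fin (2 * n)) (Fin (2 * n)) ℝ => specParam (stdConj g) :=
    measurable_specParam.comp continuous_stdConj.measurable
  set M : Measure (Fin n → ℝ) := (volume.withDensity fun g => ENNReal.ofReal (P g)).map fun g =>
      specParam (stdConj g) with hMdef
  have hMprob : IsProbabilityMeasure M := Measure.isProbabilityMeasure_map hS.aemeasurable
  have hM : ∀ᵐ a ∂M, StrictMono a ∧ ∀ i, 0 < a i := by
    rw [hMdef, ae_map_iff hS.aemeasurable measurableSet_chamber]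
    exact (withDensity_absolutelyContinuous _ _).ae_le ae_specParam_stdConj
  set Z : ℝ := (((∏ j : Fin n, mellH h (2 * ((j.val : ℝ) + 1) - 1)) * 2 ^ (n * (n - 1) / 2)) *
    (Matrix.vandermonde fun j : Fin n => ((j.val : ℕ) : ℝ)).det)⁻¹ with hZdef
  have hprod : 0 < ∏ j : Fin n, mellH h (2 * ((j.val : ℝ) + 1) - 1) :=
    Finset.prod_pos fun j _ => hmellpos j
  have hh0 : IntegrableOn h (Set.Ioi 0) := by simpa using hh ⟨0, by omega⟩
  have hm1 : 0 < mellH h 1 := by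
    have := hmellpos ⟨0, by omega⟩
    norm_num at this
    exact this
  have hsph : ∀ ξ : Fin n → ℝ, ∫ a, (Matrix.of fun i j : Fin n => (a i : ℂ) ^ mellExp ξ j).det /
        (vdm (fun i => a i ^ 2) : ℂ) ∂M = Z * (Matrix.of fun j c : Fin n =>
          mellC h (mellExp ξ j) * (mellExp ξ j + 1) ^ c.val).det := by
    intro ξ
    have hmeas : StronglyMeasurable fun a : Fin n → ℝ => (Matrix.of fun i j : Fin n =>
        ((a i ^ 2 : ℝ) : ℂ) ^ kap (mellPar ξ) j).det / (vdm (fun i => a i ^ 2) : ℂ) := by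
      refine Measurable.stronglyMeasurable (Measurable.div ?_ ?_)
      · simp only [Matrix.det_apply, Matrix.of_apply]
        refine Finset.measurable_sum _ fun σ _ => Measurable.const_smul
          (Finset.measurable_prod _ fun i _ => Measurable.pow_const ?_ _) _
        exact Complex.measurable_ofReal.comp ((measurable_pi_apply _).pow_const 2)
      · exact Complex.measurable_ofReal.comp (measurable_vdm.comp (by fun_prop))
    have h1 := integral_spherical hfac hdet hh0 hm1 (mellPar_re ξ)
    have h2 := integral_map_specParam hfac hmeas
    simp only [Complex.real_smul] at h2
    rw [← h2] at h1
    have h3 := integral_det_mellExp (hM.mono fun a ha => ha.2)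
      (Finset.prod_ne_zero_iff.2 fun j _ => Complex.ofReal_ne_zero.2 (hmellpos j).ne') ξ h1
    rw [h3, hZdef]
    have hV : (Matrix.vandermonde fun j : Fin n => ((j.val : ℕ) : ℂ)).det =
        (((Matrix.vandermonde fun j : Fin n => ((j.val : ℕ) : ℝ)).det : ℝ) : ℂ) := by
      rw [Matrix.det_vandermonde, Matrix.det_vandermonde]
      push_cast
      rfl
    rw [hV]
    push_cast
    rfl
  obtain ⟨hq0, hMq⟩ := eq_withDensity_chamber hM hh hn hd hsph
  have hqsv : ∀ a : Fin n → ℝ, Z * (vdm fun i => a i ^ 2) *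
      (Matrix.of fun b c : Fin n => negADeriv c.val h (a b)).det =
        n.factorial * svDensity n h a := by
    intro a
    have hf : (n.factorial : ℝ) ≠ 0 := Nat.cast_ne_zero.2 n.factorial_ne_zero
    rw [svDensity, hZdef, Finset.prod_mul_distrib, ← factorial_mul_det_vandermonde (by omega)]
    generalize (Matrix.vandermonde fun j : Fin n => ((j.val : ℕ) : ℝ)).det = V
    rw [one_div, mul_inv, mul_inv, mul_inv, mul_inv, mul_inv]
    field_simp
  simp only [hqsv] at hq0 hMq
  have hcont : ContinuousOn h (Set.Ioi 0) := hd.continuousOn_negADeriv (m := 0) (by omega)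
  have hqm : AEStronglyMeasurable (fun a => (n.factorial : ℝ) * svDensity n h a)
      (volume.restrict (chamber n)) := by
    simp only [← hqsv]
    exact ((measurable_vdm.comp (by fun_prop)).const_mul Z).aestronglyMeasurable.mul
      (aestronglyMeasurable_negADeriv_det hcont)
  have hqi : IntegrableOn (fun a => (n.factorial : ℝ) * svDensity n h a) (chamber n) := by
    refine ⟨hqm, ?_⟩
    rw [hasFiniteIntegral_iff_ofReal ((ae_restrict_iff' measurableSet_chamber).2
      (Filter.Eventually.of_forall hq0))]
    have := measure_lt_top M Set.univ
    rwa [hMq, withDensity_apply _ MeasurableSet.univ, Measure.restrict_univ] at this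
  obtain ⟨C, hC⟩ := hφ.2.1
  have hφm : Measurable fun a : Fin n → ℝ => φ (Dmat a) := hφ.1.comp continuous_Dmat.measurable
  have hint : IntegrableOn (fun a => φ (Dmat a) * svDensity n h a) (chamber n) := by
    have h1 : IntegrableOn (fun a => svDensity n h a) (chamber n) := by
      have := hqi.const_mul (n.factorial : ℝ)⁻¹
      refine this.congr (Filter.Eventually.of_forall fun a => ?_)
      simp only
      rw [inv_mul_cancel_left₀ (Nat.cast_ne_zero.2 n.factorial_ne_zero)]
    exact Integrable.bdd_mul (c := C) h1 hφm.aestronglyMeasurable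
      (Filter.Eventually.of_forall fun a => hC _)
  rw [integral_pos_eq_factorial_mul (fun w a => by
    rw [hφ.comp_perm, svDensity_comp_perm]) hint, ← integral_const_mul]
  calc ∫ g, P g * φ (stdConj g) = ∫ g, P g • φ (Dmat (specParam (stdConj g))) := by
        simp only [hφ.stdConj_eq, smul_eq_mul]
    _ = ∫ a, φ (Dmat a) ∂M := (integral_map_specParam hfac hφm.stronglyMeasurable).symm
    _ = ∫ a in chamber n, (n.factorial : ℝ) * (φ (Dmat a) * svDensity n h a) := by
        rw [hMq, integral_withDensity_eq_integral_toReal_smul₀ hqm.aemeasurable.ennreal_ofReal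
          (Filter.Eventually.of_forall fun _ => ENNReal.ofReal_lt_top)]
        refine setIntegral_congr_fun measurableSet_chamber fun a ha => ?_
        simp only [ENNReal.toReal_ofReal (hq0 a ha), smul_eq_mul]
        ring

end Main

theorem factorizing_times_identity (n : ℕ) (hn : 1 ≤ n)
    (P : Matrix (Fin (2 * n)) (Fin (2 * n)) ℝ → ℝ)
    (σw : Matrix (Fin 2) (Fin 2) ℝ → ℝ) (hfac : IsFactorizing n P σw)
    {Ω : Type*} [MeasurableSpace Ω] (μ : Measure Ω) [IsProbabilityMeasure μ]
    (g : Ω → Matrix (Fin (2 * n)) (Fin (2 * n)) ℝ) (hg : AEMeasurable g μ)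
    (hlaw : μ.map g = volume.withDensity fun x => ENNReal.ofReal (P x))
    (h : ℝ → ℝ) (hdet : IsDetDensity σw h)
    (hmellpos : ∀ j : Fin n, 0 < mellH h (2 * ((j.val : ℝ) + 1) - 1))
    (hmellint : ∀ j : Fin n,
      IntegrableOn (fun t : ℝ => h t * t ^ (2 * ((j.val : ℝ) + 1) - 1 - 1)) (Set.Ioi 0))
    (hdiff : ∀ k : ℕ, k + 1 < n → DifferentiableOn ℝ (iteratedDeriv k h) (Set.Ioi 0))
    (φ : Matrix (Fin (2 * n)) (Fin (2 * n)) ℝ → ℝ) (hφ : IsInvTest (2 * n) φ) :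
    (∫ ω, φ (g ω * Dmat (fun _ => 1) * (g ω).transpose) ∂μ) =
      ∫ a in {a : Fin n → ℝ | ∀ j, 0 < a j}, φ (Dmat a) * svDensity n h a := by
  have hφs : Measurable fun x : Matrix (Fin (2 * n)) (Fin (2 * n)) ℝ => φ (stdConj x) :=
    hφ.1.comp continuous_stdConj.measurable
  have hL : ∫ ω, φ (g ω * Dmat (fun _ => 1) * (g ω).transpose) ∂μ = ∫ x, P x * φ (stdConj x) := by
    have h1 := integral_map hg (f := fun x => φ (stdConj x)) hφs.aestronglyMeasurable
    rw [hlaw, integral_withDensity_eq_integral_toReal_smul₀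
      hfac.integrable.1.aemeasurable.ennreal_ofReal
      (Filter.Eventually.of_forall fun _ => ENNReal.ofReal_lt_top)] at h1
    refine h1.symm.trans (integral_congr_ae (Filter.Eventually.of_forall fun x => ?_))
    simp only [ENNReal.toReal_ofReal (hfac.nonneg x), smul_eq_mul]
  rw [hL]
  rcases hn.eq_or_lt with rfl | hn2
  · exact integral_single_block hfac hdet hφ
  · refine integral_mul_stdConj hn2 hfac hdet hmellpos (fun j => ?_)
      (fun k hk => hdiff k (by omega)) hφ
    have := hmellint j
    rwa [show 2 * ((j.val : ℝ) + 1) - 1 - 1 = 2 * (j.val : ℝ) by ring] at this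

end
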